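/- Let Φ be a local Zhou weight related to |f₀|²e^{-2φ₀} near o, and let ψ be a psh function near o with ψ ≤ ν₀·log|z| + O(1) near o for some ν₀ > 0 (i.e. the Lelong number of ψ at o is positive). Define the Tian function Tn(t) := sup{ c : |f₀|²e^{-2φ₀}e^{2tψ}e^{-2cΦ} is integrable near o }. Then Tn(0) = 1, Tn is differentiable at t = 0 with lim_{t→0+} (Tn(0) - Tn(-t))/t = σ(ψ, Φ), and Tn(t) = 1 + σ(ψ, Φ)·t holds for all t ≥ 0. -/

import Mathlib

open MeasureTheory Filter Topology
open scoped ENNReal NNReal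

noncomputable section

/-- `ℂⁿ`. -/
abbrev Cn (n : ℕ) : Type := Fin n → ℂ

variable {n : ℕ}

/-- The exponential function `EReal → ℝ≥0∞`, with `exp ⊥ = 0` and `exp ⊤ = ⊤`. -/
def expE (x : EReal) : ℝ≥0∞ :=
  if x = ⊥ then 0 else if x = ⊤ then ⊤ else ENNReal.ofReal (Real.exp x.toReal)

/-- The logarithm `ℝ → EReal`, with value `⊥` for `x ≤ 0`. -/
def elog (x : ℝ) : EReal := if x ≤ 0 then (⊥ : EReal) else ((Real.log x : ℝ) : EReal)

/-- The density `e^{c·φ} : ℂⁿ → [0,∞]` associated to an extended-real-valued `φ`. -/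
def wexp (c : ℝ) (φ : Cn n → EReal) (z : Cn n) : ℝ≥0∞ := expE ((c : EReal) * φ z)

/-- `|f₀|² = ∑ⱼ |f₀ⱼ|²` as a `[0,∞]`-valued density, for a tuple `f₀` of functions. -/
def normSq2 {m : ℕ} (f₀ : Fin m → Cn n → ℂ) (z : Cn n) : ℝ≥0∞ :=
  ∑ j, (‖f₀ j z‖₊ : ℝ≥0∞) ^ 2

/-- `log |f₀| = (1/2) log ∑ⱼ |f₀ⱼ|²` for a tuple `f₀`. -/
def logAbsT {m : ℕ} (f₀ : Fin m → Cn n → ℂ) (z : Cn n) : EReal :=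
  elog (Real.sqrt (∑ j, ‖f₀ j z‖ ^ 2))

/-- The weight `|f₀|² e^{-2φ₀}`. -/
def dens0 {m : ℕ} (f₀ : Fin m → Cn n → ℂ) (φ₀ : Cn n → EReal) (z : Cn n) : ℝ≥0∞ :=
  normSq2 f₀ z * wexp (-2) φ₀ z

/-- A nonnegative function is (Lebesgue-)integrable near the origin. -/
def IntNear (g : Cn n → ℝ≥0∞) : Prop := ∃ U ∈ 𝓝 (0 : Cn n), (∫⁻ z in U, g z) < ⊤

/-- `ψ ≤ φ + O(1)` near the origin. -/
def leO (ψ φ : Cn n → EReal) : Prop := ∃ C : ℝ, ∀ᶠ z in 𝓝 (0 : Cn n), ψ z ≤ φ z + (C : EReal)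

/-- `ψ = φ + O(1)` near the origin. -/
def eqO (ψ φ : Cn n → EReal) : Prop := leO ψ φ ∧ leO φ ψ

/-- The truncated average of `u` over the circle `θ ↦ z + r e^{iθ} w`, truncated below at `-m`. -/
def circleAvg (u : Cn n → EReal) (z w : Cn n) (r : ℝ) (m : ℕ) : ℝ :=
  (2 * Real.pi)⁻¹ * ∫ θ in (0:ℝ)..(2 * Real.pi),
    (max (u (z + ((r : ℂ) * Complex.exp (Complex.I * (θ : ℂ))) • w)) ((-(m : ℝ) : ℝ) : EReal)).toReal

/-- `u` is plurisubharmonic on `Ω`: it is upper semicontinuous on `Ω`, takes values in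
`[-∞, ∞)`, is not identically `-∞` on any connected component of `Ω`, and satisfies the
sub-mean value inequality on all small circles inside complex lines. -/
structure PSHOn (u : Cn n → EReal) (Ω : Set (Cn n)) : Prop where
  usc : UpperSemicontinuousOn u Ω
  lt_top : ∀ z ∈ Ω, u z < ⊤
  not_botOnComponents : ∀ z ∈ Ω, ∃ w ∈ connectedComponentIn Ω z, u w ≠ ⊥
  submean : ∀ z ∈ Ω, ∀ w : Cn n, ∃ ε > 0, ∀ r : ℝ, 0 < r → r < ε →
    u z ≤ ⨅ m : ℕ, ((circleAvg u z w r m : ℝ) : EReal)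

/-- `u` is plurisubharmonic near the origin. -/
def PSHNear (u : Cn n → EReal) : Prop := ∃ U ∈ 𝓝 (0 : Cn n), IsOpen U ∧ PSHOn u U

/-- `f` is holomorphic near the origin. -/
def HoloNear (f : Cn n → ℂ) : Prop := ∃ U ∈ 𝓝 (0 : Cn n), IsOpen U ∧ DifferentiableOn ℂ f U

/-- `Φ` is a (local) Zhou weight near the origin related to a general nonnegative
weight `W`. -/
structure IsZhouWeightFor (W : Cn n → ℝ≥0∞) (Φ : Cn n → EReal) : Prop where
  psh : PSHNear Φ
  intN : ∃ N₁ : ℕ, ∀ N₀ : ℕ, N₁ ≤ N₀ →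
    IntNear fun z => W z * ENNReal.ofReal (‖z‖ ^ (2 * N₀)) * wexp (-2) Φ z
  nonint : ¬ IntNear fun z => W z * wexp (-2) Φ z
  maximal : ∀ φ' : Cn n → EReal, PSHNear φ' → leO Φ φ' →
    (¬ IntNear fun z => W z * wexp (-2) φ' z) → eqO φ' Φ

/-- `Φ` is a local Zhou weight related to `|f₀|² e^{-2φ₀}` near the origin (including the
standing assumptions that `f₀` is a tuple of holomorphic functions near `o`, `φ₀` is
plurisubharmonic near `o`, and `|f₀|² e^{-2φ₀}` is integrable near `o`). -/
structure IsLocalZhouWeight {m : ℕ} (f₀ : Fin m → Cn n → ℂ) (φ₀ : Cn n → EReal)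
    (Φ : Cn n → EReal) : Prop where
  holo : ∀ j, HoloNear (f₀ j)
  psh₀ : PSHNear φ₀
  int₀ : IntNear (dens0 f₀ φ₀)
  zhou : IsZhouWeightFor (dens0 f₀ φ₀) Φ

/-- The Zhou number (relative type) `σ(ψ, Φ) = sup { b ≥ 0 : ψ ≤ bΦ + O(1) near o }`. -/
def zhouNumber (ψ Φ : Cn n → EReal) : ℝ :=
  sSup {b : ℝ | 0 ≤ b ∧ leO ψ fun z => (b : EReal) * Φ z}

/-- `log ‖f‖ : ℂⁿ → EReal`. -/
def logAbs (f : Cn n → ℂ) (z : Cn n) : EReal := elog ‖f z‖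

/-- `ν(f, Φ) = σ(log|f|, Φ)`. -/
def nuNumber (f : Cn n → ℂ) (Φ : Cn n → EReal) : ℝ := zhouNumber (logAbs f) Φ

/-- The jumping number `c_o^G(Φ) = sup { c ≥ 0 : |G|² e^{-2cΦ} integrable near o }`. -/
def jumping (G : Cn n → ℂ) (Φ : Cn n → EReal) : ℝ :=
  sSup {c : ℝ | 0 ≤ c ∧ IntNear fun z => (‖G z‖₊ : ℝ≥0∞) ^ 2 * wexp (-2 * c) Φ z}

/-- The inclusion `ℐ(φ)ₒ ⊆ ℐ(ψ)ₒ` of multiplier ideals at the origin. -/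
def mIdealLE (φ ψ : Cn n → EReal) : Prop :=
  ∀ f : Cn n → ℂ, HoloNear f →
    (IntNear fun z => (‖f z‖₊ : ℝ≥0∞) ^ 2 * wexp (-2) φ z) →
    IntNear fun z => (‖f z‖₊ : ℝ≥0∞) ^ 2 * wexp (-2) ψ z

/-- The Tian function `Tn(t; f, v, φ₀) = sup { c ≥ 0 : |f|^{2t} e^{-2cv - 2φ₀} integrable near o }`. -/
def tian (t : ℝ) (f : Cn n → ℂ) (v φ₀ : Cn n → EReal) : ℝ :=
  sSup {c : ℝ | 0 ≤ c ∧
    IntNear fun z => ENNReal.ofReal (‖f z‖ ^ (2 * t)) * wexp (-2 * c) v z * wexp (-2) φ₀ z}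

/-- The Tian function `Tn(t) = sup { c : |f₀|²e^{-2φ₀} e^{2tψ} e^{-2cΦ} integrable near o }`. -/
def TnW {n m : ℕ} (f₀ : Fin m → Cn n → ℂ) (φ₀ ψ Φ : Cn n → EReal) (t : ℝ) : ℝ :=
  sSup {c : ℝ | IntNear fun z => dens0 f₀ φ₀ z * wexp (2 * t) ψ z * wexp (-2 * c) Φ z}

open scoped ContDiff Convolution ComplexConjugate

/-- The squared Euclidean norm on `ℂⁿ`. -/
def nsq (z : Cn n) : ℝ := ∑ j, ‖z j‖ ^ 2

lemma nsq_nonneg (z : Cn n) : 0 ≤ nsq z := Finset.sum_nonneg fun _ _ => sq_nonneg _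

lemma contDiff_nsq : ContDiff ℝ ∞ (nsq : Cn n → ℝ) := by
  unfold nsq
  exact ContDiff.sum fun j _ => (contDiff_apply ℝ ℂ j).norm_sq ℝ

lemma norm_sq_le_nsq (z : Cn n) : ‖z‖ ^ 2 ≤ nsq z := by
  have h : ‖z‖ ≤ Real.sqrt (nsq z) := by
    refine (pi_norm_le_iff_of_nonneg (Real.sqrt_nonneg _)).2 fun j => ?_
    refine Real.le_sqrt_of_sq_le ?_
    exact Finset.single_le_sum (f := fun j => ‖z j‖ ^ 2) (fun _ _ => sq_nonneg _) (Finset.mem_univ j)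
  calc ‖z‖ ^ 2 ≤ (Real.sqrt (nsq z)) ^ 2 := by gcongr
    _ = nsq z := Real.sq_sqrt (nsq_nonneg z)

lemma nsq_le (z : Cn n) : nsq z ≤ n * ‖z‖ ^ 2 := by
  calc nsq z ≤ ∑ _j : Fin n, ‖z‖ ^ 2 := by
        refine Finset.sum_le_sum fun j _ => ?_
        gcongr
        exact norm_le_pi_norm z j
    _ = n * ‖z‖ ^ 2 := by simp

lemma nsq_smul (c : ℂ) (z : Cn n) : nsq (c • z) = ‖c‖ ^ 2 * nsq z := by
  simp [nsq, Finset.mul_sum, mul_pow]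

@[simp] lemma nsq_zero : nsq (0 : Cn n) = 0 := by simp [nsq]

/-- A smooth circle-invariant bump function supported in the Euclidean unit ball. -/
def bump (z : Cn n) : ℝ := Real.smoothTransition (1 - nsq z)

lemma contDiff_bump : ContDiff ℝ ∞ (bump : Cn n → ℝ) :=
  Real.smoothTransition.contDiff.comp (contDiff_const.sub contDiff_nsq)

lemma bump_nonneg (z : Cn n) : 0 ≤ bump z := Real.smoothTransition.nonneg _

lemma bump_zero : bump (0 : Cn n) = 1 := by simp [bump]

lemma bump_eq_zero {z : Cn n} (h : 1 ≤ ‖z‖) : bump z = 0 := by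
  refine Real.smoothTransition.zero_of_nonpos ?_
  have := norm_sq_le_nsq z
  nlinarith

lemma bump_rot {c : ℂ} (hc : ‖c‖ = 1) (z : Cn n) : bump (c • z) = bump z := by
  simp [bump, nsq_smul, hc]

/-- The unnormalized mollifier at scale `ε`. -/
def bumpE (ε : ℝ) (z : Cn n) : ℝ := bump (ε⁻¹ • z)

/-- The circle-invariant mollifier at scale `ε`. -/
def moll (ε : ℝ) (z : Cn n) : ℝ := (∫ w : Cn n, bumpE ε w)⁻¹ * bumpE ε z

lemma contDiff_bumpE (ε : ℝ) : ContDiff ℝ ∞ (bumpE ε : Cn n → ℝ) :=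
  contDiff_bump.comp (contDiff_const_smul _)

lemma contDiff_moll (ε : ℝ) : ContDiff ℝ ∞ (moll ε : Cn n → ℝ) :=
  contDiff_const.mul (contDiff_bumpE ε)

lemma bumpE_eq_zero {ε : ℝ} (hε : 0 < ε) {z : Cn n} (h : ε ≤ ‖z‖) : bumpE ε z = 0 := by
  refine bump_eq_zero ?_
  rw [norm_smul, norm_inv, Real.norm_of_nonneg hε.le, inv_mul_eq_div, le_div_iff₀ hε]
  simpa using h

lemma moll_eq_zero {ε : ℝ} (hε : 0 < ε) {z : Cn n} (h : ε ≤ ‖z‖) : moll ε z = 0 := by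
  simp [moll, bumpE_eq_zero hε h]

lemma hasCompactSupport_bumpE {ε : ℝ} (hε : 0 < ε) : HasCompactSupport (bumpE ε : Cn n → ℝ) :=
  HasCompactSupport.of_support_subset_isCompact (isCompact_closedBall (0 : Cn n) ε) fun z hz => by
    by_contra h
    simp only [Metric.mem_closedBall, dist_zero_right, not_le] at h
    exact hz (bumpE_eq_zero hε h.le)

lemma hasCompactSupport_moll {ε : ℝ} (hε : 0 < ε) : HasCompactSupport (moll ε : Cn n → ℝ) :=
  (hasCompactSupport_bumpE hε).mul_left

lemma integrable_bumpE {ε : ℝ} (hε : 0 < ε) : Integrable (bumpE ε : Cn n → ℝ) :=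
  (contDiff_bumpE ε).continuous.integrable_of_hasCompactSupport (hasCompactSupport_bumpE hε)

lemma integrable_moll {ε : ℝ} (hε : 0 < ε) : Integrable (moll ε : Cn n → ℝ) :=
  (integrable_bumpE hε).const_mul _

lemma bumpE_nonneg (ε : ℝ) (z : Cn n) : 0 ≤ bumpE ε z := bump_nonneg _

lemma integral_bumpE_pos {ε : ℝ} (hε : 0 < ε) : 0 < ∫ w : Cn n, bumpE ε w := by
  refine (contDiff_bumpE ε).continuous.integral_pos_of_hasCompactSupport_nonneg_nonzero
    (hasCompactSupport_bumpE hε) (bumpE_nonneg ε) (x := 0) ?_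
  simp [bumpE, bump_zero]

lemma moll_nonneg (ε : ℝ) (z : Cn n) : 0 ≤ moll ε z :=
  mul_nonneg (inv_nonneg.2 (integral_nonneg (bumpE_nonneg ε))) (bumpE_nonneg ε z)

lemma integral_moll {ε : ℝ} (hε : 0 < ε) : ∫ z : Cn n, moll ε z = 1 := by
  simp only [moll, integral_const_mul]
  exact inv_mul_cancel₀ (integral_bumpE_pos hε).ne'

lemma moll_rot (ε : ℝ) {c : ℂ} (hc : ‖c‖ = 1) (z : Cn n) : moll ε (c • z) = moll ε z := by
  simp only [moll, bumpE]
  rw [smul_comm, bump_rot hc]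

lemma moll_neg (ε : ℝ) (z : Cn n) : moll ε (-z) = moll ε z := by
  have := moll_rot ε (c := -1) (by simp) z
  simpa using this

lemma lintegral_moll {ε : ℝ} (hε : 0 < ε) : ∫⁻ z : Cn n, ENNReal.ofReal (moll ε z) = 1 := by
  rw [← ofReal_integral_eq_lintegral_ofReal (integrable_moll hε)
    (Eventually.of_forall (moll_nonneg ε)), integral_moll hε, ENNReal.ofReal_one]

/-- Mollification of a complex-valued function. -/
def cmoll (ε : ℝ) (u : Cn n → ℂ) (x : Cn n) : ℂ := ∫ y, moll ε y • u (x - y)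

lemma cmoll_eq_convolution (ε : ℝ) (u : Cn n → ℂ) :
    cmoll ε u = (moll ε ⋆[ContinuousLinearMap.lsmul ℝ ℝ, volume] u) := rfl

lemma contDiff_cmoll {ε : ℝ} (hε : 0 < ε) {u : Cn n → ℂ} (hu : LocallyIntegrable u) :
    ContDiff ℝ ∞ (cmoll ε u) := by
  rw [cmoll_eq_convolution]
  exact (hasCompactSupport_moll hε).contDiff_convolution_left _ (contDiff_moll ε) hu

lemma hasCompactSupport_cmoll {ε : ℝ} (hε : 0 < ε) {u : Cn n → ℂ} (hu : HasCompactSupport u) :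
    HasCompactSupport (cmoll ε u) := by
  rw [cmoll_eq_convolution]
  exact (hasCompactSupport_moll hε).convolution _ hu

lemma sq_lintegral_le_of_prob {α : Type*} [MeasurableSpace α] {μ : Measure α}
    [IsProbabilityMeasure μ] {f : α → ℝ≥0∞} (hf : AEMeasurable f μ) :
    (∫⁻ x, f x ∂μ) ^ 2 ≤ ∫⁻ x, f x ^ 2 ∂μ := by
  have h := ENNReal.lintegral_mul_le_Lp_mul_Lq μ Real.HolderConjugate.two_two hf
    (aemeasurable_const (b := (1 : ℝ≥0∞)))
  simp only [Pi.mul_apply, mul_one, ENNReal.one_rpow, lintegral_const, measure_univ] at h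
  calc (∫⁻ x, f x ∂μ) ^ 2 ≤ ((∫⁻ x, f x ^ (2 : ℝ) ∂μ) ^ (1 / 2 : ℝ)) ^ 2 := by gcongr
    _ = ∫⁻ x, f x ^ 2 ∂μ := by
      rw [← ENNReal.rpow_natCast, ← ENNReal.rpow_mul]
      norm_num

lemma enorm_sq_cmoll_sub_le {ε : ℝ} (hε : 0 < ε) {u : Cn n → ℂ} (hum : Measurable u)
    (hu : LocallyIntegrable u) (x : Cn n) :
    ‖cmoll ε u x - u x‖ₑ ^ 2 ≤
      ∫⁻ y, ENNReal.ofReal (moll ε y) * ‖u (x - y) - u x‖ₑ ^ 2 := by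
  have hm : Measurable fun y : Cn n => ENNReal.ofReal (moll ε y) :=
    (contDiff_moll ε).continuous.measurable.ennreal_ofReal
  set μ : Measure (Cn n) := volume.withDensity fun y => ENNReal.ofReal (moll ε y) with hμ
  have : IsProbabilityMeasure μ := ⟨by
    rw [hμ, withDensity_apply _ MeasurableSet.univ, Measure.restrict_univ, lintegral_moll hε]⟩
  have h1 : Integrable fun y => moll ε y • u (x - y) :=
    ((hasCompactSupport_moll hε).convolutionExists_left (ContinuousLinearMap.lsmul ℝ ℝ)
      (contDiff_moll ε).continuous hu x)
  have h2 : Integrable fun y : Cn n => moll ε y • u x := (integrable_moll hε).smul_const _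
  have e1 : cmoll ε u x - u x = ∫ y, moll ε y • (u (x - y) - u x) := by
    simp only [smul_sub]
    rw [integral_sub h1 h2, integral_smul_const, integral_moll hε, one_smul]
    rfl
  have hmeas : Measurable fun y => ‖u (x - y) - u x‖ₑ :=
    ((hum.comp (measurable_const.sub measurable_id)).sub_const _).enorm
  have e2 : ‖cmoll ε u x - u x‖ₑ ≤ ∫⁻ y, ‖u (x - y) - u x‖ₑ ∂μ := by
    rw [e1, hμ, lintegral_withDensity_eq_lintegral_mul _ hm hmeas]
    refine (enorm_integral_le_lintegral_enorm _).trans (le_of_eq ?_)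
    refine lintegral_congr fun y => ?_
    simp only [Pi.mul_apply]
    rw [enorm_smul, Real.enorm_of_nonneg (moll_nonneg ε y)]
  calc ‖cmoll ε u x - u x‖ₑ ^ 2 ≤ (∫⁻ y, ‖u (x - y) - u x‖ₑ ∂μ) ^ 2 := by gcongr
    _ ≤ ∫⁻ y, ‖u (x - y) - u x‖ₑ ^ 2 ∂μ := sq_lintegral_le_of_prob hmeas.aemeasurable
    _ = _ := by
      rw [hμ, lintegral_withDensity_eq_lintegral_mul _ hm (hmeas.pow_const 2)]
      rfl

lemma tendsto_translate_L2 {u : Cn n → ℂ} (hu : MemLp u 2 volume) {δ : ℝ≥0∞}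
    (hδ : 0 < δ) : ∃ ε > 0, ∀ y : Cn n, ‖y‖ < ε → ∫⁻ x, ‖u (x - y) - u x‖ₑ ^ 2 ≤ δ := by
  let g : Cn n → C(Cn n, Cn n) := fun y => ⟨fun x => x - y, by fun_prop⟩
  have hg : Continuous g := by
    have : Continuous fun p : Cn n × Cn n => p.2 - p.1 := by fun_prop
    exact ((⟨_, this⟩ : C(Cn n × Cn n, Cn n)).curry).continuous
  have hgm : ∀ y, MeasurePreserving (g y) volume volume := fun y => measurePreserving_sub_right _ y
  have hc := (Continuous.compMeasurePreservingLp (continuous_const (y := hu.toLp u)) hg hgm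
    (by simp)).tendsto 0
  have hδ' : 0 < δ ^ (1 / 2 : ℝ) := ENNReal.rpow_pos_of_nonneg hδ (by norm_num)
  have := EMetric.tendsto_nhds.1 hc _ hδ'
  obtain ⟨ε, hε, h⟩ := Metric.eventually_nhds_iff.1 this
  refine ⟨ε, hε, fun y hy => ?_⟩
  have h1 := h (y := y) (by simpa using hy)
  rw [Lp.edist_def, eLpNorm_eq_lintegral_rpow_enorm_toReal (by simp) (by simp)] at h1
  simp only [ENNReal.toReal_ofNat, Pi.sub_apply] at h1
  have h2 := (ENNReal.rpow_lt_rpow_iff (by norm_num : (0 : ℝ) < 1 / 2)).1 h1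
  refine (le_of_eq ?_).trans h2.le
  refine lintegral_congr_ae ?_
  have a1 : ∀ y, (Lp.compMeasurePreserving (g y) (hgm y) (hu.toLp u) : Cn n → ℂ) =ᵐ[volume]
      fun x => u (x - y) := fun y => by
    refine (Lp.coeFn_compMeasurePreserving _ (hgm y)).trans ?_
    exact (hgm y).quasiMeasurePreserving.ae_eq_comp hu.coeFn_toLp
  filter_upwards [a1 y, a1 0] with x hx hx0
  rw [hx, hx0, ← ENNReal.rpow_ofNat, sub_zero]

/-- Mollifications of a square-integrable function converge to it in `L²`. -/
lemma tendsto_cmoll_L2 {u : Cn n → ℂ} (hum : Measurable u) (hu : MemLp u 2 volume) :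
    Tendsto (fun ε : ℝ => ∫⁻ x, ‖cmoll ε u x - u x‖ₑ ^ 2) (𝓝[>] 0) (𝓝 0) := by
  rw [ENNReal.tendsto_nhds_zero]
  intro δ hδ
  obtain ⟨ε₀, hε₀, h⟩ := tendsto_translate_L2 hu hδ
  filter_upwards [Ioo_mem_nhdsGT hε₀] with ε hε
  have hli : LocallyIntegrable u := hu.locallyIntegrable (by norm_num)
  have hm : Measurable fun y : Cn n => ENNReal.ofReal (moll ε y) :=
    (contDiff_moll ε).continuous.measurable.ennreal_ofReal
  calc ∫⁻ x, ‖cmoll ε u x - u x‖ₑ ^ 2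
      ≤ ∫⁻ x, ∫⁻ y, ENNReal.ofReal (moll ε y) * ‖u (x - y) - u x‖ₑ ^ 2 :=
        lintegral_mono fun x => enorm_sq_cmoll_sub_le hε.1 hum hli x
    _ = ∫⁻ y, ∫⁻ x, ENNReal.ofReal (moll ε y) * ‖u (x - y) - u x‖ₑ ^ 2 := by
        refine lintegral_lintegral_swap (Measurable.aemeasurable ?_)
        refine (hm.comp measurable_snd).mul ?_
        exact (((hum.comp (measurable_fst.sub measurable_snd)).sub
          (hum.comp measurable_fst)).enorm).pow_const 2
    _ = ∫⁻ y, ENNReal.ofReal (moll ε y) * ∫⁻ x, ‖u (x - y) - u x‖ₑ ^ 2 := by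
        refine lintegral_congr fun y => ?_
        rw [lintegral_const_mul' _ _ ENNReal.ofReal_ne_top]
    _ ≤ ∫⁻ y, ENNReal.ofReal (moll ε y) * δ := by
        refine lintegral_mono fun y => ?_
        by_cases hy : ‖y‖ < ε
        · exact mul_le_mul_right (h y (hy.trans hε.2)) _
        · simp [moll_eq_zero hε.1 (not_lt.1 hy)]
    _ = δ := by
        rw [lintegral_mul_const _ hm, lintegral_moll hε.1, one_mul]

/-- Smooth compactly supported functions. -/
structure IsTest (w : Cn n → ℂ) : Prop where
  smooth : ContDiff ℝ ∞ w
  compact : HasCompactSupport w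

/-- Linear functionals on real derivatives: constant coefficient first-order operators. -/
abbrev Symb (n : ℕ) : Type := (Cn n →L[ℝ] ℂ) →L[ℂ] ℂ

/-- The first-order operator with constant coefficients given by `l`. -/
def pd (l : Symb n) (w : Cn n → ℂ) (z : Cn n) : ℂ := l (fderiv ℝ w z)

lemma contDiff_pd (l : Symb n) {w : Cn n → ℂ} (hw : ContDiff ℝ ∞ w) : ContDiff ℝ ∞ (pd l w) :=
  (l.restrictScalars ℝ).contDiff.comp (hw.fderiv_right (m := ∞) (by simp))

lemma IsTest.pd (l : Symb n) {w : Cn n → ℂ} (hw : IsTest w) : IsTest (pd l w) :=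
  ⟨contDiff_pd l hw.smooth, (hw.compact.fderiv ℝ).comp_left (map_zero l)⟩

lemma IsTest.mul_left {w q : Cn n → ℂ} (hw : IsTest w) (hq : ContDiff ℝ ∞ q) :
    IsTest fun z => q z * w z := ⟨hq.mul hw.smooth, hw.compact.mul_left⟩

lemma IsTest.add {w v : Cn n → ℂ} (hw : IsTest w) (hv : IsTest v) : IsTest fun z => w z + v z :=
  ⟨hw.smooth.add hv.smooth, hw.compact.add hv.compact⟩

lemma IsTest.neg {w : Cn n → ℂ} (hw : IsTest w) : IsTest fun z => - w z :=
  ⟨hw.smooth.neg, hw.compact.neg⟩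

lemma IsTest.sub {w v : Cn n → ℂ} (hw : IsTest w) (hv : IsTest v) : IsTest fun z => w z - v z := by
  simpa [sub_eq_add_neg] using hw.add hv.neg

lemma isTest_zero : IsTest (fun _ : Cn n => (0 : ℂ)) :=
  ⟨contDiff_const, HasCompactSupport.zero⟩

lemma IsTest.sum {ι : Type*} (s : Finset ι) {w : ι → Cn n → ℂ} (hw : ∀ i ∈ s, IsTest (w i)) :
    IsTest fun z => ∑ i ∈ s, w i z := by
  classical
  induction s using Finset.induction_on with
  | empty => simpa using isTest_zero
  | insert a s ha ih =>
    simp only [Finset.sum_insert ha]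
    exact (hw a (by simp)).add (ih fun i hi => hw i (by simp [hi]))

lemma IsTest.continuous {w : Cn n → ℂ} (hw : IsTest w) : Continuous w := hw.smooth.continuous

lemma IsTest.integrable {w : Cn n → ℂ} (hw : IsTest w) : Integrable w :=
  hw.continuous.integrable_of_hasCompactSupport hw.compact

lemma IsTest.memLp {w : Cn n → ℂ} (hw : IsTest w) : MemLp w 2 volume :=
  hw.continuous.memLp_of_hasCompactSupport hw.compact

lemma IsTest.integrable_mul {w u : Cn n → ℂ} (hw : IsTest w) (hu : LocallyIntegrable u) :
    Integrable fun z => u z * w z := by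
  have := hu.integrable_smul_left_of_hasCompactSupport hw.continuous hw.compact
  simpa [mul_comm] using this

lemma pd_mul (l : Symb n) {w v : Cn n → ℂ} {z : Cn n} (hw : DifferentiableAt ℝ w z)
    (hv : DifferentiableAt ℝ v z) :
    pd l (fun z => w z * v z) z = w z * pd l v z + v z * pd l w z := by
  unfold pd
  rw [fderiv_fun_mul hw hv, map_add, map_smul, map_smul, smul_eq_mul, smul_eq_mul]

lemma pd_add (l : Symb n) {w v : Cn n → ℂ} {z : Cn n} (hw : DifferentiableAt ℝ w z)
    (hv : DifferentiableAt ℝ v z) :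
    pd l (fun z => w z + v z) z = pd l w z + pd l v z := by
  unfold pd
  rw [fderiv_fun_add hw hv, map_add]

/-- Integration by parts for constant coefficient operators. -/
lemma integral_pd_mul (l : Symb n) {w v : Cn n → ℂ} (hw : IsTest w) (hv : ContDiff ℝ ∞ v) :
    ∫ z, pd l w z * v z = - ∫ z, w z * pd l v z := by
  have hcw : Continuous (fderiv ℝ w) := hw.smooth.continuous_fderiv (by simp)
  have hcv : Continuous (fderiv ℝ v) := hv.continuous_fderiv (by simp)
  have i1 : Integrable fun z => v z • fderiv ℝ w z :=
    (hv.continuous.smul hcw).integrable_of_hasCompactSupport 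
      ((hw.compact.fderiv ℝ).mono fun z hz h0 => hz (by
        change v z • fderiv ℝ w z = 0
        rw [h0]
        ext x
        simp))
  have i2 : Integrable fun z => w z • fderiv ℝ v z :=
    (hw.continuous.smul hcv).integrable_of_hasCompactSupport 
      (hw.compact.mono fun z hz h0 => hz (by
        change w z • fderiv ℝ v z = 0
        rw [h0]
        ext x
        simp))
  have key : ∫ z, v z • fderiv ℝ w z = - ∫ z, w z • fderiv ℝ v z := by
    ext x
    rw [neg_apply, ContinuousLinearMap.integral_apply i1,
      ContinuousLinearMap.integral_apply i2]
    simp only [smul_apply, smul_eq_mul]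
    refine integral_mul_fderiv_eq_neg_fderiv_mul_of_integrable
      (f := v) (g := w) (v := x) ?_ ?_ ?_ ?_ ?_ |>.trans ?_
    · have := (i2.apply_continuousLinearMap x)
      simpa [mul_comm] using this
    · have := (i1.apply_continuousLinearMap x)
      simpa [mul_comm] using this
    · exact hw.integrable_mul hv.continuous.locallyIntegrable
    · exact fun z _ => hv.differentiable (by simp) z
    · exact fun z _ => hw.smooth.differentiable (by simp) z
    · simp only [mul_comm]
  have h := congrArg l key
  rw [map_neg, ← l.integral_comp_comm i1, ← l.integral_comp_comm i2] at h
  simpa [pd, mul_comm] using h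

lemma cmoll_eq (ε : ℝ) (u : Cn n → ℂ) (x : Cn n) :
    cmoll ε u x = ∫ y, u y * (moll ε (x - y) : ℂ) := by
  unfold cmoll
  rw [← integral_sub_left_eq_self _ volume x]
  simp [mul_comm]

lemma isTest_moll_sub {ε : ℝ} (hε : 0 < ε) (x : Cn n) : IsTest fun y => (moll ε (x - y) : ℂ) := by
  refine ⟨Complex.ofRealCLM.contDiff.comp ((contDiff_moll ε).comp (contDiff_const.sub contDiff_id)), ?_⟩
  have : HasCompactSupport fun y => moll ε (x - y) :=
    (hasCompactSupport_moll hε).comp_homeomorph (Homeomorph.subLeft x)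
  exact this.comp_left (g := fun r : ℝ => (r : ℂ)) (by simp)

lemma pd_cmoll (l : Symb n) {ε : ℝ} (hε : 0 < ε) {u : Cn n → ℂ} (hu : LocallyIntegrable u)
    (x : Cn n) :
    pd l (cmoll ε u) x = - ∫ y, u y * pd l (fun y => (moll ε (x - y) : ℂ)) y := by
  have h := (hasCompactSupport_moll hε).hasFDerivAt_convolution_left
    (ContinuousLinearMap.lsmul ℝ ℝ) ((contDiff_moll ε).of_le (by simp)) hu x
  have hD : ∀ y, fderiv ℝ (fun y => (moll ε (x - y) : ℂ)) y =
      - (Complex.ofRealCLM.comp (fderiv ℝ (moll ε) (x - y))) := by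
    intro y
    have h1 : HasFDerivAt (moll ε) (fderiv ℝ (moll ε) (x - y)) (x - y) :=
      ((contDiff_moll ε).differentiable (by simp) _).hasFDerivAt
    have h2 : HasFDerivAt (fun y => x - y) (-(ContinuousLinearMap.id ℝ (Cn n))) y :=
      (hasFDerivAt_id y).const_sub x
    have h3 := Complex.ofRealCLM.hasFDerivAt.comp y (h1.comp y h2)
    have := h3.fderiv
    refine Eq.trans ?_ (this.trans ?_)
    · rfl
    · ext v; simp
  have hint : Integrable fun y => u y • (Complex.ofRealCLM.comp (fderiv ℝ (moll ε) (x - y))) := by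
    have hc : Continuous fun y => Complex.ofRealCLM.comp (fderiv ℝ (moll ε) (x - y)) :=
      continuous_const.clm_comp
        (((contDiff_moll ε).continuous_fderiv (by simp)).comp (continuous_const.sub continuous_id))
    refine hu.integrable_smul_right_of_hasCompactSupport hc ?_
    exact ((((hasCompactSupport_moll hε).fderiv ℝ).comp_homeomorph (Homeomorph.subLeft x))).comp_left
      (g := fun L => Complex.ofRealCLM.comp L) (by simp)
  have e : fderiv ℝ (cmoll ε u) x =
      ∫ y, u y • (Complex.ofRealCLM.comp (fderiv ℝ (moll ε) (x - y))) := by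
    rw [cmoll_eq_convolution, h.fderiv, convolution,
      ← integral_sub_left_eq_self _ volume x]
    refine integral_congr_ae (Eventually.of_forall fun y => ?_)
    ext v
    simp [mul_comm]
  unfold pd
  rw [e, ← l.integral_comp_comm hint, ← integral_neg]
  refine integral_congr_ae (Eventually.of_forall fun y => ?_)
  simp only [hD, map_smul, smul_eq_mul, map_neg, mul_neg, neg_neg]

/-- The first-order operator `u ↦ ∑ᵢ (lᵢ(D uᵢ) + qᵢ uᵢ)` on tuples. -/
def fop (l : Fin n → Symb n) (q : Fin n → Cn n → ℂ) (u : Fin n → Cn n → ℂ) (z : Cn n) : ℂ :=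
  ∑ i, (pd (l i) (u i) z + q i z * u i z)

/-- The weak form of `fop l q u = k`. -/
def WeakEq (l : Fin n → Symb n) (q : Fin n → Cn n → ℂ) (u : Fin n → Cn n → ℂ) (k : Cn n → ℂ) :
    Prop :=
  ∀ w, IsTest w → ∑ i, ∫ z, u i z * (q i z * w z - pd (l i) w z) = ∫ z, k z * w z

/-- The cutoff function at scale `R`. -/
def cutoff (R : ℝ) (z : Cn n) : ℝ := Real.smoothTransition (2 - nsq (R⁻¹ • z))

lemma contDiff_cutoff (R : ℝ) : ContDiff ℝ ∞ (cutoff R : Cn n → ℝ) :=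
  Real.smoothTransition.contDiff.comp
    (contDiff_const.sub (contDiff_nsq.comp (contDiff_const_smul _)))

lemma nsq_real_smul (c : ℝ) (z : Cn n) : nsq (c • z) = c ^ 2 * nsq z := by
  have := nsq_smul (c : ℂ) z
  simpa using this

lemma hasCompactSupport_cutoff {R : ℝ} (hR : 0 < R) : HasCompactSupport (cutoff R : Cn n → ℝ) := by
  refine HasCompactSupport.of_support_subset_isCompact (isCompact_closedBall (0 : Cn n) (2 * R))
    fun z hz => ?_
  by_contra h
  simp only [Metric.mem_closedBall, dist_zero_right, not_le] at h
  refine hz (Real.smoothTransition.zero_of_nonpos ?_)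
  rw [nsq_real_smul, inv_pow, inv_mul_eq_div, sub_nonpos, le_div_iff₀ (by positivity)]
  have := norm_sq_le_nsq z
  nlinarith

lemma isTest_cutoff {R : ℝ} (hR : 0 < R) : IsTest fun z : Cn n => (cutoff R z : ℂ) :=
  ⟨Complex.ofRealCLM.contDiff.comp (contDiff_cutoff R),
    (hasCompactSupport_cutoff hR).comp_left (g := fun r : ℝ => (r : ℂ)) (by simp)⟩

lemma cutoff_norm_le (R : ℝ) (z : Cn n) : ‖(cutoff R z : ℂ)‖ ≤ 1 := by
  rw [Complex.norm_real, cutoff, Real.norm_of_nonneg (Real.smoothTransition.nonneg _)]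
  exact Real.smoothTransition.le_one _

lemma cutoff_eventually_one (z : Cn n) : ∀ᶠ R in atTop, ∀ᶠ y in 𝓝 z, cutoff R y = 1 := by
  filter_upwards [eventually_gt_atTop (0 : ℝ), eventually_gt_atTop (Real.sqrt (nsq z + 1))]
    with R h0 h1
  have hc : ∀ᶠ y in 𝓝 z, nsq y < nsq z + 1 :=
    (contDiff_nsq.continuous.tendsto z).eventually_lt_const (by linarith)
  filter_upwards [hc] with y hy
  refine Real.smoothTransition.one_of_one_le ?_
  rw [nsq_real_smul, inv_pow, inv_mul_eq_div]
  have : nsq z + 1 ≤ R ^ 2 := by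
    have h2 := Real.sq_sqrt (show 0 ≤ nsq z + 1 by have := nsq_nonneg z; linarith)
    nlinarith [Real.sqrt_nonneg (nsq z + 1)]
  have : nsq y / R ^ 2 ≤ 1 := (div_le_one (by positivity)).2 (by linarith)
  linarith

/-- The derivatives of the cutoffs are uniformly bounded for scales at least one. -/
lemma exists_pd_cutoff_le (l : Symb n) :
    ∃ C : ℝ, 0 ≤ C ∧ ∀ R ≥ 1, ∀ z : Cn n, ‖pd l (fun z => (cutoff R z : ℂ)) z‖ ≤ C := by
  have ht := isTest_cutoff (n := n) one_pos
  obtain ⟨C, hC⟩ := (ht.smooth.continuous_fderiv (by simp)).bounded_above_of_compact_support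
    (ht.compact.fderiv ℝ)
  have hC0 : 0 ≤ C := (norm_nonneg _).trans (hC 0)
  refine ⟨‖l‖ * C, by positivity, fun R hR z => ?_⟩
  have hRp : (0 : ℝ) < R := by linarith
  have e : (fun z : Cn n => (cutoff R z : ℂ)) = fun z => (fun z : Cn n => (cutoff 1 z : ℂ)) (R⁻¹ • z) := by
    funext z; simp [cutoff]
  refine (l.le_opNorm _).trans ?_
  gcongr
  rw [e]
  have h1 : HasFDerivAt (fun z : Cn n => (cutoff 1 z : ℂ))
      (fderiv ℝ (fun z : Cn n => (cutoff 1 z : ℂ)) (R⁻¹ • z)) (R⁻¹ • z) :=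
    (ht.smooth.differentiable (by simp) _).hasFDerivAt
  have h2 : HasFDerivAt (fun z : Cn n => R⁻¹ • z) (R⁻¹ • ContinuousLinearMap.id ℝ (Cn n)) z :=
    (hasFDerivAt_id z).const_smul R⁻¹
  have h3 := (h1.comp z h2).fderiv
  have h4 : fderiv ℝ (fun z => (fun z : Cn n => (cutoff 1 z : ℂ)) (R⁻¹ • z)) z =
      R⁻¹ • fderiv ℝ (fun z : Cn n => (cutoff 1 z : ℂ)) (R⁻¹ • z) := by
    refine h3.trans ?_
    ext v; simp
  rw [h4, norm_smul]
  have : ‖R⁻¹‖ ≤ 1 := by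
    rw [norm_inv, Real.norm_of_nonneg hRp.le]; exact inv_le_one_of_one_le₀ hR
  calc ‖R⁻¹‖ * _ ≤ 1 * C := by gcongr; exact hC _
    _ = C := one_mul C

lemma weakEq_cutoff {l : Fin n → Symb n} {q : Fin n → Cn n → ℂ} {u : Fin n → Cn n → ℂ}
    {k χ : Cn n → ℂ} (h : WeakEq l q u k) (hχ : IsTest χ) (hq : ∀ i, ContDiff ℝ ∞ (q i))
    (hu : ∀ i, LocallyIntegrable (u i)) (hk : LocallyIntegrable k) :
    WeakEq l q (fun i z => χ z * u i z) (fun z => χ z * k z + ∑ i, pd (l i) χ z * u i z) := by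
  intro w hw
  have hχw : IsTest fun z => χ z * w z := hw.mul_left hχ.smooth
  have h1 := h _ hχw
  have e1 : ∀ i, ∫ z, χ z * u i z * (q i z * w z - pd (l i) w z) =
      (∫ z, u i z * (q i z * (χ z * w z) - pd (l i) (fun z => χ z * w z) z)) +
        ∫ z, u i z * (pd (l i) χ z * w z) := by
    intro i
    rw [← integral_add]
    · refine integral_congr_ae (Eventually.of_forall fun z => ?_)
      simp only
      rw [pd_mul (l i) (hχ.smooth.differentiable (by simp) z) (hw.smooth.differentiable (by simp) z)]
      ring
    · exact ((hχw.mul_left (hq i)).sub (hχw.pd (l i))).integrable_mul (hu i)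
    · exact (hw.mul_left (hχ.pd (l i)).smooth).integrable_mul (hu i)
  simp only [e1]
  rw [Finset.sum_add_distrib, h1, ← integral_finsetSum, ← integral_add]
  · refine integral_congr_ae (Eventually.of_forall fun z => ?_)
    simp only [add_mul, Finset.sum_mul]
    congr 1
    · ring
    · exact Finset.sum_congr rfl fun i _ => by ring
  · exact hχw.integrable_mul hk
  · exact integrable_finsetSum _ fun i _ => (hw.mul_left (hχ.pd (l i)).smooth).integrable_mul (hu i)
  · exact fun i _ => (hw.mul_left (hχ.pd (l i)).smooth).integrable_mul (hu i)

lemma eLpNorm_two_eq (f : Cn n → ℂ) :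
    eLpNorm f 2 volume = (∫⁻ x, ‖f x‖ₑ ^ 2) ^ (1 / 2 : ℝ) := by
  rw [eLpNorm_eq_lintegral_rpow_enorm_toReal (by simp) (by simp)]
  simp

lemma tendsto_cmoll_eLpNorm {u : Cn n → ℂ} (hum : Measurable u) (hu : MemLp u 2 volume) :
    Tendsto (fun ε : ℝ => eLpNorm (fun x => cmoll ε u x - u x) 2 volume) (𝓝[>] 0) (𝓝 0) := by
  simp only [eLpNorm_two_eq]
  have := (tendsto_cmoll_L2 hum hu).ennrpow_const (1 / 2 : ℝ)
  simpa using this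

/-- Dominated convergence in `L²`. -/
lemma tendsto_eLpNorm_zero_of_dominated {F : ℝ → Cn n → ℂ} {g : Cn n → ℝ} {l : Filter ℝ}
    [l.IsCountablyGenerated]
    (hF : ∀ᶠ R in l, Measurable (F R)) (hg : MemLp g 2 volume)
    (hb : ∀ᶠ R in l, ∀ z, ‖F R z‖ ≤ g z) (h0 : ∀ z, ∀ᶠ R in l, F R z = 0) :
    Tendsto (fun R => eLpNorm (F R) 2 volume) l (𝓝 0) := by
  have key : Tendsto (fun R => ∫⁻ x, ‖F R x‖ₑ ^ 2) l (𝓝 (∫⁻ _ : Cn n, 0)) := by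
    refine tendsto_lintegral_filter_of_dominated_convergence (fun z => ‖g z‖ₑ ^ 2) ?_ ?_ ?_ ?_
    · filter_upwards [hF] with R hR using (hR.enorm).pow_const 2
    · filter_upwards [hb] with R hR
      refine Eventually.of_forall fun z => ?_
      gcongr
      refine enorm_le_iff_norm_le.2 ?_
      exact (hR z).trans (Real.le_norm_self _)
    · have := hg.eLpNorm_lt_top
      rw [eLpNorm_eq_lintegral_rpow_enorm_toReal (by simp) (by simp)] at this
      simp only [ENNReal.toReal_ofNat, ENNReal.rpow_ofNat] at this
      exact fun h => by simp [h] at this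
    · refine Eventually.of_forall fun z => ?_
      refine tendsto_const_nhds.congr' ?_
      filter_upwards [h0 z] with R hR
      simp [hR]
  simp only [lintegral_zero] at key
  simp only [eLpNorm_two_eq]
  have := key.ennrpow_const (1 / 2 : ℝ)
  simpa using this

lemma fop_cmoll {l : Fin n → Symb n} {q : Fin n → Cn n → ℂ} {u : Fin n → Cn n → ℂ}
    {k : Cn n → ℂ} (h : WeakEq l q u k) (hq : ∀ i, ContDiff ℝ ∞ (q i))
    (hu : ∀ i, LocallyIntegrable (u i)) {ε : ℝ} (hε : 0 < ε) (x : Cn n) :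
    fop l q (fun i => cmoll ε (u i)) x = cmoll ε k x +
      ∑ i, (q i x * cmoll ε (u i) x - cmoll ε (fun z => q i z * u i z) x) := by
  have ht := isTest_moll_sub (n := n) hε x
  have h1 := h _ ht
  rw [← cmoll_eq] at h1
  rw [← h1, ← Finset.sum_add_distrib]
  refine Finset.sum_congr rfl fun i _ => ?_
  rw [pd_cmoll (l i) hε (hu i), cmoll_eq ε (fun z => q i z * u i z)]
  simp only [mul_sub]
  rw [integral_sub]
  · have : ∀ z, u i z * (q i z * (moll ε (x - z) : ℂ)) = q i z * u i z * (moll ε (x - z) : ℂ) :=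
      fun z => by ring
    simp only [this]
    ring
  · exact (ht.mul_left (hq i)).integrable_mul (hu i)
  · exact (ht.pd (l i)).integrable_mul (hu i)

lemma cmoll_eq_zero {R ε : ℝ} (hε : 0 < ε) {u : Cn n → ℂ} (hR : ∀ z, R ≤ ‖z‖ → u z = 0)
    {x : Cn n} (hx : R + ε ≤ ‖x‖) : cmoll ε u x = 0 := by
  unfold cmoll
  rw [integral_eq_zero_of_ae]
  refine Eventually.of_forall fun y => ?_
  by_cases hy : ε ≤ ‖y‖
  · simp [moll_eq_zero hε hy]
  · have : R ≤ ‖x - y‖ := by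
      have := norm_sub_norm_le x y
      linarith [not_le.1 hy]
    simp [hR _ this]

lemma measurable_cmoll {ε : ℝ} (hε : 0 < ε) {u : Cn n → ℂ} (hu : LocallyIntegrable u) :
    Measurable (cmoll ε u) := (contDiff_cmoll hε hu).continuous.measurable

lemma tendsto_fop_cmoll {l : Fin n → Symb n} {q : Fin n → Cn n → ℂ} {u : Fin n → Cn n → ℂ}
    {k : Cn n → ℂ} (h : WeakEq l q u k) (hq : ∀ i, ContDiff ℝ ∞ (q i))
    (hum : ∀ i, Measurable (u i)) (hu : ∀ i, MemLp (u i) 2 volume)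
    (hkm : Measurable k) (hk : MemLp k 2 volume) {R : ℝ} (hR : ∀ i z, R ≤ ‖z‖ → u i z = 0) :
    Tendsto (fun ε : ℝ => eLpNorm (fun x => fop l q (fun i => cmoll ε (u i)) x - k x) 2 volume)
      (𝓝[>] 0) (𝓝 0) := by
  have hul : ∀ i, LocallyIntegrable (u i) := fun i => (hu i).locallyIntegrable (by norm_num)
  have hkl : LocallyIntegrable k := hk.locallyIntegrable (by norm_num)
  have hbd : ∀ i, ∃ C : ℝ≥0, ∀ z ∈ Metric.closedBall (0 : Cn n) (R + 1), ‖q i z‖₊ ≤ C := by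
    intro i
    obtain ⟨C, hC⟩ := (isCompact_closedBall (0 : Cn n) (R + 1)).exists_bound_of_continuousOn
      (hq i).continuous.continuousOn
    refine ⟨C.toNNReal, fun z hz => ?_⟩
    rw [← NNReal.coe_le_coe, coe_nnnorm]
    exact (hC z hz).trans (Real.le_coe_toNNReal C)
  choose C hC using hbd
  have hquR : ∀ i z, R ≤ ‖z‖ → q i z * u i z = 0 := fun i z hz => by rw [hR i z hz, mul_zero]
  have hqum : ∀ i, Measurable fun z => q i z * u i z := fun i =>
    (hq i).continuous.measurable.mul (hum i)
  have hqu : ∀ i, MemLp (fun z => q i z * u i z) 2 volume := by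
    intro i
    refine (hu i).of_le_mul (c := C i) (hqum i).aestronglyMeasurable
      (Eventually.of_forall fun z => ?_)
    rw [norm_mul]
    by_cases hz : R ≤ ‖z‖
    · simp [hR i z hz]
    · gcongr
      have := hC i z (by simpa using (by linarith [not_le.1 hz] : ‖z‖ ≤ R + 1))
      exact_mod_cast this
  have hqul : ∀ i, LocallyIntegrable (fun z => q i z * u i z) := fun i =>
    (hqu i).locallyIntegrable (by norm_num)
  have hbound : ∀ᶠ ε : ℝ in 𝓝[>] 0,
      eLpNorm (fun x => fop l q (fun i => cmoll ε (u i)) x - k x) 2 volume ≤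
      eLpNorm (fun x => cmoll ε k x - k x) 2 volume + ∑ i,
        (C i * eLpNorm (fun x => cmoll ε (u i) x - u i x) 2 volume +
          eLpNorm (fun x => cmoll ε (fun z => q i z * u i z) x - q i x * u i x) 2 volume) := by
    filter_upwards [Ioo_mem_nhdsGT (zero_lt_one' ℝ)] with ε hε
    have m1 : AEStronglyMeasurable (fun x => cmoll ε k x - k x) volume :=
      ((measurable_cmoll hε.1 hkl).sub hkm).aestronglyMeasurable
    have m2 : ∀ i, AEStronglyMeasurable (fun x => q i x * (cmoll ε (u i) x - u i x)) volume :=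
      fun i => ((hq i).continuous.measurable.mul
        ((measurable_cmoll hε.1 (hul i)).sub (hum i))).aestronglyMeasurable
    have m3 : ∀ i, AEStronglyMeasurable
        (fun x => cmoll ε (fun z => q i z * u i z) x - q i x * u i x) volume :=
      fun i => ((measurable_cmoll hε.1 (hqul i)).sub (hqum i)).aestronglyMeasurable
    have e : (fun x => fop l q (fun i => cmoll ε (u i)) x - k x) =
        (fun x => cmoll ε k x - k x) + ∑ i, ((fun x => q i x * (cmoll ε (u i) x - u i x)) -
          fun x => cmoll ε (fun z => q i z * u i z) x - q i x * u i x) := by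
      funext x
      rw [fop_cmoll h hq hul hε.1]
      simp only [Pi.add_apply, Finset.sum_apply, Pi.sub_apply]
      rw [add_sub_right_comm]
      congr 1
      exact Finset.sum_congr rfl fun i _ => by ring
    rw [e]
    refine (eLpNorm_add_le m1 (Finset.aestronglyMeasurable_sum _ fun i _ => (m2 i).sub (m3 i))
      (by norm_num)).trans ?_
    gcongr
    refine (eLpNorm_sum_le (fun i _ => (m2 i).sub (m3 i)) (by norm_num)).trans ?_
    refine Finset.sum_le_sum fun i _ => ?_
    refine (eLpNorm_sub_le (m2 i) (m3 i) (by norm_num)).trans ?_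
    gcongr
    have := eLpNorm_le_nnreal_smul_eLpNorm_of_ae_le_mul (p := 2) (μ := volume) (c := C i)
      (f := fun x => q i x * (cmoll ε (u i) x - u i x)) (g := fun x => cmoll ε (u i) x - u i x)
      (Eventually.of_forall fun x => ?_)
    · simpa [ENNReal.smul_def] using this
    · rw [nnnorm_mul]
      by_cases hx : ‖x‖ ≤ R + 1
      · gcongr
        exact hC i x (by simpa using hx)
      · rw [cmoll_eq_zero hε.1 (hR i) (by linarith [hε.2, not_le.1 hx]),
          hR i x (by linarith [not_le.1 hx])]
        simp
  refine tendsto_of_tendsto_of_tendsto_of_le_of_le' tendsto_const_nhds ?_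
    (Eventually.of_forall fun _ => zero_le) hbound
  have hlim := (tendsto_cmoll_eLpNorm hkm hk).add (tendsto_finsetSum Finset.univ fun i _ =>
    ((ENNReal.Tendsto.const_mul (tendsto_cmoll_eLpNorm (hum i) (hu i))
      (Or.inr (ENNReal.coe_ne_top (r := C i)))).add (tendsto_cmoll_eLpNorm (hqum i) (hqu i))))
  simpa using hlim

/-- Friedrichs' lemma: weak solutions in `L²` of finitely many first-order equations are
approximated by test functions in the graph norm. -/
theorem exists_test_approx {ι : Type*} [Finite ι] {l : ι → Fin n → Symb n}
    {q : ι → Fin n → Cn n → ℂ} {u : Fin n → Cn n → ℂ} {k : ι → Cn n → ℂ}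
    (h : ∀ m, WeakEq (l m) (q m) u (k m)) (hq : ∀ m i, ContDiff ℝ ∞ (q m i))
    (hum : ∀ i, Measurable (u i)) (hu : ∀ i, MemLp (u i) 2 volume)
    (hkm : ∀ m, Measurable (k m)) (hk : ∀ m, MemLp (k m) 2 volume) {δ : ℝ≥0∞} (hδ : 0 < δ) :
    ∃ u' : Fin n → Cn n → ℂ, (∀ i, IsTest (u' i)) ∧
      (∀ i, eLpNorm (fun x => u' i x - u i x) 2 volume ≤ δ) ∧
      ∀ m, eLpNorm (fun x => fop (l m) (q m) u' x - k m x) 2 volume ≤ δ := by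
  have hul : ∀ i, LocallyIntegrable (u i) := fun i => (hu i).locallyIntegrable (by norm_num)
  have hkl : ∀ m, LocallyIntegrable (k m) := fun m => (hk m).locallyIntegrable (by norm_num)
  let χ : ℝ → Cn n → ℂ := fun R z => (cutoff R z : ℂ)
  have hχ1 : ∀ z : Cn n, ∀ᶠ R in atTop, χ R z = 1 := fun z => by
    filter_upwards [cutoff_eventually_one z] with R hR
    simp [χ, hR.self_of_nhds]
  have hχd : ∀ (L : Symb n) (z : Cn n), ∀ᶠ R in atTop, pd L (χ R) z = 0 := fun L z => by
    filter_upwards [cutoff_eventually_one z] with R hR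
    have : χ R =ᶠ[𝓝 z] fun _ => 1 := by
      filter_upwards [hR] with y hy
      simp [χ, hy]
    simp [pd, this.fderiv_eq]
  have hχm : ∀ R, Measurable (χ R) := fun R =>
    (Complex.continuous_ofReal.comp (contDiff_cutoff R).continuous).measurable
  have hχs : ∀ R, ContDiff ℝ ∞ (χ R) := fun R => Complex.ofRealCLM.contDiff.comp (contDiff_cutoff R)
  have t1 : ∀ i, Tendsto (fun R => eLpNorm (fun x => χ R x * u i x - u i x) 2 volume) atTop (𝓝 0) := by
    intro i
    refine tendsto_eLpNorm_zero_of_dominated (g := fun z => 2 * ‖u i z‖)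
      (Eventually.of_forall fun R => ((hχm R).mul (hum i)).sub (hum i)) ((hu i).norm.const_mul 2)
      (Eventually.of_forall fun R z => ?_) fun z => ?_
    · calc ‖χ R z * u i z - u i z‖ ≤ ‖χ R z * u i z‖ + ‖u i z‖ := norm_sub_le _ _
        _ ≤ 1 * ‖u i z‖ + ‖u i z‖ := by rw [norm_mul]; gcongr; exact cutoff_norm_le R z
        _ = _ := by ring
    · filter_upwards [hχ1 z] with R hR
      simp [hR]
  let kR : ι → ℝ → Cn n → ℂ := fun m R z => χ R z * k m z + ∑ i, pd (l m i) (χ R) z * u i z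
  have hkRm : ∀ m R, Measurable (kR m R) := fun m R =>
    ((hχm R).mul (hkm m)).add (Finset.measurable_fun_sum _ fun i _ =>
      (contDiff_pd (l m i) (hχs R)).continuous.measurable.mul (hum i))
  choose Cb hCb0 hCb using fun m i => exists_pd_cutoff_le (l m i)
  have hdom : ∀ m, ∀ R ≥ 1, ∀ z, ‖kR m R z - k m z‖ ≤ 2 * ‖k m z‖ + ∑ i, Cb m i * ‖u i z‖ := by
    intro m R hR z
    have e : kR m R z - k m z = (χ R z * k m z - k m z) + ∑ i, pd (l m i) (χ R) z * u i z := by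
      simp only [kR]; ring
    rw [e]
    refine (norm_add_le _ _).trans (add_le_add ?_ ?_)
    · calc ‖χ R z * k m z - k m z‖ ≤ ‖χ R z * k m z‖ + ‖k m z‖ := norm_sub_le _ _
        _ ≤ 1 * ‖k m z‖ + ‖k m z‖ := by rw [norm_mul]; gcongr; exact cutoff_norm_le R z
        _ = _ := by ring
    · refine (norm_sum_le _ _).trans (Finset.sum_le_sum fun i _ => ?_)
      rw [norm_mul]
      gcongr
      exact hCb m i R hR z
  have hgm : ∀ m, MemLp (fun z => 2 * ‖k m z‖ + ∑ i, Cb m i * ‖u i z‖) 2 volume := fun m =>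
    ((hk m).norm.const_mul 2).add (memLp_finsetSum _ fun i _ => (hu i).norm.const_mul _)
  have t2 : ∀ m, Tendsto (fun R => eLpNorm (fun x => kR m R x - k m x) 2 volume) atTop (𝓝 0) := by
    intro m
    refine tendsto_eLpNorm_zero_of_dominated
      (Eventually.of_forall fun R => (hkRm m R).sub (hkm m)) (hgm m) ?_ fun z => ?_
    · filter_upwards [eventually_ge_atTop 1] with R hR using hdom m R hR
    · have : ∀ᶠ R in atTop, ∀ i, pd (l m i) (χ R) z = 0 :=
        eventually_all.2 fun i => hχd (l m i) z
      filter_upwards [this, hχ1 z] with R h1 h2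
      simp [kR, h1, h2]
  have hδ2 : 0 < δ / 2 := ENNReal.half_pos hδ.ne'
  obtain ⟨R, hR1, hRu, hRk⟩ : ∃ R : ℝ, 1 ≤ R ∧
      (∀ i, eLpNorm (fun x => χ R x * u i x - u i x) 2 volume ≤ δ / 2) ∧
      ∀ m, eLpNorm (fun x => kR m R x - k m x) 2 volume ≤ δ / 2 :=
    ((eventually_ge_atTop 1).and ((eventually_all.2 fun i => (t1 i).eventually_le_const hδ2).and
      (eventually_all.2 fun m => (t2 m).eventually_le_const hδ2))).exists
  have hR0 : 0 < R := by linarith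
  have htχ : IsTest (χ R) := isTest_cutoff hR0
  obtain ⟨R', hR'⟩ := htχ.compact.isCompact.isBounded.subset_ball (0 : Cn n)
  have hsupp : ∀ i z, R' ≤ ‖z‖ → χ R z * u i z = 0 := by
    intro i z hz
    have : z ∉ tsupport (χ R) := fun hmem => by
      have := hR' hmem
      simp only [Metric.mem_ball, dist_zero_right] at this
      linarith
    rw [image_eq_zero_of_notMem_tsupport this, zero_mul]
  have huRm : ∀ i, Measurable fun z => χ R z * u i z := fun i => (hχm R).mul (hum i)
  have huR : ∀ i, MemLp (fun z => χ R z * u i z) 2 volume := fun i => by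
    refine (hu i).of_le (huRm i).aestronglyMeasurable (Eventually.of_forall fun z => ?_)
    rw [norm_mul]
    exact mul_le_of_le_one_left (norm_nonneg _) (cutoff_norm_le R z)
  have hkR : ∀ m, MemLp (kR m R) 2 volume := fun m => by
    have h1 : MemLp (fun z => kR m R z - k m z) 2 volume := by
      refine (hgm m).of_le ((hkRm m R).sub (hkm m)).aestronglyMeasurable
        (Eventually.of_forall fun z => ?_)
      exact (hdom m R hR1 z).trans (Real.le_norm_self _)
    have e : kR m R = (fun z => kR m R z - k m z) + k m := by funext z; simp
    rw [e]
    exact h1.add (hk m)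
  have hweak : ∀ m, WeakEq (l m) (q m) (fun i z => χ R z * u i z) (kR m R) := fun m =>
    weakEq_cutoff (h m) htχ (hq m) hul (hkl m)
  obtain ⟨ε, hε0, hεu, hεk⟩ : ∃ ε : ℝ, 0 < ε ∧
      (∀ i, eLpNorm (fun x => cmoll ε (fun z => χ R z * u i z) x - χ R x * u i x) 2 volume ≤ δ / 2) ∧
      ∀ m, eLpNorm (fun x => fop (l m) (q m) (fun i => cmoll ε fun z => χ R z * u i z) x - kR m R x)
        2 volume ≤ δ / 2 :=
    ((eventually_mem_nhdsWithin (a := (0 : ℝ)) (s := Set.Ioi 0)).and ((eventually_all.2 fun i =>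
      (tendsto_cmoll_eLpNorm (huRm i) (huR i)).eventually_le_const hδ2).and
      (eventually_all.2 fun m => (tendsto_fop_cmoll (hweak m) (hq m) huRm huR (hkRm m R) (hkR m)
        hsupp).eventually_le_const hδ2))).exists
  have hli : ∀ i, LocallyIntegrable fun z => χ R z * u i z := fun i =>
    (huR i).locallyIntegrable (by norm_num)
  have htest : ∀ i, IsTest (cmoll ε fun z => χ R z * u i z) := fun i =>
    ⟨contDiff_cmoll hε0 (hli i), hasCompactSupport_cmoll hε0 htχ.compact.mul_right⟩
  have add_half : ∀ {f g k : Cn n → ℂ}, Measurable f → Measurable g → Measurable k →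
      eLpNorm (fun x => f x - g x) 2 volume ≤ δ / 2 → eLpNorm (fun x => g x - k x) 2 volume ≤ δ / 2 →
      eLpNorm (fun x => f x - k x) 2 volume ≤ δ := by
    intro f g k hf hg hk h1 h2
    have e : (fun x => f x - k x) = (fun x => f x - g x) + fun x => g x - k x := by
      funext x; simp
    rw [e]
    refine (eLpNorm_add_le (hf.sub hg).aestronglyMeasurable (hg.sub hk).aestronglyMeasurable
      (by norm_num)).trans ?_
    calc _ ≤ δ / 2 + δ / 2 := add_le_add h1 h2
      _ = δ := ENNReal.add_halves δ
  refine ⟨_, htest, fun i => ?_, fun m => ?_⟩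
  · exact add_half (htest i).continuous.measurable (huRm i) (hum i) (hεu i) (hRu i)
  · refine add_half ?_ (hkRm m R) (hkm m) (hεk m) (hRk m)
    exact Finset.measurable_fun_sum _ fun i _ =>
      ((htest i).pd _).continuous.measurable.add
        ((hq m i).continuous.measurable.mul (htest i).continuous.measurable)

/-- Evaluation of the derivative at a vector. -/
def evS (v : Cn n) : Symb n :=
  LinearMap.mkContinuous
    { toFun := fun L => L v
      map_add' := fun _ _ => rfl
      map_smul' := fun _ _ => rfl } ‖v‖ fun L => by
        simpa [mul_comm] using L.le_opNorm v

@[simp] lemma evS_apply (v : Cn n) (L : Cn n →L[ℝ] ℂ) : evS v L = L v := rfl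

/-- The operator `∂_a = ∑ aⱼ ∂/∂zⱼ`. -/
def dzA (a : Cn n) : Symb n := (1 / 2 : ℂ) • (evS a - Complex.I • evS (Complex.I • a))

/-- The operator `∑ conj aⱼ ∂/∂z̄ⱼ`. -/
def dzbA (a : Cn n) : Symb n := (1 / 2 : ℂ) • (evS a + Complex.I • evS (Complex.I • a))

lemma dzA_apply (a : Cn n) (L : Cn n →L[ℝ] ℂ) :
    dzA a L = (L a - Complex.I * L (Complex.I • a)) / 2 := by
  simp [dzA]; ring

lemma dzbA_apply (a : Cn n) (L : Cn n →L[ℝ] ℂ) :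
    dzbA a L = (L a + Complex.I * L (Complex.I • a)) / 2 := by
  simp [dzbA]; ring

lemma fderiv_two_symm {w : Cn n → ℂ} (hw : ContDiff ℝ ∞ w) (z v v' : Cn n) :
    fderiv ℝ (fderiv ℝ w) z v v' = fderiv ℝ (fderiv ℝ w) z v' v :=
  (hw.contDiffAt (x := z)).isSymmSndFDerivAt (by simpa using ENat.LEInfty.out) v v'

lemma pd_const_mul (l : Symb n) (c : ℂ) {w : Cn n → ℂ} {z : Cn n} (hw : DifferentiableAt ℝ w z) :
    pd l (fun z => c * w z) z = c * pd l w z := by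
  unfold pd
  rw [fderiv_const_mul hw, map_smul, smul_eq_mul]

lemma fderiv_pd (l : Symb n) {w : Cn n → ℂ} (hw : ContDiff ℝ ∞ w) (z v : Cn n) :
    fderiv ℝ (pd l w) z v = l (fderiv ℝ (fderiv ℝ w) z v) := by
  have hd : DifferentiableAt ℝ (fderiv ℝ w) z :=
    (hw.fderiv_right (m := ∞) (by simp)).differentiable (by simp) z
  have h := (l.restrictScalars ℝ).hasFDerivAt.comp z hd.hasFDerivAt
  change fderiv ℝ ((l.restrictScalars ℝ) ∘ (fderiv ℝ w)) z v = _
  rw [h.fderiv]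
  rfl

lemma pd_dzbA_dzA {w : Cn n → ℂ} (hw : ContDiff ℝ ∞ w) (a b z : Cn n) :
    pd (dzbA b) (pd (dzA a) w) z = pd (dzA a) (pd (dzbA b) w) z := by
  simp only [pd, dzbA_apply, dzA_apply]
  change (fderiv ℝ (pd (dzA a) w) z b + Complex.I * fderiv ℝ (pd (dzA a) w) z (Complex.I • b)) / 2 =
    (fderiv ℝ (pd (dzbA b) w) z a - Complex.I * fderiv ℝ (pd (dzbA b) w) z (Complex.I • a)) / 2
  simp only [fderiv_pd _ hw, dzbA_apply, dzA_apply]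
  rw [fderiv_two_symm hw z b a, fderiv_two_symm hw z b (Complex.I • a),
    fderiv_two_symm hw z (Complex.I • b) a, fderiv_two_symm hw z (Complex.I • b) (Complex.I • a)]
  ring

lemma pd_dzbA_dzbA {w : Cn n → ℂ} (hw : ContDiff ℝ ∞ w) (a b z : Cn n) :
    pd (dzbA b) (pd (dzbA a) w) z = pd (dzbA a) (pd (dzbA b) w) z := by
  simp only [pd, dzbA_apply]
  change (fderiv ℝ (pd (dzbA a) w) z b + Complex.I * fderiv ℝ (pd (dzbA a) w) z (Complex.I • b)) / 2 =
    (fderiv ℝ (pd (dzbA b) w) z a + Complex.I * fderiv ℝ (pd (dzbA b) w) z (Complex.I • a)) / 2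
  simp only [fderiv_pd _ hw, dzbA_apply]
  rw [fderiv_two_symm hw z b a, fderiv_two_symm hw z b (Complex.I • a),
    fderiv_two_symm hw z (Complex.I • b) a, fderiv_two_symm hw z (Complex.I • b) (Complex.I • a)]
  ring

/-- The `j`-th standard basis vector. -/
abbrev eb (j : Fin n) : Cn n := Pi.single j 1

lemma clm_eq_sum (L : Cn n →L[ℝ] ℂ) (a : Cn n) :
    L a = ∑ j, ((a j).re * L (eb j) + (a j).im * L (Complex.I • eb j)) := by
  have e : a = ∑ j, ((a j).re • (eb j : Cn n) + (a j).im • (Complex.I • (eb j : Cn n))) := by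
    funext i
    simp only [Finset.sum_apply, Pi.add_apply, Pi.smul_apply, Complex.real_smul, smul_eq_mul]
    rw [Finset.sum_eq_single i]
    · simp [Complex.re_add_im]
    · intro b _ hb
      simp [hb.symm]
    · simp
  conv_lhs => rw [e]
  simp [map_sum]

lemma dzA_eq_sum (a : Cn n) : dzA a = ∑ j, a j • dzA (eb j) := by
  ext L
  simp only [FunLike.coe_sum, Finset.sum_apply, smul_apply, dzA_apply, smul_eq_mul]
  rw [clm_eq_sum L a, clm_eq_sum L (Complex.I • a), Finset.mul_sum, ← Finset.sum_sub_distrib,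
    Finset.sum_div]
  refine Finset.sum_congr rfl fun j _ => ?_
  simp only [Pi.smul_apply, smul_eq_mul, Complex.mul_re, Complex.mul_im, Complex.I_re, Complex.I_im]
  conv_rhs => rw [← Complex.re_add_im (a j)]
  push_cast
  linear_combination (1 / 2 : ℂ) * (a j).im * L (Complex.I • eb j) * Complex.I_mul_I

lemma dzbA_eq_sum (a : Cn n) : dzbA a = ∑ j, conj (a j) • dzbA (eb j) := by
  ext L
  simp only [FunLike.coe_sum, Finset.sum_apply, smul_apply, dzbA_apply, smul_eq_mul]
  rw [clm_eq_sum L a, clm_eq_sum L (Complex.I • a), Finset.mul_sum, ← Finset.sum_add_distrib,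
    Finset.sum_div]
  refine Finset.sum_congr rfl fun j _ => ?_
  simp only [Pi.smul_apply, smul_eq_mul, Complex.mul_re, Complex.mul_im, Complex.I_re, Complex.I_im]
  conv_rhs => rw [← Complex.re_add_im (a j)]
  simp only [map_add, map_mul, Complex.conj_ofReal, Complex.conj_I]
  push_cast
  linear_combination (1 / 2 : ℂ) * (a j).im * L (Complex.I • eb j) * (Complex.I_mul_I)

/-- The Levi form of a real function. -/
def levi (Q : Cn n → ℝ) (z a : Cn n) : ℝ :=
  (pd (dzbA a) (pd (dzA a) fun z => (Q z : ℂ)) z).re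

lemma pd_conj (a : Cn n) {w : Cn n → ℂ} {z : Cn n} (hw : DifferentiableAt ℝ w z) :
    pd (dzbA a) (fun z => conj (w z)) z = conj (pd (dzA a) w z) := by
  have h := (Complex.conjCLE.toContinuousLinearMap.hasFDerivAt.comp z hw.hasFDerivAt).fderiv
  have h' : fderiv ℝ (fun z => conj (w z)) z =
      (Complex.conjCLE.toContinuousLinearMap).comp (fderiv ℝ w z) := h
  unfold pd
  rw [h', dzbA_apply, dzA_apply]
  simp [map_sub, map_mul, map_div₀, Complex.conj_ofNat]

lemma pd_conj' (a : Cn n) {w : Cn n → ℂ} {z : Cn n} (hw : DifferentiableAt ℝ w z) :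
    pd (dzA a) (fun z => conj (w z)) z = conj (pd (dzbA a) w z) := by
  have h := (Complex.conjCLE.toContinuousLinearMap.hasFDerivAt.comp z hw.hasFDerivAt).fderiv
  have h' : fderiv ℝ (fun z => conj (w z)) z =
      (Complex.conjCLE.toContinuousLinearMap).comp (fderiv ℝ w z) := h
  unfold pd
  rw [h', dzbA_apply, dzA_apply]
  simp [map_add, map_mul, map_div₀, Complex.conj_ofNat, sub_eq_add_neg]

lemma contDiff_conj {w : Cn n → ℂ} (hw : ContDiff ℝ ∞ w) : ContDiff ℝ ∞ fun z => conj (w z) :=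
  Complex.conjCLE.contDiff.comp hw

lemma IsTest.conj {w : Cn n → ℂ} (hw : IsTest w) : IsTest fun z => conj (w z) :=
  ⟨contDiff_conj hw.smooth, hw.compact.comp_left (g := fun x : ℂ => starRingEnd ℂ x) (map_zero _)⟩

lemma contDiff_ofReal {Q : Cn n → ℝ} (hQ : ContDiff ℝ ∞ Q) : ContDiff ℝ ∞ fun z => (Q z : ℂ) :=
  Complex.ofRealCLM.contDiff.comp hQ

/-- Half of the antiholomorphic derivative of the weight. -/
def qf (Q : Cn n → ℝ) (j : Fin n) (z : Cn n) : ℂ := pd (dzbA (eb j)) (fun z => (Q z : ℂ)) z / 2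

/-- The conjugated operator `e^{-Q/2} ∂̄ⱼ e^{Q/2}`. -/
def Tbar (Q : Cn n → ℝ) (j : Fin n) (u : Cn n → ℂ) (z : Cn n) : ℂ :=
  pd (dzbA (eb j)) u z + qf Q j z * u z

/-- The formal adjoint of `Tbar`. -/
def Tst (Q : Cn n → ℝ) (j : Fin n) (u : Cn n → ℂ) (z : Cn n) : ℂ :=
  - pd (dzA (eb j)) u z + conj (qf Q j z) * u z

lemma contDiff_qf {Q : Cn n → ℝ} (hQ : ContDiff ℝ ∞ Q) (j : Fin n) : ContDiff ℝ ∞ (qf Q j) :=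
  (contDiff_pd _ (contDiff_ofReal hQ)).div_const _

lemma IsTest.top {Q : Cn n → ℝ} (hQ : ContDiff ℝ ∞ Q) (j : Fin n) {u : Cn n → ℂ} (hu : IsTest u) :
    IsTest (Tbar Q j u) := (hu.pd _).add (hu.mul_left (contDiff_qf hQ j))

lemma IsTest.tst {Q : Cn n → ℝ} (hQ : ContDiff ℝ ∞ Q) (j : Fin n) {u : Cn n → ℂ} (hu : IsTest u) :
    IsTest (Tst Q j u) := (hu.pd _).neg.add (hu.mul_left (contDiff_conj (contDiff_qf hQ j)))

lemma conj_qf {Q : Cn n → ℝ} (hQ : ContDiff ℝ ∞ Q) (j : Fin n) (z : Cn n) :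
    conj (qf Q j z) = pd (dzA (eb j)) (fun z => (Q z : ℂ)) z / 2 := by
  unfold qf
  rw [map_div₀, ← pd_conj' _ ((contDiff_ofReal hQ).differentiable (by simp) z)]
  simp [Complex.conj_ofNat]

lemma integral_Tbar_mul {Q : Cn n → ℝ} (hQ : ContDiff ℝ ∞ Q) (j : Fin n) {u v : Cn n → ℂ}
    (hu : IsTest u) (hv : ContDiff ℝ ∞ v) :
    ∫ z, Tbar Q j u z * conj (v z) = ∫ z, u z * conj (Tst Q j v z) := by
  have h := integral_pd_mul (dzbA (eb j)) hu (contDiff_conj hv)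
  have i1 : Integrable fun z => pd (dzbA (eb j)) u z * conj (v z) := by
    simpa [mul_comm] using ((hu.pd (dzbA (eb j))).mul_left (contDiff_conj hv)).integrable
  have i2 : Integrable fun z => qf Q j z * u z * conj (v z) := by
    have := ((hu.mul_left (contDiff_qf hQ j)).mul_left (contDiff_conj hv)).integrable
    refine this.congr (Eventually.of_forall fun z => ?_)
    simp only; ring
  have i3 : Integrable fun z => u z * pd (dzbA (eb j)) (fun z => conj (v z)) z := by
    have := ((hu.mul_left (contDiff_pd (dzbA (eb j)) (contDiff_conj hv)))).integrable
    refine this.congr (Eventually.of_forall fun z => ?_)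
    simp only; ring
  calc ∫ z, Tbar Q j u z * conj (v z)
      = ∫ z, (pd (dzbA (eb j)) u z * conj (v z) + qf Q j z * u z * conj (v z)) := by
        congr 1; funext z; simp only [Tbar]; ring
    _ = -(∫ z, u z * pd (dzbA (eb j)) (fun z => conj (v z)) z) +
          ∫ z, qf Q j z * u z * conj (v z) := by rw [integral_add i1 i2, h]
    _ = ∫ z, (-(u z * pd (dzbA (eb j)) (fun z => conj (v z)) z) +
          qf Q j z * u z * conj (v z)) := by
        rw [← integral_neg, ← integral_add (by exact i3.neg) i2]
    _ = _ := by
        congr 1; funext z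
        rw [pd_conj _ (hv.differentiable (by simp) z)]
        simp only [Tst, map_add, map_neg, map_mul, Complex.conj_conj]; ring

lemma integral_Tst_mul {Q : Cn n → ℝ} (hQ : ContDiff ℝ ∞ Q) (j : Fin n) {u v : Cn n → ℂ}
    (hu : ContDiff ℝ ∞ u) (hv : IsTest v) :
    ∫ z, Tst Q j u z * conj (v z) = ∫ z, u z * conj (Tbar Q j v z) := by
  have h := congrArg conj (integral_Tbar_mul hQ j hv hu)
  rw [← integral_conj, ← integral_conj] at h
  simp only [map_mul, Complex.conj_conj] at h
  simpa [mul_comm] using h.symm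

lemma pd_neg (l : Symb n) (w : Cn n → ℂ) (z : Cn n) : pd l (fun z => - w z) z = - pd l w z := by
  unfold pd; rw [fderiv_fun_neg, map_neg]

/-- The commutator of `Tbar` and `Tst`. -/
lemma Tbar_Tst {Q : Cn n → ℝ} (hQ : ContDiff ℝ ∞ Q) (j k : Fin n) {u : Cn n → ℂ}
    (hu : ContDiff ℝ ∞ u) (z : Cn n) :
    Tbar Q k (Tst Q j u) z = Tst Q j (Tbar Q k u) z +
      pd (dzbA (eb k)) (pd (dzA (eb j)) fun z => (Q z : ℂ)) z * u z := by
  have dQ := contDiff_ofReal hQ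
  have d0 : ∀ {w : Cn n → ℂ}, ContDiff ℝ ∞ w → DifferentiableAt ℝ w z :=
    fun h => h.differentiable (by simp) z
  have e1 : pd (dzbA (eb k)) (Tst Q j u) z = - pd (dzbA (eb k)) (pd (dzA (eb j)) u) z +
      (conj (qf Q j z) * pd (dzbA (eb k)) u z +
        pd (dzbA (eb k)) (fun z => conj (qf Q j z)) z * u z) := by
    have : Tst Q j u = fun z => (fun z => - pd (dzA (eb j)) u z) z +
        (fun z => (fun z => conj (qf Q j z)) z * u z) z := rfl
    rw [this, pd_add _ (d0 (contDiff_pd _ hu).neg)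
      (d0 ((contDiff_conj (contDiff_qf hQ j)).mul hu)), pd_neg,
      pd_mul _ (d0 (contDiff_conj (contDiff_qf hQ j))) (d0 hu)]
    ring
  have e2 : pd (dzA (eb j)) (Tbar Q k u) z = pd (dzA (eb j)) (pd (dzbA (eb k)) u) z +
      (qf Q k z * pd (dzA (eb j)) u z + pd (dzA (eb j)) (qf Q k) z * u z) := by
    have : Tbar Q k u = fun z => (fun z => pd (dzbA (eb k)) u z) z +
        (fun z => (qf Q k) z * u z) z := rfl
    rw [this, pd_add _ (d0 (contDiff_pd _ hu)) (d0 ((contDiff_qf hQ k).mul hu)),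
      pd_mul _ (d0 (contDiff_qf hQ k)) (d0 hu)]
    ring
  have e3 : pd (dzbA (eb k)) (fun z => conj (qf Q j z)) z =
      (1 / 2) * pd (dzbA (eb k)) (pd (dzA (eb j)) fun z => (Q z : ℂ)) z := by
    have : (fun z => conj (qf Q j z)) =
        fun z => (1 / 2 : ℂ) * pd (dzA (eb j)) (fun z => (Q z : ℂ)) z := by
      funext z; rw [conj_qf hQ]; ring
    rw [this, pd_const_mul _ _ (d0 (contDiff_pd _ dQ))]
  have e4 : pd (dzA (eb j)) (qf Q k) z =
      (1 / 2) * pd (dzbA (eb k)) (pd (dzA (eb j)) fun z => (Q z : ℂ)) z := by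
    have : (qf Q k) = fun z => (1 / 2 : ℂ) * pd (dzbA (eb k)) (fun z => (Q z : ℂ)) z := by
      funext z; simp only [qf]; ring
    rw [this, pd_const_mul _ _ (d0 (contDiff_pd _ dQ)), pd_dzbA_dzA dQ]
  have c := pd_dzbA_dzA hu (eb j) (eb k) z
  conv_lhs => rw [Tbar]
  conv_rhs => rw [Tst]
  rw [e1, e2, e3, e4, c]
  simp only [Tbar, Tst]
  ring

lemma levi_eq_sum {Q : Cn n → ℝ} (hQ : ContDiff ℝ ∞ Q) (z a : Cn n) :
    levi Q z a = (∑ j, ∑ k, pd (dzbA (eb k)) (pd (dzA (eb j)) fun z => (Q z : ℂ)) z *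
      a j * conj (a k)).re := by
  have e : pd (dzA a) (fun z => (Q z : ℂ)) =
      fun z => ∑ j, a j * pd (dzA (eb j)) (fun z => (Q z : ℂ)) z := by
    funext z; rw [dzA_eq_sum]; simp [pd]
  unfold levi
  rw [e, dzbA_eq_sum]
  congr 1
  have : ∀ l : Symb n, pd l (fun z => ∑ j, a j * pd (dzA (eb j)) (fun z => (Q z : ℂ)) z) z =
      ∑ j, a j * pd l (pd (dzA (eb j)) (fun z => (Q z : ℂ))) z := by
    intro l
    change l (fderiv ℝ (fun z => ∑ j, a j * pd (dzA (eb j)) (fun z => (Q z : ℂ)) z) z) =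
      ∑ j, a j * l (fderiv ℝ (pd (dzA (eb j)) (fun z => (Q z : ℂ))) z)
    rw [fderiv_fun_sum fun j _ => (((contDiff_pd _ (contDiff_ofReal hQ)).differentiable
      (by simp) z).const_mul _), map_sum]
    refine Finset.sum_congr rfl fun j _ => ?_
    rw [fderiv_const_mul ((contDiff_pd _ (contDiff_ofReal hQ)).differentiable (by simp) z),
      map_smul, smul_eq_mul]
  rw [this]
  refine Finset.sum_congr rfl fun j _ => ?_
  simp only [pd, FunLike.coe_sum, Finset.sum_apply, smul_apply, smul_eq_mul, Finset.mul_sum]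
  refine Finset.sum_congr rfl fun k _ => ?_
  ring

lemma re_double_sum_add {ι : Type*} [Fintype ι] (A : ι → ι → ℂ) :
    0 ≤ (∑ j, ∑ k, A j k * conj (A k j)).re + (1 / 2) * ∑ j, ∑ k, ‖A j k - A k j‖ ^ 2 := by
  have h : ∀ j k, ‖A j k - A k j‖ ^ 2 =
      ‖A j k‖ ^ 2 + ‖A k j‖ ^ 2 - 2 * (A j k * conj (A k j)).re := by
    intro j k
    simp only [← Complex.normSq_eq_norm_sq]
    rw [Complex.normSq_sub]
  have hs : ∑ j, ∑ k, ‖A j k - A k j‖ ^ 2 =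
      2 * ∑ j, ∑ k, ‖A j k‖ ^ 2 - 2 * (∑ j, ∑ k, A j k * conj (A k j)).re := by
    simp only [h, Finset.sum_sub_distrib, Finset.sum_add_distrib, Complex.re_sum, Finset.mul_sum]
    rw [Finset.sum_comm (f := fun j k => ‖A k j‖ ^ 2)]
    simp only [two_mul, Finset.sum_add_distrib]
  rw [hs]
  have : 0 ≤ ∑ j, ∑ k, ‖A j k‖ ^ 2 :=
    Finset.sum_nonneg fun _ _ => Finset.sum_nonneg fun _ _ => sq_nonneg _
  linarith

/-- The basic `L²` inequality for the twisted `∂̄` complex. -/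
theorem integral_levi_le {Q : Cn n → ℝ} (hQ : ContDiff ℝ ∞ Q) {α : Fin n → Cn n → ℂ}
    (hα : ∀ j, IsTest (α j)) :
    ∫ z, levi Q z (fun j => α j z) ≤ (∫ z, ‖∑ j, Tst Q j (α j) z‖ ^ 2) +
      (1 / 2) * ∑ j, ∑ k, ∫ z, ‖Tbar Q k (α j) z - Tbar Q j (α k) z‖ ^ 2 := by
  set L : Fin n → Fin n → Cn n → ℂ := fun j k =>
    pd (dzbA (eb k)) (pd (dzA (eb j)) fun z => (Q z : ℂ)) with hL
  have hLs : ∀ j k, ContDiff ℝ ∞ (L j k) := fun j k =>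
    contDiff_pd _ (contDiff_pd _ (contDiff_ofReal hQ))
  have tA : ∀ j k, IsTest fun z => Tbar Q k (α j) z * conj (Tbar Q j (α k) z) := fun j k =>
    (((hα k).top hQ j).conj).mul_left ((hα j).top hQ k).smooth
  have tB : ∀ j k, IsTest fun z => L j k z * α j z * conj (α k z) := fun j k =>
    ((hα k).conj).mul_left ((hLs j k).mul (hα j).smooth)
  have tS : ∀ j k, IsTest fun z => Tst Q j (α j) z * conj (Tst Q k (α k) z) := fun j k =>
    (((hα k).tst hQ k).conj).mul_left ((hα j).tst hQ j).smooth
  have key : ∀ j k, ∫ z, Tst Q j (α j) z * conj (Tst Q k (α k) z) =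
      (∫ z, Tbar Q k (α j) z * conj (Tbar Q j (α k) z)) + ∫ z, L j k z * α j z * conj (α k z) := by
    intro j k
    rw [← integral_Tbar_mul hQ k ((hα j).tst hQ j) (hα k).smooth,
      ← integral_Tst_mul hQ j ((hα j).top hQ k).smooth (hα k), ← integral_add _ (tB j k).integrable]
    · congr 1; funext z; rw [Tbar_Tst hQ j k (hα j).smooth]; ring
    · exact ((((hα j).top hQ k).tst hQ j).mul_left (contDiff_conj (hα k).smooth)).integrable.congr
        (Eventually.of_forall fun z => mul_comm _ _)
  have hsq : ∫ z, ‖∑ j, Tst Q j (α j) z‖ ^ 2 =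
      (∑ j, ∑ k, ∫ z, Tst Q j (α j) z * conj (Tst Q k (α k) z)).re := by
    have : ∀ z, ‖∑ j, Tst Q j (α j) z‖ ^ 2 =
        (∑ j, ∑ k, Tst Q j (α j) z * conj (Tst Q k (α k) z)).re := by
      intro z
      rw [← Finset.sum_mul_sum, ← map_sum, Complex.mul_conj, Complex.ofReal_re,
        Complex.normSq_eq_norm_sq]
    simp only [this]
    have t : IsTest fun z => ∑ j, ∑ k, Tst Q j (α j) z * conj (Tst Q k (α k) z) :=
      IsTest.sum _ fun j _ => IsTest.sum _ fun k _ => tS j k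
    have := integral_re (𝕜 := ℂ) t.integrable
    simp only [RCLike.re_to_complex] at this
    rw [this, integral_finsetSum _ fun j _ => (IsTest.sum _ fun k _ => tS j k).integrable]
    congr 1
    exact Finset.sum_congr rfl fun j _ => integral_finsetSum _ fun k _ => (tS j k).integrable
  have hlev : ∫ z, levi Q z (fun j => α j z) =
      (∑ j, ∑ k, ∫ z, L j k z * α j z * conj (α k z)).re := by
    simp only [levi_eq_sum hQ]
    have t : IsTest fun z => ∑ j, ∑ k, L j k z * α j z * conj (α k z) :=
      IsTest.sum _ fun j _ => IsTest.sum _ fun k _ => tB j k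
    have := integral_re (𝕜 := ℂ) t.integrable
    simp only [RCLike.re_to_complex] at this
    rw [this, integral_finsetSum _ fun j _ => (IsTest.sum _ fun k _ => tB j k).integrable]
    congr 1
    exact Finset.sum_congr rfl fun j _ => integral_finsetSum _ fun k _ => (tB j k).integrable
  have tC : ∀ j k, Integrable fun z => ‖Tbar Q k (α j) z - Tbar Q j (α k) z‖ ^ 2 := fun j k =>
    (memLp_two_iff_integrable_sq_norm
      (((hα j).top hQ k).sub ((hα k).top hQ j)).continuous.aestronglyMeasurable).1
      (((hα j).top hQ k).sub ((hα k).top hQ j)).memLp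
  have tAs : IsTest fun z => ∑ j, ∑ k, Tbar Q k (α j) z * conj (Tbar Q j (α k) z) :=
      IsTest.sum _ fun j _ => IsTest.sum _ fun k _ => tA j k
  have hA : 0 ≤ (∑ j, ∑ k, ∫ z, Tbar Q k (α j) z * conj (Tbar Q j (α k) z)).re +
      (1 / 2) * ∑ j, ∑ k, ∫ z, ‖Tbar Q k (α j) z - Tbar Q j (α k) z‖ ^ 2 := by
    have e1 : (∑ j, ∑ k, ∫ z, Tbar Q k (α j) z * conj (Tbar Q j (α k) z)).re =
        ∫ z, (∑ j, ∑ k, Tbar Q k (α j) z * conj (Tbar Q j (α k) z)).re := by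
      have := integral_re (𝕜 := ℂ) tAs.integrable
      simp only [RCLike.re_to_complex] at this
      rw [this, integral_finsetSum _ fun j _ => (IsTest.sum _ fun k _ => tA j k).integrable]
      congr 1
      exact Finset.sum_congr rfl fun j _ => (integral_finsetSum _ fun k _ => (tA j k).integrable).symm
    have e2 : ∑ j, ∑ k, ∫ z, ‖Tbar Q k (α j) z - Tbar Q j (α k) z‖ ^ 2 =
        ∫ z, ∑ j, ∑ k, ‖Tbar Q k (α j) z - Tbar Q j (α k) z‖ ^ 2 := by
      rw [integral_finsetSum _ fun j _ => integrable_finsetSum _ fun k _ => tC j k]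
      exact Finset.sum_congr rfl fun j _ => (integral_finsetSum _ fun k _ => tC j k).symm
    have i1 : Integrable fun z => (∑ j, ∑ k, Tbar Q k (α j) z * conj (Tbar Q j (α k) z)).re := by
      simpa using tAs.integrable.re
    rw [e1, e2, ← integral_const_mul, ← integral_add i1
      ((integrable_finsetSum _ fun j _ => integrable_finsetSum _ fun k _ => tC j k).const_mul _)]
    exact integral_nonneg fun z => re_double_sum_add fun j k => Tbar Q k (α j) z
  rw [hsq, hlev]
  simp only [key, Finset.sum_add_distrib, Complex.add_re]
  linarith

/-- The `L²` norm as a real number. -/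
def l2 (u : Cn n → ℂ) : ℝ := (eLpNorm u 2 volume).toReal

lemma l2_nonneg (u : Cn n → ℂ) : 0 ≤ l2 u := ENNReal.toReal_nonneg

lemma inner_toLp {u v : Cn n → ℂ} (hu : MemLp u 2 volume) (hv : MemLp v 2 volume) :
    inner ℂ (hv.toLp v) (hu.toLp u) = ∫ z, u z * conj (v z) := by
  rw [L2.inner_def]
  refine integral_congr_ae ?_
  filter_upwards [hu.coeFn_toLp, hv.coeFn_toLp] with z h1 h2
  rw [h1, h2, RCLike.inner_apply]

lemma norm_toLp_eq_l2 {u : Cn n → ℂ} (hu : MemLp u 2 volume) : ‖hu.toLp u‖ = l2 u :=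
  Lp.norm_toLp u hu

lemma l2_sq {u : Cn n → ℂ} (hu : MemLp u 2 volume) : l2 u ^ 2 = ∫ z, ‖u z‖ ^ 2 := by
  rw [← norm_toLp_eq_l2 hu]
  have h := inner_self_eq_norm_sq_to_K (𝕜 := ℂ) (hu.toLp u)
  rw [inner_toLp hu hu] at h
  have : ∫ z, u z * conj (u z) = ((∫ z, ‖u z‖ ^ 2 : ℝ) : ℂ) := by
    rw [← integral_complex_ofReal]
    congr 1; funext z
    rw [Complex.mul_conj, Complex.normSq_eq_norm_sq]
  rw [this] at h
  refine Complex.ofReal_injective ?_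
  rw [h]; push_cast; rfl

lemma norm_integral_mul_conj_le {u v : Cn n → ℂ} (hu : MemLp u 2 volume) (hv : MemLp v 2 volume) :
    ‖∫ z, u z * conj (v z)‖ ≤ l2 u * l2 v := by
  rw [← inner_toLp hu hv, ← norm_toLp_eq_l2 hu, ← norm_toLp_eq_l2 hv, mul_comm]
  exact norm_inner_le_norm _ _

lemma integrable_mul_conj {u v : Cn n → ℂ} (hu : MemLp u 2 volume) (hv : MemLp v 2 volume) :
    Integrable fun z => u z * conj (v z) := by
  have := hu.integrable_mul (q := 2) (hv.star)
  exact this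

lemma l2_le_of_sub {u v : Cn n → ℂ} (hu : MemLp u 2 volume) (hv : MemLp v 2 volume) {δ : ℝ}
    (hδ : 0 ≤ δ) (h : eLpNorm (fun x => u x - v x) 2 volume ≤ ENNReal.ofReal δ) :
    l2 u ≤ l2 v + δ := by
  have h1 : eLpNorm u 2 volume ≤ eLpNorm (fun x => u x - v x) 2 volume + eLpNorm v 2 volume := by
    have := eLpNorm_add_le (μ := volume) (p := 2) (hu.sub hv).1 hv.1 (by norm_num)
    rw [sub_add_cancel] at this
    exact this
  have h2 := ENNReal.toReal_mono (by finiteness [hv.2.ne]) (h1.trans (add_le_add_left h _))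
  rw [ENNReal.toReal_add (by finiteness) hv.2.ne, ENNReal.toReal_ofReal hδ] at h2
  unfold l2; linarith

/-- Riesz representation along a linear map. -/
lemma exists_inner_eq_of_le {E H : Type*} [AddCommGroup E] [Module ℂ E] [NormedAddCommGroup H]
    [InnerProductSpace ℂ H] [CompleteSpace H] (A : E →ₗ[ℂ] H) (l : E →ₗ[ℂ] ℂ) {C : ℝ}
    (hC : 0 ≤ C) (h : ∀ x, ‖l x‖ ≤ C * ‖A x‖) :
    ∃ v : H, ‖v‖ ≤ C ∧ ∀ x, l x = inner ℂ v (A x) := by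
  have hker : LinearMap.ker A ≤ LinearMap.ker l := by
    intro x hx
    rw [LinearMap.mem_ker] at *
    have := h x
    rw [hx] at this
    simpa using this
  let l' : LinearMap.range A →ₗ[ℂ] ℂ :=
    (LinearMap.ker A).liftQ l hker ∘ₗ A.quotKerEquivRange.symm.toLinearMap
  have hl' : ∀ x, l' ⟨A x, LinearMap.mem_range_self A x⟩ = l x := by
    intro x
    have : A.quotKerEquivRange.symm ⟨A x, LinearMap.mem_range_self A x⟩ =
        (LinearMap.ker A).mkQ x := by
      rw [LinearEquiv.symm_apply_eq]; rfl
    simp only [l', LinearMap.comp_apply, LinearEquiv.coe_coe, this]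
    simp
  let lc : LinearMap.range A →L[ℂ] ℂ := l'.mkContinuous C (by
    rintro ⟨_, x, rfl⟩
    rw [hl']; exact h x)
  obtain ⟨L, hL, hn⟩ := exists_extension_norm_eq (LinearMap.range A) lc
  refine ⟨(InnerProductSpace.toDual ℂ H).symm L, ?_, fun x => ?_⟩
  · rw [LinearIsometryEquiv.norm_map, hn]
    exact LinearMap.mkContinuous_norm_le _ hC _
  · rw [InnerProductSpace.toDual_symm_apply, ← hl' x]
    exact (hL ⟨A x, LinearMap.mem_range_self A x⟩).symm

/-- Test functions as a submodule. -/
def testSub (n : ℕ) : Submodule ℂ (Cn n → ℂ) where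
  carrier := {w | IsTest w}
  add_mem' h1 h2 := h1.add h2
  zero_mem' := isTest_zero
  smul_mem' c _ h := h.mul_left (q := fun _ => c) contDiff_const

/-- Tuples of test functions. -/
abbrev testTuple (n : ℕ) : Type := Fin n → testSub n

lemma isTest_coe (w : testSub n) : IsTest (w : Cn n → ℂ) := w.2

lemma fop_Tst (Q : Cn n → ℝ) (u : Fin n → Cn n → ℂ) (z : Cn n) :
    fop (fun i => - dzA (eb i)) (fun i z => conj (qf Q i z)) u z = ∑ i, Tst Q i (u i) z := rfl

/-- The symbols of the components of the twisted `∂̄`-operator on `(0,1)`-forms. -/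
def curlL (j k i : Fin n) : Symb n :=
  (if i = j then dzbA (eb k) else 0) - (if i = k then dzbA (eb j) else 0)

/-- The zeroth order part of the components of the twisted `∂̄`-operator on `(0,1)`-forms. -/
def curlQ (Q : Cn n → ℝ) (j k i : Fin n) (z : Cn n) : ℂ :=
  (if i = j then qf Q k z else 0) - (if i = k then qf Q j z else 0)

lemma sum_curl (Q : Cn n → ℝ) (j k : Fin n) (u w : Fin n → ℂ) (L : Fin n → Cn n →L[ℝ] ℂ) (z) :
    ∑ i, (w i * curlL j k i (L i) + curlQ Q j k i z * u i) =
      (w j * dzbA (eb k) (L j) + qf Q k z * u j) - (w k * dzbA (eb j) (L k) + qf Q j z * u k) := by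
  have e : ∀ i, (w i * curlL j k i (L i) + curlQ Q j k i z * u i) =
      (if i = j then (w i * dzbA (eb k) (L i) + qf Q k z * u i) else 0) -
      (if i = k then (w i * dzbA (eb j) (L i) + qf Q j z * u i) else 0) := by
    intro i
    unfold curlL curlQ
    split_ifs <;> simp <;> ring
  simp only [e, Finset.sum_sub_distrib, Finset.sum_ite_eq', Finset.mem_univ, if_true]

lemma fop_curl (Q : Cn n → ℝ) (j k : Fin n) (u : Fin n → Cn n → ℂ) (z : Cn n) :
    fop (curlL j k) (curlQ Q j k) u z = Tbar Q k (u j) z - Tbar Q j (u k) z := by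
  have := sum_curl Q j k (fun i => u i z) (fun _ => 1) (fun i => fderiv ℝ (u i) z) z
  simp only [one_mul] at this
  exact this

lemma contDiff_curlQ {Q : Cn n → ℝ} (hQ : ContDiff ℝ ∞ Q) (j k i : Fin n) :
    ContDiff ℝ ∞ (curlQ Q j k i) := by
  unfold curlQ
  refine ContDiff.sub ?_ ?_ <;> split_ifs <;> first | exact contDiff_qf hQ _ | exact contDiff_const

lemma exists_orthogonal_decomp {H : Type*} [NormedAddCommGroup H]
    [InnerProductSpace ℂ H] [CompleteSpace H] (S : Submodule ℂ H) (a : H) :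
    ∃ b ∈ S.orthogonal, ∃ c ∈ S.orthogonal.orthogonal, a = b + c :=
  S.orthogonal.exists_add_mem_mem_orthogonal a

/-- The Hilbert space of `L²` tuples. -/
abbrev L2n (n : ℕ) : Type := PiLp 2 fun _ : Fin n => Lp ℂ 2 (volume : Measure (Cn n))

/-- A tuple of `L²` functions as an element of the Hilbert space. -/
def toL2n {u : Fin n → Cn n → ℂ} (hu : ∀ i, MemLp (u i) 2 volume) : L2n n :=
  WithLp.toLp 2 fun i => (hu i).toLp (u i)

lemma inner_toL2n {u : Fin n → Cn n → ℂ} (hu : ∀ i, MemLp (u i) 2 volume) (b : L2n n) :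
    inner ℂ b (toL2n hu) = ∑ i, ∫ z, u i z * conj (b i z) := by
  rw [PiLp.inner_apply]
  refine Finset.sum_congr rfl fun i _ => ?_
  rw [L2.inner_def]
  refine integral_congr_ae ?_
  filter_upwards [(hu i).coeFn_toLp] with z h1
  rw [RCLike.inner_apply]
  change ((hu i).toLp (u i)) z * _ = _
  rw [h1]

/-- The tuple dual to the curl component `(j,k)` applied to `w`. -/
def curlT (Q : Cn n → ℝ) (j k : Fin n) (w : Cn n → ℂ) (i : Fin n) (z : Cn n) : ℂ :=
  (if i = j then Tst Q k w z else 0) - (if i = k then Tst Q j w z else 0)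

lemma isTest_curlT {Q : Cn n → ℝ} (hQ : ContDiff ℝ ∞ Q) (j k : Fin n) {w : Cn n → ℂ}
    (hw : IsTest w) (i : Fin n) : IsTest (curlT Q j k w i) := by
  unfold curlT
  refine IsTest.sub ?_ ?_ <;> split_ifs <;> first | exact hw.tst hQ _ | exact isTest_zero

lemma sum_curlT {Q : Cn n → ℝ} {j k : Fin n} {w : Cn n → ℂ} (u : Fin n → Cn n → ℂ) :
    ∑ i, ∫ z, curlT Q j k w i z * conj (u i z) =
      (∫ z, Tst Q k w z * conj (u j z)) - ∫ z, Tst Q j w z * conj (u k z) := by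
  by_cases hjk : j = k
  · subst hjk; simp [curlT]
  have e : ∀ i, ∫ z, curlT Q j k w i z * conj (u i z) =
      (if i = j then ∫ z, Tst Q k w z * conj (u i z) else 0) -
      (if i = k then ∫ z, Tst Q j w z * conj (u i z) else 0) := by
    intro i
    unfold curlT
    by_cases h1 : i = j
    · have h2 : i ≠ k := fun h => hjk (h1.symm.trans h)
      simp [h1, hjk]
    · by_cases h2 : i = k
      · simp [h2, integral_neg, Ne.symm hjk]
      · simp [h1, h2]
  simp only [e, Finset.sum_sub_distrib, Finset.sum_ite_eq', Finset.mem_univ, if_true]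

lemma Tbar_comm {Q : Cn n → ℝ} (hQ : ContDiff ℝ ∞ Q) (j k : Fin n) {u : Cn n → ℂ}
    (hu : ContDiff ℝ ∞ u) (z : Cn n) :
    Tbar Q k (Tbar Q j u) z = Tbar Q j (Tbar Q k u) z := by
  have dQ := contDiff_ofReal hQ
  have d0 : ∀ {w : Cn n → ℂ}, ContDiff ℝ ∞ w → DifferentiableAt ℝ w z :=
    fun h => h.differentiable (by simp) z
  have e2 : ∀ j k, pd (dzbA (eb j)) (Tbar Q k u) z = pd (dzbA (eb j)) (pd (dzbA (eb k)) u) z +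
      (qf Q k z * pd (dzbA (eb j)) u z + pd (dzbA (eb j)) (qf Q k) z * u z) := by
    intro j k
    have : Tbar Q k u = fun z => (fun z => pd (dzbA (eb k)) u z) z +
        (fun z => (qf Q k) z * u z) z := rfl
    rw [this, pd_add _ (d0 (contDiff_pd _ hu)) (d0 ((contDiff_qf hQ k).mul hu)),
      pd_mul _ (d0 (contDiff_qf hQ k)) (d0 hu)]
    ring
  have e4 : ∀ j k, pd (dzbA (eb j)) (qf Q k) z =
      (1 / 2) * pd (dzbA (eb j)) (pd (dzbA (eb k)) fun z => (Q z : ℂ)) z := by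
    intro j k
    have : (qf Q k) = fun z => (1 / 2 : ℂ) * pd (dzbA (eb k)) (fun z => (Q z : ℂ)) z := by
      funext z; simp only [qf]; ring
    rw [this, pd_const_mul _ _ (d0 (contDiff_pd _ dQ))]
  have c := pd_dzbA_dzbA hu (eb j) (eb k) z
  have c' := pd_dzbA_dzbA dQ (eb j) (eb k) z
  have l1 : Tbar Q k (Tbar Q j u) z = pd (dzbA (eb k)) (Tbar Q j u) z + qf Q k z * Tbar Q j u z := rfl
  have l2 : Tbar Q j (Tbar Q k u) z = pd (dzbA (eb j)) (Tbar Q k u) z + qf Q j z * Tbar Q k u z := rfl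
  rw [l1, l2, e2, e2, e4, e4, c, c']
  simp only [Tbar]
  ring

/-- The a priori estimate for test tuples, after projecting to the weakly closed tuples. -/
theorem norm_pairing_sq_le {Q : Cn n → ℝ} (hQ : ContDiff ℝ ∞ Q) {g : Fin n → Cn n → ℂ}
    (hg : ∀ k, IsTest (g k)) (hcurl : ∀ j k z, Tbar Q k (g j) z = Tbar Q j (g k) z)
    {M : ℝ} (hM0 : 0 ≤ M)
    (hM : ∀ α : Fin n → Cn n → ℂ, (∀ j, IsTest (α j)) →
      ‖∑ k, ∫ z, g k z * conj (α k z)‖ ^ 2 ≤ M * ∫ z, levi Q z fun j => α j z)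
    {α : Fin n → Cn n → ℂ} (hα : ∀ j, IsTest (α j)) :
    ‖∑ k, ∫ z, g k z * conj (α k z)‖ ^ 2 ≤ M * l2 (fun z => ∑ j, Tst Q j (α j) z) ^ 2 := by
  let S : Submodule ℂ (L2n n) := Submodule.span ℂ
    {s | ∃ j k : Fin n, ∃ w : Cn n → ℂ, ∃ hw : IsTest w,
      s = toL2n fun i => (isTest_curlT hQ j k hw i).memLp}
  -- the tuple `α` in the Hilbert space
  let a : L2n n := toL2n fun i => (hα i).memLp
  obtain ⟨b, hb, c, hc, hab⟩ := exists_orthogonal_decomp S a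
  have memS : ∀ (u : Fin n → Cn n → ℂ) (hu : ∀ i, MemLp (u i) 2 volume),
      (∀ j k (w : Cn n → ℂ), IsTest w →
        ∫ z, Tst Q k w z * conj (u j z) = ∫ z, Tst Q j w z * conj (u k z)) → toL2n hu ∈ S.orthogonal := by
    intro u hu h
    rw [Submodule.mem_orthogonal']
    intro s hs
    induction hs using Submodule.span_induction with
    | mem x hx =>
      obtain ⟨j, k, w, hw, rfl⟩ := hx
      rw [inner_toL2n]
      have : ∑ i, ∫ z, curlT Q j k w i z * conj ((toL2n hu) i z) =
          ∑ i, ∫ z, curlT Q j k w i z * conj (u i z) := by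
        refine Finset.sum_congr rfl fun i _ => integral_congr_ae ?_
        filter_upwards [(hu i).coeFn_toLp] with z hz
        change _ * conj ((hu i).toLp (u i) z) = _
        rw [hz]
      rw [this, sum_curlT, h j k w hw, sub_self]
    | zero => simp
    | add x y _ _ hx hy => rw [inner_add_right, hx, hy, add_zero]
    | smul t x _ hx => rw [inner_smul_right, hx, mul_zero]
  have memCl : ∀ (u : Fin n → Cn n → ℂ) (hu : ∀ i, IsTest (u i)),
      (∀ j k z, Tbar Q k (u j) z = Tbar Q j (u k) z) → (toL2n fun i => (hu i).memLp) ∈ S.orthogonal := by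
    intro u hu h
    refine memS u _ fun j k w hw => ?_
    rw [integral_Tst_mul hQ k hw.smooth (hu j), integral_Tst_mul hQ j hw.smooth (hu k)]
    simp only [h j k]
  -- pairings with `α` and `b` agree on closed test tuples
  have pair : ∀ (u : Fin n → Cn n → ℂ) (hu : ∀ i, IsTest (u i)),
      (∀ j k z, Tbar Q k (u j) z = Tbar Q j (u k) z) →
      ∑ i, ∫ z, u i z * conj (α i z) = ∑ i, ∫ z, u i z * conj (b i z) := by
    intro u hu h
    have h1 := memCl u hu h
    have h2 : inner ℂ c (toL2n fun i => (hu i).memLp) = 0 :=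
      (Submodule.mem_orthogonal' _ _).1 hc _ h1
    have h3 : inner ℂ a (toL2n fun i => (hu i).memLp) =
        inner ℂ b (toL2n fun i => (hu i).memLp) := by
      rw [hab, inner_add_left, h2, add_zero]
    rw [inner_toL2n, inner_toL2n] at h3
    rw [← h3]
    refine Finset.sum_congr rfl fun i _ => integral_congr_ae ?_
    filter_upwards [(hα i).memLp.coeFn_toLp] with z hz
    change _ = _ * conj ((hα i).memLp.toLp (α i) z)
    rw [hz]
  have hbm : ∀ i, Measurable (b i : Cn n → ℂ) := fun i => (Lp.stronglyMeasurable _).measurable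
  have hbL : ∀ i, MemLp (b i : Cn n → ℂ) 2 volume := fun i => Lp.memLp _
  have hk0 : IsTest fun z => ∑ j, Tst Q j (α j) z := IsTest.sum _ fun j _ => (hα j).tst hQ j
  -- the weak equations
  have w1 : WeakEq (fun i => - dzA (eb i)) (fun i z => conj (qf Q i z)) (fun i => b i)
      (fun z => ∑ j, Tst Q j (α j) z) := by
    intro w hw
    have h := pair (fun i => Tbar Q i fun z => conj (w z)) (fun i => hw.conj.top hQ i)
      (fun j k z => Tbar_comm hQ j k (contDiff_conj hw.smooth) z)
    have e1 : ∑ i, ∫ z, Tbar Q i (fun z => conj (w z)) z * conj (α i z) =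
        ∫ z, conj (w z) * conj (∑ j, Tst Q j (α j) z) := by
      simp only [map_sum, Finset.mul_sum]
      rw [integral_finsetSum]
      · exact Finset.sum_congr rfl fun i _ => integral_Tbar_mul hQ i hw.conj (hα i).smooth
      · intro i _
        exact integrable_mul_conj hw.conj.memLp ((hα i).tst hQ i).memLp
    rw [e1] at h
    have h' := congrArg conj h
    rw [map_sum, ← integral_conj] at h'
    simp only [← integral_conj, map_mul, Complex.conj_conj] at h'
    rw [show (∫ z, (∑ j, Tst Q j (α j) z) * w z) = ∫ z, w z * (∑ j, Tst Q j (α j) z) by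
      simp only [mul_comm], h']
    refine Finset.sum_congr rfl fun i _ => ?_
    congr 1; funext z
    have : conj (Tbar Q i (fun z => conj (w z)) z) = conj (qf Q i z) * w z - pd (-dzA (eb i)) w z := by
      simp only [Tbar, map_add, map_mul, Complex.conj_conj]
      rw [pd_conj _ (hw.smooth.differentiable (by simp) z), Complex.conj_conj]
      change _ = _ - (- pd (dzA (eb i)) w z)
      ring
    rw [this, mul_comm]
  have w2 : ∀ j k, WeakEq (curlL j k) (curlQ Q j k) (fun i => b i) (fun _ => 0) := by
    intro j k w hw
    have h : inner ℂ b (toL2n fun i => (isTest_curlT hQ j k hw.conj i).memLp) = 0 :=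
      (Submodule.mem_orthogonal' _ _).1 hb _ (Submodule.subset_span ⟨j, k, _, hw.conj, rfl⟩)
    rw [inner_toL2n] at h
    have h' := congrArg conj h
    rw [map_sum] at h'
    simp only [← integral_conj, map_mul, Complex.conj_conj, map_zero] at h'
    simp only [zero_mul, integral_zero]
    rw [← h']
    refine Finset.sum_congr rfl fun i _ => ?_
    congr 1; funext z
    have e : ∀ k, conj (Tst Q k (fun z => conj (w z)) z) = qf Q k z * w z - pd (dzbA (eb k)) w z := by
      intro k
      simp only [Tst, map_add, map_mul, map_neg, Complex.conj_conj]
      rw [pd_conj' _ (hw.smooth.differentiable (by simp) z), Complex.conj_conj]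
      ring
    have e2 : conj (curlT Q j k (fun z => conj (w z)) i z) =
        curlQ Q j k i z * w z - pd (curlL j k i) w z := by
      unfold curlT curlQ curlL
      split_ifs <;> simp [e, pd] <;> ring
    rw [e2, mul_comm]
  -- approximation by test tuples
  set K := l2 (fun z => ∑ j, Tst Q j (α j) z) with hK
  set P := ‖∑ k, ∫ z, g k z * conj (α k z)‖ with hP
  set G := ∑ k, l2 (g k) with hG
  have hbound : ∀ δ : ℝ, 0 < δ →
      P ≤ G * δ + √(M * ((K + δ) ^ 2 + (1 / 2) * ∑ _j : Fin n, ∑ _k : Fin n, δ ^ 2)) := by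
    intro δ hδ
    obtain ⟨b', hb't, hb'1, hb'2⟩ := exists_test_approx (ι := Option (Fin n × Fin n))
      (l := fun m => m.elim (fun i => - dzA (eb i)) fun p => curlL p.1 p.2)
      (q := fun m => m.elim (fun i z => conj (qf Q i z)) fun p => curlQ Q p.1 p.2)
      (u := fun i => b i)
      (k := fun m => m.elim (fun z => ∑ j, Tst Q j (α j) z) fun _ _ => 0)
      (by rintro (_ | ⟨j, k⟩); exacts [w1, w2 j k])
      (by rintro (_ | ⟨j, k⟩) i
          exacts [contDiff_conj (contDiff_qf hQ i), contDiff_curlQ hQ j k i])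
      hbm hbL
      (by rintro (_ | ⟨j, k⟩); exacts [hk0.continuous.measurable, measurable_const])
      (by rintro (_ | ⟨j, k⟩); exacts [hk0.memLp, isTest_zero.memLp])
      (ENNReal.ofReal_pos.2 hδ)
    have a1 := hb'2 none
    have a2 := fun j k => hb'2 (some (j, k))
    simp only [Option.elim_none, Option.elim_some, fop_Tst, fop_curl] at a1 a2
    have t1 : IsTest fun z => ∑ j, Tst Q j (b' j) z := IsTest.sum _ fun j _ => (hb't j).tst hQ j
    have t2 : ∀ j k, IsTest fun z => Tbar Q k (b' j) z - Tbar Q j (b' k) z := fun j k =>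
      ((hb't j).top hQ k).sub ((hb't k).top hQ j)
    have c1 : l2 (fun z => ∑ j, Tst Q j (b' j) z) ≤ K + δ :=
      l2_le_of_sub t1.memLp hk0.memLp hδ.le a1
    have c2 : ∀ j k, l2 (fun z => Tbar Q k (b' j) z - Tbar Q j (b' k) z) ≤ δ := by
      intro j k
      have := l2_le_of_sub (t2 j k).memLp (isTest_zero (n := n)).memLp hδ.le (a2 j k)
      have h0 : l2 (fun _ : Cn n => (0 : ℂ)) = 0 := by simp [l2]
      linarith
    have c3 : ‖∑ k, ∫ z, g k z * conj (b' k z)‖ ^ 2 ≤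
        M * ((K + δ) ^ 2 + (1 / 2) * ∑ _j : Fin n, ∑ _k : Fin n, δ ^ 2) := by
      refine (hM b' hb't).trans (mul_le_mul_of_nonneg_left ?_ hM0)
      refine (integral_levi_le hQ hb't).trans ?_
      rw [← l2_sq t1.memLp]
      simp only [fun j k => (l2_sq (t2 j k).memLp).symm]
      gcongr
      · exact l2_nonneg _
      · exact l2_nonneg _
      · exact c2 _ _
    have c4 : ‖∑ k, ∫ z, g k z * conj (b' k z)‖ ≤
        √(M * ((K + δ) ^ 2 + (1 / 2) * ∑ _j : Fin n, ∑ _k : Fin n, δ ^ 2)) :=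
      Real.le_sqrt_of_sq_le c3
    have c5 : ‖∑ k, ∫ z, g k z * conj (b k z - b' k z)‖ ≤ G * δ := by
      rw [hG, Finset.sum_mul]
      refine (norm_sum_le _ _).trans (Finset.sum_le_sum fun k _ => ?_)
      refine (norm_integral_mul_conj_le (hg k).memLp ((hbL k).sub (hb't k).memLp)).trans ?_
      refine mul_le_mul_of_nonneg_left ?_ (l2_nonneg _)
      unfold l2
      have h1 := hb'1 k
      have h2 := eLpNorm_sub_comm (b' k) (b k : Cn n → ℂ) 2 volume
      replace h1 := h2.symm.le.trans h1
      exact (ENNReal.toReal_mono ENNReal.ofReal_ne_top h1).trans (ENNReal.toReal_ofReal hδ.le).le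
    have c6 : ∑ k, ∫ z, g k z * conj (α k z) = (∑ k, ∫ z, g k z * conj (b k z - b' k z)) +
        ∑ k, ∫ z, g k z * conj (b' k z) := by
      rw [pair g hg hcurl, ← Finset.sum_add_distrib]
      refine Finset.sum_congr rfl fun k _ => ?_
      rw [← integral_add (by exact integrable_mul_conj (hg k).memLp ((hbL k).sub (hb't k).memLp))
        (integrable_mul_conj (hg k).memLp (hb't k).memLp)]
      congr 1; funext z
      simp only [map_sub]; ring
    rw [hP, c6]
    exact (norm_add_le _ _).trans (add_le_add c5 c4)
  have hlim : P ≤ √(M * K ^ 2) := by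
    have ht : Tendsto (fun δ : ℝ =>
        G * δ + √(M * ((K + δ) ^ 2 + (1 / 2) * ∑ _j : Fin n, ∑ _k : Fin n, δ ^ 2)))
        (𝓝[>] 0) (𝓝 (G * 0 + √(M * ((K + 0) ^ 2 + (1 / 2) * ∑ _j : Fin n, ∑ _k : Fin n, (0:ℝ) ^ 2)))) := by
      refine Tendsto.mono_left (Continuous.tendsto ?_ 0) nhdsWithin_le_nhds
      fun_prop
    have := ge_of_tendsto ht (eventually_mem_nhdsWithin.mono fun δ hδ => hbound δ hδ)
    simpa using this
  calc P ^ 2 ≤ √(M * K ^ 2) ^ 2 := by gcongr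
    _ = M * K ^ 2 := Real.sq_sqrt (by positivity)

/-- Solvability of the twisted `∂̄`-equation with `L²` bounds. -/
theorem exists_Tbar_solution {Q : Cn n → ℝ} (hQ : ContDiff ℝ ∞ Q) {g : Fin n → Cn n → ℂ}
    (hg : ∀ k, IsTest (g k)) (hcurl : ∀ j k z, Tbar Q k (g j) z = Tbar Q j (g k) z)
    {M : ℝ} (hM0 : 0 ≤ M)
    (hM : ∀ α : Fin n → Cn n → ℂ, (∀ j, IsTest (α j)) →
      ‖∑ k, ∫ z, g k z * conj (α k z)‖ ^ 2 ≤ M * ∫ z, levi Q z fun j => α j z) :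
    ∃ v : Cn n → ℂ, Measurable v ∧ MemLp v 2 volume ∧ l2 v ^ 2 ≤ M ∧
      ∀ k (w : Cn n → ℂ), IsTest w → ∫ z, v z * conj (Tst Q k w z) = ∫ z, g k z * conj (w z) := by
  have hT : ∀ α : testTuple n, IsTest fun z => ∑ j, Tst Q j (α j) z :=
    fun α => IsTest.sum _ fun j _ => (isTest_coe (α j)).tst hQ j
  have dA : ∀ (w : testSub n) z, DifferentiableAt ℝ (w : Cn n → ℂ) z :=
    fun w z => (isTest_coe w).smooth.differentiable (by simp) z
  have Tadd : ∀ j (u v : testSub n) z, Tst Q j (u + v : testSub n) z =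
      Tst Q j u z + Tst Q j v z := by
    intro j u v z
    have := pd_add (dzA (eb j)) (dA u z) (dA v z)
    simp only [Tst]
    rw [show pd (dzA (eb j)) ((u + v : testSub n) : Cn n → ℂ) z = _ from this]
    simp only [Submodule.coe_add, Pi.add_apply]; ring
  have Tsmul : ∀ j (c : ℂ) (u : testSub n) z, Tst Q j (c • u : testSub n) z = c * Tst Q j u z := by
    intro j c u z
    have := pd_const_mul (dzA (eb j)) c (dA u z)
    simp only [Tst]
    rw [show pd (dzA (eb j)) ((c • u : testSub n) : Cn n → ℂ) z = _ from this]
    simp only [Submodule.coe_smul, Pi.smul_apply, smul_eq_mul]; ring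
  let A : testTuple n →ₗ[ℂ] Lp ℂ 2 (volume : Measure (Cn n)) :=
    { toFun := fun α => (hT α).memLp.toLp _
      map_add' := by
        intro α β
        rw [← MemLp.toLp_add]
        refine MemLp.toLp_congr _ _ (Eventually.of_forall fun z => ?_)
        simp only [Pi.add_apply, Tadd, Finset.sum_add_distrib]
      map_smul' := by
        intro c α
        rw [RingHom.id_apply, ← MemLp.toLp_const_smul]
        refine MemLp.toLp_congr _ _ (Eventually.of_forall fun z => ?_)
        simp only [Pi.smul_apply, Tsmul, smul_eq_mul, Finset.mul_sum] }
  have ig : ∀ k (w : testSub n), Integrable fun z => (w : Cn n → ℂ) z * conj (g k z) :=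
    fun k w => integrable_mul_conj (isTest_coe w).memLp (hg k).memLp
  let l : testTuple n →ₗ[ℂ] ℂ :=
    { toFun := fun α => ∑ k, ∫ z, (α k : Cn n → ℂ) z * conj (g k z)
      map_add' := by
        intro α β
        rw [← Finset.sum_add_distrib]
        refine Finset.sum_congr rfl fun k _ => ?_
        rw [← integral_add (ig k _) (ig k _)]
        congr 1; funext z
        simp only [Pi.add_apply, Submodule.coe_add]; ring
      map_smul' := by
        intro c α
        rw [RingHom.id_apply, smul_eq_mul, Finset.mul_sum]
        refine Finset.sum_congr rfl fun k _ => ?_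
        rw [← integral_const_mul]
        congr 1; funext z
        simp only [Pi.smul_apply, Submodule.coe_smul, smul_eq_mul]; ring }
  have hl : ∀ α : testTuple n, l α = conj (∑ k, ∫ z, g k z * conj ((α k : Cn n → ℂ) z)) := by
    intro α
    change ∑ k, ∫ z, (α k : Cn n → ℂ) z * conj (g k z) = _
    rw [map_sum (starRingEnd ℂ)]
    refine Finset.sum_congr rfl fun k _ => ?_
    rw [← integral_conj]
    congr 1; funext z
    simp only [map_mul, Complex.conj_conj]; ring
  obtain ⟨v, hv, hvl⟩ := exists_inner_eq_of_le A l (Real.sqrt_nonneg M) (fun α => by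
    have h := norm_pairing_sq_le hQ hg hcurl hM0 hM fun j => isTest_coe (α j)
    rw [hl, Complex.norm_conj]
    have e : ‖A α‖ = l2 (fun z => ∑ j, Tst Q j (α j) z) := norm_toLp_eq_l2 (hT α).memLp
    rw [e]
    have := Real.le_sqrt_of_sq_le h
    rwa [Real.sqrt_mul hM0, Real.sqrt_sq (l2_nonneg _)] at this)
  have e0 : l2 (v : Cn n → ℂ) = ‖v‖ := rfl
  refine ⟨v, (Lp.stronglyMeasurable v).measurable, Lp.memLp v, ?_, fun k w hw => ?_⟩
  · rw [e0]
    calc ‖v‖ ^ 2 ≤ √M ^ 2 := by gcongr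
      _ = M := Real.sq_sqrt hM0
  · have h := hvl (Pi.single k ⟨w, hw⟩)
    rw [hl] at h
    have h' := congrArg conj h
    rw [Complex.conj_conj] at h'
    have e2 : ∑ i, ∫ z, g i z * conj (((Pi.single k ⟨w, hw⟩ : testTuple n) i : Cn n → ℂ) z) =
        ∫ z, g k z * conj (w z) := by
      rw [Finset.sum_eq_single k]
      · simp
      · intro i _ hi; simp [hi]
      · simp
    have e3 : (fun z => ∑ j, Tst Q j ((Pi.single k ⟨w, hw⟩ : testTuple n) j : Cn n → ℂ) z) =
        Tst Q k w := by
      funext z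
      rw [Finset.sum_eq_single k]
      · simp
      · intro i _ hi; simp [hi, Tst, pd]
      · simp
    rw [e2] at h'
    rw [h', L2.inner_def, ← integral_conj]
    refine integral_congr_ae ?_
    have ha := (hT (Pi.single k ⟨w, hw⟩)).memLp.coeFn_toLp
    filter_upwards [ha] with z hz
    change _ = conj (inner ℂ (v z) ((hT (Pi.single k ⟨w, hw⟩)).memLp.toLp _ z))
    rw [hz, congrFun e3 z, RCLike.inner_apply, map_mul, Complex.conj_conj, mul_comm]

lemma measurePreserving_rot {c : ℂ} (hc : ‖c‖ = 1) :
    MeasurePreserving (fun z : Cn n => c • z) volume volume := by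
  have h1 : MeasurePreserving (fun z : ℂ => c * z) volume volume :=
    (rotation ⟨c, mem_sphere_zero_iff_norm.2 hc⟩).measurePreserving
  exact volume_preserving_pi fun _ => h1

/-- Averaging over circles does not change integrals against the mollifier. -/
lemma integral_moll_circle {F : Type*} [NormedAddCommGroup F] [NormedSpace ℝ F] [CompleteSpace F]
    [MeasurableSpace F] [BorelSpace F] [SecondCountableTopology F] {ε B : ℝ} (hε : 0 < ε) {u : Cn n → F}
    (hu : Measurable u) {x : Cn n} (hB : ∀ y ∈ Metric.ball x ε, ‖u y‖ ≤ B) :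
    ∫ y, moll ε y • u (x + y) = ∫ y, moll ε y •
      ((2 * Real.pi)⁻¹ • ∫ θ in (0:ℝ)..(2 * Real.pi), u (x + Complex.exp (Complex.I * θ) • y)) := by
  have hn : ∀ θ : ℝ, ‖Complex.exp (Complex.I * θ)‖ = 1 := fun θ => by
    rw [mul_comm]; exact Complex.norm_exp_ofReal_mul_I θ
  have h1 : ∀ θ : ℝ, ∫ y, moll ε y • u (x + Complex.exp (Complex.I * θ) • y) =
      ∫ y, moll ε y • u (x + y) := by
    intro θ
    have mp := measurePreserving_rot (n := n) (hn θ)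
    have me : MeasurableEmbedding fun z : Cn n => Complex.exp (Complex.I * θ) • z :=
      (MeasurableEquiv.smul₀ (Complex.exp (Complex.I * θ)) (Complex.exp_ne_zero _)).measurableEmbedding
    have := mp.integral_comp me fun y => moll ε y • u (x + y)
    rw [← this]
    simp only [moll_rot ε (hn θ)]
  have hint : Integrable (Function.uncurry fun (θ : ℝ) (y : Cn n) =>
      moll ε y • u (x + Complex.exp (Complex.I * θ) • y))
      ((volume.restrict (Set.uIoc 0 (2 * Real.pi))).prod volume) := by
    have hb : Integrable (fun p : ℝ × Cn n => (B : ℝ) * moll ε p.2)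
        ((volume.restrict (Set.uIoc 0 (2 * Real.pi))).prod volume) := by
      have : IsFiniteMeasure (volume.restrict (Set.uIoc (0:ℝ) (2 * Real.pi))) :=
        ⟨by rw [Measure.restrict_apply_univ, Set.uIoc]; exact measure_Ioc_lt_top⟩
      exact (integrable_const B).mul_prod (integrable_moll (n := n) hε)
    refine hb.mono' ?_ (Eventually.of_forall fun p => ?_)
    · have m1 : Measurable fun p : ℝ × Cn n => x + Complex.exp (Complex.I * p.1) • p.2 := by
        have : Continuous fun p : ℝ × Cn n => x + Complex.exp (Complex.I * p.1) • p.2 := by fun_prop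
        exact this.measurable
      have m2 : Measurable fun p : ℝ × Cn n => moll ε p.2 :=
        ((contDiff_moll ε).continuous.comp continuous_snd).measurable
      exact (m2.smul (hu.comp m1)).aestronglyMeasurable
    · simp only [Function.uncurry]
      rw [norm_smul, Real.norm_of_nonneg (moll_nonneg ε _), mul_comm]
      by_cases hy : ε ≤ ‖p.2‖
      · simp [moll_eq_zero hε hy]
      · refine mul_le_mul_of_nonneg_right (hB _ ?_) (moll_nonneg ε _)
        rw [mem_ball_iff_norm, add_sub_cancel_left, norm_smul, hn, one_mul]
        exact not_le.1 hy
  have hpi : (0:ℝ) < 2 * Real.pi := by positivity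
  have h2 : ∫ y, moll ε y • (∫ θ in (0:ℝ)..(2 * Real.pi), u (x + Complex.exp (Complex.I * θ) • y)) =
      ∫ θ in (0:ℝ)..(2 * Real.pi), ∫ y, moll ε y • u (x + Complex.exp (Complex.I * θ) • y) := by
    rw [intervalIntegral_integral_swap hint]
    simp only [intervalIntegral.integral_smul]
  simp only [h1] at h2
  rw [intervalIntegral.integral_const, sub_zero] at h2
  simp only [smul_comm _ (2 * Real.pi)⁻¹]
  rw [integral_smul, h2, smul_smul, inv_mul_cancel₀ hpi.ne', one_smul]

lemma hasCircleAverage {R ε : ℝ} (hεR : ε < R) {x : Cn n} {G : Cn n → ℂ}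
    (hG : DifferentiableOn ℂ G (Metric.ball x R)) {y : Cn n} (hy : ‖y‖ < ε) :
    ((2 * Real.pi)⁻¹ : ℝ) • ∫ θ in (0:ℝ)..(2 * Real.pi), G (x + Complex.exp (Complex.I * θ) • y) =
      G x := by
  have h : DifferentiableOn ℂ (fun ζ : ℂ => G (x + ζ • y)) (closure (Metric.ball 0 |1|)) := by
    refine hG.comp (by fun_prop) fun ζ hζ => ?_
    have h1 := Metric.closure_ball_subset_closedBall hζ
    rw [mem_closedBall_zero_iff, abs_one] at h1
    rw [mem_ball_iff_norm, add_sub_cancel_left, norm_smul]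
    nlinarith [norm_nonneg y, norm_nonneg ζ]
  have := h.diffContOnCl.circleAverage
  rw [Real.circleAverage_def] at this
  simp only [circleMap_zero, Complex.ofReal_one, one_mul, zero_smul, add_zero] at this
  rw [← this]
  simp only [mul_comm Complex.I]

/-- Mean value property of holomorphic functions for the mollifier. -/
lemma integral_moll_holo {R ε : ℝ} (hε : 0 < ε) (hεR : ε < R) {x : Cn n} {G : Cn n → ℂ}
    (hG : DifferentiableOn ℂ G (Metric.ball x R)) :
    ∫ y, moll ε y • G (x + y) = G x := by
  set u : Cn n → ℂ := (Metric.closedBall x ε).indicator G with hu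
  have hc : ContinuousOn G (Metric.closedBall x ε) :=
    hG.continuousOn.mono (Metric.closedBall_subset_ball hεR)
  have hum : Measurable u := by
    classical
    have := hc.measurable_piecewise (g := fun _ => (0:ℂ)) continuousOn_const measurableSet_closedBall
    change Measurable ((Metric.closedBall x ε).piecewise G 0) at this
    rwa [Set.piecewise_eq_indicator] at this
  obtain ⟨B, hB⟩ := (isCompact_closedBall x ε).exists_bound_of_continuousOn hc
  have hin : ∀ y : Cn n, ‖y‖ < ε → u (x + y) = G (x + y) := fun y hy =>
    Set.indicator_of_mem (by rw [mem_closedBall_iff_norm, add_sub_cancel_left]; exact hy.le) _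
  have key := integral_moll_circle hε hum (x := x) (B := B) fun y hy => by
    rw [hu, Set.indicator_of_mem (Metric.ball_subset_closedBall hy)]
    exact hB y (Metric.ball_subset_closedBall hy)
  have e1 : ∀ y, moll ε y • u (x + y) = moll ε y • G (x + y) := fun y => by
    rcases lt_or_ge ‖y‖ ε with h | h
    · rw [hin y h]
    · simp [moll_eq_zero hε h]
  have e2 : ∀ y, moll ε y • ((2 * Real.pi)⁻¹ • ∫ θ in (0:ℝ)..(2 * Real.pi),
      u (x + Complex.exp (Complex.I * θ) • y)) = moll ε y • G x := fun y => by
    rcases lt_or_ge ‖y‖ ε with h | h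
    · congr 1
      rw [← hasCircleAverage hεR hG h]
      congr 2
      ext θ
      refine hin _ ?_
      rw [norm_smul, mul_comm Complex.I, Complex.norm_exp_ofReal_mul_I, one_mul]
      exact h
    · simp [moll_eq_zero hε h]
  simp only [e1, e2] at key
  rw [key, integral_smul_const, integral_moll hε, one_smul]

lemma differentiableAt_of_pd_eq_zero {w : Cn n → ℂ} {z : Cn n} (hw : DifferentiableAt ℝ w z)
    (h : ∀ k, pd (dzbA (eb k)) w z = 0) : DifferentiableAt ℂ w z := by
  have h' : ∀ k, fderiv ℝ w z (Complex.I • eb k) = Complex.I * fderiv ℝ w z (eb k) := fun k => by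
    have := h k
    rw [pd, dzbA_apply, div_eq_zero_iff] at this
    have h2 := this.resolve_right two_ne_zero
    linear_combination (-Complex.I) * h2 + fderiv ℝ w z (Complex.I • eb k) * Complex.I_mul_I
  refine (differentiableAt_iff_restrictScalars ℝ hw).2
    ⟨∑ j, (fderiv ℝ w z (eb j)) • (ContinuousLinearMap.proj j : Cn n →L[ℂ] ℂ), ?_⟩
  ext a
  rw [clm_eq_sum (fderiv ℝ w z) a]
  simp only [ContinuousLinearMap.coe_restrictScalars', FunLike.coe_sum, Finset.sum_apply,
    smul_apply, ContinuousLinearMap.proj_apply, smul_eq_mul]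
  refine Finset.sum_congr rfl fun j _ => ?_
  rw [h' j]
  nth_rewrite 1 [← Complex.re_add_im (a j)]
  ring

lemma cmoll_congr {ε : ℝ} (hε : 0 < ε) {u v : Cn n → ℂ} {x : Cn n}
    (h : ∀ y, ‖y - x‖ < ε → u y = v y) : cmoll ε u x = cmoll ε v x := by
  unfold cmoll
  congr 1; funext y
  rcases lt_or_ge ‖y‖ ε with hy | hy
  · rw [h (x - y) (by simpa using hy)]
  · simp [moll_eq_zero hε hy]

lemma cmoll_comm {ε δ : ℝ} (hε : 0 < ε) (hδ : 0 < δ) {u : Cn n → ℂ} (hu : Integrable u)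
    (x : Cn n) : cmoll δ (cmoll ε u) x = cmoll ε (cmoll δ u) x := by
  have h1 : Integrable (fun p : Cn n × Cn n => moll ε p.2 • u (p.1 - p.2)) (volume.prod volume) :=
    (integrable_moll hε).convolution_integrand (ContinuousLinearMap.lsmul ℝ ℝ) hu
  have h2 : Integrable (fun p : Cn n × Cn n => (moll ε p.2 • u (p.1 - p.2)) *
      (moll δ (x - p.1) : ℂ)) (volume.prod volume) := by
    have hc : Continuous fun p : Cn n × Cn n => ((moll δ (x - p.1) : ℝ) : ℂ) := by
      have := (contDiff_moll (n := n) δ).continuous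
      fun_prop
    obtain ⟨C, hC⟩ := (contDiff_moll (n := n) δ).continuous.bounded_above_of_compact_support
      (hasCompactSupport_moll hδ)
    exact h1.mul_bdd (c := C) hc.aestronglyMeasurable (Eventually.of_forall fun p => by
      rw [Complex.norm_real]; exact hC _)
  rw [cmoll_eq]
  have e1 : ∀ w, cmoll ε u w * (moll δ (x - w) : ℂ) =
      ∫ z, (moll ε z • u (w - z)) * (moll δ (x - w) : ℂ) := fun w => by
    rw [integral_mul_const]; rfl
  simp only [e1]
  rw [integral_integral_swap h2]
  rw [cmoll]
  congr 1; funext z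
  rw [cmoll_eq, ← integral_add_right_eq_self (fun w => moll ε z • u (w - z) * (moll δ (x - w) : ℂ)) z,
    ← integral_smul]
  congr 1; funext w
  rw [add_sub_cancel_right, smul_mul_assoc, sub_sub, add_comm w z]

/-- Weyl's lemma for the `∂̄`-operator. -/
theorem exists_holo_of_weak {F₀ : Cn n → ℂ} (hm : Measurable F₀)
    (hL : ∀ R : ℝ, MemLp ((Metric.ball 0 R).indicator F₀) 2 volume)
    (hw : ∀ k w, IsTest w → ∫ z, F₀ z * pd (dzbA (eb k)) w z = 0) :
    ∃ F : Cn n → ℂ, Differentiable ℂ F ∧ F =ᵐ[volume] F₀ := by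
  have hI : ∀ R : ℝ, Integrable ((Metric.ball 0 R).indicator F₀) := fun R => by
    rw [integrable_indicator_iff measurableSet_ball]
    have := (memLp_indicator_iff_restrict measurableSet_ball).1 (hL R)
    have hf : IsFiniteMeasure (volume.restrict (Metric.ball (0:Cn n) R)) :=
      ⟨by rw [Measure.restrict_apply_univ]; exact measure_ball_lt_top⟩
    exact this.integrable one_le_two
  have hli : LocallyIntegrable F₀ := fun x => by
    refine ⟨Metric.ball 0 (‖x‖ + 1), Metric.isOpen_ball.mem_nhds (by simp), ?_⟩
    rw [← integrable_indicator_iff measurableSet_ball]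
    exact hI _
  have hol : ∀ ε : ℝ, 0 < ε → Differentiable ℂ (cmoll ε F₀) := fun ε hε z => by
    refine differentiableAt_of_pd_eq_zero ((contDiff_cmoll hε hli).differentiable (by simp) z)
      fun k => ?_
    rw [pd_cmoll _ hε hli, hw k _ (isTest_moll_sub hε z), neg_zero]
  have hmv : ∀ ε δ : ℝ, 0 < ε → 0 < δ → ∀ x, cmoll δ (cmoll ε F₀) x = cmoll ε F₀ x := by
    intro ε δ hε hδ x
    have := integral_moll_holo hδ (lt_add_one δ) (x := x) ((hol ε hε).differentiableOn)
    rw [← this, cmoll, ← integral_neg_eq_self]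
    simp only [moll_neg, sub_neg_eq_add]
  have hloc : ∀ ε R : ℝ, 0 < ε → ∀ x : Cn n, ‖x‖ + ε ≤ R →
      cmoll ε F₀ x = cmoll ε ((Metric.ball 0 R).indicator F₀) x := fun ε R hε x hx =>
    cmoll_congr hε fun y hy => by
      rw [Set.indicator_of_mem]
      rw [mem_ball_zero_iff]
      have := norm_sub_norm_le y x
      linarith
  have hcomm : ∀ ε δ : ℝ, 0 < ε → 0 < δ → ∀ x, cmoll δ (cmoll ε F₀) x = cmoll ε (cmoll δ F₀) x := by
    intro ε δ hε hδ x
    set R := ‖x‖ + ε + δ with hR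
    have A : ∀ ε δ : ℝ, 0 < ε → 0 < δ → ‖x‖ + ε + δ = R →
        cmoll δ (cmoll ε F₀) x = cmoll δ (cmoll ε ((Metric.ball 0 R).indicator F₀)) x := by
      intro ε δ hε hδ h
      refine cmoll_congr hδ fun y hy => hloc ε R hε y ?_
      have := norm_sub_norm_le y x
      linarith
    rw [A ε δ hε hδ rfl, A δ ε hδ hε (by rw [hR]; ring), cmoll_comm hε hδ (hI R)]
  have heq : ∀ ε : ℝ, 0 < ε → ∀ x, cmoll ε F₀ x = cmoll 1 F₀ x := fun ε hε x => by
    rw [← hmv ε 1 hε one_pos, hcomm ε 1 hε one_pos, hmv 1 ε one_pos hε]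
  refine ⟨cmoll 1 F₀, hol 1 one_pos, ?_⟩
  have key : ∀ N : ℕ, ∀ᵐ x : Cn n, x ∈ Metric.ball (0 : Cn n) N → cmoll 1 F₀ x = F₀ x := by
    intro N
    set u := (Metric.ball (0 : Cn n) (N + 1)).indicator F₀ with hu
    have hum : Measurable u := hm.indicator measurableSet_ball
    have ht := tendsto_cmoll_eLpNorm hum (hL (N + 1))
    have hle : ∀ᶠ ε : ℝ in 𝓝[>] 0, eLpNorm ((Metric.ball (0 : Cn n) N).indicator
        fun x => cmoll 1 F₀ x - F₀ x) 2 volume ≤ eLpNorm (fun x => cmoll ε u x - u x) 2 volume := by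
      filter_upwards [Ioo_mem_nhdsGT (one_pos : (0:ℝ) < 1)] with ε hε
      refine eLpNorm_mono fun x => ?_
      by_cases hx : x ∈ Metric.ball (0 : Cn n) N
      · rw [Set.indicator_of_mem hx]
        rw [mem_ball_zero_iff] at hx
        have : u x = F₀ x := Set.indicator_of_mem (by rw [mem_ball_zero_iff]; linarith) _
        rw [this, ← heq ε hε.1 x, hloc ε (N + 1) hε.1 x (by linarith [hε.2])]
      · rw [Set.indicator_of_notMem hx, norm_zero]; exact norm_nonneg _
    have h0 := le_of_tendsto_of_tendsto tendsto_const_nhds ht hle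
    have hmeas : AEStronglyMeasurable ((Metric.ball (0 : Cn n) N).indicator
        fun x => cmoll 1 F₀ x - F₀ x) volume :=
      (((hol 1 one_pos).continuous.measurable.sub hm).indicator
        measurableSet_ball).aestronglyMeasurable
    have h1 := (eLpNorm_eq_zero_iff hmeas two_ne_zero).1 (le_antisymm h0 bot_le)
    filter_upwards [h1] with x hx hxN
    rw [Set.indicator_of_mem hxN] at hx
    exact sub_eq_zero.1 hx
  filter_upwards [ae_all_iff.2 key] with x hx
  obtain ⟨N, hN⟩ := exists_nat_gt ‖x‖
  exact hx N (by rwa [mem_ball_zero_iff])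

lemma pd_exp (l : Symb n) (c : ℝ) {Q : Cn n → ℝ} {z : Cn n} (hQ : DifferentiableAt ℝ Q z) :
    pd l (fun z => (Real.exp (c * Q z) : ℂ)) z =
      c * Real.exp (c * Q z) * pd l (fun z => (Q z : ℂ)) z := by
  have h0 : DifferentiableAt ℝ (fun z => (Q z : ℂ)) z := 
    Complex.ofRealCLM.differentiableAt.comp z hQ
  have h1 := ((h0.hasFDerivAt.const_mul (c : ℂ)).cexp).fderiv
  have h2 : (fun z => (Real.exp (c * Q z) : ℂ)) = fun z => Complex.exp ((c : ℂ) * (Q z : ℂ)) := by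
    funext z; push_cast; rfl
  rw [h2]
  unfold pd
  rw [h1, map_smul, map_smul]
  push_cast
  simp only [smul_eq_mul]; ring

lemma contDiff_exp_mul (c : ℝ) {Q : Cn n → ℝ} (hQ : ContDiff ℝ ∞ Q) :
    ContDiff ℝ ∞ fun z => (Real.exp (c * Q z) : ℂ) :=
  contDiff_ofReal (Real.contDiff_exp.comp (contDiff_const.mul hQ))

lemma integrable_levi {Q : Cn n → ℝ} (hQ : ContDiff ℝ ∞ Q) {α : Fin n → Cn n → ℂ}
    (hα : ∀ j, IsTest (α j)) : Integrable fun z => levi Q z fun j => α j z := by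
  have : IsTest fun z => ∑ j, ∑ k, pd (dzbA (eb k)) (pd (dzA (eb j)) fun z => (Q z : ℂ)) z *
      α j z * conj (α k z) :=
    IsTest.sum _ fun j _ => IsTest.sum _ fun k _ => (hα k).conj.mul_left
      ((contDiff_pd _ (contDiff_pd _ (contDiff_ofReal hQ))).mul (hα j).smooth)
  simp only [levi_eq_sum hQ]
  exact this.integrable.re

lemma norm_integral_sq_le_of_le {u : Cn n → ℂ} {a b : Cn n → ℝ} (ha : Integrable a)
    (hb : Integrable b) (ha0 : ∀ z, 0 ≤ a z) (hb0 : ∀ z, 0 ≤ b z)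
    (h : ∀ z, ‖u z‖ ^ 2 ≤ a z * b z) : ‖∫ z, u z‖ ^ 2 ≤ (∫ z, a z) * ∫ z, b z := by
  have hs : ∀ {a : Cn n → ℝ}, Integrable a → (∀ z, 0 ≤ a z) →
      MemLp (fun z => ((√(a z) : ℝ) : ℂ)) 2 volume ∧ l2 (fun z => ((√(a z) : ℝ) : ℂ)) ^ 2 =
        ∫ z, a z := by
    intro a ha ha0
    have hn : ∀ z, ‖((√(a z) : ℝ) : ℂ)‖ ^ 2 = a z := fun z => by
      rw [Complex.norm_real, Real.norm_of_nonneg (Real.sqrt_nonneg _), Real.sq_sqrt (ha0 z)]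
    have hm : MemLp (fun z => ((√(a z) : ℝ) : ℂ)) 2 volume := by
      rw [memLp_two_iff_integrable_sq_norm]
      · simpa only [hn] using ha
      · exact Complex.continuous_ofReal.comp_aestronglyMeasurable
          (Real.continuous_sqrt.comp_aestronglyMeasurable ha.1)
    exact ⟨hm, by rw [l2_sq hm]; simp only [hn]⟩
  obtain ⟨ma, la⟩ := hs ha ha0
  obtain ⟨mb, lb⟩ := hs hb hb0
  have hI := (integrable_mul_conj ma mb).norm
  have hle : ‖∫ z, u z‖ ≤ ∫ z, ‖((√(a z) : ℝ) : ℂ) * conj ((√(b z) : ℝ) : ℂ)‖ := by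
    refine norm_integral_le_of_norm_le hI (Eventually.of_forall fun z => ?_)
    rw [Complex.conj_ofReal, ← Complex.ofReal_mul, Complex.norm_real,
      Real.norm_of_nonneg (by positivity), ← Real.sqrt_mul (ha0 z)]
    exact Real.le_sqrt_of_sq_le (h z)
  have h3 : ∫ z, ‖((√(a z) : ℝ) : ℂ) * conj ((√(b z) : ℝ) : ℂ)‖ ≤
      l2 (fun z => ((√(a z) : ℝ) : ℂ)) * l2 (fun z => ((√(b z) : ℝ) : ℂ)) := by
    refine le_trans (le_of_eq ?_) (norm_integral_mul_conj_le ma mb)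
    have e : ∀ z, ((√(a z) : ℝ) : ℂ) * conj ((√(b z) : ℝ) : ℂ) = ((√(a z) * √(b z) : ℝ) : ℂ) :=
      fun z => by rw [Complex.conj_ofReal]; push_cast; rfl
    simp only [e, integral_complex_ofReal, Complex.norm_real]
    rw [Real.norm_of_nonneg (integral_nonneg fun z => by positivity)]
    congr 1; funext z
    exact Real.norm_of_nonneg (by positivity)
  have h4 := hle.trans h3
  calc ‖∫ z, u z‖ ^ 2 ≤ (l2 (fun z => ((√(a z) : ℝ) : ℂ)) * l2 (fun z => ((√(b z) : ℝ) : ℂ))) ^ 2 :=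
        pow_le_pow_left₀ (norm_nonneg _) h4 2
    _ = _ := by rw [mul_pow, la, lb]

/-- Hörmander's `L²` theorem, in a form adapted to approximating a test function by an entire
function. -/
theorem hormander {Q : Cn n → ℝ} (hQ : ContDiff ℝ ∞ Q) (hpos : ∀ z a, 0 ≤ levi Q z a)
    {h : Cn n → ℂ} (hh : IsTest h) {κ : Cn n → ℝ} (hκ0 : ∀ z, 0 ≤ κ z)
    (hκ : ∀ z a, ‖pd (dzbA a) h z‖ ^ 2 ≤ κ z * levi Q z a)
    (hκi : Integrable fun z => κ z * Real.exp (-Q z)) :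
    ∃ F : Cn n → ℂ, Differentiable ℂ F ∧
      ∫⁻ z, ENNReal.ofReal (‖h z - F z‖ ^ 2 * Real.exp (-Q z)) ≤
        ENNReal.ofReal (∫ z, κ z * Real.exp (-Q z)) := by
  set E : Cn n → ℝ := fun z => Real.exp (-(1/2) * Q z) with hE
  have hEpos : ∀ z, 0 < E z := fun z => Real.exp_pos _
  have hE2 : ∀ z, E z ^ 2 = Real.exp (-Q z) := fun z => by
    rw [hE, ← Real.exp_nat_mul]; congr 1; push_cast; ring
  have hEs : ContDiff ℝ ∞ fun z => (E z : ℂ) := contDiff_exp_mul _ hQ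
  have hQd : ∀ z, DifferentiableAt ℝ Q z := fun z => hQ.differentiable (by simp) z
  have hEh : IsTest fun z => (E z : ℂ) * h z := hh.mul_left hEs
  have hgT : ∀ k z, Tbar Q k (fun z => (E z : ℂ) * h z) z = (E z : ℂ) * pd (dzbA (eb k)) h z := by
    intro k z
    rw [Tbar, pd_mul _ (hEs.differentiable (by simp) z) (hh.smooth.differentiable (by simp) z), hE,
      pd_exp _ _ (hQd z), qf]
    push_cast; ring
  set g : Fin n → Cn n → ℂ := fun k => Tbar Q k fun z => (E z : ℂ) * h z with hg
  set M := ∫ z, κ z * Real.exp (-Q z) with hMdef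
  have hM0 : 0 ≤ M := integral_nonneg fun z => mul_nonneg (hκ0 z) (Real.exp_pos _).le
  have hM : ∀ α : Fin n → Cn n → ℂ, (∀ j, IsTest (α j)) →
      ‖∑ k, ∫ z, g k z * conj (α k z)‖ ^ 2 ≤ M * ∫ z, levi Q z fun j => α j z := by
    intro α hα
    rw [← integral_finsetSum _ fun k _ => ((hα k).conj.mul_left (hEh.top hQ k).smooth).integrable]
    refine norm_integral_sq_le_of_le hκi (integrable_levi hQ hα)
      (fun z => mul_nonneg (hκ0 z) (Real.exp_pos _).le) (fun z => hpos z _) fun z => ?_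
    have e : ∑ k, g k z * conj (α k z) = (E z : ℂ) * pd (dzbA fun j => α j z) h z := by
      rw [dzbA_eq_sum]
      simp only [hg, hgT, pd, FunLike.coe_sum, Finset.sum_apply, smul_apply, smul_eq_mul,
        Finset.mul_sum]
      exact Finset.sum_congr rfl fun k _ => by ring
    rw [e, norm_mul, mul_pow, Complex.norm_real, Real.norm_of_nonneg (hEpos z).le, hE2]
    nlinarith [hκ z fun j => α j z, Real.exp_pos (-Q z)]
  obtain ⟨v, hvm, hv2, hvM, hv⟩ := exists_Tbar_solution hQ (g := g) (fun k => hEh.top hQ k)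
    (fun j k z => Tbar_comm hQ j k hEh.smooth z) hM0 hM
  set F₀ : Cn n → ℂ := fun z => h z - v z * (Real.exp (1/2 * Q z) : ℂ) with hF₀
  have hEi : ContDiff ℝ ∞ fun z => (Real.exp (1/2 * Q z) : ℂ) := contDiff_exp_mul _ hQ
  have hEEi : ∀ z, E z * Real.exp (1/2 * Q z) = 1 := fun z => by
    rw [hE, ← Real.exp_add]; simp
  have hF₀m : Measurable F₀ := hh.continuous.measurable.sub (hvm.mul hEi.continuous.measurable)
  have hvE : ∀ R : ℝ, MemLp ((Metric.ball 0 R).indicator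
      fun z => v z * (Real.exp (1/2 * Q z) : ℂ)) 2 volume := fun R => by
    obtain ⟨C, hC⟩ := (isCompact_closedBall (0 : Cn n) R).exists_bound_of_continuousOn
      hEi.continuous.continuousOn
    refine MemLp.of_le_mul (c := max C 0) hv2 ((hvm.mul hEi.continuous.measurable).indicator
      measurableSet_ball).aestronglyMeasurable (Eventually.of_forall fun z => ?_)
    by_cases hz : z ∈ Metric.ball (0 : Cn n) R
    · rw [Set.indicator_of_mem hz, norm_mul, mul_comm]
      exact mul_le_mul_of_nonneg_right ((hC z (Metric.ball_subset_closedBall hz)).trans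
        (le_max_left _ _)) (norm_nonneg _)
    · rw [Set.indicator_of_notMem hz, norm_zero]; positivity
  have hL : ∀ R : ℝ, MemLp ((Metric.ball 0 R).indicator F₀) 2 volume := fun R => by
    have := (hh.memLp.indicator (measurableSet_ball (x := (0 : Cn n)) (ε := R))).sub (hvE R)
    rwa [← Set.indicator_sub'] at this
  have hvli : LocallyIntegrable fun z => v z * (Real.exp (1/2 * Q z) : ℂ) := by
    have := (hv2.locallyIntegrable (by norm_num)).smul_continuous hEi.continuous
    simpa [mul_comm] using this
  have hweak : ∀ k w, IsTest w → ∫ z, F₀ z * pd (dzbA (eb k)) w z = 0 := by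
    intro k w hw
    set W : Cn n → ℂ := fun z => (Real.exp (1/2 * Q z) : ℂ) * conj (w z) with hW
    have hWt : IsTest W := hw.conj.mul_left hEi
    have h1 := hv k W hWt
    have e1 : ∀ z, conj (Tst Q k W z) = - ((Real.exp (1/2 * Q z) : ℂ) * pd (dzbA (eb k)) w z) := by
      intro z
      have hc : conj (pd (dzA (eb k)) W z) = pd (dzbA (eb k)) (fun z => conj (W z)) z :=
        (pd_conj _ (hWt.smooth.differentiable (by simp) z)).symm
      have hcW : (fun z => conj (W z)) = fun z => (Real.exp (1/2 * Q z) : ℂ) * w z := by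
        funext z; simp only [hW, map_mul, Complex.conj_ofReal, Complex.conj_conj]
      rw [Tst, map_add, map_neg, hc, hcW, pd_mul _ (hEi.differentiable (by simp) z)
        (hw.smooth.differentiable (by simp) z), pd_exp _ _ (hQd z), map_mul, Complex.conj_conj]
      rw [show conj (W z) = _ from congrFun hcW z, qf]
      push_cast; ring
    have e2 : ∀ z, g k z * conj (W z) = pd (dzbA (eb k)) h z * w z := by
      intro z
      simp only [hg, hgT, hW, map_mul, Complex.conj_ofReal, Complex.conj_conj]
      have : (E z : ℂ) * (Real.exp (1/2 * Q z) : ℂ) = 1 := by exact_mod_cast hEEi z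
      linear_combination (pd (dzbA (eb k)) h z * w z) * this
    simp only [e1, e2] at h1
    have e3 : ∀ z, F₀ z * pd (dzbA (eb k)) w z = h z * pd (dzbA (eb k)) w z +
        v z * -((Real.exp (1/2 * Q z) : ℂ) * pd (dzbA (eb k)) w z) := fun z => by
      simp only [hF₀]; ring
    have hi : Integrable fun z => v z * -((Real.exp (1/2 * Q z) : ℂ) * pd (dzbA (eb k)) w z) := by
      refine ((hw.pd (dzbA (eb k))).neg.integrable_mul hvli).congr
        (Eventually.of_forall fun z => by ring)
    simp only [e3]
    rw [integral_add ((hw.pd _).mul_left hh.smooth).integrable hi, h1, integral_pd_mul _ hh hw.smooth]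
    ring
  obtain ⟨F, hF, hFe⟩ := exists_holo_of_weak hF₀m hL hweak
  refine ⟨F, hF, ?_⟩
  have hae : ∀ᵐ z, ENNReal.ofReal (‖h z - F z‖ ^ 2 * Real.exp (-Q z)) =
      ENNReal.ofReal (‖v z‖ ^ 2) := by
    filter_upwards [hFe] with z hz
    rw [hz, hF₀]
    simp only [sub_sub_cancel]
    rw [norm_mul, Complex.norm_real, Real.norm_of_nonneg (Real.exp_pos _).le, mul_pow, mul_assoc,
      ← hE2, ← mul_pow, mul_comm (Real.exp _), hEEi, one_pow, mul_one]
  rw [lintegral_congr_ae hae, ← ofReal_integral_eq_lintegral_ofReal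
    ((memLp_two_iff_integrable_sq_norm hv2.1).1 hv2) (Eventually.of_forall fun z => by positivity),
    ← l2_sq hv2]
  exact ENNReal.ofReal_le_ofReal hvM

lemma intervalIntegrable_usc {g : ℝ → ℝ} (hg : UpperSemicontinuous g) {m B : ℝ}
    (hm : ∀ θ, m ≤ g θ) (hB : ∀ θ, g θ ≤ B) (a b : ℝ) : IntervalIntegrable g volume a b := by
  have hc : IntervalIntegrable (fun _ : ℝ => max |m| |B|) volume a b := intervalIntegrable_const
  refine hc.mono_fun hg.measurable.aestronglyMeasurable (Eventually.of_forall fun θ => ?_)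
  simp only [Real.norm_eq_abs]
  rw [abs_of_nonneg (le_max_of_le_left (abs_nonneg m))]
  exact abs_le_max_abs_abs (hm θ) (hB θ)

lemma norm_exp_I_mul (θ : ℝ) : ‖Complex.exp (Complex.I * θ)‖ = 1 := by
  rw [mul_comm]; exact Complex.norm_exp_ofReal_mul_I θ

lemma circle_mem_closedBall {ζ : ℂ} {r : ℝ} (hr : 0 ≤ r) (h : ‖ζ‖ + r ≤ 1) (θ : ℝ) :
    ζ + r * Complex.exp (Complex.I * θ) ∈ Metric.closedBall (0 : ℂ) 1 := by
  rw [mem_closedBall_zero_iff]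
  refine (norm_add_le _ _).trans ?_
  rw [norm_mul, norm_exp_I_mul, Complex.norm_real, Real.norm_of_nonneg hr, mul_one]
  exact h

lemma usc_circle {g : ℂ → ℝ} (husc : UpperSemicontinuousOn g (Metric.closedBall 0 1)) {ζ : ℂ}
    {r : ℝ} (hr : 0 ≤ r) (h : ‖ζ‖ + r ≤ 1) :
    UpperSemicontinuous fun θ : ℝ => g (ζ + r * Complex.exp (Complex.I * θ)) := by
  have hc : ContinuousOn (fun θ : ℝ => ζ + r * Complex.exp (Complex.I * θ)) Set.univ := by fun_prop
  have := husc.comp hc fun θ _ => circle_mem_closedBall hr h θ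
  exact upperSemicontinuousOn_univ_iff.1 this

lemma average_circle_re {q : ℂ → ℂ} (hq : Differentiable ℂ q) (ζ : ℂ) (r : ℝ) :
    (2 * Real.pi)⁻¹ * ∫ θ in (0:ℝ)..(2 * Real.pi), (q (ζ + r * Complex.exp (Complex.I * θ))).re =
      (q ζ).re := by
  have h := (hq.differentiableOn (s := closure (Metric.ball ζ |r|))).diffContOnCl.circleAverage
  rw [Real.circleAverage_def] at h
  have hcont : Continuous fun θ : ℝ => q (circleMap ζ r θ) :=
    hq.continuous.comp (continuous_circleMap ζ r)
  have h2 : ∫ θ in (0:ℝ)..(2 * Real.pi), (q (circleMap ζ r θ)).re =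
      (∫ θ in (0:ℝ)..(2 * Real.pi), q (circleMap ζ r θ)).re := by
    have := Complex.reCLM.intervalIntegral_comp_comm (μ := volume) (hcont.intervalIntegrable 0 (2 * Real.pi))
    simpa using this
  rw [← h, Complex.smul_re, smul_eq_mul, ← h2]
  simp only [circleMap, mul_comm Complex.I]

/-- Maximum principle for upper semicontinuous functions with the local sub-mean value property. -/
lemma le_re_of_le_sphere {g : ℂ → ℝ} {m : ℝ}
    (husc : UpperSemicontinuousOn g (Metric.closedBall 0 1))
    (hm : ∀ ζ ∈ Metric.closedBall (0 : ℂ) 1, m ≤ g ζ)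
    (hloc : ∀ ζ ∈ Metric.ball (0 : ℂ) 1, ∃ ε > 0, ∀ r : ℝ, 0 < r → r < ε →
      g ζ ≤ (2 * Real.pi)⁻¹ * ∫ θ in (0:ℝ)..(2 * Real.pi), g (ζ + r * Complex.exp (Complex.I * θ)))
    {q : ℂ → ℂ} (hq : Differentiable ℂ q) {ε : ℝ}
    (hle : ∀ ζ : ℂ, ‖ζ‖ = 1 → g ζ ≤ (q ζ).re + ε) : g 0 ≤ (q 0).re + ε := by
  refine le_of_forall_pos_le_add fun δ hδ => ?_
  set h : ℂ → ℝ := fun ζ => g ζ + (-(q ζ).re + δ * ‖ζ‖ ^ 2) with hh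
  have hcont : Continuous fun ζ => -(q ζ).re + δ * ‖ζ‖ ^ 2 := by
    have := hq.continuous
    fun_prop
  have hu : UpperSemicontinuousOn h (Metric.closedBall 0 1) :=
    husc.add hcont.continuousOn.upperSemicontinuousOn
  obtain ⟨ζ, hζ, hmax⟩ := hu.exists_isMaxOn ⟨0, by simp⟩ (isCompact_closedBall (0 : ℂ) 1)
  have h0 : h 0 ≤ h ζ := hmax (by simp)
  rw [mem_closedBall_zero_iff] at hζ
  rcases hζ.lt_or_eq with hlt | heq
  · exfalso
    obtain ⟨r₀, hr₀, hr⟩ := hloc ζ (by simpa using hlt)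
    obtain ⟨r, hr1, hr2⟩ := exists_between (lt_min hr₀ (sub_pos.2 hlt))
    have hr3 := lt_min_iff.1 hr2
    have hsum : ‖ζ‖ + r ≤ 1 := by linarith
    have key := hr r hr1 hr3.1
    set q₂ : ℂ → ℂ := fun w => q w - 2 * δ * conj ζ * (w - ζ) with hq₂
    have hq₂d : Differentiable ℂ q₂ := by
      have := hq
      fun_prop
    have hav := average_circle_re hq₂d ζ r
    have hpt : ∀ θ : ℝ, g (ζ + r * Complex.exp (Complex.I * θ)) ≤
        (h ζ - δ * (‖ζ‖ ^ 2 + r ^ 2)) + (q₂ (ζ + r * Complex.exp (Complex.I * θ))).re := by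
      intro θ
      have h1 : h (ζ + r * Complex.exp (Complex.I * θ)) ≤ h ζ :=
        hmax (circle_mem_closedBall hr1.le hsum θ)
      have h2 : ‖ζ + r * Complex.exp (Complex.I * θ)‖ ^ 2 = ‖ζ‖ ^ 2 + r ^ 2 +
          2 * (conj ζ * (r * Complex.exp (Complex.I * θ))).re := by
        have hn : ‖(r : ℂ) * Complex.exp (Complex.I * θ)‖ ^ 2 = r ^ 2 := by
          rw [norm_mul, norm_exp_I_mul, Complex.norm_real, mul_one, Real.norm_eq_abs, sq_abs]
        rw [← hn, ← Complex.normSq_eq_norm_sq, ← Complex.normSq_eq_norm_sq,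
          ← Complex.normSq_eq_norm_sq, Complex.normSq_add]
        simp only [Complex.mul_re, Complex.conj_re, Complex.conj_im]
        ring
      simp only [hh] at h1 ⊢
      rw [h2] at h1
      simp only [hq₂, add_sub_cancel_left, Complex.sub_re]
      have h3 : (2 * (δ : ℂ) * conj ζ * (r * Complex.exp (Complex.I * θ))).re =
          2 * δ * (conj ζ * (r * Complex.exp (Complex.I * θ))).re := by
        rw [mul_assoc, ← Complex.re_ofReal_mul]; push_cast; rfl
      rw [h3]
      linarith
    obtain ⟨B, hB⟩ := husc.bddAbove_of_isCompact (isCompact_closedBall (0 : ℂ) 1)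
    have hi1 := intervalIntegrable_usc (usc_circle husc hr1.le hsum)
      (fun θ => hm _ (circle_mem_closedBall hr1.le hsum θ))
      (fun θ => hB ⟨_, circle_mem_closedBall hr1.le hsum θ, rfl⟩) 0 (2 * Real.pi)
    have hi2 : IntervalIntegrable (fun θ : ℝ =>
        (q₂ (ζ + r * Complex.exp (Complex.I * θ))).re) volume 0 (2 * Real.pi) := by
      refine Continuous.intervalIntegrable ?_ _ _
      have := hq₂d.continuous
      fun_prop
    have hmono := intervalIntegral.integral_mono_on (by positivity) hi1
      ((intervalIntegrable_const).add hi2) fun θ _ => hpt θ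
    rw [intervalIntegral.integral_add intervalIntegrable_const hi2,
      intervalIntegral.integral_const, sub_zero, smul_eq_mul] at hmono
    have hpi : (0:ℝ) < (2 * Real.pi)⁻¹ := by positivity
    have h5 := mul_le_mul_of_nonneg_left hmono hpi.le
    rw [mul_add, hav, ← mul_assoc, inv_mul_cancel₀ (by positivity), one_mul] at h5
    have h6 := key.trans h5
    have h7 : (q₂ ζ).re = (q ζ).re := by simp [hq₂]
    rw [h7] at h6
    simp only [hh] at h6
    nlinarith [mul_pos hδ (pow_pos hr1 2)]
  · have h1 := hle ζ heq
    simp only [hh, heq, norm_zero] at h0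
    nlinarith

lemma exists_entire_approx {G : ℂ → ℝ} (hG : Continuous G) {ε : ℝ} (hε : 0 < ε) :
    ∃ q : ℂ → ℂ, Differentiable ℂ q ∧ ∀ ζ : ℂ, ‖ζ‖ = 1 → |(q ζ).re - G ζ| ≤ ε := by
  have : Fact (0 < 2 * Real.pi) := ⟨by positivity⟩
  let e : AddCircle (2 * Real.pi) → ℂ := fun x => (AddCircle.toCircle x : ℂ)
  have he : Continuous e := by
    exact continuous_subtype_val.comp AddCircle.continuous_toCircle
  let Gc : C(AddCircle (2 * Real.pi), ℂ) :=
    ⟨fun x => (G (e x) : ℂ), Complex.continuous_ofReal.comp (hG.comp he)⟩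
  have hmem : Gc ∈ (Submodule.span ℂ (Set.range (@fourier (2 * Real.pi)))).topologicalClosure := by
    rw [span_fourier_closure_eq_top]; trivial
  obtain ⟨P, hP, hdist⟩ := Metric.mem_closure_iff.1 hmem ε hε
  have hform : ∃ q₁ q₂ : ℂ → ℂ, Differentiable ℂ q₁ ∧ Differentiable ℂ q₂ ∧
      ∀ x, P x = q₁ (e x) + conj (q₂ (e x)) := by
    refine Submodule.span_induction (p := fun P _ => ∃ q₁ q₂ : ℂ → ℂ, Differentiable ℂ q₁ ∧
      Differentiable ℂ q₂ ∧ ∀ x, P x = q₁ (e x) + conj (q₂ (e x))) ?_ ?_ ?_ ?_ hP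
    · rintro _ ⟨k, rfl⟩
      rcases Int.eq_nat_or_neg k with ⟨j, rfl | rfl⟩
      · refine ⟨fun w => w ^ j, fun _ => 0, by fun_prop, by fun_prop, fun x => ?_⟩
        simp only [map_zero, add_zero, e, fourier_apply]
        rw [natCast_zsmul, AddCircle.toCircle_nsmul, Circle.coe_pow]
      · refine ⟨fun _ => 0, fun w => w ^ j, by fun_prop, by fun_prop, fun x => ?_⟩
        rw [fourier_neg]
        simp only [zero_add, e, fourier_apply]
        rw [natCast_zsmul, AddCircle.toCircle_nsmul, Circle.coe_pow]
    · exact ⟨fun _ => 0, fun _ => 0, by fun_prop, by fun_prop, by simp⟩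
    · rintro P P' _ _ ⟨a, b, ha, hb, h⟩ ⟨a', b', ha', hb', h'⟩
      exact ⟨fun w => a w + a' w, fun w => b w + b' w, ha.add ha', hb.add hb', fun x => by
        rw [ContinuousMap.add_apply, h, h', map_add]; ring⟩
    · rintro c P _ ⟨a, b, ha, hb, h⟩
      exact ⟨fun w => c * a w, fun w => conj c * b w, ha.const_mul c, hb.const_mul _, fun x => by
        rw [ContinuousMap.smul_apply, h, map_mul, Complex.conj_conj, smul_eq_mul, mul_add]⟩
  obtain ⟨q₁, q₂, h₁, h₂, hq⟩ := hform
  refine ⟨fun w => q₁ w + q₂ w, h₁.add h₂, fun ζ hζ => ?_⟩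
  obtain ⟨x, hx⟩ : ∃ x, e x = ζ := by
    obtain ⟨x, hx⟩ := (AddCircle.homeomorphCircle (T := 2 * Real.pi) (by positivity)).surjective
      ⟨ζ, mem_sphere_zero_iff_norm.2 hζ⟩
    refine ⟨x, ?_⟩
    rw [AddCircle.homeomorphCircle_apply] at hx
    simp only [e, hx]
  have h3 : ‖Gc x - P x‖ ≤ ε := by
    rw [← dist_eq_norm]
    exact (ContinuousMap.dist_apply_le_dist x).trans hdist.le
  have h4 : (q₁ ζ + q₂ ζ).re - G ζ = -(Gc x - P x).re := by
    rw [hq, hx]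
    simp only [Gc, ContinuousMap.coe_mk, hx, Complex.sub_re, Complex.add_re, Complex.conj_re,
      Complex.ofReal_re]
    ring
  simp only [h4, abs_neg]
  exact (Complex.abs_re_le_norm _).trans h3

lemma submean_of_continuous {g : ℂ → ℝ} {m : ℝ}
    (husc : UpperSemicontinuousOn g (Metric.closedBall 0 1))
    (hm : ∀ ζ ∈ Metric.closedBall (0 : ℂ) 1, m ≤ g ζ)
    (hloc : ∀ ζ ∈ Metric.ball (0 : ℂ) 1, ∃ ε > 0, ∀ r : ℝ, 0 < r → r < ε →
      g ζ ≤ (2 * Real.pi)⁻¹ * ∫ θ in (0:ℝ)..(2 * Real.pi), g (ζ + r * Complex.exp (Complex.I * θ)))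
    {G : ℂ → ℝ} (hG : Continuous G) (hle : ∀ ζ : ℂ, ‖ζ‖ = 1 → g ζ ≤ G ζ) :
    g 0 ≤ (2 * Real.pi)⁻¹ * ∫ θ in (0:ℝ)..(2 * Real.pi), G (Complex.exp (Complex.I * θ)) := by
  refine le_of_forall_pos_le_add fun ε hε => ?_
  obtain ⟨q, hq, hqG⟩ := exists_entire_approx hG (half_pos hε)
  have h1 := le_re_of_le_sphere husc hm hloc hq (ε := ε / 2) fun ζ hζ => by
    have := abs_le.1 (hqG ζ hζ)
    linarith [hle ζ hζ, this.1]
  have h2 := average_circle_re hq 0 1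
  simp only [Complex.ofReal_one, one_mul, zero_add] at h2
  have hc1 : Continuous fun θ : ℝ => (q (Complex.exp (Complex.I * θ))).re := by
    have := hq.continuous
    fun_prop
  have hc2 : Continuous fun θ : ℝ => G (Complex.exp (Complex.I * θ)) := by fun_prop
  have hmono := intervalIntegral.integral_mono_on (μ := volume) (a := 0) (b := 2 * Real.pi)
    (by positivity) (hc1.intervalIntegrable _ _)
    ((hc2.add continuous_const).intervalIntegrable (b := 2 * Real.pi) (a := 0))
    (g := fun θ : ℝ => G (Complex.exp (Complex.I * θ)) + ε / 2) fun θ _ => by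
      have := abs_le.1 (hqG _ (norm_exp_I_mul θ))
      linarith [this.2]
  rw [intervalIntegral.integral_add (hc2.intervalIntegrable _ _) intervalIntegrable_const,
      intervalIntegral.integral_const, sub_zero, smul_eq_mul] at hmono
  have hpi : (0:ℝ) < (2 * Real.pi)⁻¹ := by positivity
  have h5 := mul_le_mul_of_nonneg_left hmono hpi.le
  rw [h2, mul_add, ← mul_assoc (2 * Real.pi)⁻¹ (2 * Real.pi), inv_mul_cancel₀ (by positivity),
    one_mul] at h5
  linarith

/-- The local sub-mean value property implies the global one. -/
lemma submean_disc {g : ℂ → ℝ} {m : ℝ}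
    (husc : UpperSemicontinuousOn g (Metric.closedBall 0 1))
    (hm : ∀ ζ ∈ Metric.closedBall (0 : ℂ) 1, m ≤ g ζ)
    (hloc : ∀ ζ ∈ Metric.ball (0 : ℂ) 1, ∃ ε > 0, ∀ r : ℝ, 0 < r → r < ε →
      g ζ ≤ (2 * Real.pi)⁻¹ * ∫ θ in (0:ℝ)..(2 * Real.pi), g (ζ + r * Complex.exp (Complex.I * θ))) :
    g 0 ≤ (2 * Real.pi)⁻¹ * ∫ θ in (0:ℝ)..(2 * Real.pi), g (Complex.exp (Complex.I * θ)) := by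
  obtain ⟨B, hB⟩ := husc.bddAbove_of_isCompact (isCompact_closedBall (0 : ℂ) 1)
  have hsp : ∀ η : Metric.sphere (0 : ℂ) 1, (η : ℂ) ∈ Metric.closedBall (0 : ℂ) 1 := fun η =>
    Metric.sphere_subset_closedBall η.2
  have hBs : ∀ η : Metric.sphere (0 : ℂ) 1, g η ≤ B := fun η => hB ⟨η, hsp η, rfl⟩
  let G : ℕ → ℂ → ℝ := fun k ζ => ⨆ η : Metric.sphere (0 : ℂ) 1, (g η - k * dist ζ η)
  have hne : Nonempty (Metric.sphere (0 : ℂ) 1) := ⟨⟨1, by simp⟩⟩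
  have hbdd : ∀ (k : ℕ) (ζ : ℂ), BddAbove (Set.range fun η : Metric.sphere (0 : ℂ) 1 =>
      g η - k * dist ζ η) := fun k ζ => ⟨B, by
    rintro _ ⟨η, rfl⟩
    have : (0:ℝ) ≤ k * dist ζ η := by positivity
    simp only
    linarith [hBs η]⟩
  have hGB : ∀ k ζ, G k ζ ≤ B := fun k ζ => ciSup_le fun η => by
    have : (0:ℝ) ≤ k * dist ζ η := by positivity
    linarith [hBs η]
  have hGg : ∀ k (ζ : ℂ), ‖ζ‖ = 1 → g ζ ≤ G k ζ := fun k ζ hζ => by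
    have := le_ciSup (hbdd k ζ) ⟨ζ, by simpa using hζ⟩
    simpa using this
  have hGc : ∀ k, Continuous (G k) := fun k => by
    refine (LipschitzWith.of_le_add_mul (k : ℝ≥0) fun x y => ciSup_le fun η => ?_).continuous
    have h1 : g η - k * dist y η ≤ G k y := le_ciSup (hbdd k y) η
    have h2 := mul_le_mul_of_nonneg_left (dist_triangle_left y η x) (Nat.cast_nonneg (α := ℝ) k)
    change g η - k * dist x η ≤ G k y + _
    push_cast
    linarith
  have hlim : ∀ ζ : ℂ, ‖ζ‖ = 1 → Tendsto (fun k => G k ζ) atTop (𝓝 (g ζ)) := by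
    intro ζ hζ
    refine tendsto_order.2 ⟨fun a ha => Eventually.of_forall fun k => ha.trans_le (hGg k ζ hζ),
      fun a ha => ?_⟩
    obtain ⟨A, hA1, hA2⟩ := exists_between ha
    have hu := husc ζ (by simp [hζ]) A hA1
    obtain ⟨δ, hδ, hball⟩ := Metric.mem_nhdsWithin_iff.1 hu
    obtain ⟨K, hK⟩ := exists_nat_ge ((B - A) / δ)
    filter_upwards [eventually_ge_atTop K] with k hk
    refine lt_of_le_of_lt (ciSup_le fun η => ?_) hA2
    rcases lt_or_ge (dist ζ η) δ with hd | hd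
    · have h1 : g η < A := hball ⟨by rwa [Metric.mem_ball, dist_comm], hsp η⟩
      have : (0:ℝ) ≤ k * dist ζ η := by positivity
      linarith
    · have h1 : (K : ℝ) ≤ k := by exact_mod_cast hk
      have h2 : B - A ≤ K * δ := (div_le_iff₀ hδ).1 hK
      have h3 : (K : ℝ) * δ ≤ k * dist ζ η := by gcongr
      linarith [hBs η]
  have hI : Tendsto (fun k => ∫ θ in (0:ℝ)..(2 * Real.pi), G k (Complex.exp (Complex.I * θ))) atTop
      (𝓝 (∫ θ in (0:ℝ)..(2 * Real.pi), g (Complex.exp (Complex.I * θ)))) := by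
    refine intervalIntegral.tendsto_integral_filter_of_dominated_convergence
      (fun _ => max |m| |B|) (Eventually.of_forall fun k => ?_) (Eventually.of_forall fun k =>
      Eventually.of_forall fun θ _ => ?_) intervalIntegrable_const
      (Eventually.of_forall fun θ _ => hlim _ (norm_exp_I_mul θ))
    · have := hGc k
      exact Continuous.aestronglyMeasurable (by fun_prop)
    · have h1 := hGg k _ (norm_exp_I_mul θ)
      have h2 := hm (Complex.exp (Complex.I * θ)) (by simp)
      exact abs_le_max_abs_abs (h2.trans h1) (hGB k _)
  exact ge_of_tendsto' (hI.const_mul _) fun k => submean_of_continuous husc hm hloc (hGc k) (hGg k)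

/-- The truncation of `u` from below at `-m`, as a real function. -/
def trunc (u : Cn n → EReal) (m : ℕ) (z : Cn n) : ℝ := (max (u z) ((-(m : ℝ) : ℝ) : EReal)).toReal

lemma coe_trunc {u : Cn n → EReal} {z : Cn n} (h : u z < ⊤) (m : ℕ) :
    ((trunc u m z : ℝ) : EReal) = max (u z) ((-(m : ℝ) : ℝ) : EReal) := by
  refine EReal.coe_toReal (max_lt h (EReal.coe_lt_top _)).ne ?_
  exact (lt_of_lt_of_le (EReal.bot_lt_coe _) (le_max_right _ _)).ne'

lemma neg_le_trunc {u : Cn n → EReal} {z : Cn n} (h : u z < ⊤) (m : ℕ) : -(m : ℝ) ≤ trunc u m z := by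
  rw [← EReal.coe_le_coe_iff, coe_trunc h]
  exact le_max_right _ _

lemma le_trunc {u : Cn n → EReal} {z : Cn n} (h : u z < ⊤) (m : ℕ) :
    u z ≤ (trunc u m z : ℝ) := by
  rw [coe_trunc h]; exact le_max_left _ _

lemma trunc_lt_iff {u : Cn n → EReal} {z : Cn n} (h : u z < ⊤) (m : ℕ) {A : ℝ} :
    trunc u m z < A ↔ u z < A ∧ -(m : ℝ) < A := by
  rw [← EReal.coe_lt_coe_iff, coe_trunc h, max_lt_iff, EReal.coe_lt_coe_iff]

lemma usc_trunc {u : Cn n → EReal} {U : Set (Cn n)} (hu : PSHOn u U) (m : ℕ) :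
    UpperSemicontinuousOn (trunc u m) U := by
  intro z hz A hA
  rw [trunc_lt_iff (hu.lt_top z hz)] at hA
  filter_upwards [hu.usc z hz A hA.1, self_mem_nhdsWithin] with y hy hyU
  exact (trunc_lt_iff (hu.lt_top y hyU) m).2 ⟨hy, hA.2⟩

/-- Sub-mean value inequality for truncations over large discs. -/
lemma trunc_submean {u : Cn n → EReal} {U : Set (Cn n)} (hu : PSHOn u U) (m : ℕ) {z w : Cn n}
    (hd : ∀ ζ ∈ Metric.closedBall (0 : ℂ) 1, z + ζ • w ∈ U) :
    trunc u m z ≤ (2 * Real.pi)⁻¹ *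
      ∫ θ in (0:ℝ)..(2 * Real.pi), trunc u m (z + Complex.exp (Complex.I * θ) • w) := by
  set g : ℂ → ℝ := fun ζ => trunc u m (z + ζ • w) with hg
  have husc : UpperSemicontinuousOn g (Metric.closedBall 0 1) := by
    have hc : ContinuousOn (fun ζ : ℂ => z + ζ • w) (Metric.closedBall 0 1) := by fun_prop
    exact (usc_trunc hu m).comp hc hd
  have hm : ∀ ζ ∈ Metric.closedBall (0 : ℂ) 1, -(m : ℝ) ≤ g ζ := fun ζ hζ =>
    neg_le_trunc (hu.lt_top _ (hd ζ hζ)) m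
  have key := submean_disc husc hm fun ζ hζ => by
    have hζ' := Metric.ball_subset_closedBall hζ
    obtain ⟨ε, hε, h⟩ := hu.submean (z + ζ • w) (hd ζ hζ') w
    rw [mem_ball_zero_iff] at hζ
    refine ⟨min ε (1 - ‖ζ‖), lt_min hε (sub_pos.2 hζ), fun r hr hr2 => ?_⟩
    obtain ⟨hr3, hr4⟩ := lt_min_iff.1 hr2
    have hsum : ‖ζ‖ + r ≤ 1 := by linarith
    have h1 : u (z + ζ • w) ≤ ((circleAvg u (z + ζ • w) w r m : ℝ) : EReal) :=
      (h r hr hr3).trans (iInf_le _ m)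
    have h2 : circleAvg u (z + ζ • w) w r m =
        (2 * Real.pi)⁻¹ * ∫ θ in (0:ℝ)..(2 * Real.pi), g (ζ + r * Complex.exp (Complex.I * θ)) := by
      rw [circleAvg]
      congr 2; funext θ
      simp only [hg, trunc, add_smul, add_assoc]
    rw [h2] at h1
    obtain ⟨B, hB⟩ := husc.bddAbove_of_isCompact (isCompact_closedBall (0 : ℂ) 1)
    have hi := intervalIntegrable_usc (usc_circle husc hr.le hsum)
      (fun θ => hm _ (circle_mem_closedBall hr.le hsum θ))
      (fun θ => hB ⟨_, circle_mem_closedBall hr.le hsum θ, rfl⟩) 0 (2 * Real.pi)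
    have h3 := intervalIntegral.integral_mono_on (by positivity) intervalIntegrable_const hi
      fun θ _ => hm _ (circle_mem_closedBall hr.le hsum θ)
    rw [intervalIntegral.integral_const, sub_zero, smul_eq_mul] at h3
    have hpi : (0:ℝ) < (2 * Real.pi)⁻¹ := by positivity
    have h4 := mul_le_mul_of_nonneg_left h3 hpi.le
    rw [← mul_assoc, inv_mul_cancel₀ (by positivity), one_mul] at h4
    rw [← EReal.coe_le_coe_iff]
    simp only [hg]
    rw [coe_trunc (hu.lt_top _ (hd ζ hζ')) m]
    exact max_le h1 (EReal.coe_le_coe_iff.2 h4)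
  simpa [hg] using key

/-- Bounded measurable functions with the sub-mean value property on discs in a ball. -/
structure SubMean (v : Cn n → ℝ) (R : ℝ) : Prop where
  meas : Measurable v
  bdd : ∃ B, ∀ z, |v z| ≤ B
  submean : ∀ z w : Cn n, ‖z‖ + ‖w‖ ≤ R → v z ≤ (2 * Real.pi)⁻¹ *
    ∫ θ in (0:ℝ)..(2 * Real.pi), v (z + Complex.exp (Complex.I * θ) • w)

lemma subMean_trunc {u : Cn n → EReal} {U : Set (Cn n)} (hu : PSHOn u U) (m : ℕ) {R : ℝ} {x : Cn n}
    (hR : Metric.closedBall x R ⊆ U) :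
    SubMean ((Metric.closedBall (0 : Cn n) R).indicator fun y => trunc u m (x + y)) R := by
  have hR' : ∀ y ∈ Metric.closedBall (0 : Cn n) R, x + y ∈ U := fun y hy => hR (by simpa using hy)
  have husc : UpperSemicontinuousOn (fun y => trunc u m (x + y)) (Metric.closedBall (0 : Cn n) R) :=
    (usc_trunc hu m).comp (by fun_prop) hR'
  have hin : ∀ z w : Cn n, ‖z‖ + ‖w‖ ≤ R → ∀ ζ ∈ Metric.closedBall (0 : ℂ) 1,
      z + ζ • w ∈ Metric.closedBall (0 : Cn n) R := by
    intro z w h ζ hζ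
    rw [mem_closedBall_zero_iff] at hζ ⊢
    refine (norm_add_le _ _).trans ?_
    rw [norm_smul]
    nlinarith [norm_nonneg w]
  refine ⟨?_, ?_, fun z w h => ?_⟩
  · refine measurable_of_restrict_of_restrict_compl (s := Metric.closedBall (0 : Cn n) R)
      measurableSet_closedBall ?_ ?_
    · have h1 := (upperSemicontinuousOn_iff_restrict.2 husc).measurable
      convert! h1 using 1
      ext z
      exact Set.indicator_of_mem z.2 _
    · convert! (measurable_const : Measurable fun _ => (0:ℝ)) using 1
      ext z
      exact Set.indicator_of_notMem z.2 _
  · obtain ⟨B, hB⟩ := husc.bddAbove_of_isCompact (isCompact_closedBall (0 : Cn n) R)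
    refine ⟨max |(-(m:ℝ))| |B|, fun z => ?_⟩
    by_cases hz : z ∈ Metric.closedBall (0 : Cn n) R
    · rw [Set.indicator_of_mem hz]
      exact abs_le_max_abs_abs (neg_le_trunc (hu.lt_top _ (hR' z hz)) m) (hB ⟨z, hz, rfl⟩)
    · rw [Set.indicator_of_notMem hz, abs_zero]; positivity
  · have hz : z ∈ Metric.closedBall (0 : Cn n) R := by
      rw [mem_closedBall_zero_iff]; linarith [norm_nonneg w]
    rw [Set.indicator_of_mem hz]
    refine (trunc_submean hu m (w := w) fun ζ hζ => ?_).trans (le_of_eq ?_)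
    · rw [add_assoc]; exact hR' _ (hin z w h ζ hζ)
    congr 2; funext θ
    rw [add_assoc]
    rw [Set.indicator_of_mem (hin z w h (Complex.exp (Complex.I * θ)) (by simp))]

lemma levi_eq {Q : Cn n → ℝ} (hQ : ContDiff ℝ ∞ Q) (z a : Cn n) :
    levi Q z a = (fderiv ℝ (fderiv ℝ Q) z a a +
      fderiv ℝ (fderiv ℝ Q) z (Complex.I • a) (Complex.I • a)) / 4 := by
  have hw := contDiff_ofReal hQ
  have h1 : (fderiv ℝ fun z => (Q z : ℂ)) = fun z => Complex.ofRealCLM.comp (fderiv ℝ Q z) := by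
    funext y
    exact (Complex.ofRealCLM.hasFDerivAt.comp y (hQ.differentiable (by simp) y).hasFDerivAt).fderiv
  have hd : DifferentiableAt ℝ (fderiv ℝ Q) z :=
    (hQ.fderiv_right (m := ∞) (by simp)).differentiable (by simp) z
  have h2 : ∀ v v', fderiv ℝ (fderiv ℝ fun z => (Q z : ℂ)) z v v' =
      ((fderiv ℝ (fderiv ℝ Q) z v v' : ℝ) : ℂ) := by
    intro v v'
    rw [h1]
    have := (((ContinuousLinearMap.compL ℝ (Cn n) ℝ ℂ) Complex.ofRealCLM).hasFDerivAt.comp z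
      hd.hasFDerivAt).fderiv
    change fderiv ℝ (((ContinuousLinearMap.compL ℝ (Cn n) ℝ ℂ) Complex.ofRealCLM) ∘
      (fderiv ℝ Q)) z v v' = _
    rw [this]
    rfl
  have h3 : pd (dzbA a) (pd (dzA a) fun z => (Q z : ℂ)) z =
      (fderiv ℝ (pd (dzA a) fun z => (Q z : ℂ)) z a +
        Complex.I * fderiv ℝ (pd (dzA a) fun z => (Q z : ℂ)) z (Complex.I • a)) / 2 := by
    rw [pd, dzbA_apply]
  rw [levi, h3]
  simp only [fderiv_pd _ hw, dzA_apply, h2]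
  have hs : fderiv ℝ (fderiv ℝ Q) z (Complex.I • a) a =
      fderiv ℝ (fderiv ℝ Q) z a (Complex.I • a) :=
    (hQ.contDiffAt (x := z)).isSymmSndFDerivAt (by simpa using ENat.LEInfty.out) _ _
  rw [hs]
  have : ∀ p q r : ℝ, ((((p:ℂ) - Complex.I * r) / 2 + Complex.I * ((r - Complex.I * q) / 2)) / 2).re =
      (p + q) / 4 := by
    intro p q r
    have : ((((p:ℂ) - Complex.I * r) / 2 + Complex.I * ((r - Complex.I * q) / 2)) / 2) =
      (((p + q) / 4 : ℝ) : ℂ) := by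
      push_cast
      linear_combination (-(q:ℂ) / 4) * Complex.I_sq
    rw [this, Complex.ofReal_re]
  exact this _ _ _

/-- Second order Taylor expansion. -/
lemma taylor_two {Q : Cn n → ℝ} (hQ : ContDiff ℝ ∞ Q) (x : Cn n) {η : ℝ} (hη : 0 < η) :
    ∃ δ > 0, ∀ h : Cn n, ‖h‖ < δ →
      |Q (x + h) - Q x - fderiv ℝ Q x h - fderiv ℝ (fderiv ℝ Q) x h h / 2| ≤ η * ‖h‖ ^ 2 := by
  have hd : DifferentiableAt ℝ (fderiv ℝ Q) x :=
    (hQ.fderiv_right (m := ∞) (by simp)).differentiable (by simp) x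
  have h1 := hd.hasFDerivAt.isLittleO.def hη
  obtain ⟨δ, hδ, h2⟩ := Metric.eventually_nhds_iff.1 h1
  refine ⟨δ, hδ, fun h hh => ?_⟩
  set D := fderiv ℝ (fderiv ℝ Q) x with hD
  have hsym : ∀ u v, D u v = D v u :=
    (hQ.contDiffAt (x := x)).isSymmSndFDerivAt (by simpa using ENat.LEInfty.out)
  let k : Cn n → ℝ := fun y => Q (x + y) - Q x - fderiv ℝ Q x y - D y y / 2
  have hk : ∀ y, HasFDerivAt k (fderiv ℝ Q (x + y) - fderiv ℝ Q x - D y) y := by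
    intro y
    have a1 : HasFDerivAt (fun y => Q (x + y)) (fderiv ℝ Q (x + y)) y := by
      have := (hQ.differentiable (by simp) (x + y)).hasFDerivAt
      rw [hasFDerivAt_comp_add_left]; exact this
    have a2 := (fderiv ℝ Q x).hasFDerivAt (x := y)
    have a3 := (D.hasFDerivAt (x := y)).clm_apply (hasFDerivAt_id y)
    have := ((a1.sub_const (Q x)).sub a2).sub (a3.mul_const (1/2 : ℝ))
    convert! this using 1
    · funext y; simp [k]; ring
    · ext v
      simp [hsym v y]
      ring
  have hb : ∀ y ∈ segment ℝ 0 h, ‖fderiv ℝ Q (x + y) - fderiv ℝ Q x - D y‖ ≤ η * ‖h‖ := by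
    intro y hy
    have hyh : ‖y‖ ≤ ‖h‖ := by
      rw [segment_eq_image] at hy
      obtain ⟨t, ht, rfl⟩ := hy
      simp only [smul_zero, zero_add, norm_smul, Real.norm_of_nonneg ht.1]
      exact mul_le_of_le_one_left (norm_nonneg _) ht.2
    have := h2 (y := x + y) (by simpa using hyh.trans_lt hh)
    simp only [add_sub_cancel_left] at this
    exact this.trans (by gcongr)
  have := (convex_segment (0 : Cn n) h).norm_image_sub_le_of_norm_hasFDerivWithin_le
    (f := k) (fun y hy => (hk y).hasFDerivWithinAt) hb (left_mem_segment ℝ 0 h)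
    (right_mem_segment ℝ 0 h)
  have hk0 : k 0 = 0 := by simp [k]
  rw [hk0, sub_zero, sub_zero, Real.norm_eq_abs] at this
  exact this.trans (le_of_eq (by ring))

/-- A smooth function with the sub-mean value property has nonnegative Levi form. -/
lemma levi_nonneg_of_submean {Q : Cn n → ℝ} (hQ : ContDiff ℝ ∞ Q) {x : Cn n} {r₀ : ℝ}
    (hr₀ : 0 < r₀) (hsub : ∀ w : Cn n, ‖w‖ < r₀ → Q x ≤ (2 * Real.pi)⁻¹ *
      ∫ θ in (0:ℝ)..(2 * Real.pi), Q (x + Complex.exp (Complex.I * θ) • w)) (a : Cn n) :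
    0 ≤ levi Q x a := by
  by_contra! hneg
  have hη : 0 < -levi Q x a / (2 * (‖a‖ ^ 2 + 1)) := by
    apply div_pos (neg_pos.2 hneg); positivity
  set η := -levi Q x a / (2 * (‖a‖ ^ 2 + 1)) with hηd
  obtain ⟨δ, hδ, ht⟩ := taylor_two hQ x hη
  obtain ⟨r, hr, hr1⟩ : ∃ r : ℝ, 0 < r ∧ r * ‖a‖ < min δ r₀ := by
    refine ⟨min δ r₀ / (2 * (‖a‖ + 1)), by positivity, ?_⟩
    rw [div_mul_eq_mul_div, div_lt_iff₀ (by positivity)]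
    have : 0 < min δ r₀ := by positivity
    nlinarith [norm_nonneg a]
  obtain ⟨hr2, hr3⟩ := lt_min_iff.1 hr1
  set D := fderiv ℝ (fderiv ℝ Q) x with hD
  have hpt : ∀ θ : ℝ, Q (x + Complex.exp (Complex.I * θ) • ((r:ℂ) • a)) +
      Q (x + Complex.exp (Complex.I * θ) • ((Complex.I * r : ℂ) • a)) +
      Q (x + Complex.exp (Complex.I * θ) • ((-r : ℂ) • a)) +
      Q (x + Complex.exp (Complex.I * θ) • ((-(Complex.I * r) : ℂ) • a)) - 4 * Q x ≤
      2 * r ^ 2 * levi Q x a := by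
    intro θ
    set h := Complex.exp (Complex.I * θ) • ((r:ℂ) • a) with hh
    have e1 : Complex.exp (Complex.I * θ) • ((Complex.I * r : ℂ) • a) = Complex.I • h := by
      rw [hh]; simp only [smul_smul]; congr 1; ring
    have e2 : Complex.exp (Complex.I * θ) • ((-r : ℂ) • a) = - h := by
      rw [hh]; simp only [smul_smul, neg_smul, smul_neg]
    have e3 : Complex.exp (Complex.I * θ) • ((-(Complex.I * r) : ℂ) • a) = - (Complex.I • h) := by
      rw [hh]; simp only [smul_smul, neg_smul, smul_neg]; congr 2; ring
    rw [e1, e2, e3]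
    have hn : ‖h‖ = r * ‖a‖ := by
      rw [hh, norm_smul, norm_smul, norm_exp_I_mul, one_mul, Complex.norm_real,
        Real.norm_of_nonneg hr.le]
    have hn1 : ‖Complex.I • h‖ = r * ‖a‖ := by rw [norm_smul, Complex.norm_I, one_mul, hn]
    have t1 := (abs_le.1 (ht h (by rw [hn]; exact hr2))).2
    have t2 := (abs_le.1 (ht (Complex.I • h) (by rw [hn1]; exact hr2))).2
    have t3 := (abs_le.1 (ht (-h) (by rw [norm_neg, hn]; exact hr2))).2
    have t4 := (abs_le.1 (ht (-(Complex.I • h)) (by rw [norm_neg, hn1]; exact hr2))).2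
    rw [hn] at t1
    rw [hn1] at t2
    rw [norm_neg, hn] at t3
    rw [norm_neg, hn1] at t4
    simp only [map_neg, neg_apply, neg_neg] at t3 t4
    have hsym : ∀ u v, D u v = D v u :=
      (hQ.contDiffAt (x := x)).isSymmSndFDerivAt (by simpa using ENat.LEInfty.out)
    have hc : h = (r * Real.cos θ) • a + (r * Real.sin θ) • (Complex.I • a) := by
      rw [hh]
      have : Complex.exp (Complex.I * θ) = Real.cos θ + Real.sin θ * Complex.I := by
        rw [mul_comm, Complex.exp_mul_I]; push_cast; ring
      rw [this]
      ext j
      simp only [Pi.smul_apply, Pi.add_apply, smul_eq_mul, Complex.real_smul]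
      push_cast
      ring
    have hc2 : Complex.I • h = (r * Real.cos θ) • (Complex.I • a) - (r * Real.sin θ) • a := by
      rw [hc, smul_add, smul_comm Complex.I, smul_comm Complex.I, smul_smul Complex.I Complex.I a,
        Complex.I_mul_I, neg_one_smul, smul_neg, sub_eq_add_neg]
    have hDD : D h h + D (Complex.I • h) (Complex.I • h) = 4 * r ^ 2 * levi Q x a := by
      rw [hc2, hc, levi_eq hQ]
      simp only [map_add, map_sub, map_smul, add_apply, sub_apply, smul_apply, smul_eq_mul]
      rw [hsym (Complex.I • a) a]
      linear_combination (r ^ 2 * (D a a + D (Complex.I • a) (Complex.I • a))) *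
        (Real.sin_sq_add_cos_sq θ)
    have hηa : η * (r * ‖a‖) ^ 2 ≤ -levi Q x a / 2 * r ^ 2 := by
      have : η * ‖a‖ ^ 2 ≤ -levi Q x a / 2 := by
        rw [hηd, div_mul_eq_mul_div, div_le_div_iff₀ (by positivity) (by norm_num)]
        nlinarith [sq_nonneg ‖a‖]
      nlinarith [sq_nonneg r]
    nlinarith
  have hci : ∀ w : Cn n, IntervalIntegrable
      (fun θ : ℝ => Q (x + Complex.exp (Complex.I * θ) • w)) volume 0 (2 * Real.pi) := by
    intro w
    refine Continuous.intervalIntegrable ?_ _ _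
    exact hQ.continuous.comp (by fun_prop)
  have hnr : ∀ c : ℂ, ‖c‖ = r → ‖c • a‖ < r₀ := fun c hc => by rw [norm_smul, hc]; exact hr3
  have s1 := hsub ((r:ℂ) • a) (hnr _ (by simp [abs_of_pos hr]))
  have s2 := hsub ((Complex.I * r : ℂ) • a) (hnr _ (by simp [abs_of_pos hr]))
  have s3 := hsub ((-r : ℂ) • a) (hnr _ (by simp [abs_of_pos hr]))
  have s4 := hsub ((-(Complex.I * r) : ℂ) • a) (hnr _ (by simp [abs_of_pos hr]))
  have i2 : IntervalIntegrable (fun θ : ℝ => Q (x + Complex.exp (Complex.I * θ) • ((r:ℂ) • a)) +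
      Q (x + Complex.exp (Complex.I * θ) • ((Complex.I * r : ℂ) • a))) volume 0 (2 * Real.pi) :=
    (hci _).add (hci _)
  have i3 : IntervalIntegrable (fun θ : ℝ => Q (x + Complex.exp (Complex.I * θ) • ((r:ℂ) • a)) +
      Q (x + Complex.exp (Complex.I * θ) • ((Complex.I * r : ℂ) • a)) +
      Q (x + Complex.exp (Complex.I * θ) • ((-r : ℂ) • a))) volume 0 (2 * Real.pi) := i2.add (hci _)
  have i4 : IntervalIntegrable (fun θ : ℝ => Q (x + Complex.exp (Complex.I * θ) • ((r:ℂ) • a)) +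
      Q (x + Complex.exp (Complex.I * θ) • ((Complex.I * r : ℂ) • a)) +
      Q (x + Complex.exp (Complex.I * θ) • ((-r : ℂ) • a)) +
      Q (x + Complex.exp (Complex.I * θ) • ((-(Complex.I * r) : ℂ) • a))) volume 0 (2 * Real.pi) :=
    i3.add (hci _)
  have hI := intervalIntegral.integral_mono (μ := volume) (by positivity : (0:ℝ) ≤ 2 * Real.pi)
    (i4.sub (intervalIntegrable_const (c := 4 * Q x)))
    (intervalIntegrable_const (c := 2 * r ^ 2 * levi Q x a)) hpt
  rw [intervalIntegral.integral_sub i4 intervalIntegrable_const,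
    intervalIntegral.integral_add i3 (hci _), intervalIntegral.integral_add i2 (hci _),
    intervalIntegral.integral_add (hci _) (hci _),
    intervalIntegral.integral_const, intervalIntegral.integral_const, smul_eq_mul, smul_eq_mul,
    sub_zero] at hI
  have hpi : (0:ℝ) < 2 * Real.pi := by positivity
  rw [inv_mul_eq_div, le_div_iff₀ hpi] at s1 s2 s3 s4
  have : 0 < r ^ 2 * -levi Q x a := mul_pos (by positivity) (neg_pos.2 hneg)
  nlinarith

/-- Mollification of a real-valued function. -/
def rmoll (ε : ℝ) (v : Cn n → ℝ) (x : Cn n) : ℝ := ∫ y, moll ε y • v (x + y)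

lemma SubMean.integrable_translate {v : Cn n → ℝ} {R : ℝ} (hv : SubMean v R) {ε : ℝ} (hε : 0 < ε)
    (x : Cn n) : Integrable fun y => moll ε y • v (x + y) := by
  obtain ⟨B, hB⟩ := hv.bdd
  refine ((integrable_moll (n := n) hε).const_mul B).mono' ?_ (Eventually.of_forall fun y => ?_)
  · exact ((contDiff_moll ε).continuous.measurable.mul
      (hv.meas.comp (measurable_const_add x))).aestronglyMeasurable
  · rw [norm_smul, Real.norm_of_nonneg (moll_nonneg ε y), mul_comm]
    exact mul_le_mul_of_nonneg_right (hB _) (moll_nonneg ε y)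

lemma SubMean.contDiff_rmoll {v : Cn n → ℝ} {R : ℝ} (hv : SubMean v R) {ε : ℝ} (hε : 0 < ε) :
    ContDiff ℝ ∞ (rmoll ε v) := by
  obtain ⟨B, hB⟩ := hv.bdd
  have hl : LocallyIntegrable fun z => (v z : ℂ) := by
    refine (locallyIntegrable_const (B : ℝ)).mono
      (Complex.measurable_ofReal.comp hv.meas).aestronglyMeasurable (Eventually.of_forall fun z => ?_)
    rw [Complex.norm_real, Real.norm_eq_abs]
    exact (hB z).trans (le_abs_self B)
  have h : rmoll ε v = fun x => (cmoll ε (fun z => (v z : ℂ)) x).re := by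
    funext x
    have h1 : cmoll ε (fun z => (v z : ℂ)) x = ((rmoll ε v x : ℝ) : ℂ) := by
      rw [cmoll, ← integral_neg_eq_self, rmoll, ← integral_complex_ofReal]
      refine integral_congr_ae (Eventually.of_forall fun y => ?_)
      simp only [moll_neg, sub_neg_eq_add, smul_eq_mul, Complex.real_smul]
      push_cast
      rfl
    rw [h1, Complex.ofReal_re]
  rw [h]
  exact Complex.reCLM.contDiff.comp (contDiff_cmoll hε hl)

lemma SubMean.le_rmoll {v : Cn n → ℝ} {R : ℝ} (hv : SubMean v R) {ε : ℝ} (hε : 0 < ε) {x : Cn n}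
    (hx : ‖x‖ + ε ≤ R) : v x ≤ rmoll ε v x := by
  obtain ⟨B, hB⟩ := hv.bdd
  have h1 := integral_moll_circle hε hv.meas (x := x) (B := B) fun y _ => hB y
  rw [rmoll, h1]
  have h2 : v x = ∫ y : Cn n, moll ε y • v x := by
    rw [integral_smul_const, integral_moll hε, one_smul]
  conv_lhs => rw [h2]
  have hm : Measurable fun y : Cn n => ∫ θ in (0:ℝ)..(2 * Real.pi),
      v (x + Complex.exp (Complex.I * θ) • y) := by
    have m1 : Measurable fun p : Cn n × ℝ => x + Complex.exp (Complex.I * p.2) • p.1 := by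
      have : Continuous fun p : Cn n × ℝ => x + Complex.exp (Complex.I * p.2) • p.1 := by fun_prop
      exact this.measurable
    simp only [intervalIntegral.integral_of_le (by positivity : (0:ℝ) ≤ 2 * Real.pi)]
    exact ((hv.meas.comp m1).stronglyMeasurable.integral_prod_right').measurable
  have hpi : (0:ℝ) < 2 * Real.pi := by positivity
  refine integral_mono ((integrable_moll hε).smul_const _) ?_ fun y => ?_
  · refine ((integrable_moll (n := n) hε).const_mul B).mono' ?_ (Eventually.of_forall fun y => ?_)
    · exact ((contDiff_moll ε).continuous.measurable.smul (hm.const_smul (2 * Real.pi)⁻¹)).aestronglyMeasurable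
    · rw [norm_smul, Real.norm_of_nonneg (moll_nonneg ε y), mul_comm]
      refine mul_le_mul_of_nonneg_right ?_ (moll_nonneg ε y)
      have := intervalIntegral.norm_integral_le_of_norm_le_const (a := 0) (b := 2 * Real.pi)
        (f := fun θ : ℝ => v (x + Complex.exp (Complex.I * θ) • y)) (C := B) fun θ _ => hB _
      rw [norm_smul, norm_inv, Real.norm_of_nonneg hpi.le, inv_mul_eq_div, div_le_iff₀ hpi]
      rwa [sub_zero, abs_of_pos hpi] at this
  · by_cases hy : ε ≤ ‖y‖
    · simp [moll_eq_zero hε hy]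
    · refine mul_le_mul_of_nonneg_left ?_ (moll_nonneg ε y)
      exact hv.submean x y (by linarith [not_le.1 hy])

lemma SubMean.rmoll_le {v : Cn n → ℝ} {R : ℝ} (hv : SubMean v R) {ε : ℝ} (hε : 0 < ε) {x : Cn n}
    {A : ℝ} (hA : ∀ y, ‖y‖ < ε → v (x + y) ≤ A) : rmoll ε v x ≤ A := by
  have h2 : A = ∫ y : Cn n, moll ε y • A := by
    rw [integral_smul_const, integral_moll hε, one_smul]
  conv_rhs => rw [h2]
  refine integral_mono (hv.integrable_translate hε x) ((integrable_moll hε).smul_const _) fun y => ?_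
  by_cases hy : ε ≤ ‖y‖
  · simp [moll_eq_zero hε hy]
  · exact mul_le_mul_of_nonneg_left (hA y (not_le.1 hy)) (moll_nonneg ε y)

lemma SubMean.rmoll_submean {v : Cn n → ℝ} {R : ℝ} (hv : SubMean v R) {ε : ℝ} (hε : 0 < ε)
    {x w : Cn n} (hx : ‖x‖ + ‖w‖ + ε ≤ R) : rmoll ε v x ≤ (2 * Real.pi)⁻¹ *
      ∫ θ in (0:ℝ)..(2 * Real.pi), rmoll ε v (x + Complex.exp (Complex.I * θ) • w) := by
  obtain ⟨B, hB⟩ := hv.bdd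
  have hpi : (0:ℝ) < 2 * Real.pi := by positivity
  have hint : Integrable (Function.uncurry fun (θ : ℝ) (y : Cn n) =>
      moll ε y • v (x + Complex.exp (Complex.I * θ) • w + y))
      ((volume.restrict (Set.uIoc 0 (2 * Real.pi))).prod volume) := by
    have hb : Integrable (fun p : ℝ × Cn n => (B : ℝ) * moll ε p.2)
        ((volume.restrict (Set.uIoc 0 (2 * Real.pi))).prod volume) := by
      have : IsFiniteMeasure (volume.restrict (Set.uIoc (0:ℝ) (2 * Real.pi))) :=
        ⟨by rw [Measure.restrict_apply_univ, Set.uIoc]; exact measure_Ioc_lt_top⟩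
      exact (integrable_const B).mul_prod (integrable_moll (n := n) hε)
    refine hb.mono' ?_ (Eventually.of_forall fun p => ?_)
    · have m1 : Measurable fun p : ℝ × Cn n => x + Complex.exp (Complex.I * p.1) • w + p.2 := by
        have : Continuous fun p : ℝ × Cn n => x + Complex.exp (Complex.I * p.1) • w + p.2 := by
          fun_prop
        exact this.measurable
      have m2 : Measurable fun p : ℝ × Cn n => moll ε p.2 :=
        ((contDiff_moll ε).continuous.comp continuous_snd).measurable
      exact (m2.smul (hv.meas.comp m1)).aestronglyMeasurable
    · simp only [Function.uncurry]
      rw [norm_smul, Real.norm_of_nonneg (moll_nonneg ε _), mul_comm]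
      exact mul_le_mul_of_nonneg_right (hB _) (moll_nonneg ε _)
  simp only [rmoll]
  have hsw := intervalIntegral_integral_swap hint
  rw [hsw, ← integral_const_mul]
  have hint2 : Integrable fun y : Cn n => ∫ θ in (0:ℝ)..(2 * Real.pi),
      moll ε y • v (x + Complex.exp (Complex.I * θ) • w + y) := by
    have := hint.swap.integral_prod_left
    simp only [intervalIntegral.integral_of_le hpi.le]
    rw [Set.uIoc_of_le hpi.le] at this
    exact this
  refine integral_mono (hv.integrable_translate hε x) (hint2.const_mul _) fun y => ?_
  simp only [smul_eq_mul]
  by_cases hy : ε ≤ ‖y‖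
  · simp [moll_eq_zero hε hy]
  · have h1 := hv.submean (x + y) w (by linarith [norm_add_le x y, not_le.1 hy])
    have h2 := mul_le_mul_of_nonneg_left h1 (moll_nonneg ε y)
    refine h2.trans (le_of_eq ?_)
    simp only [add_right_comm x y, intervalIntegral.integral_const_mul]
    ring

lemma SubMean.levi_rmoll_nonneg {v : Cn n → ℝ} {R : ℝ} (hv : SubMean v R) {ε : ℝ} (hε : 0 < ε)
    {x : Cn n} (hx : ‖x‖ + ε < R) (a : Cn n) : 0 ≤ levi (rmoll ε v) x a :=
  levi_nonneg_of_submean (hv.contDiff_rmoll hε) (sub_pos.2 hx)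
    (fun w hw => hv.rmoll_submean hε (by linarith)) a

lemma moll_pos {ε : ℝ} (hε : 0 < ε) {y : Cn n} (hy : n * ‖y‖ ^ 2 < ε ^ 2) : 0 < moll ε y := by
  refine mul_pos (inv_pos.2 (integral_bumpE_pos hε)) ?_
  refine Real.smoothTransition.pos_of_pos ?_
  have h1 := nsq_le (ε⁻¹ • y)
  rw [norm_smul, norm_inv, Real.norm_of_nonneg hε.le, mul_pow, inv_pow] at h1
  have h2 : (ε ^ 2)⁻¹ * (n * ‖y‖ ^ 2) < 1 := by
    rw [inv_mul_lt_iff₀ (by positivity), mul_one]; exact hy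
  linarith [h1.trans (le_of_eq (by ring : (n:ℝ) * ((ε ^ 2)⁻¹ * ‖y‖ ^ 2) = (ε ^ 2)⁻¹ * (n * ‖y‖ ^ 2)))]

lemma trunc_le_trunc_zero {u : Cn n → EReal} {z : Cn n} (h : u z < ⊤) (m : ℕ) :
    trunc u m z ≤ trunc u 0 z := by
  rw [← EReal.coe_le_coe_iff, coe_trunc h, coe_trunc h]
  refine max_le_max le_rfl (EReal.coe_le_coe_iff.2 ?_)
  simp

lemma trunc_of_eq_bot {u : Cn n → EReal} {z : Cn n} (h : u z = ⊥) (m : ℕ) : trunc u m z = -m := by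
  rw [trunc, h, max_eq_right bot_le, EReal.toReal_coe]

/-- A plurisubharmonic function finite at `a` is finite almost everywhere near `a`. -/
lemma ae_ne_bot_of_ne_bot {u : Cn n → EReal} {U : Set (Cn n)} (hu : PSHOn u U) {a : Cn n} {r : ℝ}
    (hr : 0 < r) (hR : Metric.closedBall a r ⊆ U) (ha : u a ≠ ⊥) :
    ∀ᵐ y : Cn n, n * ‖y - a‖ ^ 2 < r ^ 2 → ‖y - a‖ < r → u y ≠ ⊥ := by
  have hR' : ∀ y ∈ Metric.closedBall (0 : Cn n) r, a + y ∈ U := fun y hy => hR (by simpa using hy)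
  set v : ℕ → Cn n → ℝ := fun m => (Metric.closedBall (0 : Cn n) r).indicator fun y =>
    trunc u m (a + y) with hv
  have hsub : ∀ m, SubMean (v m) r := fun m => subMean_trunc hu m hR
  obtain ⟨A, hA⟩ := (hsub 0).bdd
  have hA0 : 0 ≤ A := (abs_nonneg _).trans (hA 0)
  set S : Set (Cn n) := Metric.ball 0 r ∩ {y | u (a + y) = ⊥} with hS
  have hSm : MeasurableSet S := by
    have : S = Metric.ball 0 r ∩ ⋂ m : ℕ, {y | v m y ≤ -(m : ℝ)} := by
      ext y
      simp only [hS, Set.mem_inter_iff, Set.mem_ofPred_eq, Set.mem_iInter]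
      refine and_congr_right fun hy => ?_
      have hy' := Metric.ball_subset_closedBall hy
      have hvm : ∀ m, v m y = trunc u m (a + y) := fun m => Set.indicator_of_mem hy' _
      simp only [hvm]
      constructor
      · intro h m
        rw [trunc_of_eq_bot h]
      · intro h
        rw [EReal.eq_bot_iff_forall_lt]
        intro t
        obtain ⟨k, hk⟩ := exists_nat_gt (-t)
        refine (le_trunc (hu.lt_top _ (hR' y hy')) k).trans_lt (EReal.coe_lt_coe_iff.2 ?_)
        linarith [h k]
    rw [this]
    exact measurableSet_ball.inter (MeasurableSet.iInter fun m =>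
      measurableSet_le (hsub m).meas measurable_const)
  set I : ℝ := ∫ y in S, moll r y with hI
  have hI0 : 0 ≤ I := integral_nonneg (moll_nonneg r)
  have key : ∀ m : ℕ, trunc u m a ≤ A - (A + m) * I := by
    intro m
    have h1 := (hsub m).le_rmoll hr (x := 0) (by simp)
    have h2 : v m 0 = trunc u m a := by
      simp only [hv]
      rw [Set.indicator_of_mem (by simpa using hr.le), add_zero]
    rw [h2] at h1
    refine h1.trans ?_
    have h3 : A - (A + m) * I = ∫ y : Cn n, moll r y * A - (A + m) * S.indicator (moll r) y := by
      rw [integral_sub ((integrable_moll hr).mul_const A)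
        (((integrable_moll hr).indicator hSm).const_mul _), integral_mul_const, integral_moll hr,
        integral_const_mul, integral_indicator hSm, one_mul]
    rw [h3]
    refine integral_mono ((hsub m).integrable_translate hr 0) (((integrable_moll hr).mul_const A).sub
      (((integrable_moll hr).indicator hSm).const_mul _)) fun y => ?_
    simp only [zero_add, smul_eq_mul]
    by_cases hy : ‖y‖ < r
    · have hy' : y ∈ Metric.closedBall (0 : Cn n) r := by simpa using hy.le
      have hvm : ∀ m, v m y = trunc u m (a + y) := fun m => Set.indicator_of_mem hy' _
      by_cases hyS : y ∈ S
      · rw [Set.indicator_of_mem hyS, hvm]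
        have : trunc u m (a + y) = -m := trunc_of_eq_bot hyS.2 m
        rw [this]
        linarith
      · rw [Set.indicator_of_notMem hyS, mul_zero, sub_zero]
        refine mul_le_mul_of_nonneg_left ?_ (moll_nonneg r y)
        rw [hvm]
        refine (trunc_le_trunc_zero (hu.lt_top _ (hR' y hy')) m).trans ?_
        rw [← hvm]
        exact (le_abs_self _).trans (hA y)
    · have hyS : y ∉ S := fun h => hy (by simpa using h.1)
      rw [Set.indicator_of_notMem hyS, moll_eq_zero hr (not_lt.1 hy)]
      simp
  have hIz : I = 0 := by
    by_contra hne
    have hIp : 0 < I := lt_of_le_of_ne hI0 (Ne.symm hne)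
    refine ha ((EReal.eq_bot_iff_forall_lt _).2 fun t => ?_)
    obtain ⟨k, hk⟩ := exists_nat_gt ((A - t) / I)
    rw [div_lt_iff₀ hIp] at hk
    refine (le_trunc (hu.lt_top a (hR (Metric.mem_closedBall_self hr.le))) k).trans_lt
      (EReal.coe_lt_coe_iff.2 ((key k).trans_lt ?_))
    nlinarith [mul_nonneg hA0 hI0]
  have hae : ∀ᵐ y : Cn n, y ∈ S → moll r y = 0 := by
    rw [← ae_restrict_iff' hSm]
    exact (integral_eq_zero_iff_of_nonneg (fun y => moll_nonneg r y)
      (integrable_moll hr).integrableOn).1 hIz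
  have htr := (measurePreserving_sub_right (volume : Measure (Cn n)) a).quasiMeasurePreserving.ae hae
  filter_upwards [htr] with y hy h1 h2 h3
  refine (moll_pos hr h1).ne' (hy ⟨by simpa using h2, ?_⟩)
  simpa using h3

lemma ae_ne_bot {u : Cn n → EReal} (hu : PSHNear u) :
    ∃ ε > 0, ∀ᵐ y : Cn n, y ∈ Metric.ball (0 : Cn n) ε → u y ≠ ⊥ := by
  obtain ⟨U, hU0, hU, hp⟩ := hu
  set Y : Set (Cn n) := {z | ∃ ε > 0, ∀ᵐ y : Cn n, y ∈ Metric.ball z ε → u y ≠ ⊥} with hY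
  set X : Set (Cn n) := interior {z | u z = ⊥} with hX
  have hXb : ∀ z ∈ X, u z = ⊥ := fun z hz => by
    have : z ∈ {z | u z = ⊥} := interior_subset hz
    exact this
  have hYo : IsOpen Y := by
    rw [Metric.isOpen_iff]
    rintro z ⟨ε, hε, h⟩
    refine ⟨ε / 2, half_pos hε, fun w hw => ⟨ε / 2, half_pos hε, ?_⟩⟩
    filter_upwards [h] with y hy hyw
    refine hy ?_
    rw [Metric.mem_ball] at *
    linarith [dist_triangle y w z]
  have hcase : ∀ z ∈ U, z ∈ X ∪ Y := by
    intro z hz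
    obtain ⟨r, hr, hrU⟩ := Metric.isOpen_iff.1 hU z hz
    have hr3 : 0 < r / 3 := by positivity
    set e : ℝ := r / 3 / (n + 1) with he
    have hepos : 0 < e := by positivity
    have her : e ≤ r / 3 := div_le_self hr3.le (by linarith [(Nat.cast_nonneg n : (0:ℝ) ≤ n)])
    have hen : (n : ℝ) * e ^ 2 < (r / 3) ^ 2 := by
      have h0 : (0:ℝ) ≤ n := Nat.cast_nonneg n
      have : r / 3 = e * (n + 1) := by rw [he]; field_simp
      rw [this, mul_pow]
      have : 0 < e ^ 2 := by positivity
      nlinarith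
    by_cases hb : ∃ a ∈ Metric.ball z (e / 2), u a ≠ ⊥
    · right
      obtain ⟨a, haz, ha⟩ := hb
      rw [Metric.mem_ball] at haz
      have := ae_ne_bot_of_ne_bot hp (a := a) hr3 (fun y hy => hrU (by
        rw [Metric.mem_closedBall] at hy
        rw [Metric.mem_ball]
        linarith [dist_triangle y a z])) ha
      refine ⟨e / 2, by positivity, ?_⟩
      filter_upwards [this] with y hy hyz
      rw [Metric.mem_ball] at hyz
      have hd : ‖y - a‖ < e := by
        rw [← dist_eq_norm]
        linarith [dist_triangle y z a, dist_comm a z]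
      refine hy (lt_of_le_of_lt ?_ hen) (hd.trans_le her)
      gcongr
    · left
      push Not at hb
      exact mem_interior_iff_mem_nhds.2 (mem_of_superset (Metric.ball_mem_nhds z (by positivity)) hb)
  have h0U := mem_of_mem_nhds hU0
  have hdisj : ∀ z, z ∈ X → z ∈ Y → False := by
    rintro z hzX ⟨ε, hε, h⟩
    obtain ⟨δ, hδ, hδX⟩ := Metric.isOpen_iff.1 isOpen_interior z hzX
    have hpos : 0 < volume (Metric.ball z (min δ ε)) := Metric.measure_ball_pos _ _ (lt_min hδ hε)
    refine hpos.ne' (measure_mono_null ?_ (ae_iff.1 h))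
    intro y hy
    simp only [Set.mem_ofPred_eq, not_forall, not_not]
    exact ⟨Metric.ball_subset_ball (min_le_right _ _) hy,
      hXb _ (hδX (Metric.ball_subset_ball (min_le_left _ _) hy))⟩
  obtain ⟨w, hw, hwb⟩ := hp.not_botOnComponents 0 h0U
  rcases hcase 0 h0U with h | h
  · exfalso
    have hwU := connectedComponentIn_subset U 0 hw
    have hwY : w ∈ Y := (hcase w hwU).resolve_left fun hx => hwb (hXb w hx)
    obtain ⟨z, -, hz1, hz2⟩ := isPreconnected_connectedComponentIn (F := U) (x := (0 : Cn n)) X Y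
      isOpen_interior hYo (fun z hz => hcase z (connectedComponentIn_subset U 0 hz))
      ⟨0, mem_connectedComponentIn h0U, h⟩ ⟨w, hw, hwY⟩
    exact hdisj z hz1 hz2
  · exact h

/-- Approximation of a plurisubharmonic function by smooth plurisubharmonic functions. -/
structure IsRegularization (u : Cn n → EReal) (R C : ℝ) (p : ℕ → Cn n → ℝ) : Prop where
  smooth : ∀ k, ContDiff ℝ ∞ (p k)
  levi_nonneg : ∀ k, ∀ z ∈ Metric.ball (0 : Cn n) R, ∀ a, 0 ≤ levi (p k) z a
  le_const : ∀ k, ∀ z ∈ Metric.ball (0 : Cn n) R, p k z ≤ C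
  le : ∀ k, ∀ z ∈ Metric.ball (0 : Cn n) R, u z ≤ (p k z : ℝ)
  eventually_le : ∀ z ∈ Metric.ball (0 : Cn n) R, ∀ A : ℝ, u z < A → ∀ᶠ k in atTop, p k z ≤ A

lemma exists_regularization {u : Cn n → EReal} (hu : PSHNear u) :
    ∃ R > 0, ∃ (C : ℝ) (p : ℕ → Cn n → ℝ), IsRegularization u R C p := by
  obtain ⟨U, hU0, hU, hp⟩ := hu
  obtain ⟨R₀, hR₀, hRU⟩ := Metric.nhds_basis_closedBall.mem_iff.1 hU0
  set R := R₀ / 2 with hR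
  have hRp : 0 < R := by positivity
  set v : ℕ → Cn n → ℝ := fun m => (Metric.closedBall (0 : Cn n) R₀).indicator fun y =>
    trunc u m (0 + y) with hv
  have hsub : ∀ m, SubMean (v m) R₀ := fun m => subMean_trunc hp m hRU
  have hvm : ∀ m, ∀ y ∈ Metric.closedBall (0 : Cn n) R₀, v m y = trunc u m y := fun m y hy => by
    simp only [hv]
    rw [Set.indicator_of_mem hy, zero_add]
  obtain ⟨A, hA⟩ := (hsub 0).bdd
  let ε : ℕ → ℝ := fun k => R / (k + 2)
  have hε : ∀ k, 0 < ε k := fun k => by positivity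
  have hεR : ∀ k, ε k < R := fun k => by
    refine div_lt_self hRp ?_
    linarith [(Nat.cast_nonneg k : (0:ℝ) ≤ k)]
  have hnear : ∀ k, ∀ z ∈ Metric.ball (0 : Cn n) R, ∀ y : Cn n, ‖y‖ < ε k →
      z + y ∈ Metric.closedBall (0 : Cn n) R₀ := by
    intro k z hz y hy
    rw [mem_ball_zero_iff] at hz
    rw [mem_closedBall_zero_iff]
    linarith [norm_add_le z y, hεR k]
  have hsum : ∀ k, ∀ z ∈ Metric.ball (0 : Cn n) R, ‖z‖ + ε k < R₀ := by
    intro k z hz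
    rw [mem_ball_zero_iff] at hz
    linarith [hεR k]
  refine ⟨R, hRp, A, fun k => rmoll (ε k) (v k), fun k => (hsub k).contDiff_rmoll (hε k),
    fun k z hz a => (hsub k).levi_rmoll_nonneg (hε k) (hsum k z hz) a, fun k z hz => ?_,
    fun k z hz => ?_, fun z hz A' hA' => ?_⟩
  · refine (hsub k).rmoll_le (hε k) fun y hy => ?_
    have hzy := hnear k z hz y hy
    rw [hvm _ _ hzy]
    refine (trunc_le_trunc_zero (hp.lt_top _ (hRU hzy)) k).trans ?_
    rw [← hvm _ _ hzy]
    exact (le_abs_self _).trans (hA _)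
  · have hzz : z ∈ Metric.closedBall (0 : Cn n) R₀ := by
      simpa using hnear k z hz 0 (by simpa using hε k)
    refine (le_trunc (hp.lt_top z (hRU hzz)) k).trans (EReal.coe_le_coe_iff.2 ?_)
    rw [← hvm k z hzz]
    exact (hsub k).le_rmoll (hε k) (hsum k z hz).le
  · have hzz : z ∈ Metric.closedBall (0 : Cn n) R₀ := by
      simpa using hnear 0 z hz 0 (by simpa using hε 0)
    have h1 := hp.usc z (hRU hzz) A' hA'
    rw [hU.nhdsWithin_eq (hRU hzz)] at h1
    obtain ⟨δ, hδ, h2⟩ := Metric.eventually_nhds_iff.1 h1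
    obtain ⟨K, hK⟩ := exists_nat_gt (max (-A') (R / δ))
    obtain ⟨hK1, hK2⟩ := max_lt_iff.1 hK
    filter_upwards [eventually_ge_atTop K] with k hk
    have hkK : (K : ℝ) ≤ k := by exact_mod_cast hk
    refine (hsub k).rmoll_le (hε k) fun y hy => ?_
    have hzy := hnear k z hz y hy
    rw [hvm _ _ hzy]
    refine ((trunc_lt_iff (hp.lt_top _ (hRU hzy)) k).2 ⟨h2 ?_, by linarith⟩).le
    rw [dist_eq_norm, add_sub_cancel_left]
    refine hy.trans_le ?_
    rw [div_le_iff₀ (by positivity)]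
    rw [div_lt_iff₀ hδ] at hK2
    nlinarith

/-- The squared norm of the `(1,0)`-derivative of a real function in direction `a`. -/
def gsq (Q : Cn n → ℝ) (z a : Cn n) : ℝ :=
  ((fderiv ℝ Q z a) ^ 2 + (fderiv ℝ Q z (Complex.I • a)) ^ 2) / 4

lemma gsq_nonneg (Q : Cn n → ℝ) (z a : Cn n) : 0 ≤ gsq Q z a := by unfold gsq; positivity

lemma hasFDerivAt_fderiv {Q : Cn n → ℝ} (hQ : ContDiff ℝ ∞ Q) (z : Cn n) :
    HasFDerivAt (fderiv ℝ Q) (fderiv ℝ (fderiv ℝ Q) z) z :=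
  ((hQ.fderiv_right (m := ∞) (by simp)).differentiable (by simp) z).hasFDerivAt

lemma hasFDerivAt_of_contDiff {Q : Cn n → ℝ} (hQ : ContDiff ℝ ∞ Q) (z : Cn n) :
    HasFDerivAt Q (fderiv ℝ Q z) z := (hQ.differentiable (by simp) z).hasFDerivAt

lemma levi_add {P Q : Cn n → ℝ} (hP : ContDiff ℝ ∞ P) (hQ : ContDiff ℝ ∞ Q) (z a : Cn n) :
    levi (fun z => P z + Q z) z a = levi P z a + levi Q z a := by
  have h1 : fderiv ℝ (fun z => P z + Q z) = fun z => fderiv ℝ P z + fderiv ℝ Q z := by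
    funext y
    exact ((hasFDerivAt_of_contDiff hP y).add (hasFDerivAt_of_contDiff hQ y)).fderiv
  rw [levi_eq (hP.add hQ), levi_eq hP, levi_eq hQ, h1,
    HasFDerivAt.fderiv (by exact (hasFDerivAt_fderiv hP z).add (hasFDerivAt_fderiv hQ z))]
  simp only [add_apply]
  ring

lemma levi_comp {χ : ℝ → ℝ} (hχ : ContDiff ℝ ∞ χ) {Q : Cn n → ℝ} (hQ : ContDiff ℝ ∞ Q)
    (z a : Cn n) : levi (fun z => χ (Q z)) z a =
      deriv χ (Q z) * levi Q z a + deriv (deriv χ) (Q z) * gsq Q z a := by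
  have hd : ∀ x, HasDerivAt χ (deriv χ x) x := fun x => (hχ.differentiable (by simp) x).hasDerivAt
  have hχ' : ContDiff ℝ ∞ (deriv χ) := hχ.deriv'
  have hdd : ∀ x, HasDerivAt (deriv χ) (deriv (deriv χ) x) x := fun x =>
    (hχ'.differentiable (by simp) x).hasDerivAt
  have h1 : fderiv ℝ (fun z => χ (Q z)) = fun z => deriv χ (Q z) • fderiv ℝ Q z := by
    funext y
    exact ((hd (Q y)).comp_hasFDerivAt y (hasFDerivAt_of_contDiff hQ y)).fderiv
  have h2 := ((hdd (Q z)).comp_hasFDerivAt z (hasFDerivAt_of_contDiff hQ z)).smul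
    (hasFDerivAt_fderiv hQ z)
  rw [levi_eq (by exact hχ.comp hQ), levi_eq hQ, h1, HasFDerivAt.fderiv (by exact h2), gsq]
  simp only [add_apply, smul_apply, ContinuousLinearMap.smulRight_apply, Function.comp, smul_eq_mul]
  ring

lemma gsq_comp {χ : ℝ → ℝ} (hχ : ContDiff ℝ ∞ χ) {Q : Cn n → ℝ} (hQ : ContDiff ℝ ∞ Q)
    (z a : Cn n) : gsq (fun z => χ (Q z)) z a = (deriv χ (Q z)) ^ 2 * gsq Q z a := by
  have hd : ∀ x, HasDerivAt χ (deriv χ x) x := fun x => (hχ.differentiable (by simp) x).hasDerivAt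
  rw [gsq, gsq, HasFDerivAt.fderiv
    (by exact (hd (Q z)).comp_hasFDerivAt z (hasFDerivAt_of_contDiff hQ z))]
  simp only [smul_apply, smul_eq_mul]
  ring

lemma levi_const_mul (c : ℝ) {Q : Cn n → ℝ} (hQ : ContDiff ℝ ∞ Q) (z a : Cn n) :
    levi (fun z => c * Q z) z a = c * levi Q z a := by
  have h1 : deriv (fun x : ℝ => c * x) = fun _ => c := by
    funext x; simp
  have := levi_comp (χ := fun x => c * x) (by fun_prop) hQ z a
  rw [this, h1]
  simp

lemma levi_const (c : ℝ) (z a : Cn n) : levi (fun _ : Cn n => c) z a = 0 := by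
  have h1 : fderiv ℝ (fun _ : Cn n => c) = fun _ => 0 := by funext x; simp
  rw [levi_eq contDiff_const, h1]
  simp

/-- The real bilinear form polarizing `nsq`. -/
def nsqB (z w : Cn n) : ℝ := ∑ j, (z j * conj (w j)).re

lemma fderiv_nsq (z v : Cn n) : fderiv ℝ nsq z v = 2 * nsqB z v := by
  have h : HasFDerivAt (fun z : Cn n => ∑ j, ‖z j‖ ^ 2)
      (∑ j, 2 • (innerSL ℝ (z j)).comp (ContinuousLinearMap.proj (R := ℝ) (φ := fun _ : Fin n => ℂ) j)) z := by
    refine HasFDerivAt.fun_sum fun j _ => ?_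
    have h1 := ((ContinuousLinearMap.proj (R := ℝ) (φ := fun _ : Fin n => ℂ) j).hasFDerivAt
      (x := z)).norm_sq
    exact h1
  have : nsq = fun z : Cn n => ∑ j, ‖z j‖ ^ 2 := rfl
  rw [this, h.fderiv, nsqB, Finset.mul_sum]
  rw [FunLike.coe_sum, Finset.sum_apply]
  refine Finset.sum_congr rfl fun j _ => ?_
  simp [Complex.inner]
  ring

lemma gsq_nsq_le (z a : Cn n) : gsq nsq z a ≤ nsq z * nsq a := by
  rw [gsq, fderiv_nsq, fderiv_nsq]
  have h1 : (∑ j, z j * conj (a j)).re = nsqB z a := by simp [nsqB]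
  have h2 : (∑ j, z j * conj (a j)).im = nsqB z (Complex.I • a) := by
    rw [Complex.im_sum, nsqB]
    refine Finset.sum_congr rfl fun j _ => ?_
    simp [Complex.mul_re, Complex.mul_im]
    ring
  have h3 : ((2 * nsqB z a) ^ 2 + (2 * nsqB z (Complex.I • a)) ^ 2) / 4 =
      ‖∑ j, z j * conj (a j)‖ ^ 2 := by
    rw [← h1, ← h2, Complex.sq_norm, Complex.normSq_apply]; ring
  rw [h3]
  have h4 : ‖∑ j, z j * conj (a j)‖ ≤ ∑ j, ‖z j‖ * ‖a j‖ :=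
    (norm_sum_le _ _).trans (le_of_eq (by simp))
  calc ‖∑ j, z j * conj (a j)‖ ^ 2 ≤ (∑ j, ‖z j‖ * ‖a j‖) ^ 2 := by gcongr
    _ ≤ _ := Finset.sum_mul_sq_le_sq_mul_sq _ _ _

lemma levi_nsq (z a : Cn n) : levi nsq z a = nsq a := by
  have h2 : ∀ v, fderiv ℝ (fderiv ℝ nsq) z v v = 2 * nsq v := by
    intro v
    have h3 := (hasFDerivAt_fderiv contDiff_nsq z).clm_apply (hasFDerivAt_const v z)
    have h4 : (fun y => (fderiv ℝ nsq y) v) = fun y => 2 * nsqB y v := by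
      funext y; exact fderiv_nsq y v
    rw [h4] at h3
    have h5 : HasFDerivAt (fun y => 2 * nsqB y v) (fderiv ℝ nsq v) z := by
      have : (fun y => 2 * nsqB y v) = fderiv ℝ nsq v := by
        funext y
        rw [fderiv_nsq]
        simp only [nsqB]
        congr 1
        refine Finset.sum_congr rfl fun j _ => ?_
        simp [Complex.mul_re]; ring
      rw [this]
      exact (fderiv ℝ nsq v).hasFDerivAt
    have h6 := congrArg (fun L => L v) (h3.unique h5)
    simp only [add_apply, ContinuousLinearMap.flip_apply] at h6
    rw [fderiv_nsq] at h6
    have h7 : nsqB v v = nsq v := by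
      simp only [nsqB, nsq]
      refine Finset.sum_congr rfl fun j _ => ?_
      rw [Complex.mul_conj, Complex.ofReal_re, Complex.normSq_eq_norm_sq]
    rw [h7] at h6
    simpa using h6
  rw [levi_eq contDiff_nsq, h2, h2, nsq_smul]
  simp
  ring

lemma norm_pd_dzbA_sq {Q : Cn n → ℝ} (hQ : ContDiff ℝ ∞ Q) (z a : Cn n) :
    ‖pd (dzbA a) (fun z => (Q z : ℂ)) z‖ ^ 2 = gsq Q z a := by
  have h1 : fderiv ℝ (fun z => (Q z : ℂ)) z = Complex.ofRealCLM.comp (fderiv ℝ Q z) :=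
    (Complex.ofRealCLM.hasFDerivAt.comp z (hasFDerivAt_of_contDiff hQ z)).fderiv
  rw [pd, dzbA_apply, h1, gsq, Complex.sq_norm, Complex.normSq_apply]
  simp
  ring

lemma levi_congr {P Q : Cn n → ℝ} {z : Cn n} (h : P =ᶠ[𝓝 z] Q) (a : Cn n) :
    levi P z a = levi Q z a := by
  have h1 : (fun z => (P z : ℂ)) =ᶠ[𝓝 z] fun z => (Q z : ℂ) := h.mono fun y hy => by simp [hy]
  have h2 : pd (dzA a) (fun z => (P z : ℂ)) =ᶠ[𝓝 z] pd (dzA a) fun z => (Q z : ℂ) :=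
    h1.fderiv.mono fun y hy => by rw [pd, pd, hy]
  rw [levi, levi, pd, pd, h2.fderiv_eq]

/-- A smooth function of `nsq` equal to `1` for `nsq z ≤ u` and to `0` for `nsq z ≥ v`. -/
def shellCut (u v : ℝ) (z : Cn n) : ℝ := Real.smoothTransition ((v - nsq z) / (v - u))

lemma contDiff_shellCut (u v : ℝ) : ContDiff ℝ ∞ (shellCut u v : Cn n → ℝ) :=
  Real.smoothTransition.contDiff.comp ((contDiff_const.sub contDiff_nsq).div_const _)

lemma shellCut_eq_one {u v : ℝ} (huv : u < v) {z : Cn n} (hz : nsq z ≤ u) : shellCut u v z = 1 :=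
  Real.smoothTransition.one_of_one_le ((one_le_div (sub_pos.2 huv)).2 (by linarith))

lemma shellCut_eq_zero {u v : ℝ} (huv : u < v) {z : Cn n} (hz : v ≤ nsq z) : shellCut u v z = 0 :=
  Real.smoothTransition.zero_of_nonpos (div_nonpos_of_nonpos_of_nonneg (by linarith) (by linarith))

lemma shellCut_nonneg (u v : ℝ) (z : Cn n) : 0 ≤ shellCut u v z := Real.smoothTransition.nonneg _

lemma shellCut_le_one (u v : ℝ) (z : Cn n) : shellCut u v z ≤ 1 := Real.smoothTransition.le_one _

lemma isCompact_nsq_le (v : ℝ) : IsCompact {z : Cn n | nsq z ≤ v} := by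
  refine Metric.isCompact_of_isClosed_isBounded (isClosed_le contDiff_nsq.continuous continuous_const) ?_
  refine (Metric.isBounded_closedBall (x := (0 : Cn n)) (r := Real.sqrt v)).subset fun z hz => ?_
  rw [mem_closedBall_zero_iff]
  exact Real.le_sqrt_of_sq_le ((norm_sq_le_nsq z).trans hz)

lemma hasCompactSupport_shellCut {u v : ℝ} (huv : u < v) :
    HasCompactSupport (shellCut u v : Cn n → ℝ) :=
  HasCompactSupport.of_support_subset_isCompact (isCompact_nsq_le v) fun z hz => by
    by_contra h
    exact hz (shellCut_eq_zero huv (not_le.1 h).le)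

lemma exists_levi_lower_bound {Q : Cn n → ℝ} (hQ : ContDiff ℝ ∞ Q) (hc : HasCompactSupport Q) :
    ∃ B, ∀ z a, -(B * nsq a) ≤ levi Q z a := by
  obtain ⟨B, hB⟩ := IsCompact.exists_bound_of_continuousOn (show IsCompact (tsupport Q) from hc)
    (hQ.continuous_iteratedFDeriv (m := 2) ENat.LEInfty.out).continuousOn
  refine ⟨max B 0, fun z a => ?_⟩
  by_cases hz : z ∈ tsupport Q
  swap
  · have h0 : levi Q z a = levi (fun _ => (0 : ℝ)) z a :=
      levi_congr (notMem_tsupport_iff_eventuallyEq.1 hz) a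
    rw [h0, levi_const]
    have := nsq_nonneg a
    have : 0 ≤ max B 0 * nsq a := by positivity
    linarith
  have hB1 : ‖iteratedFDeriv ℝ 2 Q z‖ ≤ max B 0 := (hB z hz).trans (le_max_left _ _)
  have hB0 : 0 ≤ max B 0 := le_max_right _ _
  generalize max B 0 = B at hB1 hB0
  have h1 : ∀ v : Cn n, -(B * ‖v‖ ^ 2) ≤ fderiv ℝ (fderiv ℝ Q) z v v := by
    intro v
    have h2 := (iteratedFDeriv ℝ 2 Q z).le_opNorm ![v, v]
    rw [iteratedFDeriv_two_apply] at h2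
    simp only [Fin.prod_univ_two, Matrix.cons_val_zero, Matrix.cons_val_one] at h2
    have h3 : ‖fderiv ℝ (fderiv ℝ Q) z v v‖ ≤ B * ‖v‖ ^ 2 := by
      refine h2.trans ?_
      rw [← sq]
      exact mul_le_mul_of_nonneg_right hB1 (sq_nonneg _)
    exact (abs_le.1 h3).1
  have h2 := h1 a
  have h3 := h1 (Complex.I • a)
  rw [norm_smul, Complex.norm_I, one_mul] at h3
  rw [levi_eq hQ]
  have h4 := mul_le_mul_of_nonneg_left (norm_sq_le_nsq a) hB0
  have h5 := mul_nonneg hB0 (nsq_nonneg a)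
  linarith

lemma levi_nsq_pow {c : ℝ} (hc : 0 < c) (m : ℕ) (z a : Cn n) :
    ((m : ℝ) / c * (nsq z / c) ^ (m - 1)) * nsq a ≤ levi (fun z => (nsq z / c) ^ m) z a := by
  have hd : ∀ m : ℕ, deriv (fun x : ℝ => (x / c) ^ m) = fun x => (m : ℝ) / c * (x / c) ^ (m - 1) := by
    intro m
    funext x
    have := (((hasDerivAt_id x).div_const c).pow m).deriv
    simp only [id] at this
    rw [show (fun x : ℝ => (x / c) ^ m) = (fun x : ℝ => x / c) ^ m from rfl, this]
    ring
  have h1 := levi_comp (χ := fun x : ℝ => (x / c) ^ m) (by fun_prop) contDiff_nsq z a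
  rw [h1, levi_nsq, hd]
  have h2 : deriv (fun x => (m : ℝ) / c * (x / c) ^ (m - 1)) (nsq z) =
      (m : ℝ) / c * (((m - 1 : ℕ) : ℝ) / c * (nsq z / c) ^ (m - 1 - 1)) := by
    rw [deriv_const_mul_field, hd]
  rw [h2]
  have := nsq_nonneg z
  have := gsq_nonneg nsq z a
  have : 0 ≤ (m : ℝ) / c * (((m - 1 : ℕ) : ℝ) / c * (nsq z / c) ^ (m - 1 - 1)) * gsq nsq z a := by
    positivity
  linarith

/-- Extension of a plurisubharmonic weight to the whole space. -/
lemma exists_extension {Q : Cn n → ℝ} (hQ : ContDiff ℝ ∞ Q) {c c' : ℝ} (hc : 0 < c) (hcc : c < c')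
    (hpos : ∀ z, nsq z < c' → ∀ a, 0 ≤ levi Q z a) :
    ∃ P : Cn n → ℝ, ContDiff ℝ ∞ P ∧ (∀ z a, 0 ≤ levi P z a) ∧
      ∀ z, nsq z ≤ c → Q z ≤ P z ∧ P z ≤ Q z + 1 ∧ ∀ a, levi Q z a ≤ levi P z a := by
  set u := (2 * c + c') / 3 with hu
  set v := (c + 2 * c') / 3 with hv
  have huv : u < v := by linarith
  have hcu : c < u := by linarith
  have hvc : v < c' := by linarith
  have hω := contDiff_shellCut (n := n) u v
  have hωQ : ContDiff ℝ ∞ fun z => shellCut u v z * Q z := hω.mul hQ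
  obtain ⟨B, hB⟩ := exists_levi_lower_bound hωQ (hasCompactSupport_shellCut huv).mul_right
  obtain ⟨m, hm⟩ := exists_nat_ge (B * c)
  have hpow : ContDiff ℝ ∞ fun z : Cn n => (nsq z / c) ^ m := (contDiff_nsq.div_const c).pow m
  have hpow0 : ∀ z a : Cn n, 0 ≤ levi (fun z => (nsq z / c) ^ m) z a := fun z a => by
    refine le_trans ?_ (levi_nsq_pow hc m z a)
    have := nsq_nonneg z
    have := nsq_nonneg a
    positivity
  have hin : ∀ z, nsq z < u → ∀ a, levi (fun z => shellCut u v z * Q z) z a = levi Q z a := by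
    intro z hz a
    refine levi_congr ?_ a
    filter_upwards [(isOpen_lt contDiff_nsq.continuous continuous_const).mem_nhds hz] with y hy
    have hy' : nsq y < u := hy
    rw [shellCut_eq_one huv hy'.le, one_mul]
  refine ⟨fun z => shellCut u v z * Q z + (nsq z / c) ^ m, hωQ.add hpow, fun z a => ?_,
    fun z hz => ⟨?_, ?_, fun a => ?_⟩⟩
  · rw [levi_add hωQ hpow]
    by_cases hz : nsq z < u
    · rw [hin z hz]
      exact add_nonneg (hpos z (by linarith) a) (hpow0 z a)
    · push Not at hz
      have h1 := levi_nsq_pow hc m z a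
      have h2 : (1 : ℝ) ≤ (nsq z / c) ^ (m - 1) := one_le_pow₀ ((one_le_div hc).2 (by linarith))
      have h3 : B ≤ (m : ℝ) / c := (le_div_iff₀ hc).2 hm
      have h4 : B * nsq a ≤ ((m : ℝ) / c * (nsq z / c) ^ (m - 1)) * nsq a := by
        refine mul_le_mul_of_nonneg_right (h3.trans ?_) (nsq_nonneg a)
        exact le_mul_of_one_le_right (by positivity) h2
      linarith [hB z a]
  · simp only [shellCut_eq_one huv (hz.trans hcu.le), one_mul]
    have := nsq_nonneg z
    have : 0 ≤ (nsq z / c) ^ m := by positivity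
    linarith
  · simp only [shellCut_eq_one huv (hz.trans hcu.le), one_mul]
    have := pow_le_one₀ (n := m) (div_nonneg (nsq_nonneg z) hc.le) ((div_le_one hc).2 hz)
    linarith
  · rw [levi_add hωQ hpow, hin z (by linarith)]
    linarith [hpow0 z a]

lemma exists_deriv_smoothTransition_bound : ∃ S > 0, (∀ x, |deriv Real.smoothTransition x| ≤ S) ∧
    ∀ x, (x < 0 ∨ 1 < x) → deriv Real.smoothTransition x = 0 := by
  have hz : ∀ x : ℝ, (x < 0 ∨ 1 < x) → deriv Real.smoothTransition x = 0 := by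
    rintro x (hx | hx)
    · have : Real.smoothTransition =ᶠ[𝓝 x] fun _ => (0 : ℝ) := by
        filter_upwards [Iio_mem_nhds hx] with y hy
        exact Real.smoothTransition.zero_of_nonpos (le_of_lt hy)
      rw [this.deriv_eq]; simp
    · have : Real.smoothTransition =ᶠ[𝓝 x] fun _ => (1 : ℝ) := by
        filter_upwards [Ioi_mem_nhds hx] with y hy
        exact Real.smoothTransition.one_of_one_le (le_of_lt hy)
      rw [this.deriv_eq]; simp
  have hc : Continuous (deriv Real.smoothTransition) :=
    (Real.smoothTransition.contDiff (n := 1)).continuous_deriv le_rfl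
  obtain ⟨S, hS⟩ := (isCompact_Icc (a := (0 : ℝ)) (b := 1)).exists_bound_of_continuousOn hc.continuousOn
  refine ⟨max S 1, by positivity, fun x => ?_, hz⟩
  by_cases hx : x < 0 ∨ 1 < x
  · rw [hz x hx, abs_zero]; positivity
  · push Not at hx
    exact (hS x ⟨hx.1, hx.2⟩).trans (le_max_left _ _)

/-- The function `x ↦ -log √(1 + x²)`. -/
def yfun (x : ℝ) : ℝ := -(1 / 2) * Real.log (1 + x ^ 2)

lemma contDiff_yfun : ContDiff ℝ ∞ yfun := by
  refine contDiff_const.mul (ContDiff.log (by fun_prop) fun x => by positivity)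

lemma yfun_nonpos (x : ℝ) : yfun x ≤ 0 := by
  have := Real.log_nonneg (x := 1 + x ^ 2) (by nlinarith [sq_nonneg x])
  unfold yfun; linarith

lemma deriv_yfun : deriv yfun = fun x => -x / (1 + x ^ 2) := by
  funext x
  have h0 : (1 + x ^ 2) ≠ 0 := by positivity
  have h := ((((hasDerivAt_id x).pow 2).const_add 1).log h0).const_mul (-(1/2 : ℝ))
  have h2 := HasDerivAt.deriv h
  simp only [id, Pi.pow_apply] at h2
  change deriv yfun x = _ at h2
  rw [h2]
  field_simp
  ring

lemma deriv_deriv_yfun (x : ℝ) : deriv (deriv yfun) x = (x ^ 2 - 1) / (1 + x ^ 2) ^ 2 := by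
  rw [deriv_yfun]
  have h0 : (1 + x ^ 2) ≠ 0 := by positivity
  have h := (hasDerivAt_id x).neg.div (((hasDerivAt_id x).pow 2).const_add 1) h0
  have h2 := HasDerivAt.deriv h
  simp only [id, Pi.pow_apply, Pi.neg_apply] at h2
  change deriv (fun x => -x / (1 + x ^ 2)) x = _ at h2
  rw [h2]
  field_simp
  ring

lemma levi_yfun_comp_ge {r : Cn n → ℝ} (hr : ContDiff ℝ ∞ r) {z : Cn n} (hz : r z ≤ -2) {a : Cn n}
    (h0 : 0 ≤ levi r z a) :
    1 / 2 * gsq (fun z => yfun (r z)) z a ≤ levi (fun z => yfun (r z)) z a := by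
  rw [levi_comp contDiff_yfun hr, gsq_comp contDiff_yfun hr, deriv_deriv_yfun, deriv_yfun]
  have hg := gsq_nonneg r z a
  set x := r z
  have h1 : 0 ≤ -x / (1 + x ^ 2) := by apply div_nonneg <;> nlinarith
  have h2 : 1 / 2 * (-x / (1 + x ^ 2)) ^ 2 ≤ (x ^ 2 - 1) / (1 + x ^ 2) ^ 2 := by
    rw [div_pow, ← mul_div_assoc]
    gcongr
    nlinarith
  have h3 := mul_le_mul_of_nonneg_right h2 hg
  have h4 := mul_nonneg h1 h0
  simp only
  linarith

lemma abs_le_exp_neg_yfun (x : ℝ) : |x| ≤ Real.exp (-yfun x) := by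
  have h : Real.exp (-yfun x) = Real.sqrt (1 + x ^ 2) := by
    rw [yfun, Real.sqrt_eq_rpow, Real.rpow_def_of_pos (by positivity)]
    congr 1; ring
  rw [h]
  exact Real.abs_le_sqrt (by linarith)

lemma le_abs_of_le_neg_yfun {x L : ℝ} (hL : 0 ≤ L) (h : L ≤ -yfun x) : L ≤ |x| := by
  have h1 : Real.exp (2 * L) ≤ 1 + x ^ 2 := by
    rw [← Real.le_log_iff_exp_le (by positivity)]
    unfold yfun at h; linarith
  have h2 : (L + 1) ^ 2 ≤ Real.exp (2 * L) := by
    rw [two_mul, Real.exp_add, ← sq]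
    have := Real.add_one_le_exp L
    gcongr
  have h3 : L ^ 2 ≤ x ^ 2 := by nlinarith
  rw [← abs_of_nonneg hL]; exact sq_le_sq.1 h3

/-- A holomorphic function agrees, away from the boundary of its domain, with a globally smooth
function. -/
lemma exists_contDiff_eq_of_holo {f : Cn n → ℂ} {R c : ℝ} (hf : DifferentiableOn ℂ f (Metric.ball 0 R))
    (hcR : c < R) :
    ∃ g : Cn n → ℂ, ContDiff ℝ ∞ g ∧ ∀ z ∈ Metric.ball (0 : Cn n) c, g z = f z := by
  set m := (c + R) / 2 with hm
  set ε := (R - c) / 4 with hε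
  have hε0 : 0 < ε := by linarith
  set u : Cn n → ℂ := (Metric.closedBall 0 m).indicator f with hu
  have hcont : ContinuousOn f (Metric.closedBall 0 m) :=
    hf.continuousOn.mono (Metric.closedBall_subset_ball (by linarith))
  have hui : LocallyIntegrable u :=
    ((integrable_indicator_iff measurableSet_closedBall).2
      (hcont.integrableOn_compact (isCompact_closedBall _ _))).locallyIntegrable
  refine ⟨cmoll ε u, contDiff_cmoll hε0 hui, fun z hz => ?_⟩
  rw [mem_ball_zero_iff] at hz
  have hsub : Metric.ball z (2 * ε) ⊆ Metric.ball 0 R := by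
    intro y hy
    rw [Metric.mem_ball, dist_eq_norm] at hy
    rw [mem_ball_zero_iff]
    calc ‖y‖ = ‖z + (y - z)‖ := by congr 1; abel
      _ ≤ ‖z‖ + ‖y - z‖ := norm_add_le _ _
      _ < R := by linarith
  have h1 := integral_moll_holo hε0 (by linarith : ε < 2 * ε) (hf.mono hsub)
  rw [← h1, cmoll, ← integral_neg_eq_self]
  refine integral_congr_ae (Eventually.of_forall fun y => ?_)
  simp only
  rw [moll_neg, sub_neg_eq_add]
  by_cases hy : ε ≤ ‖y‖
  · rw [moll_eq_zero hε0 hy, zero_smul, zero_smul]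
  · push Not at hy
    have : z + y ∈ Metric.closedBall (0 : Cn n) m := by
      rw [mem_closedBall_zero_iff]
      linarith [norm_add_le z y]
    rw [hu, Set.indicator_of_mem this]

lemma pd_dzbA_of_holo {f : Cn n → ℂ} {z : Cn n} (hf : DifferentiableAt ℂ f z) (a : Cn n) :
    pd (dzbA a) f z = 0 := by
  have h : fderiv ℝ f z = (fderiv ℂ f z).restrictScalars ℝ :=
    (hf.hasFDerivAt.restrictScalars ℝ).fderiv
  rw [pd, dzbA_apply, h]
  simp only [ContinuousLinearMap.coe_restrictScalars', map_smul, smul_eq_mul]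
  rw [← mul_assoc, Complex.I_mul_I]
  ring

lemma gsq_mul_le {u v : Cn n → ℝ} (hu : ContDiff ℝ ∞ u) (hv : ContDiff ℝ ∞ v) (z a : Cn n) :
    gsq (fun z => u z * v z) z a ≤ 2 * (u z ^ 2 * gsq v z a + v z ^ 2 * gsq u z a) := by
  have h : fderiv ℝ (fun z => u z * v z) z = u z • fderiv ℝ v z + v z • fderiv ℝ u z :=
    ((hasFDerivAt_of_contDiff hu z).mul (hasFDerivAt_of_contDiff hv z)).fderiv
  have h' : ∀ w, fderiv ℝ (fun z => u z * v z) z w = u z * fderiv ℝ v z w + v z * fderiv ℝ u z w := by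
    intro w; rw [h]; rfl
  rw [gsq, gsq, gsq, h', h']
  nlinarith [sq_nonneg (u z * fderiv ℝ v z a - v z * fderiv ℝ u z a),
    sq_nonneg (u z * fderiv ℝ v z (Complex.I • a) - v z * fderiv ℝ u z (Complex.I • a))]

lemma gsq_smoothTransition (α β : ℝ) {Q : Cn n → ℝ} (hQ : ContDiff ℝ ∞ Q) (z a : Cn n) :
    gsq (fun z => Real.smoothTransition (α * Q z + β)) z a =
      (α * deriv Real.smoothTransition (α * Q z + β)) ^ 2 * gsq Q z a := by
  have hd : deriv (fun x : ℝ => Real.smoothTransition (α * x + β)) (Q z) =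
      α * deriv Real.smoothTransition (α * Q z + β) := by
    have h1 : HasDerivAt Real.smoothTransition _ (α * Q z + β) :=
      ((Real.smoothTransition.contDiff (n := 1)).differentiable (by simp) _).hasDerivAt
    have h2 : HasDerivAt (fun x : ℝ => α * x + β) (α * 1) (Q z) :=
      ((hasDerivAt_id (Q z)).const_mul α).add_const β
    have h3 := HasDerivAt.comp (Q z) h1 h2
    rw [mul_comm]
    rw [mul_one] at h3
    exact h3.deriv
  rw [gsq_comp (χ := fun x => Real.smoothTransition (α * x + β))
    (Real.smoothTransition.contDiff.comp (by fun_prop)) hQ, hd]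

lemma gsq_one_sub (u : Cn n → ℝ) (z a : Cn n) : gsq (fun z => 1 - u z) z a = gsq u z a := by
  have h : fderiv ℝ (fun z => 1 - u z) z = - fderiv ℝ u z := fderiv_const_sub _
  rw [gsq, gsq, h]
  simp

lemma gsq_shellCut_le {S : ℝ} (hS : ∀ x, |deriv Real.smoothTransition x| ≤ S) {u v : ℝ}
    (huv : u < v) {z : Cn n} (hz : nsq z ≤ v) (a : Cn n) :
    gsq (shellCut u v) z a ≤ S ^ 2 * v / (v - u) ^ 2 * nsq a := by
  have h0 : 0 < v - u := sub_pos.2 huv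
  have h1 : (shellCut u v : Cn n → ℝ) =
      fun z => Real.smoothTransition ((-1 / (v - u)) * nsq z + v / (v - u)) := by
    funext z; rw [shellCut]; congr 1; ring
  rw [h1, gsq_smoothTransition _ _ contDiff_nsq]
  have h2 : ((-1 / (v - u)) * deriv Real.smoothTransition ((-1 / (v - u)) * nsq z + v / (v - u))) ^ 2 ≤
      S ^ 2 / (v - u) ^ 2 := by
    rw [mul_pow, div_pow, ← sq_abs (deriv _ _), neg_one_sq, one_div_mul_eq_div]
    gcongr
    exact hS _
  calc _ ≤ S ^ 2 / (v - u) ^ 2 * (v * nsq a) := by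
        refine mul_le_mul h2 ((gsq_nsq_le z a).trans ?_) (gsq_nonneg _ _ _) (by positivity)
        exact mul_le_mul_of_nonneg_right hz (nsq_nonneg a)
    _ = _ := by ring

lemma gsq_shellCut_eq_zero {u v : ℝ} (huv : u < v) {z : Cn n} (hz : nsq z < u) (a : Cn n) :
    gsq (shellCut u v) z a = 0 := by
  have : (shellCut u v : Cn n → ℝ) =ᶠ[𝓝 z] fun _ => 1 := by
    filter_upwards [(isOpen_lt contDiff_nsq.continuous continuous_const).mem_nhds hz] with y hy
    have hy' : nsq y < u := hy
    exact shellCut_eq_one huv hy'.le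
  rw [gsq, this.fderiv_eq]
  simp

/-- The cutoff `1 - η` in the region where `r` is very negative. -/
def poleCut (L : ℝ) (r : Cn n → ℝ) (z : Cn n) : ℝ :=
  1 - Real.smoothTransition ((-1 / L) * yfun (r z) + (-1))

lemma contDiff_poleCut (L : ℝ) {r : Cn n → ℝ} (hr : ContDiff ℝ ∞ r) : ContDiff ℝ ∞ (poleCut L r) :=
  contDiff_const.sub (Real.smoothTransition.contDiff.comp
    ((contDiff_const.mul (contDiff_yfun.comp hr)).add contDiff_const))

lemma poleCut_nonneg (L : ℝ) (r : Cn n → ℝ) (z : Cn n) : 0 ≤ poleCut L r z :=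
  sub_nonneg.2 (Real.smoothTransition.le_one _)

lemma poleCut_le_one (L : ℝ) (r : Cn n → ℝ) (z : Cn n) : poleCut L r z ≤ 1 :=
  sub_le_self _ (Real.smoothTransition.nonneg _)

lemma poleCut_eq_one {L : ℝ} (hL : 0 < L) {r : Cn n → ℝ} {z : Cn n} (h : -yfun (r z) ≤ L) :
    poleCut L r z = 1 := by
  rw [poleCut, Real.smoothTransition.zero_of_nonpos, sub_zero]
  have : -yfun (r z) / L ≤ 1 := (div_le_one hL).2 h
  have h2 : (-1 / L) * yfun (r z) = -yfun (r z) / L := by ring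
  linarith

lemma poleCut_eq_zero {L : ℝ} (hL : 0 < L) {r : Cn n → ℝ} {z : Cn n} (h : 2 * L ≤ -yfun (r z)) :
    poleCut L r z = 0 := by
  rw [poleCut, Real.smoothTransition.one_of_one_le, sub_self]
  have : 2 ≤ -yfun (r z) / L := (le_div_iff₀ hL).2 h
  have h2 : (-1 / L) * yfun (r z) = -yfun (r z) / L := by ring
  linarith

lemma gsq_poleCut_le {S : ℝ} (hS : ∀ x, |deriv Real.smoothTransition x| ≤ S) {L : ℝ} (hL : 0 < L)
    {r : Cn n → ℝ} (hr : ContDiff ℝ ∞ r) (z a : Cn n) :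
    gsq (poleCut L r) z a ≤ S ^ 2 / L ^ 2 * gsq (fun z => yfun (r z)) z a := by
  unfold poleCut
  rw [gsq_one_sub, gsq_smoothTransition (Q := fun z => yfun (r z)) _ _ (contDiff_yfun.comp hr)]
  refine mul_le_mul_of_nonneg_right ?_ (gsq_nonneg _ _ _)
  rw [mul_pow, div_pow, ← sq_abs (deriv _ _), neg_one_sq, one_div_mul_eq_div]
  gcongr
  exact hS _

lemma gsq_poleCut_eq_zero (hS : ∀ x, (x < 0 ∨ 1 < x) → deriv Real.smoothTransition x = 0) {L : ℝ}
    (hL : 0 < L) {r : Cn n → ℝ} (hr : ContDiff ℝ ∞ r) {z : Cn n}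
    (hz : -yfun (r z) < L ∨ 2 * L < -yfun (r z)) (a : Cn n) : gsq (poleCut L r) z a = 0 := by
  unfold poleCut
  rw [gsq_one_sub, gsq_smoothTransition (Q := fun z => yfun (r z)) _ _ (contDiff_yfun.comp hr),
    hS]
  · ring
  · have h2 : (-1 / L) * yfun (r z) = -yfun (r z) / L := by ring
    rw [h2]
    rcases hz with h | h
    · left; have := (div_lt_one hL).2 h; linarith
    · right; have := (lt_div_iff₀ hL).2 h; linarith

set_option maxHeartbeats 1000000 in
/-- The holomorphic approximation of `f` given by the `∂̄`-equation with weight built from `P` and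
`r`, with quantitative control of the error. -/
lemma exists_holo_approx {c' c₂ c₃ : ℝ} (hc' : 0 < c') (hc₂ : c' < c₂) (hc₃ : c₂ < c₃) :
    ∃ C₁ : ℝ≥0∞, C₁ ≠ ⊤ ∧ ∀ (c : ℝ) (f : Cn n → ℂ) (P r : Cn n → ℝ) (K L : ℝ), 0 < c → c < c' →
      ContDiff ℝ ∞ f → (∀ z, nsq z < c₃ → DifferentiableAt ℂ f z) →
      ContDiff ℝ ∞ P → ContDiff ℝ ∞ r → (∀ z, nsq z < c₃ → ∀ a, 0 ≤ levi P z a) →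
      (∀ z, nsq z < c₃ → ∀ a, 0 ≤ levi r z a) → (∀ z, nsq z < c₃ → r z ≤ -2) → 1 ≤ K → 1 ≤ L →
      ∃ F : Cn n → ℂ, Differentiable ℂ F ∧
        ∫⁻ z in {z | nsq z ≤ c}, ENNReal.ofReal (‖(poleCut L r z : ℂ) * f z - F z‖ ^ 2 *
            Real.exp (-2 * P z - 2 * Real.exp (-2 * L) * r z)) ≤
          C₁ * (ENNReal.ofReal (Real.exp (-2 * K * (c' - c))) *
              (∫⁻ z in {z | nsq z ≤ c₂}, ENNReal.ofReal (‖f z‖ ^ 2 * Real.exp (-2 * P z))) +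
            ENNReal.ofReal (Real.exp (2 * K * c)) * (∫⁻ z in {z | nsq z ≤ c₂ ∧ L ≤ -yfun (r z)},
              ENNReal.ofReal (‖f z‖ ^ 2 * Real.exp (-2 * P z)))) := by
  obtain ⟨S, hS0, hS, hS'⟩ := exists_deriv_smoothTransition_bound
  set Ca : ℝ := S ^ 2 * c₂ / (c₂ - c') ^ 2 with hCa
  have hCa0 : 0 ≤ Ca := by
    have : 0 < c₂ := hc'.trans hc₂
    positivity
  set C₀ : ℝ := 2 * (Ca + 4 * S ^ 2) with hC₀
  have hC₀0 : 0 ≤ C₀ := by positivity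
  refine ⟨ENNReal.ofReal (C₀ * Real.exp 4), ENNReal.ofReal_ne_top, ?_⟩
  intro c f P r K L hc hcc' hfs hfh hP hr hPl hrl hr2 hK hL
  have hL0 : 0 < L := by linarith
  set s := Real.exp (-2 * L) with hs
  have hs0 : 0 < s := Real.exp_pos _
  set α := 1 / (2 * L) with hα
  have hα0 : 0 < α := by positivity
  set Y : Cn n → ℝ := fun z => yfun (r z) with hY
  have hYs : ContDiff ℝ ∞ Y := contDiff_yfun.comp hr
  set Q : Cn n → ℝ := fun z => (((2 * P z + 2 * s * r z) + α * Y z) + 2 * K * nsq z) + (-(2 * K * c))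
    with hQ
  have hs1 : ContDiff ℝ ∞ fun z => 2 * P z := contDiff_const.mul hP
  have hs2 : ContDiff ℝ ∞ fun z => 2 * s * r z := contDiff_const.mul hr
  have hs3 : ContDiff ℝ ∞ fun z => α * Y z := contDiff_const.mul hYs
  have hs4 : ContDiff ℝ ∞ fun z : Cn n => 2 * K * nsq z := contDiff_const.mul contDiff_nsq
  have hQs : ContDiff ℝ ∞ Q := (((hs1.add hs2).add hs3).add hs4).add contDiff_const
  have hlevi : ∀ z a, levi Q z a = 2 * levi P z a + 2 * s * levi r z a + α * levi Y z a +
      2 * K * nsq a := by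
    intro z a
    rw [hQ, levi_add (((hs1.add hs2).add hs3).add hs4) contDiff_const,
      levi_add ((hs1.add hs2).add hs3) hs4, levi_add (hs1.add hs2) hs3, levi_add hs1 hs2,
      levi_const_mul _ hP, levi_const_mul _ hr, levi_const_mul _ hYs, levi_const_mul _ contDiff_nsq,
      levi_nsq, levi_const]
    ring
  have hge : ∀ z, nsq z < c₃ → ∀ a, α / 2 * gsq Y z a + 2 * K * nsq a ≤ levi Q z a := by
    intro z hz a
    rw [hlevi]
    have h1 := levi_yfun_comp_ge hr (hr2 z hz) (hrl z hz a)
    have h2 := hPl z hz a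
    have h3 := mul_nonneg hs0.le (hrl z hz a)
    have h4 := mul_le_mul_of_nonneg_left h1 hα0.le
    linarith
  obtain ⟨Qt, hQts, hQtl, hQt⟩ := exists_extension hQs (hc'.trans hc₂) hc₃ fun z hz a => by
    refine le_trans ?_ (hge z hz a)
    have := gsq_nonneg Y z a
    have := nsq_nonneg a
    positivity
  set k : Cn n → ℝ := fun z => shellCut c' c₂ z * poleCut L r z with hk
  have hks : ContDiff ℝ ∞ k := (contDiff_shellCut c' c₂).mul (contDiff_poleCut L hr)
  have hkc : HasCompactSupport k := (hasCompactSupport_shellCut hc₂).mul_right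
  set h : Cn n → ℂ := fun z => (k z : ℂ) * f z with hh
  have hht : IsTest h := by
    refine ⟨(contDiff_ofReal hks).mul hfs, HasCompactSupport.mul_right ?_⟩
    exact hkc.comp_left Complex.ofReal_zero
  set A : Set (Cn n) := {z | (c' ≤ nsq z ∧ nsq z ≤ c₂) ∧ -Y z ≤ 2 * L} with hA
  set B : Set (Cn n) := {z | (nsq z ≤ c₂ ∧ L ≤ -Y z) ∧ -Y z ≤ 2 * L} with hB
  have hYc : Continuous fun z => -Y z := hYs.continuous.neg
  have hnc : Continuous (nsq : Cn n → ℝ) := contDiff_nsq.continuous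
  have hAcl : IsClosed A := ((isClosed_le continuous_const hnc).inter
    (isClosed_le hnc continuous_const)).inter (isClosed_le hYc continuous_const)
  have hBcl : IsClosed B := ((isClosed_le hnc continuous_const).inter
    (isClosed_le continuous_const hYc)).inter (isClosed_le hYc continuous_const)
  have hAc : IsCompact A := (isCompact_nsq_le c₂).of_isClosed_subset hAcl fun z hz => hz.1.2
  have hBc : IsCompact B := (isCompact_nsq_le c₂).of_isClosed_subset hBcl fun z hz => hz.1.1
  set g : Cn n → ℝ := fun z => ‖f z‖ ^ 2 with hg
  have hg0 : ∀ z, 0 ≤ g z := fun z => sq_nonneg _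
  have hgc : Continuous g := hfs.continuous.norm.pow 2
  set κ : Cn n → ℝ := fun z => C₀ * (A.indicator g z + B.indicator g z) with hκ
  have hiA : ∀ z, 0 ≤ A.indicator g z := fun z => Set.indicator_nonneg (fun z _ => hg0 z) z
  have hiB : ∀ z, 0 ≤ B.indicator g z := fun z => Set.indicator_nonneg (fun z _ => hg0 z) z
  have hκ0 : ∀ z, 0 ≤ κ z := fun z => mul_nonneg hC₀0 (add_nonneg (hiA z) (hiB z))
  have hκl : ∀ z a, ‖pd (dzbA a) h z‖ ^ 2 ≤ κ z * levi Qt z a := by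
    intro z a
    by_cases hz : c₂ < nsq z
    · have h0 : h =ᶠ[𝓝 z] fun _ => 0 := by
        filter_upwards [(isOpen_lt continuous_const hnc).mem_nhds hz] with y hy
        have hy' : c₂ < nsq y := hy
        rw [hh]
        simp [hk, shellCut_eq_zero hc₂ hy'.le]
      rw [pd, h0.fderiv_eq]
      simp only [fderiv_fun_const, Pi.zero_apply, map_zero, norm_zero]
      have := mul_nonneg (hκ0 z) (hQtl z a)
      linarith
    · push Not at hz
      have hz3 : nsq z < c₃ := by linarith
      have hpd : ‖pd (dzbA a) h z‖ ^ 2 = g z * gsq k z a := by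
        rw [hh, pd_mul _ ((contDiff_ofReal hks).differentiable (by simp) z)
          (hfs.differentiable (by simp) z), pd_dzbA_of_holo (hfh z hz3), mul_zero, zero_add,
          norm_mul, mul_pow, norm_pd_dzbA_sq hks]
      have hle := (hge z hz3 a).trans ((hQt z hz).2.2 a)
      set l := levi Qt z a
      have hl0 : 0 ≤ l := hQtl z a
      have hna := nsq_nonneg a
      have hgY := gsq_nonneg Y z a
      have h1 : nsq a ≤ l := by nlinarith [mul_nonneg hα0.le hgY]
      have h2 : gsq Y z a ≤ 4 * L * l := by
        have : α / 2 * gsq Y z a ≤ l := by nlinarith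
        rw [hα] at this
        have h3 : gsq Y z a = 4 * L * (1 / (2 * L) / 2 * gsq Y z a) := by field_simp; ring
        rw [h3]
        gcongr
      have hgk := gsq_mul_le (contDiff_shellCut c' c₂) (contDiff_poleCut L hr) z a
      have hT1 : g z * (shellCut c' c₂ z ^ 2 * gsq (poleCut L r) z a) ≤
          B.indicator g z * (4 * S ^ 2 * l) := by
        by_cases hzB : z ∈ B
        · rw [Set.indicator_of_mem hzB]
          refine mul_le_mul_of_nonneg_left ?_ (hg0 z)
          have h3 : shellCut c' c₂ z ^ 2 ≤ 1 :=
            pow_le_one₀ (shellCut_nonneg _ _ _) (shellCut_le_one _ _ _)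
          calc _ ≤ 1 * gsq (poleCut L r) z a :=
                mul_le_mul_of_nonneg_right h3 (gsq_nonneg _ _ _)
            _ ≤ S ^ 2 / L ^ 2 * gsq Y z a := by rw [one_mul]; exact gsq_poleCut_le hS hL0 hr z a
            _ ≤ S ^ 2 / L ^ 2 * (4 * L * l) := by gcongr
            _ = 4 * S ^ 2 * l * (1 / L) := by field_simp
            _ ≤ 4 * S ^ 2 * l * 1 := by
                gcongr
                exact (div_le_one hL0).2 hL
            _ = _ := mul_one _
        · rw [Set.indicator_of_notMem hzB, zero_mul, gsq_poleCut_eq_zero hS' hL0 hr]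
          · simp
          · by_contra hcon
            push Not at hcon
            exact hzB ⟨⟨hz, hcon.1⟩, hcon.2⟩
      have hT2 : g z * (poleCut L r z ^ 2 * gsq (shellCut c' c₂) z a) ≤
          A.indicator g z * (Ca * l) := by
        by_cases hzA : z ∈ A
        · rw [Set.indicator_of_mem hzA]
          refine mul_le_mul_of_nonneg_left ?_ (hg0 z)
          have h3 : poleCut L r z ^ 2 ≤ 1 :=
            pow_le_one₀ (poleCut_nonneg _ _ _) (poleCut_le_one _ _ _)
          calc _ ≤ 1 * gsq (shellCut c' c₂) z a :=
                mul_le_mul_of_nonneg_right h3 (gsq_nonneg _ _ _)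
            _ ≤ Ca * nsq a := by rw [one_mul]; exact gsq_shellCut_le hS hc₂ hz a
            _ ≤ Ca * l := by gcongr
        · rw [Set.indicator_of_notMem hzA, zero_mul]
          by_cases hz1 : nsq z < c'
          · rw [gsq_shellCut_eq_zero hc₂ hz1]; simp
          · push Not at hz1
            have : 2 * L ≤ -yfun (r z) := by
              by_contra hcon
              push Not at hcon
              exact hzA ⟨⟨hz1, hz⟩, hcon.le⟩
            rw [poleCut_eq_zero hL0 this]; simp
      rw [hpd, hκ, hC₀]
      simp only
      have hAl : 0 ≤ A.indicator g z * (4 * S ^ 2 * l) := mul_nonneg (hiA z) (by positivity)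
      have hBl : 0 ≤ B.indicator g z * (Ca * l) := mul_nonneg (hiB z) (by positivity)
      have := mul_le_mul_of_nonneg_left hgk (hg0 z)
      change g z * gsq k z a ≤ _ at this
      nlinarith
  have hgi : ∀ s : Set (Cn n), IsCompact s → Integrable (s.indicator fun z => g z * Real.exp (-Qt z)) :=
    fun s hs => (integrable_indicator_iff hs.measurableSet).2
      ((hgc.mul (Real.continuous_exp.comp hQts.continuous.neg)).continuousOn.integrableOn_compact hs)
  have hκe : (fun z => κ z * Real.exp (-Qt z)) = fun z => C₀ *
      (A.indicator (fun z => g z * Real.exp (-Qt z)) z +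
        B.indicator (fun z => g z * Real.exp (-Qt z)) z) := by
    funext z
    rw [hκ]
    simp only [Set.indicator]
    split_ifs <;> ring
  have hκi : Integrable fun z => κ z * Real.exp (-Qt z) := by
    rw [hκe]
    exact ((hgi A hAc).add (hgi B hBc)).const_mul C₀
  obtain ⟨F, hF, hFle⟩ := hormander hQts hQtl hht hκ0 hκl hκi
  refine ⟨F, hF, ?_⟩
  set G : Cn n → ℝ≥0∞ := fun z => ENNReal.ofReal (‖f z‖ ^ 2 * Real.exp (-2 * P z)) with hG
  have hGm : Measurable G :=
    (hgc.mul (Real.continuous_exp.comp (continuous_const.mul hP.continuous))).measurable.ennreal_ofReal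
  have hm1 : MeasurableSet {z : Cn n | nsq z ≤ c} := (isClosed_le hnc continuous_const).measurableSet
  have hm2 : MeasurableSet {z : Cn n | nsq z ≤ c₂} := (isClosed_le hnc continuous_const).measurableSet
  have hm3 : MeasurableSet {z : Cn n | nsq z ≤ c₂ ∧ L ≤ -yfun (r z)} :=
    ((isClosed_le hnc continuous_const).inter (isClosed_le continuous_const hYc)).measurableSet
  set E₁ := Real.exp (-2 * K * (c' - c)) with hE₁
  set E₂ := Real.exp (2 * K * c) with hE₂
  have hY0 : ∀ z, Y z ≤ 0 := fun z => yfun_nonpos _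
  have hleft : ∫⁻ z in {z | nsq z ≤ c}, ENNReal.ofReal (‖(poleCut L r z : ℂ) * f z - F z‖ ^ 2 *
      Real.exp (-2 * P z - 2 * s * r z)) ≤
      ENNReal.ofReal (Real.exp 1) * ∫⁻ z, ENNReal.ofReal (‖h z - F z‖ ^ 2 * Real.exp (-Qt z)) := by
    rw [← lintegral_const_mul' _ _ ENNReal.ofReal_ne_top]
    refine (setLIntegral_mono' hm1 fun z hz => ?_).trans (setLIntegral_le_lintegral _ _)
    have hz' : nsq z ≤ c := hz
    have h1 : h z = (poleCut L r z : ℂ) * f z := by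
      rw [hh]
      simp [hk, shellCut_eq_one hc₂ (hz'.trans hcc'.le)]
    rw [h1, ← ENNReal.ofReal_mul (Real.exp_pos _).le]
    refine ENNReal.ofReal_le_ofReal ?_
    rw [mul_left_comm, ← Real.exp_add]
    gcongr
    have h2 := (hQt z (by linarith)).2.1
    have h3 : Q z = (((2 * P z + 2 * s * r z) + α * Y z) + 2 * K * nsq z) + (-(2 * K * c)) := rfl
    have h4 := mul_nonneg hα0.le (neg_nonneg.2 (hY0 z))
    linarith [mul_nonneg (by linarith : (0 : ℝ) ≤ K) (sub_nonneg.2 hz')]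
  have hcore : ∀ z, nsq z ≤ c₂ → -Y z ≤ 2 * L →
      Real.exp (-Qt z) ≤ Real.exp 3 * (Real.exp (-2 * K * (nsq z - c)) * Real.exp (-2 * P z)) := by
    intro z hz hYz
    rw [← Real.exp_add, ← Real.exp_add]
    refine Real.exp_le_exp.2 ?_
    have h2 := (hQt z hz).1
    have h3 : Q z = (((2 * P z + 2 * s * r z) + α * Y z) + 2 * K * nsq z) + (-(2 * K * c)) := rfl
    have h4 : α * (-Y z) ≤ 1 := by
      calc α * (-Y z) ≤ α * (2 * L) := by gcongr
        _ = 1 := by rw [hα]; field_simp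
    have h5 : s * (-r z) ≤ 1 := by
      calc s * (-r z) ≤ s * Real.exp (2 * L) := by
            gcongr
            exact ((neg_le_abs _).trans (abs_le_exp_neg_yfun _)).trans (Real.exp_le_exp.2 hYz)
        _ = 1 := by rw [hs, ← Real.exp_add]; simp
    linarith
  have hright : ENNReal.ofReal (∫ z, κ z * Real.exp (-Qt z)) ≤ ENNReal.ofReal (C₀ * Real.exp 3) *
      (ENNReal.ofReal E₁ * (∫⁻ z in {z | nsq z ≤ c₂}, G z) +
        ENNReal.ofReal E₂ * ∫⁻ z in {z | nsq z ≤ c₂ ∧ L ≤ -yfun (r z)}, G z) := by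
    rw [ofReal_integral_eq_lintegral_ofReal hκi
      (Eventually.of_forall fun z => mul_nonneg (hκ0 z) (Real.exp_pos _).le),
      ← lintegral_indicator hm2, ← lintegral_indicator hm3,
      ← lintegral_const_mul' _ _ ENNReal.ofReal_ne_top, ← lintegral_const_mul' _ _ ENNReal.ofReal_ne_top,
      ← lintegral_add_left ((hGm.indicator hm2).const_mul _),
      ← lintegral_const_mul' _ _ ENNReal.ofReal_ne_top]
    refine lintegral_mono fun z => ?_
    have hsplit : κ z * Real.exp (-Qt z) ≤ C₀ * Real.exp 3 *
        (E₁ * (A.indicator g z * Real.exp (-2 * P z)) + E₂ * (B.indicator g z * Real.exp (-2 * P z))) := by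
      have hAz : A.indicator g z * Real.exp (-Qt z) ≤
          Real.exp 3 * (E₁ * (A.indicator g z * Real.exp (-2 * P z))) := by
        by_cases hzA : z ∈ A
        · rw [Set.indicator_of_mem hzA]
          have h1 := hcore z hzA.1.2 hzA.2
          have h2 : Real.exp (-2 * K * (nsq z - c)) ≤ E₁ := by
            refine Real.exp_le_exp.2 ?_
            linarith [mul_nonneg (by linarith : (0 : ℝ) ≤ K) (sub_nonneg.2 hzA.1.1)]
          calc g z * Real.exp (-Qt z) ≤ g z * (Real.exp 3 * (E₁ * Real.exp (-2 * P z))) := by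
                refine mul_le_mul_of_nonneg_left (h1.trans ?_) (hg0 z)
                gcongr
            _ = _ := by ring
        · rw [Set.indicator_of_notMem hzA]; simp
      have hBz : B.indicator g z * Real.exp (-Qt z) ≤
          Real.exp 3 * (E₂ * (B.indicator g z * Real.exp (-2 * P z))) := by
        by_cases hzB : z ∈ B
        · rw [Set.indicator_of_mem hzB]
          have h1 := hcore z hzB.1.1 hzB.2
          have h2 : Real.exp (-2 * K * (nsq z - c)) ≤ E₂ := by
            refine Real.exp_le_exp.2 ?_
            linarith [mul_nonneg (by linarith : (0 : ℝ) ≤ K) (nsq_nonneg z)]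
          calc g z * Real.exp (-Qt z) ≤ g z * (Real.exp 3 * (E₂ * Real.exp (-2 * P z))) := by
                refine mul_le_mul_of_nonneg_left (h1.trans ?_) (hg0 z)
                gcongr
            _ = _ := by ring
        · rw [Set.indicator_of_notMem hzB]; simp
      have := mul_le_mul_of_nonneg_left (add_le_add hAz hBz) hC₀0
      calc κ z * Real.exp (-Qt z) = C₀ * (A.indicator g z * Real.exp (-Qt z) +
            B.indicator g z * Real.exp (-Qt z)) := by rw [hκ]; ring
        _ ≤ _ := this
        _ = _ := by ring
    refine (ENNReal.ofReal_le_ofReal hsplit).trans ?_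
    have hmulA : 0 ≤ A.indicator g z * Real.exp (-2 * P z) := mul_nonneg (hiA z) (Real.exp_pos _).le
    have hmulB : 0 ≤ B.indicator g z * Real.exp (-2 * P z) := mul_nonneg (hiB z) (Real.exp_pos _).le
    have hE₁0 : 0 ≤ E₁ := (Real.exp_pos _).le
    have hE₂0 : 0 ≤ E₂ := (Real.exp_pos _).le
    rw [ENNReal.ofReal_mul (by positivity), ENNReal.ofReal_add (by positivity) (by positivity),
      ENNReal.ofReal_mul hE₁0, ENNReal.ofReal_mul hE₂0]
    gcongr
    · by_cases hzA : z ∈ A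
      · have : z ∈ {z : Cn n | nsq z ≤ c₂} := hzA.1.2
        rw [Set.indicator_of_mem hzA, Set.indicator_of_mem this]
      · rw [Set.indicator_of_notMem hzA]; simp
    · by_cases hzB : z ∈ B
      · have : z ∈ {z : Cn n | nsq z ≤ c₂ ∧ L ≤ -yfun (r z)} := hzB.1
        rw [Set.indicator_of_mem hzB, Set.indicator_of_mem this]
      · rw [Set.indicator_of_notMem hzB]; simp
  calc _ ≤ ENNReal.ofReal (Real.exp 1) * _ := hleft
    _ ≤ ENNReal.ofReal (Real.exp 1) * (ENNReal.ofReal (C₀ * Real.exp 3) *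
      (ENNReal.ofReal E₁ * (∫⁻ z in {z | nsq z ≤ c₂}, G z) +
        ENNReal.ofReal E₂ * ∫⁻ z in {z | nsq z ≤ c₂ ∧ L ≤ -yfun (r z)}, G z)) := by
        gcongr
        exact hFle.trans hright
    _ = _ := by
        rw [← mul_assoc, ← ENNReal.ofReal_mul (Real.exp_pos _).le]
        congr 2
        rw [mul_left_comm, ← Real.exp_add]
        norm_num

lemma expE_coe (x : ℝ) : expE (x : EReal) = ENNReal.ofReal (Real.exp x) := by
  rw [expE, if_neg (EReal.coe_ne_bot x), if_neg (EReal.coe_ne_top x), EReal.toReal_coe]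

lemma expE_top : expE ⊤ = ⊤ := by simp [expE]

lemma wexp_of_eq_coe (c : ℝ) {u : Cn n → EReal} {z : Cn n} {x : ℝ} (h : u z = x) :
    wexp c u z = ENNReal.ofReal (Real.exp (c * x)) := by
  rw [wexp, h, ← EReal.coe_mul, expE_coe]

lemma wexp_of_eq_bot {c : ℝ} (hc : c < 0) {u : Cn n → EReal} {z : Cn n} (h : u z = ⊥) :
    wexp c u z = ⊤ := by
  rw [wexp, h, EReal.coe_mul_bot_of_neg hc, expE_top]

lemma wexp_zero (u : Cn n → EReal) (z : Cn n) : wexp 0 u z = 1 := by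
  rw [wexp, EReal.coe_zero, zero_mul, ← EReal.coe_zero, expE_coe]
  simp

lemma ofReal_exp_le_wexp {s : ℝ} (hs : 0 < s) {u : Cn n → EReal} {z : Cn n} {x : ℝ}
    (h : u z ≤ x) : ENNReal.ofReal (Real.exp (-2 * s * x)) ≤ wexp (-2 * s) u z := by
  induction hu : u z with
  | bot => rw [wexp_of_eq_bot (by linarith) hu]; exact le_top
  | top => rw [hu] at h; exact absurd (top_le_iff.1 h) (EReal.coe_ne_top x)
  | coe y =>
    rw [wexp_of_eq_coe _ hu]
    rw [hu, EReal.coe_le_coe_iff] at h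
    refine ENNReal.ofReal_le_ofReal (Real.exp_le_exp.2 ?_)
    nlinarith

lemma IsRegularization.wexp_le_liminf {u : Cn n → EReal} {R C : ℝ} {p : ℕ → Cn n → ℝ}
    (h : IsRegularization u R C p) {s : ℝ} (hs : 0 < s) {z : Cn n} (hz : z ∈ Metric.ball (0 : Cn n) R) :
    wexp (-2 * s) u z ≤ liminf (fun k => ENNReal.ofReal (Real.exp (-2 * s * p k z))) atTop := by
  refine le_of_forall_lt fun A hA => ?_
  obtain ⟨A', hA', hA''⟩ := exists_between hA
  have hA't : A' ≠ ⊤ := (hA''.trans_le le_top).ne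
  refine lt_of_lt_of_le hA' (le_liminf_of_le (by isBoundedDefault) ?_)
  obtain ⟨y, hy, hyA⟩ : ∃ y : ℝ, u z < y ∧ A' ≤ ENNReal.ofReal (Real.exp (-2 * s * y)) := by
    induction hu : u z with
    | bot =>
      have ht : Tendsto (fun y : ℝ => Real.exp (-2 * s * y)) atBot atTop :=
        Real.tendsto_exp_atTop.comp (tendsto_id.const_mul_atBot_of_neg (by linarith))
      obtain ⟨y, hy⟩ := (ht.eventually_ge_atTop A'.toReal).exists
      exact ⟨y, EReal.bot_lt_coe y, (ENNReal.ofReal_toReal hA't).symm.le.trans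
        (ENNReal.ofReal_le_ofReal hy)⟩
    | top =>
      have := h.le 0 z hz
      rw [hu] at this
      exact absurd (top_le_iff.1 this) (EReal.coe_ne_top _)
    | coe x =>
      rw [wexp_of_eq_coe _ hu] at hA''
      have hc : ContinuousAt (fun y : ℝ => ENNReal.ofReal (Real.exp (-2 * s * y))) x :=
        (ENNReal.continuous_ofReal.comp (by fun_prop)).continuousAt
      have h1 : ∀ᶠ y in 𝓝[>] x, A' < ENNReal.ofReal (Real.exp (-2 * s * y)) :=
        (hc.eventually (lt_mem_nhds hA'')).filter_mono nhdsWithin_le_nhds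
      obtain ⟨y, hy1, hy2⟩ := (h1.and self_mem_nhdsWithin).exists
      exact ⟨y, EReal.coe_lt_coe_iff.2 hy2, hy1.le⟩
  filter_upwards [h.eventually_le z hz y hy] with k hk
  refine hyA.trans (ENNReal.ofReal_le_ofReal (Real.exp_le_exp.2 ?_))
  nlinarith

lemma IsRegularization.isOpen_lt {u : Cn n → EReal} {R C : ℝ} {p : ℕ → Cn n → ℝ}
    (h : IsRegularization u R C p) (A : ℝ) : IsOpen {z ∈ Metric.ball (0 : Cn n) R | u z < A} := by
  have : {z ∈ Metric.ball (0 : Cn n) R | u z < A} =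
      Metric.ball (0 : Cn n) R ∩ ⋃ k, {z | p k z < A} := by
    ext z
    simp only [Set.mem_ofPred_eq, Set.mem_inter_iff, Set.mem_iUnion]
    refine and_congr_right fun hz => ⟨fun hA => ?_, fun ⟨k, hk⟩ => ?_⟩
    · obtain ⟨y, hy, hyA⟩ := EReal.lt_iff_exists_real_btwn.1 hA
      obtain ⟨k, hk⟩ := (h.eventually_le z hz y hy).exists
      exact ⟨k, hk.trans_lt (EReal.coe_lt_coe_iff.1 hyA)⟩
    · exact (h.le k z hz).trans_lt (EReal.coe_lt_coe_iff.2 hk)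
  rw [this]
  exact Metric.isOpen_ball.inter (isOpen_iUnion fun k =>
    _root_.isOpen_lt (h.smooth k).continuous continuous_const)

lemma IsRegularization.tendsto_setLIntegral {u : Cn n → EReal} {R C : ℝ} {p : ℕ → Cn n → ℝ}
    (h : IsRegularization u R C p) (hb : ∀ᵐ z : Cn n, z ∈ Metric.ball (0 : Cn n) R → u z ≠ ⊥)
    {g : Cn n → ℝ≥0∞} (hg : ∫⁻ z in Metric.ball 0 R, g z ≠ ⊤) (D : ℝ) :
    Tendsto (fun L : ℕ => ∫⁻ z in {z ∈ Metric.ball (0 : Cn n) R | u z < ((D - L : ℝ) : EReal)}, g z)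
      atTop (𝓝 0) := by
  set s : ℕ → Set (Cn n) := fun L => {z ∈ Metric.ball (0 : Cn n) R | u z < ((D - L : ℝ) : EReal)}
    with hs
  have hsub : ∀ L, s L ⊆ Metric.ball 0 R := fun L z hz => hz.1
  have hms : ∀ L, MeasurableSet (s L) := fun L => (h.isOpen_lt _).measurableSet
  have hanti : Antitone s := fun L L' hL z hz =>
    ⟨hz.1, hz.2.trans_le (EReal.coe_le_coe_iff.2 (by have : (L : ℝ) ≤ L' := Nat.cast_le.2 hL; linarith))⟩
  have hInt : (volume.restrict (Metric.ball (0 : Cn n) R)) (⋂ L, s L) = 0 := by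
    rw [Measure.restrict_apply (MeasurableSet.iInter hms)]
    refine measure_mono_null ?_ hb
    intro z hz
    simp only [Set.mem_compl_iff, Set.mem_ofPred_eq, not_forall, not_not]
    refine ⟨hz.2, EReal.eq_bot_iff_forall_lt _ |>.2 fun y => ?_⟩
    obtain ⟨L, hL⟩ := exists_nat_ge (D - y)
    have := (Set.mem_iInter.1 hz.1 L).2
    exact this.trans_le (EReal.coe_le_coe_iff.2 (by linarith))
  have h1 := tendsto_measure_iInter_atTop (μ := volume.restrict (Metric.ball (0 : Cn n) R))
    (fun L => (hms L).nullMeasurableSet) hanti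
    ⟨0, ne_of_lt ((Measure.restrict_apply_le _ _).trans_lt ((measure_mono (hsub 0)).trans_lt
      Metric.isBounded_ball.measure_lt_top))⟩
  rw [hInt] at h1
  have h2 := tendsto_setLIntegral_zero hg h1
  refine h2.congr fun L => ?_
  rw [Measure.restrict_restrict (hms L), Set.inter_eq_left.2 (hsub L)]

lemma ofReal_norm_sq_mul (w : ℂ) (x : ℝ) :
    ENNReal.ofReal (‖w‖ ^ 2 * x) = ‖w‖ₑ ^ 2 * ENNReal.ofReal x := by
  rw [ENNReal.ofReal_mul (sq_nonneg _), ENNReal.ofReal_pow (norm_nonneg _), ofReal_norm]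

lemma enorm_add_sq_le (x y : ℂ) : ‖x + y‖ₑ ^ 2 ≤ 2 * ‖x‖ₑ ^ 2 + 2 * ‖y‖ₑ ^ 2 := by
  rw [← ofReal_norm, ← ofReal_norm, ← ofReal_norm, ← ENNReal.ofReal_pow (norm_nonneg _),
    ← ENNReal.ofReal_pow (norm_nonneg _), ← ENNReal.ofReal_pow (norm_nonneg _),
    ← ENNReal.ofReal_ofNat 2, ← ENNReal.ofReal_mul (by norm_num), ← ENNReal.ofReal_mul (by norm_num),
    ← ENNReal.ofReal_add (by positivity) (by positivity)]
  refine ENNReal.ofReal_le_ofReal ?_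
  have := norm_add_le x y
  nlinarith [norm_nonneg (x + y), sq_nonneg (‖x‖ - ‖y‖), norm_nonneg x, norm_nonneg y]

set_option maxHeartbeats 1000000 in
lemma exists_approx {R : ℝ} (hR : 0 < R) {f : Cn n → ℂ} (hf : DifferentiableOn ℂ f (Metric.ball 0 R))
    {G : Cn n → ℝ≥0∞} (hJ : ∫⁻ z in Metric.ball 0 R, ‖f z‖ₑ ^ 2 * G z ≠ ⊤) {P : ℕ → Cn n → ℝ} {C : ℝ}
    (hPs : ∀ k, ContDiff ℝ ∞ (P k)) (hPl : ∀ k, ∀ z ∈ Metric.ball (0 : Cn n) R, ∀ a, 0 ≤ levi (P k) z a)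
    (hPC : ∀ k, ∀ z ∈ Metric.ball (0 : Cn n) R, P k z ≤ C)
    (hPG : ∀ k, ∀ z ∈ Metric.ball (0 : Cn n) R, ENNReal.ofReal (Real.exp (-2 * P k z)) ≤ G z)
    {ψ : Cn n → EReal} {C' : ℝ} {r : ℕ → Cn n → ℝ} (hr : IsRegularization ψ R C' r)
    (hb : ∀ᵐ z : Cn n, z ∈ Metric.ball (0 : Cn n) R → ψ z ≠ ⊥) {δ : ℝ≥0∞} (hδ : δ ≠ 0) :
    ∃ s > 0, ∃ M : ℝ≥0∞, M ≠ ⊤ ∧ ∀ k, ∃ F : Cn n → ℂ, Differentiable ℂ F ∧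
      ∫⁻ z in {z | nsq z ≤ R ^ 2 / 5}, ‖f z - F z‖ₑ ^ 2 ≤ δ ∧
      ∫⁻ z in {z | nsq z ≤ R ^ 2 / 5}, ‖F z‖ₑ ^ 2 * (ENNReal.ofReal (Real.exp (-2 * P k z)) *
        ENNReal.ofReal (Real.exp (-2 * s * r k z))) ≤ M := by
  set J := ∫⁻ z in Metric.ball 0 R, ‖f z‖ₑ ^ 2 * G z with hJdef
  set c := R ^ 2 / 5 with hc
  have hc0 : 0 < c := by positivity
  have hR2 : R ^ 2 = 5 * c := by rw [hc]; ring
  have hball : ∀ z : Cn n, nsq z < 4 * c → z ∈ Metric.ball (0 : Cn n) (9 / 10 * R) := by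
    intro z hz
    rw [mem_ball_zero_iff]
    have := norm_sq_le_nsq z
    exact lt_of_pow_lt_pow_left₀ 2 (by positivity) (by nlinarith)
  have hball' : ∀ z : Cn n, nsq z < 4 * c → z ∈ Metric.ball (0 : Cn n) R := fun z hz =>
    Metric.ball_subset_ball (by linarith) (hball z hz)
  obtain ⟨g, hgs, hgf⟩ := exists_contDiff_eq_of_holo hf (by linarith : 9 / 10 * R < R)
  have hgd : ∀ z, nsq z < 4 * c → DifferentiableAt ℂ g z := by
    intro z hz
    have h1 : g =ᶠ[𝓝 z] f := by
      filter_upwards [Metric.isOpen_ball.mem_nhds (hball z hz)] with y hy using hgf y hy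
    exact (hf.differentiableAt (Metric.isOpen_ball.mem_nhds (hball' z hz))).congr_of_eventuallyEq h1
  set D := max (C' + 2) 0 with hD
  have hD0 : 0 ≤ D := le_max_right _ _
  have hDC : C' + 2 ≤ D := le_max_left _ _
  obtain ⟨C₁, hC₁, hmain⟩ := exists_holo_approx (n := n) (c' := 2 * c) (c₂ := 3 * c) (c₃ := 4 * c)
    (by linarith) (by linarith) (by linarith)
  set T : ℕ → ℝ≥0∞ := fun L =>
    ∫⁻ z in {z ∈ Metric.ball (0 : Cn n) R | ψ z < ((D + 1 - L : ℝ) : EReal)}, ‖f z‖ₑ ^ 2 * G z with hT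
  have hTt : Tendsto T atTop (𝓝 0) := hr.tendsto_setLIntegral hb hJ (D + 1)
  have hTJ : ∀ L, T L ≤ J := fun L => lintegral_mono_set fun z hz => hz.1
  set A : ℝ≥0∞ := ENNReal.ofReal (Real.exp (2 * C)) with hA
  have hAt : A ≠ ⊤ := ENNReal.ofReal_ne_top
  -- choice of `K`
  obtain ⟨K, hK1, hK⟩ : ∃ K : ℝ, 1 ≤ K ∧
      2 * A * (C₁ * (ENNReal.ofReal (Real.exp (-2 * K * (2 * c - c))) * J)) ≤ δ / 2 := by
    have h1 : Tendsto (fun K : ℝ => ENNReal.ofReal (Real.exp (-2 * K * (2 * c - c)))) atTop (𝓝 0) := by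
      rw [← ENNReal.ofReal_zero]
      refine ENNReal.tendsto_ofReal (Real.tendsto_exp_atBot.comp ?_)
      have : (fun K : ℝ => -2 * K * (2 * c - c)) = fun K => (-2 * c) * K := by funext K; ring
      rw [this]
      exact tendsto_id.const_mul_atTop_of_neg (by linarith)
    have h2 : Tendsto (fun K : ℝ =>
        2 * A * (C₁ * (ENNReal.ofReal (Real.exp (-2 * K * (2 * c - c))) * J))) atTop (𝓝 0) := by
      have h3 := ENNReal.Tendsto.const_mul (a := 2 * A) (ENNReal.Tendsto.const_mul (a := C₁)
        (ENNReal.Tendsto.mul_const (b := J) h1 (Or.inr hJ)) (Or.inr hC₁))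
        (Or.inr (ENNReal.mul_ne_top (by simp) hAt))
      simpa using h3
    have h3 := (h2.eventually (Iic_mem_nhds (ENNReal.half_pos hδ))).and (eventually_ge_atTop 1)
    obtain ⟨K, hK⟩ := h3.exists
    exact ⟨K, hK.2, hK.1⟩
  set E₁ := ENNReal.ofReal (Real.exp (-2 * K * (2 * c - c)))
  set E₂ := ENNReal.ofReal (Real.exp (2 * K * c))
  -- choice of `L`
  obtain ⟨L, hL1, hL⟩ : ∃ L : ℕ, 1 ≤ L ∧
      2 * (A * T L) + 2 * A * (C₁ * (E₂ * T L)) ≤ δ / 2 := by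
    have h2 : Tendsto (fun L : ℕ => 2 * (A * T L) + 2 * A * (C₁ * (E₂ * T L))) atTop (𝓝 0) := by
      have h3 := ENNReal.Tendsto.const_mul (a := 2) (ENNReal.Tendsto.const_mul (a := A) hTt (Or.inr hAt))
        (Or.inr (by simp))
      have h4 := ENNReal.Tendsto.const_mul (a := 2 * A) (ENNReal.Tendsto.const_mul (a := C₁)
        (ENNReal.Tendsto.const_mul (a := E₂) hTt (Or.inr ENNReal.ofReal_ne_top)) (Or.inr hC₁))
        (Or.inr (ENNReal.mul_ne_top (by simp) hAt))
      simpa using h3.add h4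
    have h3 := (h2.eventually (Iic_mem_nhds (ENNReal.half_pos hδ))).and (eventually_ge_atTop 1)
    obtain ⟨L, hL⟩ := h3.exists
    exact ⟨L, hL.2, hL.1⟩
  have hL1' : (1 : ℝ) ≤ L := by exact_mod_cast hL1
  have hL0 : (0 : ℝ) < L := by linarith
  set s := Real.exp (-2 * (L : ℝ)) with hs
  have hs0 : 0 < s := Real.exp_pos _
  refine ⟨s, hs0, 2 * (ENNReal.ofReal (Real.exp 2) * J) + 2 * (C₁ * (E₁ * J + E₂ * J)), ?_, fun k => ?_⟩
  · have e2 : E₂ ≠ ⊤ := ENNReal.ofReal_ne_top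
    have e1 : E₁ ≠ ⊤ := ENNReal.ofReal_ne_top
    exact ENNReal.add_ne_top.2 ⟨ENNReal.mul_ne_top (by simp) (ENNReal.mul_ne_top ENNReal.ofReal_ne_top hJ),
      ENNReal.mul_ne_top (by simp) (ENNReal.mul_ne_top hC₁
        (ENNReal.add_ne_top.2 ⟨ENNReal.mul_ne_top e1 hJ, ENNReal.mul_ne_top e2 hJ⟩))⟩
  set ρ : Cn n → ℝ := fun z => r k z + (-D) with hρ
  have hρs : ContDiff ℝ ∞ ρ := (hr.smooth k).add contDiff_const
  have hρl : ∀ z, nsq z < 4 * c → ∀ a, 0 ≤ levi ρ z a := fun z hz a => by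
    rw [hρ, levi_add (hr.smooth k) contDiff_const, levi_const, add_zero]
    exact hr.levi_nonneg k z (hball' z hz) a
  have hρ2 : ∀ z, nsq z < 4 * c → ρ z ≤ -2 := fun z hz => by
    have := hr.le_const k z (hball' z hz)
    rw [hρ]; simp only; linarith
  obtain ⟨F, hF, hFle⟩ := hmain c g (P k) ρ K L hc0 (by linarith) hgs hgd (hPs k) hρs
    (fun z hz => hPl k z (hball' z hz)) hρl hρ2 hK1 hL1'
  set X : Cn n → ℝ≥0∞ := fun z => ENNReal.ofReal (‖(poleCut L ρ z : ℂ) * g z - F z‖ ^ 2 *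
    Real.exp (-2 * P k z - 2 * s * ρ z)) with hX
  have hXm : Measurable X := by
    refine Measurable.ennreal_ofReal (Continuous.measurable ?_)
    have h1 := (contDiff_poleCut L hρs).continuous
    have h2 := hF.continuous
    have h3 := hgs.continuous
    have h4 := (hPs k).continuous
    have h5 := hρs.continuous
    fun_prop
  have hin : ∀ z, nsq z < 4 * c → L ≤ -yfun (ρ z) →
      z ∈ {z ∈ Metric.ball (0 : Cn n) R | ψ z < ((D + 1 - L : ℝ) : EReal)} := by
    intro z hz hLz
    refine ⟨hball' z hz, (hr.le k z (hball' z hz)).trans_lt (EReal.coe_lt_coe_iff.2 ?_)⟩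
    have h1 := le_abs_of_le_neg_yfun hL0.le hLz
    have h2 := hρ2 z hz
    rw [abs_of_nonpos (by linarith)] at h1
    rw [hρ] at h1
    simp only at h1
    linarith
  have hpt : ∀ z, nsq z < 4 * c →
      ENNReal.ofReal (‖g z‖ ^ 2 * Real.exp (-2 * P k z)) ≤ ‖f z‖ₑ ^ 2 * G z := by
    intro z hz
    rw [ofReal_norm_sq_mul, hgf z (hball z hz)]
    gcongr
    exact hPG k z (hball' z hz)
  have hnc : Continuous (nsq : Cn n → ℝ) := contDiff_nsq.continuous
  have hm1 : ∀ v, MeasurableSet {z : Cn n | nsq z ≤ v} := fun v =>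
    (isClosed_le hnc continuous_const).measurableSet
  have hm3 : MeasurableSet {z : Cn n | nsq z ≤ 3 * c ∧ L ≤ -yfun (ρ z)} :=
    ((isClosed_le hnc continuous_const).inter (isClosed_le continuous_const
      (contDiff_yfun.continuous.comp hρs.continuous).neg)).measurableSet
  have hXle : ∫⁻ z in {z | nsq z ≤ c}, X z ≤ C₁ * (E₁ * J + E₂ * T L) := by
    refine hFle.trans ?_
    gcongr
    · refine (setLIntegral_mono' (hm1 _) fun z (hz : nsq z ≤ 3 * c) => hpt z (by linarith)).trans ?_
      exact lintegral_mono_set fun z (hz : nsq z ≤ 3 * c) => hball' z (by linarith)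
    · refine (setLIntegral_mono' hm3 fun z hz => hpt z (by linarith [hz.1])).trans ?_
      exact lintegral_mono_set fun z hz => hin z (by linarith [hz.1]) hz.2
  refine ⟨F, hF, ?_, ?_⟩
  · have hpw : ∀ z ∈ {z : Cn n | nsq z ≤ c}, ‖f z - F z‖ₑ ^ 2 ≤
        2 * (A * {z ∈ Metric.ball (0 : Cn n) R | ψ z < ((D + 1 - L : ℝ) : EReal)}.indicator
          (fun z => ‖f z‖ₑ ^ 2 * G z) z) + 2 * (A * X z) := by
      intro z hz
      have hz' : nsq z ≤ c := hz
      have hz4 : nsq z < 4 * c := by linarith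
      have hgz := hgf z (hball z hz4)
      have h1 : f z - F z = (f z - (poleCut L ρ z : ℂ) * g z) + ((poleCut L ρ z : ℂ) * g z - F z) := by
        ring
      rw [h1]
      refine (enorm_add_sq_le _ _).trans ?_
      gcongr
      · by_cases hLz : L ≤ -yfun (ρ z)
        · rw [Set.indicator_of_mem (hin z hz4 hLz)]
          have h2 : ‖f z - (poleCut L ρ z : ℂ) * g z‖ ≤ ‖f z‖ := by
            have : f z - (poleCut L ρ z : ℂ) * g z = ((1 - poleCut L ρ z : ℝ) : ℂ) * f z := by
              rw [hgz]; push_cast; ring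
            rw [this, norm_mul, Complex.norm_real, Real.norm_of_nonneg
              (sub_nonneg.2 (poleCut_le_one _ _ _))]
            exact mul_le_of_le_one_left (norm_nonneg _) (by linarith [poleCut_nonneg (L : ℝ) ρ z])
          have h3 : ‖f z - (poleCut L ρ z : ℂ) * g z‖ₑ ≤ ‖f z‖ₑ := enorm_le_iff_norm_le.2 h2
          have h4 : 1 ≤ A * G z := by
            calc (1 : ℝ≥0∞) ≤ A * ENNReal.ofReal (Real.exp (-2 * P k z)) := by
                  rw [hA, ← ENNReal.ofReal_mul (Real.exp_pos _).le, ← Real.exp_add,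
                    ← ENNReal.ofReal_one]
                  refine ENNReal.ofReal_le_ofReal (Real.one_le_exp ?_)
                  linarith [hPC k z (hball' z hz4)]
              _ ≤ _ := by gcongr; exact hPG k z (hball' z hz4)
          calc _ ≤ ‖f z‖ₑ ^ 2 * 1 := by rw [mul_one]; gcongr
            _ ≤ ‖f z‖ₑ ^ 2 * (A * G z) := by gcongr
            _ = _ := by ring
        · push Not at hLz
          rw [poleCut_eq_one hL0 hLz.le, hgz]
          simp
      · simp only [hX]; rw [hA, ofReal_norm_sq_mul, mul_left_comm, ← ENNReal.ofReal_mul (Real.exp_pos _).le,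
          ← Real.exp_add]
        refine le_mul_of_one_le_right bot_le ?_
        rw [← ENNReal.ofReal_one]
        refine ENNReal.ofReal_le_ofReal (Real.one_le_exp ?_)
        nlinarith [hPC k z (hball' z hz4), hρ2 z hz4]
    refine (setLIntegral_mono' (hm1 c) hpw).trans ?_
    rw [lintegral_add_right _ ((hXm.const_mul _).const_mul _), lintegral_const_mul' _ _ (by simp),
      lintegral_const_mul' _ _ hAt, lintegral_const_mul' _ _ (by simp), lintegral_const_mul' _ _ hAt]
    have h5 : ∫⁻ z in {z | nsq z ≤ c},
        {z ∈ Metric.ball (0 : Cn n) R | ψ z < ((D + 1 - L : ℝ) : EReal)}.indicator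
          (fun z => ‖f z‖ₑ ^ 2 * G z) z ≤ T L := by
      refine (setLIntegral_le_lintegral _ _).trans ?_
      rw [lintegral_indicator (hr.isOpen_lt _).measurableSet]
    calc _ ≤ 2 * (A * T L) + 2 * (A * (C₁ * (E₁ * J + E₂ * T L))) := by gcongr
      _ = (2 * A * (C₁ * (E₁ * J))) + (2 * (A * T L) + 2 * A * (C₁ * (E₂ * T L))) := by ring
      _ ≤ δ / 2 + δ / 2 := add_le_add hK hL
      _ = δ := ENNReal.add_halves δ
  · have hpw : ∀ z ∈ {z : Cn n | nsq z ≤ c}, ‖F z‖ₑ ^ 2 * (ENNReal.ofReal (Real.exp (-2 * P k z)) *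
        ENNReal.ofReal (Real.exp (-2 * s * r k z))) ≤
        2 * (ENNReal.ofReal (Real.exp 2) * (‖f z‖ₑ ^ 2 * G z)) + 2 * X z := by
      intro z hz
      have hz' : nsq z ≤ c := hz
      have hz4 : nsq z < 4 * c := by linarith
      have hgz := hgf z (hball z hz4)
      rw [← ENNReal.ofReal_mul (Real.exp_pos _).le, ← Real.exp_add]
      have h1 : F z = (poleCut L ρ z : ℂ) * g z + -((poleCut L ρ z : ℂ) * g z - F z) := by ring
      have h2 := enorm_add_sq_le ((poleCut L ρ z : ℂ) * g z) (-((poleCut L ρ z : ℂ) * g z - F z))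
      rw [← h1, enorm_neg] at h2
      have h3 : Real.exp (-2 * P k z + -2 * s * r k z) ≤ Real.exp (-2 * P k z - 2 * s * ρ z) := by
        refine Real.exp_le_exp.2 ?_
        rw [hρ]; simp only
        nlinarith [mul_nonneg hs0.le hD0]
      refine (mul_le_mul' h2 (ENNReal.ofReal_le_ofReal h3)).trans ?_
      simp only [hX]
      rw [add_mul, ofReal_norm_sq_mul, mul_assoc (2 : ℝ≥0∞), mul_assoc (2 : ℝ≥0∞)]
      gcongr 2 * ?_ + _
      by_cases hLz : 2 * L ≤ -yfun (ρ z)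
      · rw [poleCut_eq_zero hL0 hLz]; simp
      · push Not at hLz
        have h4 : ‖(poleCut L ρ z : ℂ) * g z‖ₑ ≤ ‖f z‖ₑ := by
          refine enorm_le_iff_norm_le.2 ?_
          rw [hgz, norm_mul, Complex.norm_real, Real.norm_of_nonneg (poleCut_nonneg _ _ _)]
          exact mul_le_of_le_one_left (norm_nonneg _) (poleCut_le_one _ _ _)
        have h5 : s * (-ρ z) ≤ 1 := by
          calc s * (-ρ z) ≤ s * Real.exp (2 * L) := by
                gcongr
                exact ((neg_le_abs _).trans (abs_le_exp_neg_yfun _)).trans (Real.exp_le_exp.2 hLz.le)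
            _ = 1 := by rw [hs, ← Real.exp_add]; simp
        have h6 : Real.exp (-2 * P k z - 2 * s * ρ z) ≤ Real.exp 2 * Real.exp (-2 * P k z) := by
          rw [← Real.exp_add]
          exact Real.exp_le_exp.2 (by linarith)
        calc _ ≤ ‖f z‖ₑ ^ 2 * ENNReal.ofReal (Real.exp 2 * Real.exp (-2 * P k z)) := by gcongr
          _ ≤ ‖f z‖ₑ ^ 2 * (ENNReal.ofReal (Real.exp 2) * G z) := by
            rw [ENNReal.ofReal_mul (Real.exp_pos _).le]
            gcongr
            exact hPG k z (hball' z hz4)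
          _ = _ := by ring
    refine (setLIntegral_mono' (hm1 c) hpw).trans ?_
    rw [lintegral_add_right _ (hXm.const_mul _), lintegral_const_mul' _ _ (by simp),
      lintegral_const_mul' _ _ ENNReal.ofReal_ne_top, lintegral_const_mul' _ _ (by simp)]
    gcongr
    · exact lintegral_mono_set fun z (hz : nsq z ≤ c) => hball' z (by linarith)
    · refine hXle.trans ?_
      gcongr
      exact hTJ L

/-- The monomial `z ^ α`. -/
def mono (α : Fin n → ℕ) (z : Cn n) : ℂ := ∏ j, z j ^ α j

/-- The inclusion `ℂⁿ → ℂⁿ⁺¹`, `z ↦ (0, z)`. -/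
def consL (n : ℕ) : Cn n →L[ℂ] Cn (n + 1) :=
  ContinuousLinearMap.pi (Fin.cons 0 fun i => ContinuousLinearMap.proj i)

lemma cons_eq_add_consL (w : ℂ) (z : Cn n) :
    (Fin.cons w z : Cn (n + 1)) = Fin.cons w 0 + consL n z := by
  ext i
  refine Fin.cases ?_ (fun i => ?_) i <;> simp [consL]

lemma cons_mem_ball {w : ℂ} {z : Cn n} {R : ℝ} (hR : 0 < R) (hw : ‖w‖ < R) (hz : ‖z‖ < R) :
    (Fin.cons w z : Cn (n + 1)) ∈ Metric.ball (0 : Cn (n + 1)) R := by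
  rw [mem_ball_zero_iff, pi_norm_lt_iff hR]
  rw [pi_norm_lt_iff hR] at hz
  intro i
  refine Fin.cases ?_ (fun i => ?_) i
  · simpa using hw
  · simpa using hz i

lemma continuous_cons_left (z : Cn n) : Continuous fun w : ℂ => (Fin.cons w z : Cn (n + 1)) := by
  refine continuous_pi fun i => ?_
  refine Fin.cases ?_ (fun i => ?_) i
  · simpa using continuous_id'
  · simpa using continuous_const

lemma norm_fderiv_le_of_bounded {G : Cn n → ℂ} {R B r : ℝ} (hG : DifferentiableOn ℂ G (Metric.ball 0 R))
    (hB : ∀ z ∈ Metric.ball (0 : Cn n) R, ‖G z‖ ≤ B) (hr : 0 < r) {z : Cn n} (hz : ‖z‖ + r ≤ R) :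
    ‖fderiv ℂ G z‖ ≤ 2 * B / r := by
  have hsub : Metric.ball z r ⊆ Metric.ball 0 R := by
    refine Metric.ball_subset_ball' ?_
    rw [dist_zero_right]; linarith
  refine Complex.norm_fderiv_le_div_of_mapsTo_ball (hG.mono hsub) (fun y hy => ?_) hr
  rw [Metric.mem_closedBall, dist_eq_norm]
  refine (norm_sub_le _ _).trans ?_
  have h1 := hB y (hsub hy)
  have h2 := hB z (hsub (Metric.mem_ball_self hr))
  linarith

lemma differentiableOn_circleIntegral_cons {G : Cn (n + 1) → ℂ} {R B ρ : ℝ} (hρ : 0 < ρ) (hρR : ρ < R)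
    (hG : DifferentiableOn ℂ G (Metric.ball 0 R)) (hB : ∀ z ∈ Metric.ball (0 : Cn (n + 1)) R, ‖G z‖ ≤ B)
    {κ : ℂ → ℂ} (hκ : ContinuousOn κ (Metric.sphere 0 ρ)) :
    DifferentiableOn ℂ (fun z : Cn n => ∮ w in C(0, ρ), κ w • G (Fin.cons w z)) (Metric.ball 0 R) := by
  intro x₀ hx₀
  refine DifferentiableAt.differentiableWithinAt ?_
  have hR : 0 < R := hρ.trans hρR
  rw [mem_ball_zero_iff] at hx₀
  set r := min ((R - ρ) / 2) ((R - ‖x₀‖) / 2) with hr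
  have hr0 : 0 < r := lt_min (by linarith) (by linarith)
  have hr1 : r ≤ (R - ρ) / 2 := min_le_left _ _
  have hr2 : r ≤ (R - ‖x₀‖) / 2 := min_le_right _ _
  set h : ℝ → ℂ := fun θ => deriv (circleMap 0 ρ) θ * κ (circleMap 0 ρ θ) with hh
  have hhc : Continuous h := by
    refine Continuous.mul ?_ (hκ.comp_continuous (continuous_circleMap 0 ρ)
      fun θ => circleMap_mem_sphere 0 hρ.le θ)
    have : deriv (circleMap 0 ρ) = fun θ => circleMap 0 ρ θ * Complex.I := by
      funext θ; simp
    rw [this]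
    exact (continuous_circleMap 0 ρ).mul continuous_const
  have hnc : ∀ θ, ‖circleMap 0 ρ θ‖ = ρ := fun θ => by simp [abs_of_pos hρ]
  have hball : ∀ x ∈ Metric.ball x₀ r, ‖x‖ + r ≤ R := by
    intro x hx
    rw [mem_ball_iff_norm] at hx
    have := norm_le_norm_add_norm_sub' x x₀
    linarith
  have hmem : ∀ x ∈ Metric.ball x₀ r, ∀ θ, (Fin.cons (circleMap 0 ρ θ) x : Cn (n + 1)) ∈
      Metric.ball (0 : Cn (n + 1)) R := fun x hx θ =>
    cons_mem_ball hR (by rw [hnc]; exact hρR) (by linarith [hball x hx])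
  have hcc : ∀ x, Continuous fun θ : ℝ => (Fin.cons (circleMap 0 ρ θ) x : Cn (n + 1)) := fun x =>
    (continuous_cons_left x).comp (continuous_circleMap 0 ρ)
  have hFc : ∀ x ∈ Metric.ball x₀ r, Continuous fun θ => h θ • G (Fin.cons (circleMap 0 ρ θ) x) :=
    fun x hx => hhc.smul (hG.continuousOn.comp_continuous (hcc x) (hmem x hx))
  have key := intervalIntegral.hasFDerivAt_integral_of_dominated_of_fderiv_le (𝕜 := ℂ) (μ := volume)
    (a := 0) (b := 2 * Real.pi)
    (F := fun (x : Cn n) θ => h θ • G (Fin.cons (circleMap 0 ρ θ) x))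
    (F' := fun (x : Cn n) θ => h θ • (fderiv ℂ G (Fin.cons (circleMap 0 ρ θ) x)).comp (consL n))
    (x₀ := x₀) (s := Metric.ball x₀ r) (bound := fun θ => ‖h θ‖ * (2 * B / r * ‖consL n‖))
    (Metric.ball_mem_nhds _ hr0)
    (by filter_upwards [Metric.ball_mem_nhds x₀ hr0] with x hx using (hFc x hx).aestronglyMeasurable)
    ((hFc x₀ (Metric.mem_ball_self hr0)).intervalIntegrable _ _) ?_ ?_
    ((hhc.norm.mul continuous_const).intervalIntegrable _ _) ?_
  · have e : (fun z : Cn n => ∮ w in C(0, ρ), κ w • G (Fin.cons w z)) = fun z =>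
        ∫ θ in (0 : ℝ)..2 * Real.pi, h θ • G (Fin.cons (circleMap 0 ρ θ) z) := by
      funext z
      rw [circleIntegral]
      refine intervalIntegral.integral_congr fun θ _ => ?_
      simp only [hh, smul_eq_mul, mul_assoc]
    rw [e]
    exact key.differentiableAt
  · have h1 : Measurable fun θ : ℝ => fderiv ℂ G (Fin.cons (circleMap 0 ρ θ) x₀) :=
      (measurable_fderiv ℂ G).comp (hcc x₀).measurable
    have h2 : Continuous fun T : Cn (n + 1) →L[ℂ] ℂ => T.comp (consL n) := by fun_prop
    exact hhc.aestronglyMeasurable.smul (h2.measurable.comp h1).aestronglyMeasurable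
  · refine Eventually.of_forall fun θ _ x hx => ?_
    rw [norm_smul]
    refine mul_le_mul_of_nonneg_left ?_ (norm_nonneg _)
    refine (ContinuousLinearMap.opNorm_comp_le _ _).trans
      (mul_le_mul_of_nonneg_right ?_ (norm_nonneg _))
    refine norm_fderiv_le_of_bounded hG hB hr0 ?_
    have : ‖(Fin.cons (circleMap 0 ρ θ) x : Cn (n + 1))‖ ≤ R - r := by
      rw [pi_norm_le_iff_of_nonneg (by linarith)]
      intro i
      refine Fin.cases ?_ (fun i => ?_) i
      · simp only [Fin.cons_zero, hnc]; linarith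
      · simp only [Fin.cons_succ]; linarith [norm_le_pi_norm x i, hball x hx]
    linarith
  · refine Eventually.of_forall fun θ _ x hx => ?_
    have h1 : HasFDerivAt (fun x : Cn n => (Fin.cons (circleMap 0 ρ θ) x : Cn (n + 1))) (consL n) x := by
      have : (fun x : Cn n => (Fin.cons (circleMap 0 ρ θ) x : Cn (n + 1))) = fun x =>
          Fin.cons (circleMap 0 ρ θ) 0 + consL n x := by
        funext x; exact cons_eq_add_consL _ _
      rw [this]
      exact (consL n).hasFDerivAt.const_add _
    have h2 := (hG.differentiableAt (Metric.isOpen_ball.mem_nhds (hmem x hx θ))).hasFDerivAt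
    exact (h2.comp x h1).const_smul (h θ)

lemma summable_prod_pow : ∀ {n : ℕ} {t : Fin n → ℝ}, (∀ j, 0 ≤ t j) → (∀ j, t j < 1) →
    Summable fun α : Fin n → ℕ => ∏ j, t j ^ α j
  | 0, _, _, _ => Summable.of_finite
  | n + 1, t, h0, h1 => by
    rw [← (Fin.consEquiv fun _ : Fin (n + 1) => ℕ).summable_iff]
    have h := (summable_geometric_of_lt_one (h0 0) (h1 0)).mul_of_nonneg
      (summable_prod_pow (t := fun j => t j.succ) (fun j => h0 _) fun j => h1 _)
      (fun k => pow_nonneg (h0 0) k) fun α => Finset.prod_nonneg fun j _ => pow_nonneg (h0 _) _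
    refine h.congr fun x => ?_
    simp [Fin.consEquiv, Fin.prod_univ_succ]

lemma norm_mul_mono_le {c : (Fin n → ℕ) → ℂ} {ρ B : ℝ} (hρ : 0 < ρ)
    (hc : ∀ α, ‖c α‖ * ρ ^ (∑ j, α j) ≤ B) (z : Cn n) (α : Fin n → ℕ) :
    ‖c α * mono α z‖ ≤ B * ∏ j, (‖z j‖ / ρ) ^ α j := by
  have h1 : ‖mono α z‖ = ρ ^ (∑ j, α j) * ∏ j, (‖z j‖ / ρ) ^ α j := by
    rw [mono, norm_prod, ← Finset.prod_pow_eq_pow_sum, ← Finset.prod_mul_distrib]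
    refine Finset.prod_congr rfl fun j _ => ?_
    rw [norm_pow, ← mul_pow, mul_div_cancel₀ _ hρ.ne']
  rw [norm_mul, h1, ← mul_assoc]
  exact mul_le_mul_of_nonneg_right (hc α) (Finset.prod_nonneg fun j _ => by positivity)

lemma summable_bound {ρ : ℝ} (B : ℝ) (hρ : 0 < ρ) {z : Cn n} (hz : ‖z‖ < ρ) :
    Summable fun α : Fin n → ℕ => B * ∏ j, (‖z j‖ / ρ) ^ α j :=
  (summable_prod_pow (fun j => by positivity)
    fun j => (div_lt_one hρ).2 ((norm_le_pi_norm z j).trans_lt hz)).mul_left B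

lemma summable_norm_mul_mono {c : (Fin n → ℕ) → ℂ} {ρ B : ℝ} (hρ : 0 < ρ)
    (hc : ∀ α, ‖c α‖ * ρ ^ (∑ j, α j) ≤ B) {z : Cn n} (hz : ‖z‖ < ρ) :
    Summable fun α => ‖c α * mono α z‖ :=
  (summable_bound B hρ hz).of_nonneg_of_le (fun _ => norm_nonneg _) (norm_mul_mono_le hρ hc z)

/-- Taylor expansion of a bounded holomorphic function on a polydisc, with Cauchy estimates. -/
lemma exists_taylor : ∀ {n : ℕ} {R ρ B : ℝ} {G : Cn n → ℂ}, 0 < ρ → ρ < R →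
    DifferentiableOn ℂ G (Metric.ball 0 R) → (∀ z ∈ Metric.ball (0 : Cn n) R, ‖G z‖ ≤ B) →
    ∃ c : (Fin n → ℕ) → ℂ, (∀ α, ‖c α‖ * ρ ^ (∑ j, α j) ≤ B) ∧
      ∀ z : Cn n, ‖z‖ < ρ → HasSum (fun α => c α * mono α z) (G z)
  | 0, R, ρ, B, G, hρ, hρR, hG, hB => by
    refine ⟨fun _ => G 0, fun α => by simpa using hB 0 (Metric.mem_ball_self (hρ.trans hρR)), fun z _ => ?_⟩
    rw [Subsingleton.elim z 0]
    simp [mono]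
  | n + 1, R, ρ, B, G, hρ, hρR, hG, hB => by
    lift ρ to ℝ≥0 using hρ.le
    have hR : 0 < R := hρ.trans hρR
    set κ : ℕ → ℂ → ℂ := fun k w => w⁻¹ ^ k * w⁻¹ with hκ
    have hκc : ∀ k, ContinuousOn (κ k) (Metric.sphere 0 ρ) := by
      intro k
      have : ContinuousOn (fun w : ℂ => w⁻¹) (Metric.sphere 0 ρ) :=
        continuousOn_id.inv₀ fun w hw (h0 : w = 0) => by
          rw [h0] at hw; simp at hw; exact hρ.ne hw
      exact (this.pow k).mul this
    set a : ℕ → Cn n → ℂ := fun k z => (2 * Real.pi * Complex.I : ℂ)⁻¹ •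
      ∮ w in C(0, ρ), κ k w • G (Fin.cons w z) with ha
    have had : ∀ k, DifferentiableOn ℂ (a k) (Metric.ball 0 R) := fun k =>
      (differentiableOn_circleIntegral_cons hρ hρR hG hB (hκc k)).const_smul
        (2 * Real.pi * Complex.I : ℂ)⁻¹
    have hab : ∀ k, ∀ z ∈ Metric.ball (0 : Cn n) R, ‖a k z‖ ≤ B * (ρ : ℝ)⁻¹ ^ k := by
      intro k z hz
      rw [mem_ball_zero_iff] at hz
      have h1 := circleIntegral.norm_two_pi_i_inv_smul_integral_le_of_norm_le_const (c := 0)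
        (f := fun w => κ k w • G (Fin.cons w z)) (C := (ρ : ℝ)⁻¹ ^ k * (ρ : ℝ)⁻¹ * B) hρ.le (fun w hw => by
          have hw' : ‖w‖ = ρ := by simpa using hw
          rw [norm_smul, hκ]
          simp only [norm_mul, norm_pow, norm_inv, hw']
          exact mul_le_mul_of_nonneg_left (hB _ (cons_mem_ball hR (by rw [hw']; exact hρR) hz))
            (by positivity))
      refine h1.trans (le_of_eq ?_)
      field_simp
    have has : ∀ z ∈ Metric.ball (0 : Cn n) R, ∀ w : ℂ, ‖w‖ < ρ →
        HasSum (fun k => w ^ k * a k z) (G (Fin.cons w z)) := by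
      intro z hz w hw
      rw [mem_ball_zero_iff] at hz
      have hd : DifferentiableOn ℂ (fun w : ℂ => G (Fin.cons w z)) (Metric.closedBall 0 ρ) := by
        refine hG.comp (f := fun w : ℂ => (Fin.cons w z : Cn (n + 1))) (fun w _ => ?_) fun w hw => ?_
        · refine DifferentiableAt.differentiableWithinAt (differentiableAt_pi.2 fun i => ?_)
          refine Fin.cases ?_ (fun i => ?_) i
          · simp only [Fin.cons_zero]; exact differentiableAt_id
          · simp only [Fin.cons_succ]; exact differentiableAt_const _
        · exact cons_mem_ball hR ((mem_closedBall_zero_iff.1 hw).trans_lt hρR) hz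
      have h1 := (DifferentiableOn.hasFPowerSeriesOnBall hd (by exact_mod_cast hρ)).hasSum
        (y := w) (by
          rw [mem_eball_zero_iff, ← ofReal_norm, ← ENNReal.ofReal_coe_nnreal]
          exact (ENNReal.ofReal_lt_ofReal_iff hρ).2 hw)
      rw [zero_add] at h1
      refine h1.congr_fun fun k => ?_
      rw [cauchyPowerSeries_apply, ha]
      simp only [hκ, sub_zero, div_eq_mul_inv, mul_pow, smul_eq_mul]
      rw [mul_left_comm, ← smul_eq_mul (w ^ k), ← circleIntegral.integral_smul]
      congr 2
      funext v
      simp only [smul_eq_mul]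
      ring
    choose c hcb hcs using fun k => exists_taylor hρ hρR (had k) (hab k)
    have hcb' : ∀ α : Fin (n + 1) → ℕ, ‖c (α 0) (Fin.tail α)‖ * ρ ^ (∑ j, α j) ≤ B := by
      intro α
      rw [Fin.sum_univ_succ, pow_add]
      have h1 := hcb (α 0) (Fin.tail α)
      have h2 : (ρ : ℝ) ^ α 0 * (ρ : ℝ)⁻¹ ^ α 0 = 1 := by rw [← mul_pow, mul_inv_cancel₀ hρ.ne', one_pow]
      calc ‖c (α 0) (Fin.tail α)‖ * (ρ ^ α 0 * ρ ^ (∑ j : Fin n, α j.succ))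
          = ρ ^ α 0 * (‖c (α 0) (Fin.tail α)‖ * ρ ^ (∑ j, Fin.tail α j)) := by
            simp only [Fin.tail]; ring
        _ ≤ ρ ^ α 0 * (B * (ρ : ℝ)⁻¹ ^ α 0) := by gcongr
        _ = B * ((ρ : ℝ) ^ α 0 * (ρ : ℝ)⁻¹ ^ α 0) := by ring
        _ = B := by rw [h2, mul_one]
    refine ⟨fun α => c (α 0) (Fin.tail α), hcb', fun z hz => ?_⟩
    · set f : (Fin (n + 1) → ℕ) → ℂ := fun α => c (α 0) (Fin.tail α) * mono α z with hf
      have hs : Summable f := (summable_norm_mul_mono hρ hcb' hz).of_norm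
      have hS := ((Fin.consEquiv fun _ : Fin (n + 1) => ℕ).hasSum_iff).2 hs.hasSum
      have hz0 : ‖z 0‖ < ρ := (norm_le_pi_norm z 0).trans_lt hz
      have hzt : ‖(Fin.tail z : Cn n)‖ < ρ := by
        rw [pi_norm_lt_iff hρ]
        exact fun j => (norm_le_pi_norm z j.succ).trans_lt hz
      have h1 : HasSum (fun k => z 0 ^ k * a k (Fin.tail z)) (∑' α, f α) := by
        refine hS.prod_fiberwise fun k => ?_
        refine ((hcs k (Fin.tail z) hzt).mul_left (z 0 ^ k)).congr_fun fun α => ?_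
        simp [hf, Fin.consEquiv, mono, Fin.prod_univ_succ, Fin.tail]
        ring
      have h2 := has (Fin.tail z) (mem_ball_zero_iff.2 (hzt.trans hρR)) (z 0) hz0
      rw [Fin.cons_self_tail] at h2
      rw [← h1.unique h2]
      exact hs.hasSum

/-- The space `ℓ¹(ι)`. -/
abbrev L1 (ι : Type*) : Type _ := lp (fun _ : ι => ℂ) 1

section L1

variable {ι : Type*} {F : Type*} [NormedAddCommGroup F] [NormedSpace ℂ F]

open Classical in
/-- The standard basis of `ℓ¹(ι)`. -/
def bas (γ : ι) : L1 ι := lp.single 1 γ (1 : ℂ)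

lemma bas_apply_self (γ : ι) : (bas γ : L1 ι) γ = 1 := by simp [bas]

lemma bas_apply_ne {γ δ : ι} (h : δ ≠ γ) : (bas γ : L1 ι) δ = 0 := by
  classical
  simp [bas, h]

lemma norm_bas (γ : ι) : ‖(bas γ : L1 ι)‖ = 1 := by
  classical
  rw [bas, lp.norm_single (by norm_num)]; simp

lemma L1_hasSum_norm (y : L1 ι) : HasSum (fun γ => ‖y γ‖) ‖y‖ := by
  simpa using lp.hasSum_norm (p := 1) (by simp) y

lemma L1_hasSum_bas (y : L1 ι) : HasSum (fun γ => y γ • bas γ) y := by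
  classical
  have h := lp.hasSum_single (p := 1) (by simp) y
  refine h.congr_fun fun γ => ?_
  rw [bas, ← lp.single_smul]; simp

/-- The element of `ℓ¹` with given summable coordinates. -/
def L1.mk (c : ι → ℂ) (hc : Summable fun γ => ‖c γ‖) : L1 ι := ⟨c, memℓp_gen (by simpa using hc)⟩

lemma L1.mk_apply (c : ι → ℂ) (hc : Summable fun γ => ‖c γ‖) (γ : ι) : L1.mk c hc γ = c γ := rfl

lemma L1.norm_mk (c : ι → ℂ) (hc : Summable fun γ => ‖c γ‖) : ‖L1.mk c hc‖ = ∑' γ, ‖c γ‖ :=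
  (L1_hasSum_norm (L1.mk c hc)).tsum_eq.symm

lemma L1_summable (y : L1 ι) {k : ι → F} {C : ℝ} (hk : ∀ γ, ‖k γ‖ ≤ C) :
    Summable fun γ => ‖y γ • k γ‖ := by
  refine ((L1_hasSum_norm y).summable.mul_right C).of_nonneg_of_le (fun _ => norm_nonneg _) fun γ => ?_
  rw [norm_smul]
  exact mul_le_mul_of_nonneg_left (hk γ) (norm_nonneg _)

lemma L1.clm_ext {T T' : L1 ι →L[ℂ] F} (h : ∀ γ, T (bas γ) = T' (bas γ)) : T = T' := by
  ext y
  have h1 := (L1_hasSum_bas y).mapL T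
  have h2 := (L1_hasSum_bas y).mapL T'
  simp only [map_smul, h] at h1 h2
  exact h1.unique h2

variable [CompleteSpace F]

/-- The continuous linear map `ℓ¹(ι) → F` determined by a bounded family of vectors. -/
def L1.lift (k : ι → F) (C : ℝ) (hk : ∀ γ, ‖k γ‖ ≤ C) : L1 ι →L[ℂ] F :=
  LinearMap.mkContinuous
    { toFun := fun y => ∑' γ, y γ • k γ
      map_add' := fun y y' => by
        rw [← ((L1_summable y hk).of_norm).tsum_add ((L1_summable y' hk).of_norm)]
        refine tsum_congr fun γ => ?_
        rw [← add_smul]; rfl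
      map_smul' := fun c y => by
        rw [RingHom.id_apply, ← ((L1_summable y hk).of_norm).tsum_const_smul]
        refine tsum_congr fun γ => ?_
        rw [← mul_smul]; rfl } C fun y => by
    refine tsum_of_norm_bounded (((L1_hasSum_norm y).mul_left C)) fun γ => ?_
    rw [norm_smul, mul_comm]
    exact mul_le_mul_of_nonneg_right (hk γ) (norm_nonneg _)

variable {k : ι → F} {C : ℝ} {hk : ∀ γ, ‖k γ‖ ≤ C}

lemma L1.lift_hasSum (y : L1 ι) : HasSum (fun γ => y γ • k γ) (L1.lift k C hk y) :=
  ((L1_summable y hk).of_norm).hasSum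

lemma L1.lift_apply (y : L1 ι) : L1.lift k C hk y = ∑' γ, y γ • k γ := rfl

lemma L1.norm_lift_apply_le (y : L1 ι) : ‖L1.lift k C hk y‖ ≤ C * ‖y‖ :=
  tsum_of_norm_bounded ((L1_hasSum_norm y).mul_left C) fun γ => by
    rw [norm_smul, mul_comm]
    exact mul_le_mul_of_nonneg_right (hk γ) (norm_nonneg _)

lemma L1.lift_bas (γ : ι) : L1.lift k C hk (bas γ) = k γ := by
  rw [L1.lift_apply, tsum_eq_single γ fun δ hδ => by rw [bas_apply_ne hδ, zero_smul],
    bas_apply_self, one_smul]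

/-- A subspace of `ℓ¹` possessing an approximate standard basis relative to its set of initial
exponents is closed. -/
lemma isClosed_of_basis (I : Submodule ℂ (L1 ι)) (S : Set ι) (x : ι → L1 ι)
    (hx : ∀ γ ∈ S, ‖x γ - bas γ‖ ≤ 1 / 2)
    (hI : ∀ A : L1 ι →L[ℂ] L1 ι, (∀ γ ∈ S, A (bas γ) = x γ) → (∀ γ ∉ S, A (bas γ) = 0) → ∀ y, A y ∈ I)
    (h0 : ∀ r ∈ I, (∀ γ ∈ S, r γ = 0) → r = 0) : IsClosed (I : Set (L1 ι)) := by
  classical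
  have hxn : ∀ γ, ‖if γ ∈ S then x γ else 0‖ ≤ 2 := by
    intro γ
    split_ifs with h
    · have h1 := norm_le_norm_add_norm_sub' (x γ) (bas γ)
      rw [norm_bas] at h1
      linarith [hx γ h]
    · simp
  set A : L1 ι →L[ℂ] L1 ι := L1.lift (fun γ => if γ ∈ S then x γ else 0) 2 hxn with hA
  have hbn : ∀ γ, ‖if γ ∈ S then (0 : L1 ι) else bas γ‖ ≤ 1 := by
    intro γ
    split_ifs <;> simp [norm_bas]
  set Bm : L1 ι →L[ℂ] L1 ι := L1.lift (fun γ => if γ ∈ S then 0 else bas γ) 1 hbn with hB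
  have hdn : ∀ γ, ‖if γ ∈ S then bas γ - x γ else 0‖ ≤ 1 / 2 := by
    intro γ
    split_ifs with h
    · rw [norm_sub_rev]; exact hx γ h
    · simp
  set D : L1 ι →L[ℂ] L1 ι := L1.lift (fun γ => if γ ∈ S then bas γ - x γ else 0) (1 / 2) hdn with hD
  have hDn : ‖D‖ < 1 := by
    refine (ContinuousLinearMap.opNorm_le_bound _ (by norm_num) fun y =>
      L1.norm_lift_apply_le y).trans_lt (by norm_num : (1 / 2 : ℝ) < 1)
  set T := Units.oneSub D hDn with hT
  have hTval : (T : L1 ι →L[ℂ] L1 ι) = A + Bm := by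
    rw [hT, Units.val_oneSub]
    refine L1.clm_ext fun γ => ?_
    change bas γ - D (bas γ) = A (bas γ) + Bm (bas γ)
    rw [hD, hA, hB, L1.lift_bas, L1.lift_bas, L1.lift_bas]
    split_ifs <;> simp
  have hAI : ∀ y, A y ∈ I := hI A (fun γ h => by rw [hA, L1.lift_bas, if_pos h])
    fun γ h => by rw [hA, L1.lift_bas, if_neg h]
  have hBS : ∀ y, ∀ γ ∈ S, Bm y γ = 0 := by
    intro y γ hγ
    have h1 := (L1.lift_hasSum (hk := hbn) y).mapL (lp.evalCLM ℂ (fun _ : ι => ℂ) 1 γ)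
    refine h1.unique ?_
    convert hasSum_zero with δ
    by_cases hδ : δ ∈ S
    · simp [hδ]
    · have : γ ≠ δ := fun h => hδ (h ▸ hγ)
      rw [if_neg hδ, map_smul]
      change y δ • (bas δ : L1 ι) γ = 0
      rw [bas_apply_ne this, smul_zero]
  set V : L1 ι →L[ℂ] L1 ι := ((T⁻¹ : (L1 ι →L[ℂ] L1 ι)ˣ) : L1 ι →L[ℂ] L1 ι) with hV
  have hdec : ∀ b, b = A (V b) + Bm (V b) := by
    intro b
    have h1 : ((T : L1 ι →L[ℂ] L1 ι) * V) b = b := by rw [hV, Units.mul_inv]; rfl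
    rw [hTval] at h1
    exact h1.symm
  have hvan : ∀ b ∈ I, Bm (V b) = 0 := by
    intro b hb
    refine h0 _ ?_ (hBS _)
    have : Bm (V b) = b - A (V b) := eq_sub_of_add_eq' (hdec b).symm
    rw [this]
    exact I.sub_mem hb (hAI _)
  have hset : (I : Set (L1 ι)) = {b | Bm (V b) = 0} := by
    ext b
    refine ⟨fun hb => hvan b hb, fun hb => ?_⟩
    have hb' : Bm (V b) = 0 := hb
    rw [hdec b, hb', add_zero]
    exact hAI _
  rw [hset]
  exact isClosed_eq (Bm.continuous.comp V.continuous) continuous_const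

end L1

/-- An injective multiplicative numbering of the exponents `α ∈ ℕⁿ`. -/
def nu (α : Fin n → ℕ) : ℕ := ∏ j : Fin n, Nat.nth Nat.Prime (j : ℕ) ^ α j

lemma prime_nth (k : ℕ) : (Nat.nth Nat.Prime k).Prime :=
  Nat.nth_mem_of_infinite Nat.infinite_setOfPred_prime k

lemma nu_pos (α : Fin n → ℕ) : 0 < nu α :=
  Finset.prod_pos fun j _ => pow_pos (prime_nth j).pos _

lemma nu_add (α β : Fin n → ℕ) : nu (α + β) = nu α * nu β := by
  simp only [nu, Pi.add_apply, pow_add, Finset.prod_mul_distrib]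

lemma nu_injective : Function.Injective (nu : (Fin n → ℕ) → ℕ) := by
  intro α β h
  have key : ∀ (γ : Fin n → ℕ) (i : Fin n), (nu γ).factorization (Nat.nth Nat.Prime i) = γ i := by
    intro γ i
    rw [nu, Nat.factorization_prod fun (j : Fin n) _ => (pow_pos (prime_nth (j : ℕ)).pos (γ j)).ne',
      Finset.sum_apply']
    rw [Finset.sum_eq_single i]
    · rw [(prime_nth i).factorization_pow]; simp
    · intro j _ hj
      rw [(prime_nth j).factorization_pow, Finsupp.single_apply, if_neg]
      intro h'
      exact hj (Fin.ext (Nat.nth_injective Nat.infinite_setOfPred_prime h'))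
    · simp
  funext i
  rw [← key α i, ← key β i, h]

/-- The polyradius `(p_j^{-σ})_j`. -/
def rad (n σ : ℕ) : Cn n := fun j => ((Nat.nth Nat.Prime j : ℂ) ^ σ)⁻¹

lemma mono_rad (σ : ℕ) (α : Fin n → ℕ) : mono α (rad n σ) = ((nu α : ℂ) ^ σ)⁻¹ := by
  simp only [mono, rad, nu, Nat.cast_prod, Nat.cast_pow, ← Finset.prod_pow, ← Finset.prod_inv_distrib]
  refine Finset.prod_congr rfl fun j _ => ?_
  rw [inv_pow, ← pow_mul, ← pow_mul, mul_comm]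

lemma norm_rad_le (σ : ℕ) : ‖rad n σ‖ ≤ (1 / 2) ^ σ := by
  rw [pi_norm_le_iff_of_nonneg (by positivity)]
  intro j
  have : (2 : ℝ) ≤ Nat.nth Nat.Prime j := by exact_mod_cast (prime_nth j).two_le
  simp only [rad, norm_inv, norm_pow, Complex.norm_natCast, one_div, inv_pow]
  gcongr

lemma mono_add (α β : Fin n → ℕ) (z : Cn n) : mono (α + β) z = mono α z * mono β z := by
  simp only [mono, Pi.add_apply, pow_add, Finset.prod_mul_distrib]

lemma continuous_mono (α : Fin n → ℕ) : Continuous (mono α) := by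
  unfold mono; fun_prop

/-- The polydisc on which a series in the weighted `ℓ¹` space converges. -/
def poly (n σ : ℕ) : Set (Cn n) := {z | ∀ j, ‖z j‖ ≤ ‖rad n σ j‖}

lemma poly_mem_nhds (σ : ℕ) : poly n σ ∈ 𝓝 (0 : Cn n) := by
  have h : ∀ j : Fin n, ∀ᶠ z in 𝓝 (0 : Cn n), ‖z j‖ ≤ ‖rad n σ j‖ := by
    intro j
    have hc : Tendsto (fun z : Cn n => ‖z j‖) (𝓝 0) (𝓝 0) := by
      have : Continuous fun z : Cn n => ‖z j‖ := by fun_prop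
      simpa using this.tendsto 0
    refine hc.eventually (Iic_mem_nhds ?_)
    rw [norm_pos_iff, rad]
    exact inv_ne_zero (pow_ne_zero _ (Nat.cast_ne_zero.2 (prime_nth j).ne_zero))
  exact eventually_all.2 h

lemma norm_mono_mul_le {σ : ℕ} {z : Cn n} (hz : z ∈ poly n σ) (α : Fin n → ℕ) :
    ‖mono α z * (nu α : ℂ) ^ σ‖ ≤ 1 := by
  have h1 : ‖mono α z‖ ≤ ‖mono α (rad n σ)‖ := by
    simp only [mono, norm_prod, norm_pow]
    gcongr with j
    exact hz j
  have h2 : (nu α : ℂ) ≠ 0 := Nat.cast_ne_zero.2 (nu_pos α).ne'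
  rw [norm_mul]
  refine (mul_le_mul_of_nonneg_right h1 (norm_nonneg _)).trans (le_of_eq ?_)
  rw [← norm_mul, mono_rad, inv_mul_cancel₀ (pow_ne_zero _ h2), norm_one]

/-- The sum of the power series with coefficients `c`. -/
def evC (c : (Fin n → ℕ) → ℂ) (z : Cn n) : ℂ := ∑' α, c α * mono α z

/-- The power series coefficients attached to an element of `ℓ¹`. -/
def cf (σ : ℕ) (y : L1 (Fin n → ℕ)) (α : Fin n → ℕ) : ℂ := y α * (nu α : ℂ) ^ σ

open Classical in
/-- Evaluation at a point of the polydisc as a functional on `ℓ¹`. -/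
def evL (σ : ℕ) (z : Cn n) : L1 (Fin n → ℕ) →L[ℂ] ℂ :=
  L1.lift (fun α => if z ∈ poly n σ then mono α z * (nu α : ℂ) ^ σ else 0) 1 fun α => by
    split_ifs with h
    · exact norm_mono_mul_le h α
    · simp

lemma evL_eq {σ : ℕ} {z : Cn n} (hz : z ∈ poly n σ) (y : L1 (Fin n → ℕ)) :
    evL σ z y = evC (cf σ y) z := by
  rw [evL, L1.lift_apply, evC]
  refine tsum_congr fun α => ?_
  rw [if_pos hz, cf, smul_eq_mul]; ring

lemma evL_bas {σ : ℕ} {z : Cn n} (hz : z ∈ poly n σ) (α : Fin n → ℕ) :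
    evL σ z (bas α) = mono α z * (nu α : ℂ) ^ σ := by
  rw [evL, L1.lift_bas, if_pos hz]

/-- Multiplication by a normalised monomial. -/
def shift (s : Fin n → ℕ) : L1 (Fin n → ℕ) →L[ℂ] L1 (Fin n → ℕ) :=
  L1.lift (fun β => bas (β + s)) 1 fun _ => (norm_bas _).le

lemma evL_shift {σ : ℕ} {z : Cn n} (hz : z ∈ poly n σ) (s : Fin n → ℕ) (y : L1 (Fin n → ℕ)) :
    evL σ z (shift s y) = mono s z * (nu s : ℂ) ^ σ * evL σ z y := by
  have h : (evL σ z).comp (shift s) = (mono s z * (nu s : ℂ) ^ σ) • evL σ z := by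
    refine L1.clm_ext fun α => ?_
    change evL σ z (shift s (bas α)) = (mono s z * (nu s : ℂ) ^ σ) * evL σ z (bas α)
    rw [shift, L1.lift_bas, evL_bas hz, evL_bas hz, mono_add, nu_add]
    push_cast
    ring
  exact congrArg (fun T : L1 (Fin n → ℕ) →L[ℂ] ℂ => T y) h

lemma eventually_initial_small {c : (Fin n → ℕ) → ℂ} {a : Fin n → ℕ} {σ₀ : ℕ}
    (hs : Summable fun β => ‖c β * ((nu β : ℂ) ^ σ₀)⁻¹‖) (ha : c a = 1)
    (hlow : ∀ β, nu β < nu a → c β = 0) :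
    ∀ᶠ σ in atTop, ∃ u : L1 (Fin n → ℕ), (∀ β, u β = c β * ((nu β : ℂ) ^ σ)⁻¹ * (nu a : ℂ) ^ σ) ∧
      ‖u - bas a‖ ≤ 1 / 2 := by
  have hpos : ∀ β : Fin n → ℕ, (0 : ℝ) < nu β := fun β => by exact_mod_cast nu_pos β
  set q : ℝ := nu a / (nu a + 1) with hq
  have hq0 : 0 ≤ q := by positivity
  have hq1 : q < 1 := by rw [hq, div_lt_one (by positivity)]; linarith
  set S := ∑' β, ‖c β * ((nu β : ℂ) ^ σ₀)⁻¹‖ with hS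
  have hlim : Tendsto (fun τ : ℕ => q ^ τ * ((nu a : ℝ) ^ σ₀ * S)) atTop (𝓝 0) := by
    simpa using (tendsto_pow_atTop_nhds_zero_of_lt_one hq0 hq1).mul_const ((nu a : ℝ) ^ σ₀ * S)
  have hev := hlim.eventually (Iic_mem_nhds (by norm_num : (0 : ℝ) < 1 / 2))
  obtain ⟨τ₀, hτ₀⟩ := eventually_atTop.1 hev
  refine eventually_atTop.2 ⟨σ₀ + τ₀, fun σ hσ => ?_⟩
  obtain ⟨τ, rfl⟩ := Nat.exists_eq_add_of_le (show σ₀ ≤ σ by omega)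
  have hτ := hτ₀ τ (by omega)
  have hsplit : ∀ β, ‖c β * ((nu β : ℂ) ^ (σ₀ + τ))⁻¹ * (nu a : ℂ) ^ (σ₀ + τ)‖ =
      ‖c β * ((nu β : ℂ) ^ σ₀)⁻¹‖ * (nu a : ℝ) ^ σ₀ * ((nu a : ℝ) / nu β) ^ τ := by
    intro β
    simp only [norm_mul, norm_inv, norm_pow, Complex.norm_natCast, pow_add, div_pow]
    field_simp
  have hle : ∀ β, β ≠ a → ‖c β * ((nu β : ℂ) ^ (σ₀ + τ))⁻¹ * (nu a : ℂ) ^ (σ₀ + τ)‖ ≤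
      q ^ τ * ((nu a : ℝ) ^ σ₀ * ‖c β * ((nu β : ℂ) ^ σ₀)⁻¹‖) := by
    intro β hβ
    rcases lt_or_gt_of_ne (fun h => hβ (nu_injective h) : nu β ≠ nu a) with h | h
    · rw [hlow β h]; simp
    · rw [hsplit]
      have : (nu a : ℝ) / nu β ≤ q := by
        rw [hq]
        have : (nu a : ℝ) + 1 ≤ nu β := by exact_mod_cast h
        gcongr
      have h2 : ((nu a : ℝ) / nu β) ^ τ ≤ q ^ τ := by gcongr
      calc _ ≤ ‖c β * ((nu β : ℂ) ^ σ₀)⁻¹‖ * (nu a : ℝ) ^ σ₀ * q ^ τ := by gcongr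
        _ = _ := by ring
  have ha0 : (nu a : ℂ) ≠ 0 := Nat.cast_ne_zero.2 (nu_pos a).ne'
  have hua : c a * ((nu a : ℂ) ^ (σ₀ + τ))⁻¹ * (nu a : ℂ) ^ (σ₀ + τ) = 1 := by
    rw [ha, one_mul, inv_mul_cancel₀ (pow_ne_zero _ ha0)]
  have hsb : Summable fun β => q ^ τ * ((nu a : ℝ) ^ σ₀ * ‖c β * ((nu β : ℂ) ^ σ₀)⁻¹‖) :=
    (hs.mul_left _).mul_left _
  have hsu : Summable fun β => ‖c β * ((nu β : ℂ) ^ (σ₀ + τ))⁻¹ * (nu a : ℂ) ^ (σ₀ + τ)‖ := by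
    refine ((hs.mul_right ((nu a : ℝ) ^ (σ₀ + τ)))).of_nonneg_of_le (fun _ => norm_nonneg _) fun β => ?_
    rw [norm_mul, norm_pow, Complex.norm_natCast]
    refine mul_le_mul_of_nonneg_right ?_ (by positivity)
    simp only [norm_mul, norm_inv, norm_pow, Complex.norm_natCast]
    have : (1 : ℝ) ≤ nu β := by exact_mod_cast nu_pos β
    gcongr
    omega
  refine ⟨L1.mk _ hsu, fun β => rfl, ?_⟩
  refine le_trans ?_ hτ
  rw [← (L1_hasSum_norm _).tsum_eq, hS, ← tsum_mul_left, ← tsum_mul_left]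
  refine (L1_hasSum_norm _).summable.tsum_le_tsum (fun β => ?_) hsb
  change ‖c β * ((nu β : ℂ) ^ (σ₀ + τ))⁻¹ * (nu a : ℂ) ^ (σ₀ + τ) - (bas a : L1 (Fin n → ℕ)) β‖ ≤ _
  by_cases hβ : β = a
  · subst hβ
    rw [hua, bas_apply_self, sub_self, norm_zero]
    positivity
  · rw [bas_apply_ne hβ, sub_zero]
    exact hle β hβ

lemma shift_bas (s α : Fin n → ℕ) : shift s (bas α) = bas (α + s) := L1.lift_bas _

lemma norm_shift_le (s : Fin n → ℕ) (y : L1 (Fin n → ℕ)) : ‖shift s y‖ ≤ ‖y‖ := by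
  simpa [shift] using L1.norm_lift_apply_le (k := fun β => bas (β + s)) (C := 1)
    (hk := fun β => (norm_bas _).le) y

lemma finite_minimal (S : Set (Fin n → ℕ)) : {a | Minimal (· ∈ S) a}.Finite := by
  have h : IsAntichain (· ≤ ·) {a | Minimal (· ∈ S) a} := setOfPred_minimal_antichain _
  exact WellQuasiOrderedLE.finite_of_isAntichain h

set_option maxHeartbeats 1000000 in
/-- A module of germs which is closed under approximation of the power series coefficients. -/
theorem mem_of_approx (Q : (Cn n → ℂ) → Prop) (hz : Q fun _ => 0)
    (hadd : ∀ f g, Q f → Q g → Q fun z => f z + g z)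
    (hmul : ∀ f q, Q f → (∃ U ∈ 𝓝 (0 : Cn n), ContinuousOn q U) → Q fun z => q z * f z)
    (hcongr : ∀ f g, f =ᶠ[𝓝 (0 : Cn n)] g → Q f → Q g)
    {b : (Fin n → ℕ) → ℂ} {ρ B : ℝ} (hρ : 0 < ρ) (hb : ∀ α, ‖b α‖ * ρ ^ (∑ j, α j) ≤ B)
    (happ : ∀ δ > 0, ∃ d : (Fin n → ℕ) → ℂ, (∀ α, ‖d α‖ * ρ ^ (∑ j, α j) ≤ δ) ∧
      Q (evC fun α => b α - d α)) : Q (evC b) := by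
  classical
  set S : Set (Fin n → ℕ) := {γ | ∃ (c : (Fin n → ℕ) → ℂ) (σ₀ : ℕ),
    Summable (fun β => ‖c β * ((nu β : ℂ) ^ σ₀)⁻¹‖) ∧ Q (evC c) ∧ c γ = 1 ∧
      ∀ β, nu β < nu γ → c β = 0} with hSdef
  have hS : ∀ γ ∈ S, ∃ (c : (Fin n → ℕ) → ℂ) (σ₀ : ℕ),
    Summable (fun β => ‖c β * ((nu β : ℂ) ^ σ₀)⁻¹‖) ∧ Q (evC c) ∧ c γ = 1 ∧
      ∀ β, nu β < nu γ → c β = 0 := fun γ hγ => hγ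
  choose! c σ₀ hsum hQ h1 hlow using hS
  set A : Set (Fin n → ℕ) := {a | Minimal (· ∈ S) a} with hA
  have hAfin : A.Finite := finite_minimal S
  have hAS : ∀ a ∈ A, a ∈ S := fun a ha => Minimal.prop ha
  have hmin : ∀ γ ∈ S, ∃ a ∈ A, a ≤ γ := fun γ hγ => by
    obtain ⟨a, h, h'⟩ := exists_minimal_le_of_wellFoundedLT (· ∈ S) γ hγ
    exact ⟨a, h', h⟩
  choose! π hπA hπle using hmin
  have hev : ∀ᶠ σ in atTop, ∀ a ∈ A, ∃ u : L1 (Fin n → ℕ),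
      (∀ β, u β = c a β * ((nu β : ℂ) ^ σ)⁻¹ * (nu a : ℂ) ^ σ) ∧ ‖u - bas a‖ ≤ 1 / 2 :=
    (Filter.eventually_all_finite hAfin).2 fun a ha =>
      eventually_initial_small (hsum a (hAS a ha)) (h1 a (hAS a ha)) (hlow a (hAS a ha))
  have hrad : ∀ᶠ σ : ℕ in atTop, (1 / 2 : ℝ) ^ σ < ρ :=
    (tendsto_pow_atTop_nhds_zero_of_lt_one (by norm_num) (by norm_num)).eventually (Iio_mem_nhds hρ)
  obtain ⟨σ, hσ, hσρ⟩ := (hev.and hrad).exists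
  choose! u hu hub using hσ
  have hnu : ∀ β : Fin n → ℕ, (nu β : ℂ) ^ σ ≠ 0 := fun β =>
    pow_ne_zero _ (Nat.cast_ne_zero.2 (nu_pos β).ne')
  have hconst : ∀ f (k : ℂ), Q f → Q fun z => k * f z := fun f k hf =>
    hmul f (fun _ => k) hf ⟨Set.univ, univ_mem, continuousOn_const⟩
  have hevQ : ∀ (y : L1 (Fin n → ℕ)) (c' : (Fin n → ℕ) → ℂ) (k : ℂ),
      (∀ β, cf σ y β = k * c' β) → Q (evC c') → Q fun z => evL σ z y := by
    intro y c' k hk h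
    refine hcongr _ _ ?_ (hconst _ k h)
    filter_upwards [poly_mem_nhds σ] with z hzp
    rw [evL_eq hzp, evC, evC, ← tsum_mul_left]
    exact tsum_congr fun α => by rw [hk]; ring
  let I : Submodule ℂ (L1 (Fin n → ℕ)) :=
    { carrier := {y | Q fun z => evL σ z y}
      add_mem' := fun {y y'} h h' => by
        have := hadd _ _ h h'
        simpa only [Set.mem_ofPred_eq, map_add] using this
      zero_mem' := by simpa using hz
      smul_mem' := fun k y h => by
        have := hconst _ k h
        simpa only [Set.mem_ofPred_eq, map_smul, smul_eq_mul] using this }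
  have hQu : ∀ a ∈ A, Q fun z => evL σ z (u a) := by
    intro a ha
    refine hevQ _ (c a) ((nu a : ℂ) ^ σ) (fun β => ?_) (hQ a (hAS a ha))
    rw [cf, hu a ha]
    field_simp [hnu β]
  have hclosed : IsClosed (I : Set (L1 (Fin n → ℕ))) := by
    refine isClosed_of_basis I S (fun γ => shift (γ - π γ) (u (π γ))) ?_ ?_ ?_
    · intro γ hγ
      have : (bas γ : L1 (Fin n → ℕ)) = shift (γ - π γ) (bas (π γ)) := by
        rw [shift_bas, add_tsub_cancel_of_le (hπle γ hγ)]
      rw [this, ← map_sub]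
      exact (norm_shift_le _ _).trans (hub _ (hπA γ hγ))
    · intro T hTS hT0 y
      set mq : (Fin n → ℕ) → Cn n → ℂ := fun a z => ∑' γ, y γ *
        (if γ ∈ S ∧ π γ = a then mono (γ - a) z * (nu (γ - a) : ℂ) ^ σ else 0) with hmq
      have hbd : ∀ a γ z, z ∈ poly n σ → ‖y γ *
          (if γ ∈ S ∧ π γ = a then mono (γ - a) z * (nu (γ - a) : ℂ) ^ σ else 0)‖ ≤ ‖y γ‖ := by
        intro a γ z hzp
        rw [norm_mul]
        refine mul_le_of_le_one_right (norm_nonneg _) ?_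
        split_ifs
        · exact norm_mono_mul_le hzp _
        · simp
      have hcont : ∀ a, ContinuousOn (mq a) (poly n σ) := by
        intro a
        refine continuousOn_tsum (fun γ => ?_) (L1_hasSum_norm y).summable (hbd a)
        refine continuousOn_const.mul ?_
        split_ifs
        · exact ((continuous_mono _).mul continuous_const).continuousOn
        · exact continuousOn_const
      have hfin : ∀ s : Finset (Fin n → ℕ), (∀ a ∈ s, a ∈ A) →
          Q fun z => ∑ a ∈ s, mq a z * evL σ z (u a) := by
        intro s
        induction s using Finset.induction_on with
        | empty => intro _; simpa using hz
        | insert a s has ih =>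
          intro h
          simp only [Finset.sum_insert has]
          exact hadd _ _ (hmul _ _ (hQu a (h a (Finset.mem_insert_self a s)))
            ⟨_, poly_mem_nhds σ, hcont a⟩) (ih fun b hb => h b (Finset.mem_insert_of_mem hb))
      refine hcongr _ _ ?_ (hfin hAfin.toFinset fun a ha => hAfin.mem_toFinset.1 ha)
      filter_upwards [poly_mem_nhds σ] with z hzp
      have hl : HasSum (fun γ => evL σ z (T (y γ • bas γ))) (evL σ z (T y)) :=
        ((L1_hasSum_bas y).mapL T).mapL (evL σ z)
      have hr : HasSum (fun γ => ∑ a ∈ hAfin.toFinset, (y γ *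
          (if γ ∈ S ∧ π γ = a then mono (γ - a) z * (nu (γ - a) : ℂ) ^ σ else 0)) * evL σ z (u a))
          (∑ a ∈ hAfin.toFinset, mq a z * evL σ z (u a)) := by
        refine hasSum_sum fun a _ => HasSum.mul_right _ ?_
        exact (((L1_hasSum_norm y).summable.of_nonneg_of_le (fun _ => norm_nonneg _)
          fun γ => hbd a γ z hzp).of_norm).hasSum
      refine (hr.congr_fun fun γ => ?_).unique hl
      by_cases hγ : γ ∈ S
      · rw [Finset.sum_eq_single (π γ)]
        · rw [if_pos ⟨hγ, rfl⟩, map_smul, map_smul, hTS γ hγ, evL_shift hzp, smul_eq_mul]; ring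
        · intro a _ ha
          rw [if_neg fun h => ha h.2.symm]; simp
        · intro h
          exact absurd (hAfin.mem_toFinset.2 (hπA γ hγ)) h
      · rw [map_smul, hT0 γ hγ]
        simp [hγ]
    · intro r hr h0
      by_contra hne
      have hT : {γ | r γ ≠ 0}.Nonempty := by
        by_contra hemp
        refine hne (lp.ext (funext fun γ => ?_))
        by_contra h
        exact hemp ⟨γ, h⟩
      obtain ⟨γ, hγ, hγmin⟩ := (measure (nu : (Fin n → ℕ) → ℕ)).wf.has_min _ hT
      refine hγ (h0 γ ⟨fun β => ((r γ)⁻¹ * ((nu γ : ℂ) ^ σ)⁻¹) * cf σ r β, σ, ?_, ?_, ?_, ?_⟩)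
      · refine ((L1_hasSum_norm r).summable.mul_left ‖(r γ)⁻¹ * ((nu γ : ℂ) ^ σ)⁻¹‖).congr fun β => ?_
        simp only [cf]
        rw [← norm_mul, ← mul_assoc, mul_assoc _ _ (((nu β : ℂ) ^ σ)⁻¹), mul_inv_cancel₀ (hnu β),
          mul_one]
      · refine hcongr _ _ ?_ (hconst _ ((r γ)⁻¹ * ((nu γ : ℂ) ^ σ)⁻¹) hr)
        filter_upwards [poly_mem_nhds σ] with z hzp
        rw [evL_eq hzp, evC, evC, ← tsum_mul_left]
        exact tsum_congr fun α => by ring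
      · have h2 : r γ ≠ 0 := hγ
        have h3 := hnu γ
        simp only [cf]; field_simp
      · intro β hβ
        have : r β = 0 := by
          by_contra h
          exact hγmin β h hβ
        simp [cf, this]
  have hr : ‖rad n σ‖ < ρ := (norm_rad_le σ).trans_lt hσρ
  have hcoef : ∀ (d : (Fin n → ℕ) → ℂ) (γ), d γ * ((nu γ : ℂ) ^ σ)⁻¹ = d γ * mono γ (rad n σ) :=
    fun d γ => by rw [mono_rad]
  have hsumd : ∀ (d : (Fin n → ℕ) → ℂ) (B : ℝ), (∀ α, ‖d α‖ * ρ ^ (∑ j, α j) ≤ B) →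
      Summable fun γ => ‖d γ * ((nu γ : ℂ) ^ σ)⁻¹‖ := by
    intro d B hd
    simp only [hcoef]
    exact summable_norm_mul_mono hρ hd hr
  have hcfmk : ∀ (d : (Fin n → ℕ) → ℂ) (hd : Summable fun γ => ‖d γ * ((nu γ : ℂ) ^ σ)⁻¹‖) β,
      cf σ (L1.mk _ hd) β = d β := fun d hd β => by
    rw [cf, L1.mk_apply, mul_assoc, inv_mul_cancel₀ (hnu β), mul_one]
  have hmem : L1.mk _ (hsumd b B hb) ∈ (I : Set (L1 (Fin n → ℕ))) := by
    rw [← hclosed.closure_eq, Metric.mem_closure_iff]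
    intro ε hε
    set K := ∑' γ : Fin n → ℕ, ∏ j, (‖rad n σ j‖ / ρ) ^ γ j with hK
    have hK0 : 0 ≤ K := tsum_nonneg fun γ => Finset.prod_nonneg fun j _ => by positivity
    obtain ⟨d, hd, hdQ⟩ := happ (ε / (K + 1)) (by positivity)
    refine ⟨L1.mk _ (hsumd b B hb) - L1.mk _ (hsumd d _ hd), ?_, ?_⟩
    · refine hevQ _ _ 1 (fun β => ?_) hdQ
      have e1 := hcfmk b (hsumd b B hb) β
      have e2 := hcfmk d (hsumd d _ hd) β
      rw [one_mul, ← e1, ← e2, cf, cf, cf]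
      change (L1.mk _ (hsumd b B hb) β - L1.mk _ (hsumd d _ hd) β) * _ = _
      ring
    · rw [dist_eq_norm, sub_sub_cancel, L1.norm_mk]
      have hsb := summable_bound (ε / (K + 1)) hρ hr
      calc _ ≤ ∑' γ : Fin n → ℕ, (ε / (K + 1)) * ∏ j, (‖rad n σ j‖ / ρ) ^ γ j := by
            refine (hsumd d _ hd).tsum_le_tsum (fun γ => ?_) hsb
            rw [hcoef]
            exact norm_mul_mono_le hρ hd _ _
        _ = (ε / (K + 1)) * K := by rw [tsum_mul_left]
        _ < ε := by
            rw [div_mul_eq_mul_div, div_lt_iff₀ (by positivity)]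
            nlinarith
  have hfin : Q fun z => evL σ z (L1.mk _ (hsumd b B hb)) := hmem
  refine hcongr _ _ ?_ hfin
  filter_upwards [poly_mem_nhds σ] with z hzp
  rw [evL_eq hzp, evC, evC]
  exact tsum_congr fun α => by rw [hcfmk]

/-- Interior sup bound for holomorphic functions by the `L²` norm. -/
lemma exists_sup_le_lintegral (n : ℕ) {ε : ℝ} (hε : 0 < ε) : ∃ K : ℝ≥0∞, K ≠ ⊤ ∧
    ∀ (G : Cn n → ℂ) (x : Cn n) (R : ℝ), ε < R → DifferentiableOn ℂ G (Metric.ball x R) →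
      ‖G x‖ₑ ^ 2 ≤ K * ∫⁻ y in Metric.ball x ε, ‖G y‖ₑ ^ 2 := by
  classical
  obtain ⟨A, hA⟩ := (hasCompactSupport_moll (n := n) hε).exists_bound_of_continuous
    (contDiff_moll ε).continuous
  refine ⟨ENNReal.ofReal A, ENNReal.ofReal_ne_top, fun G x R hR hG => ?_⟩
  have hm : Measurable fun y : Cn n => ENNReal.ofReal (moll ε y) :=
    (contDiff_moll ε).continuous.measurable.ennreal_ofReal
  set μ : Measure (Cn n) := volume.withDensity fun y => ENNReal.ofReal (moll ε y) with hμ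
  have : IsProbabilityMeasure μ := ⟨by
    rw [hμ, withDensity_apply _ MeasurableSet.univ, Measure.restrict_univ, lintegral_moll hε]⟩
  set h : Cn n → ℝ≥0∞ := (Metric.ball x ε).indicator fun y => ‖G y‖ₑ with hh
  have hc : ContinuousOn (fun y => ‖G y‖ₑ) (Metric.ball x ε) :=
    (hG.continuousOn.mono (Metric.ball_subset_ball hR.le)).enorm
  have hhm : Measurable h := by
    have := hc.measurable_piecewise (g := 0) (s := Metric.ball x ε) continuousOn_const
      measurableSet_ball
    rwa [Set.piecewise_eq_indicator] at this
  have hhx : Measurable fun y => h (x + y) := hhm.comp (measurable_const_add x)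
  have e2 : ‖G x‖ₑ ≤ ∫⁻ y, h (x + y) ∂μ := by
    rw [hμ, lintegral_withDensity_eq_lintegral_mul _ hm hhx]
    nth_rw 1 [← integral_moll_holo hε hR hG]
    refine (enorm_integral_le_lintegral_enorm _).trans (lintegral_mono fun y => ?_)
    simp only [Pi.mul_apply]
    rw [enorm_smul, Real.enorm_of_nonneg (moll_nonneg ε y)]
    by_cases hy : ‖y‖ < ε
    · rw [hh, Set.indicator_of_mem (by simpa [Metric.mem_ball, dist_eq_norm] using hy)]
    · rw [moll_eq_zero hε (not_lt.1 hy)]; simp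
  calc ‖G x‖ₑ ^ 2 ≤ (∫⁻ y, h (x + y) ∂μ) ^ 2 := by gcongr
    _ ≤ ∫⁻ y, h (x + y) ^ 2 ∂μ := sq_lintegral_le_of_prob hhx.aemeasurable
    _ = ∫⁻ y, ENNReal.ofReal (moll ε y) * h (x + y) ^ 2 := by
      rw [hμ, lintegral_withDensity_eq_lintegral_mul _ hm (hhx.pow_const 2)]
      rfl
    _ ≤ ∫⁻ y, ENNReal.ofReal A * h (x + y) ^ 2 := by
      refine lintegral_mono fun y => ?_
      gcongr
      exact (le_abs_self _).trans (hA y)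
    _ = ENNReal.ofReal A * ∫⁻ y, h y ^ 2 := by
      rw [lintegral_const_mul _ (hhx.pow_const 2)]
      congr 1
      exact lintegral_add_left_eq_self (μ := volume) (fun y => h y ^ 2) x
    _ = _ := by
      congr 1
      rw [← lintegral_indicator measurableSet_ball]
      refine lintegral_congr fun y => ?_
      rw [hh]
      by_cases hy : y ∈ Metric.ball x ε
      · simp [hy]
      · simp [hy]

lemma continuousOn_evC {c : (Fin n → ℕ) → ℂ} {ρ B : ℝ} (hρ : 0 < ρ)
    (hc : ∀ α, ‖c α‖ * ρ ^ (∑ j, α j) ≤ B) : ContinuousOn (evC c) (Metric.closedBall 0 (ρ / 2)) := by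
  have hB : 0 ≤ B := (by positivity : (0 : ℝ) ≤ ‖c 0‖ * ρ ^ _).trans (hc 0)
  have hsum : Summable fun α : Fin n → ℕ => B * ∏ j, (1 / 2 : ℝ) ^ α j :=
    (summable_prod_pow (fun _ => by norm_num) fun _ => by norm_num).mul_left B
  refine continuousOn_tsum (fun α => (continuous_const.mul (continuous_mono α)).continuousOn) hsum ?_
  intro α z hz
  refine (norm_mul_mono_le hρ hc z α).trans ?_
  refine mul_le_mul_of_nonneg_left (Finset.prod_le_prod (fun j _ => by positivity) fun j _ =>
    pow_le_pow_left₀ (by positivity) ?_ _) hB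
  rw [div_le_iff₀ hρ]
  have := (norm_le_pi_norm z j).trans (mem_closedBall_zero_iff.1 hz)
  linarith

lemma exists_subseq_coeff {d : ℕ → (Fin n → ℕ) → ℂ} {ρ B : ℝ} (hρ : 0 < ρ)
    (hd : ∀ k α, ‖d k α‖ * ρ ^ (∑ j, α j) ≤ B) : ∃ (d' : (Fin n → ℕ) → ℂ) (φ : ℕ → ℕ),
      StrictMono φ ∧ (∀ α, ‖d' α‖ * ρ ^ (∑ j, α j) ≤ B) ∧
      ∀ z : Cn n, ‖z‖ < ρ → Tendsto (fun k => evC (d (φ k)) z) atTop (𝓝 (evC d' z)) := by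
  have hK : IsCompact (Set.univ.pi fun α : Fin n → ℕ =>
      Metric.closedBall (0 : ℂ) (B / ρ ^ (∑ j, α j))) :=
    isCompact_univ_pi fun α => isCompact_closedBall _ _
  obtain ⟨d', hd', φ, hφ, hlim⟩ := hK.tendsto_subseq (x := d) fun k α _ => by
    rw [mem_closedBall_zero_iff, le_div_iff₀ (by positivity)]
    exact hd k α
  refine ⟨d', φ, hφ, fun α => ?_, fun z hz => ?_⟩
  · have := hd' α trivial
    rwa [mem_closedBall_zero_iff, le_div_iff₀ (by positivity)] at this
  · refine tendsto_tsum_of_dominated_convergence (summable_bound B hρ hz) (fun α => ?_)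
      (Eventually.of_forall fun k α => norm_mul_mono_le hρ (hd _) z α)
    exact ((tendsto_pi_nhds.1 hlim) α).mul_const _

set_option maxHeartbeats 1000000 in
/-- Approximation, in terms of power series coefficients, of a function with finite weighted `L²`
norm by functions which remain integrable against a slightly more singular weight. -/
lemma exists_coeff_approx {R : ℝ} (hR : 0 < R) {f : Cn n → ℂ}
    (hf : DifferentiableOn ℂ f (Metric.ball 0 R))
    {G : Cn n → ℝ≥0∞} (hJ : ∫⁻ z in Metric.ball 0 R, ‖f z‖ₑ ^ 2 * G z ≠ ⊤) {P : ℕ → Cn n → ℝ} {C : ℝ}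
    (hPs : ∀ k, ContDiff ℝ ∞ (P k)) (hPl : ∀ k, ∀ z ∈ Metric.ball (0 : Cn n) R, ∀ a, 0 ≤ levi (P k) z a)
    (hPC : ∀ k, ∀ z ∈ Metric.ball (0 : Cn n) R, P k z ≤ C)
    (hPG : ∀ k, ∀ z ∈ Metric.ball (0 : Cn n) R, ENNReal.ofReal (Real.exp (-2 * P k z)) ≤ G z)
    (hGP : ∀ z ∈ Metric.ball (0 : Cn n) R,
      G z ≤ liminf (fun k => ENNReal.ofReal (Real.exp (-2 * P k z))) atTop)
    {ψ : Cn n → EReal} {C' : ℝ} {r : ℕ → Cn n → ℝ} (hr : IsRegularization ψ R C' r)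
    (hb : ∀ᵐ z : Cn n, z ∈ Metric.ball (0 : Cn n) R → ψ z ≠ ⊥) :
    ∃ ρ > 0, ∃ (b : (Fin n → ℕ) → ℂ) (B : ℝ), (∀ α, ‖b α‖ * ρ ^ (∑ j, α j) ≤ B) ∧
      f =ᶠ[𝓝 0] evC b ∧ ∀ ε > 0, ∃ d : (Fin n → ℕ) → ℂ, (∀ α, ‖d α‖ * ρ ^ (∑ j, α j) ≤ ε) ∧
        (∃ U ∈ 𝓝 (0 : Cn n), ContinuousOn (evC fun α => b α - d α) U) ∧ ∃ s > 0,
        IntNear fun z => ‖evC (fun α => b α - d α) z‖ₑ ^ 2 * (G z * wexp (-2 * s) ψ z) := by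
  set R' := R / (8 * (n + 1)) with hR'
  have hR'0 : 0 < R' := by positivity
  have hRR' : 8 * (n + 1) * R' = R := by rw [hR']; field_simp
  have hn0 : (0 : ℝ) ≤ n := n.cast_nonneg
  have hR'R : 8 * R' ≤ R := by nlinarith
  set ρ := R' / 2 with hρ
  have hρ0 : 0 < ρ := by positivity
  have hρR' : ρ < R' := by linarith
  have hsub : ∀ y : Cn n, ‖y‖ < 2 * R' → y ∈ {z : Cn n | nsq z ≤ R ^ 2 / 5} := by
    intro y hy
    have h1 := nsq_le y
    have h2 : 4 * (n + 1) * ‖y‖ ≤ R := by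
      rw [← hRR']; nlinarith
    have h3 : (4 * (n + 1) * ‖y‖) ^ 2 ≤ R ^ 2 := by gcongr
    change nsq y ≤ R ^ 2 / 5
    have h4 : n * ‖y‖ ^ 2 ≤ (n + 1) ^ 2 * ‖y‖ ^ 2 := by
      gcongr; nlinarith
    nlinarith [sq_nonneg R]
  obtain ⟨K, hK, hsup⟩ := exists_sup_le_lintegral n hR'0
  obtain ⟨B, hB⟩ := (isCompact_closedBall (0 : Cn n) R').exists_bound_of_continuousOn
    (hf.continuousOn.mono (Metric.closedBall_subset_ball (by linarith)))
  obtain ⟨b, hbB, hbs⟩ := exists_taylor hρ0 hρR'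
    (hf.mono (Metric.ball_subset_ball (by linarith))) fun z hz => hB z (Metric.ball_subset_closedBall hz)
  refine ⟨ρ, hρ0, b, B, hbB, ?_, fun ε hε => ?_⟩
  · filter_upwards [Metric.ball_mem_nhds (0 : Cn n) hρ0] with z hz
    exact (hbs z (mem_ball_zero_iff.1 hz)).tsum_eq.symm
  set δ : ℝ≥0∞ := ENNReal.ofReal ε ^ 2 / (K + 1) with hδ
  have hδ0 : δ ≠ 0 := by
    rw [hδ]
    refine (ENNReal.div_pos ?_ (by simpa using hK)).ne'
    exact pow_ne_zero _ (by simpa using hε)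
  have hδK : K * δ ≤ ENNReal.ofReal ε ^ 2 := by
    calc K * δ ≤ (K + 1) * δ := by gcongr; exact le_self_add
      _ ≤ _ := ENNReal.mul_div_le
  obtain ⟨s, hs, M, hM, hF⟩ := exists_approx hR hf hJ hPs hPl hPC hPG hr hb hδ0
  choose F hFd hFδ hFM using hF
  have hsupk : ∀ k, ∀ x ∈ Metric.ball (0 : Cn n) R', ‖f x - F k x‖ ≤ ε := by
    intro k x hx
    have hx' := mem_ball_zero_iff.1 hx
    have h1 := hsup (fun z => f z - F k z) x (R - R') (by linarith)
      ((hf.sub (hFd k).differentiableOn).mono (by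
        refine Metric.ball_subset_ball' ?_
        rw [dist_zero_right]; linarith))
    have h2 : ∫⁻ y in Metric.ball x R', ‖f y - F k y‖ₑ ^ 2 ≤ δ := by
      refine (lintegral_mono_set fun y hy => ?_).trans (hFδ k)
      refine hsub y ?_
      have h3 : ‖y - x‖ < R' := mem_ball_iff_norm.1 hy
      have h4 := norm_add_le (y - x) x
      rw [sub_add_cancel] at h4
      linarith
    have h3 : ‖f x - F k x‖ₑ ^ 2 ≤ ENNReal.ofReal ε ^ 2 :=
      (h1.trans (mul_le_mul_right h2 K)).trans hδK
    have h4 : ‖f x - F k x‖ₑ ≤ ENNReal.ofReal ε := (ENNReal.pow_right_strictMono two_ne_zero).le_iff_le.1 h3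
    rwa [← ofReal_norm, ENNReal.ofReal_le_ofReal_iff hε.le] at h4
  choose d hdε hds using fun k => exists_taylor hρ0 hρR'
    ((hf.sub (hFd k).differentiableOn).mono (Metric.ball_subset_ball (by linarith))) (hsupk k)
  obtain ⟨d', φ, hφ, hd', hlim⟩ := exists_subseq_coeff hρ0 hdε
  have hbd : ∀ α, ‖b α - d' α‖ * ρ ^ (∑ j, α j) ≤ B + ε := fun α => by
    calc _ ≤ (‖b α‖ + ‖d' α‖) * ρ ^ (∑ j, α j) := by gcongr; exact norm_sub_le _ _
      _ ≤ _ := by rw [add_mul]; exact add_le_add (hbB α) (hd' α)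
  refine ⟨d', hd', ⟨_, Metric.closedBall_mem_nhds 0 (by positivity), continuousOn_evC hρ0 hbd⟩, s, hs,
    Metric.ball 0 ρ, Metric.ball_mem_nhds 0 hρ0, ?_⟩
  have hlimF : ∀ z ∈ Metric.ball (0 : Cn n) ρ,
      Tendsto (fun k => F (φ k) z) atTop (𝓝 (evC (fun α => b α - d' α) z)) := by
    intro z hz
    have hz' := mem_ball_zero_iff.1 hz
    have e1 : evC (fun α => b α - d' α) z = f z - evC d' z := by
      rw [evC, evC, ← (hbs z hz').tsum_eq,
        ← (hbs z hz').summable.tsum_sub (summable_norm_mul_mono hρ0 hd' hz').of_norm]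
      exact tsum_congr fun α => by ring
    rw [e1]
    refine (tendsto_const_nhds.sub (hlim z hz')).congr fun k => ?_
    rw [evC, (hds (φ k) z hz').tsum_eq]
    simp
  calc ∫⁻ z in Metric.ball 0 ρ, ‖evC (fun α => b α - d' α) z‖ₑ ^ 2 * (G z * wexp (-2 * s) ψ z)
      ≤ ∫⁻ z in Metric.ball 0 ρ, liminf (fun k => ‖F (φ k) z‖ₑ ^ 2 *
        (ENNReal.ofReal (Real.exp (-2 * P (φ k) z)) *
          ENNReal.ofReal (Real.exp (-2 * s * r (φ k) z)))) atTop := by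
        refine setLIntegral_mono' measurableSet_ball fun z hz => ?_
        have hzR : z ∈ Metric.ball (0 : Cn n) R := Metric.ball_subset_ball (by linarith) hz
        have h1 : G z ≤ liminf (fun k => ENNReal.ofReal (Real.exp (-2 * P (φ k) z))) atTop :=
          (hGP z hzR).trans (liminf_le_liminf_of_le hφ.tendsto_atTop)
        have h2 : wexp (-2 * s) ψ z ≤
            liminf (fun k => ENNReal.ofReal (Real.exp (-2 * s * r (φ k) z))) atTop :=
          (hr.wexp_le_liminf hs hzR).trans (liminf_le_liminf_of_le hφ.tendsto_atTop)
        have h3 : ‖evC (fun α => b α - d' α) z‖ₑ ^ 2 ≤ liminf (fun k => ‖F (φ k) z‖ₑ ^ 2) atTop :=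
          ((ENNReal.continuous_pow 2).tendsto _ |>.comp (hlimF z hz).enorm).liminf_eq.ge
        calc _ ≤ _ := mul_le_mul' h3 (mul_le_mul' h1 h2)
          _ ≤ _ := mul_le_mul' le_rfl ENNReal.le_liminf_mul
          _ ≤ _ := ENNReal.le_liminf_mul
    _ ≤ liminf (fun k => ∫⁻ z in Metric.ball 0 ρ, ‖F (φ k) z‖ₑ ^ 2 *
        (ENNReal.ofReal (Real.exp (-2 * P (φ k) z)) *
          ENNReal.ofReal (Real.exp (-2 * s * r (φ k) z)))) atTop := by
        refine lintegral_liminf_le fun k => ?_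
        have c1 := (hFd (φ k)).continuous.measurable
        have c2 := (hPs (φ k)).continuous.measurable
        have c3 := (hr.smooth (φ k)).continuous.measurable
        fun_prop
    _ ≤ M := by
        refine liminf_le_of_le (by isBoundedDefault) fun A hA => ?_
        obtain ⟨k, hk⟩ := hA.exists
        refine hk.trans ((lintegral_mono_set fun y hy => ?_).trans (hFM (φ k)))
        exact hsub y (by have := mem_ball_zero_iff.1 hy; linarith)
    _ < ⊤ := hM.lt_top

/-- Measurability near the origin. -/
def MeasNear (g : Cn n → ℝ≥0∞) : Prop := ∃ U ∈ 𝓝 (0 : Cn n), AEMeasurable g (volume.restrict U)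

lemma MeasNear.mul {g h : Cn n → ℝ≥0∞} (hg : MeasNear g) (hh : MeasNear h) :
    MeasNear fun z => g z * h z := by
  obtain ⟨U, hU, hg⟩ := hg
  obtain ⟨V, hV, hh⟩ := hh
  exact ⟨U ∩ V, inter_mem hU hV, (hg.mono_measure (Measure.restrict_mono Set.inter_subset_left le_rfl)).mul
    (hh.mono_measure (Measure.restrict_mono Set.inter_subset_right le_rfl))⟩

lemma measurable_expE_mul (c : ℝ) : Measurable fun x : EReal => expE ((c : EReal) * x) := by
  classical
  have : (fun x : EReal => expE ((c : EReal) * x)) = fun x => if x = ⊥ then expE ((c : EReal) * ⊥) else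
      if x = ⊤ then expE ((c : EReal) * ⊤) else ENNReal.ofReal (Real.exp (c * x.toReal)) := by
    funext x
    induction x with
    | bot => simp
    | top => simp
    | coe x => rw [← EReal.coe_mul, expE_coe]; simp
  rw [this]
  refine Measurable.ite (measurableSet_singleton _) measurable_const
    (Measurable.ite (measurableSet_singleton _) measurable_const ?_)
  fun_prop

lemma measNear_wexp {u : Cn n → EReal} (hu : PSHNear u) (c : ℝ) : MeasNear (wexp c u) := by
  obtain ⟨U, hU0, hU, hp⟩ := hu
  refine ⟨U, hU0, aemeasurable_restrict_of_measurable_subtype hU.measurableSet ?_⟩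
  exact (measurable_expE_mul c).comp
    (UpperSemicontinuous.measurable (upperSemicontinuousOn_iff_restrict.2 hp.usc))

lemma measNear_enorm_sq {f : Cn n → ℂ} (hf : ∃ U ∈ 𝓝 (0 : Cn n), ContinuousOn f U) :
    MeasNear fun z => ‖f z‖ₑ ^ 2 := by
  obtain ⟨U, hU, hf⟩ := hf
  refine ⟨interior U, interior_mem_nhds.2 hU, ?_⟩
  exact ((hf.mono interior_subset).aemeasurable isOpen_interior.measurableSet).enorm.pow_const 2

lemma HoloNear.continuousOn {f : Cn n → ℂ} (hf : HoloNear f) : ∃ U ∈ 𝓝 (0 : Cn n), ContinuousOn f U := by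
  obtain ⟨U, hU, _, h⟩ := hf
  exact ⟨U, hU, h.continuousOn⟩

lemma IntNear.mono_ae {g h : Cn n → ℝ≥0∞} {C : ℝ≥0∞} (hC : C ≠ ⊤) (hh : IntNear h)
    {V : Set (Cn n)} (hV : V ∈ 𝓝 0) (hle : ∀ᵐ z : Cn n, z ∈ V → g z ≤ C * h z) : IntNear g := by
  obtain ⟨U, hU, hint⟩ := hh
  refine ⟨interior (U ∩ V), interior_mem_nhds.2 (inter_mem hU hV), ?_⟩
  calc ∫⁻ z in interior (U ∩ V), g z ≤ ∫⁻ z in interior (U ∩ V), C * h z := by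
        refine setLIntegral_mono_ae' isOpen_interior.measurableSet ?_
        filter_upwards [hle] with z hz hzU
        exact hz (interior_subset hzU).2
    _ = C * ∫⁻ z in interior (U ∩ V), h z := lintegral_const_mul' _ _ hC
    _ ≤ C * ∫⁻ z in U, h z := by
        gcongr
        exact interior_subset.trans Set.inter_subset_left
    _ < ⊤ := ENNReal.mul_lt_top hC.lt_top hint

lemma IntNear.mono {g h : Cn n → ℝ≥0∞} {C : ℝ≥0∞} (hC : C ≠ ⊤) (hh : IntNear h)
    (hle : ∀ᶠ z in 𝓝 (0 : Cn n), g z ≤ C * h z) : IntNear g :=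
  hh.mono_ae hC hle (Eventually.of_forall fun _ hz => hz)

lemma IntNear.congr {g h : Cn n → ℝ≥0∞} (hh : IntNear h) (he : g =ᶠ[𝓝 0] h) : IntNear g :=
  hh.mono ENNReal.one_ne_top (he.mono fun z hz => by rw [hz, one_mul])

lemma IntNear.add {g h : Cn n → ℝ≥0∞} (hg : IntNear g) (hh : IntNear h) (hm : MeasNear g) :
    IntNear fun z => g z + h z := by
  obtain ⟨U, hU, hg⟩ := hg
  obtain ⟨V, hV, hh⟩ := hh
  obtain ⟨T, hT, hm⟩ := hm
  refine ⟨U ∩ V ∩ T, inter_mem (inter_mem hU hV) hT, ?_⟩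
  rw [lintegral_add_left' (hm.mono_measure (Measure.restrict_mono Set.inter_subset_right le_rfl))]
  refine ENNReal.add_lt_top.2 ⟨lt_of_le_of_lt (lintegral_mono_set ?_) hg,
    lt_of_le_of_lt (lintegral_mono_set ?_) hh⟩
  · exact Set.inter_subset_left.trans Set.inter_subset_left
  · exact Set.inter_subset_left.trans Set.inter_subset_right

lemma PSHNear.eventually_le {u : Cn n → EReal} (hu : PSHNear u) :
    ∃ C : ℝ, ∀ᶠ z in 𝓝 (0 : Cn n), u z ≤ C := by
  obtain ⟨U, hU0, hU, hp⟩ := hu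
  obtain ⟨C, hC⟩ := EReal.lt_iff_exists_real_btwn.1 (hp.lt_top 0 (mem_of_mem_nhds hU0))
  refine ⟨C, ?_⟩
  have := hp.usc 0 (mem_of_mem_nhds hU0) C hC.1
  rw [hU.nhdsWithin_eq (mem_of_mem_nhds hU0)] at this
  exact this.mono fun z hz => hz.le

lemma wexp_le_wexp {u : Cn n → EReal} {z : Cn n} {C : ℝ} (h : u z ≤ C) {a b : ℝ} (hab : a ≤ b)
    (hb : 0 < b) : wexp (-2 * a) u z ≤ ENNReal.ofReal (Real.exp (2 * (b - a) * C)) * wexp (-2 * b) u z := by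
  induction hu : u z with
  | bot =>
    rw [wexp_of_eq_bot (by linarith : -2 * b < 0) hu, ENNReal.mul_top]
    · exact le_top
    · simpa using Real.exp_pos _
  | top => rw [hu] at h; exact absurd (top_le_iff.1 h) (EReal.coe_ne_top C)
  | coe x =>
    rw [wexp_of_eq_coe _ hu, wexp_of_eq_coe _ hu, ← ENNReal.ofReal_mul (Real.exp_nonneg _),
      ← Real.exp_add]
    refine ENNReal.ofReal_le_ofReal (Real.exp_le_exp.2 ?_)
    rw [hu] at h
    have : x ≤ C := EReal.coe_le_coe_iff.1 h
    nlinarith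

lemma IsRegularization.mono {u : Cn n → EReal} {R R' C : ℝ} {p : ℕ → Cn n → ℝ}
    (h : IsRegularization u R C p) (hR : R' ≤ R) : IsRegularization u R' C p where
  smooth := h.smooth
  levi_nonneg k z hz := h.levi_nonneg k z (Metric.ball_subset_ball hR hz)
  le_const k z hz := h.le_const k z (Metric.ball_subset_ball hR hz)
  le k z hz := h.le k z (Metric.ball_subset_ball hR hz)
  eventually_le z hz := h.eventually_le z (Metric.ball_subset_ball hR hz)

set_option maxHeartbeats 1000000 in
/-- Strong openness of multiplier ideals. -/
theorem strong_openness {f : Cn n → ℂ} (hf : HoloNear f) {φ₁ φ₂ ψ : Cn n → EReal}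
    (h₁ : PSHNear φ₁) (h₂ : PSHNear φ₂) (hψ : PSHNear ψ)
    (hint : IntNear fun z => ‖f z‖ₑ ^ 2 * (wexp (-2) φ₁ z * wexp (-2) φ₂ z)) :
    ∃ s > 0, IntNear fun z => ‖f z‖ₑ ^ 2 * (wexp (-2) φ₁ z * wexp (-2) φ₂ z * wexp (-2 * s) ψ z) := by
  set G : Cn n → ℝ≥0∞ := fun z => wexp (-2) φ₁ z * wexp (-2) φ₂ z with hG
  have hGm : MeasNear G := (measNear_wexp h₁ _).mul (measNear_wexp h₂ _)
  obtain ⟨C₀, hC₀⟩ := hψ.eventually_le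
  set Q : (Cn n → ℂ) → Prop := fun f => (∃ U ∈ 𝓝 (0 : Cn n), ContinuousOn f U) ∧
    ∃ s > 0, IntNear fun z => ‖f z‖ₑ ^ 2 * (G z * wexp (-2 * s) ψ z) with hQ
  have hz : Q fun _ => 0 := ⟨⟨Set.univ, univ_mem, continuousOn_const⟩, 1, one_pos, Set.univ, univ_mem,
    by simp⟩
  have hdec : ∀ (f : Cn n → ℂ) (s s' : ℝ), 0 < s' → s' ≤ s → (IntNear fun z => ‖f z‖ₑ ^ 2 * (G z * wexp (-2 * s) ψ z)) →
      IntNear fun z => ‖f z‖ₑ ^ 2 * (G z * wexp (-2 * s') ψ z) := by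
    intro f s s' hs' hss h
    refine h.mono (ENNReal.ofReal_ne_top (r := Real.exp (2 * (s - s') * C₀))) ?_
    filter_upwards [hC₀] with z hz
    calc _ ≤ ‖f z‖ₑ ^ 2 * (G z * (ENNReal.ofReal (Real.exp (2 * (s - s') * C₀)) * wexp (-2 * s) ψ z)) := by
          gcongr; exact wexp_le_wexp hz hss (hs'.trans_le hss)
      _ = _ := by ring
  have hadd : ∀ f g, Q f → Q g → Q fun z => f z + g z := by
    rintro f g ⟨⟨U, hU, hfc⟩, s, hs, hfi⟩ ⟨⟨V, hV, hgc⟩, t, ht, hgi⟩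
    refine ⟨⟨U ∩ V, inter_mem hU hV, (hfc.mono Set.inter_subset_left).add
      (hgc.mono Set.inter_subset_right)⟩, min s t, lt_min hs ht, ?_⟩
    have i1 := hdec f s (min s t) (lt_min hs ht) (min_le_left _ _) hfi
    have i2 := hdec g t (min s t) (lt_min hs ht) (min_le_right _ _) hgi
    refine (i1.add i2 ((measNear_enorm_sq ⟨U, hU, hfc⟩).mul (hGm.mul (measNear_wexp hψ _)))).mono
      (ENNReal.ofNat_ne_top (n := 2)) (Eventually.of_forall fun z => ?_)
    calc _ ≤ (2 * ‖f z‖ₑ ^ 2 + 2 * ‖g z‖ₑ ^ 2) * (G z * wexp (-2 * min s t) ψ z) := by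
          gcongr; exact enorm_add_sq_le _ _
      _ = _ := by ring
  have hmul : ∀ f q, Q f → (∃ U ∈ 𝓝 (0 : Cn n), ContinuousOn q U) → Q fun z => q z * f z := by
    rintro f q ⟨⟨U, hU, hfc⟩, s, hs, hfi⟩ ⟨V, hV, hqc⟩
    refine ⟨⟨U ∩ V, inter_mem hU hV, (hqc.mono Set.inter_subset_right).mul
      (hfc.mono Set.inter_subset_left)⟩, s, hs, ?_⟩
    refine hfi.mono (C := ENNReal.ofReal (‖q 0‖ + 1) ^ 2) (by simp) ?_
    have hq : ∀ᶠ z in 𝓝 (0 : Cn n), ‖q z‖ < ‖q 0‖ + 1 :=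
      (hqc.continuousAt hV).norm.eventually (Iio_mem_nhds (by linarith))
    filter_upwards [hq] with z hz
    rw [enorm_mul, mul_pow, mul_assoc]
    gcongr
    rw [← ofReal_norm]
    exact ENNReal.ofReal_le_ofReal hz.le
  have hcongr : ∀ f g, f =ᶠ[𝓝 (0 : Cn n)] g → Q f → Q g := by
    rintro f g he ⟨⟨U, hU, hfc⟩, s, hs, hfi⟩
    refine ⟨⟨U ∩ {z | f z = g z}, inter_mem hU he, (hfc.mono Set.inter_subset_left).congr
      fun z hz => hz.2.symm⟩, s, hs, hfi.congr ?_⟩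
    filter_upwards [he] with z hz
    rw [hz]
  obtain ⟨R₁, hR₁, C₁, p, hp⟩ := exists_regularization h₁
  obtain ⟨R₂, hR₂, C₂, q, hq⟩ := exists_regularization h₂
  obtain ⟨R₃, hR₃, C₃, r, hr⟩ := exists_regularization hψ
  obtain ⟨R₄, hR₄, hb⟩ := ae_ne_bot hψ
  obtain ⟨U, hU, _, hfU⟩ := hf
  obtain ⟨V, hV, hint⟩ := hint
  obtain ⟨R₅, hR₅, hRU⟩ := Metric.mem_nhds_iff.1 (inter_mem hU hV)
  obtain ⟨R, hR, hRle⟩ : ∃ R > 0, R ≤ R₁ ∧ R ≤ R₂ ∧ R ≤ R₃ ∧ R ≤ R₄ ∧ R ≤ R₅ :=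
    ⟨min R₁ (min R₂ (min R₃ (min R₄ R₅))), by positivity, by simp⟩
  obtain ⟨l₁, l₂, l₃, l₄, l₅⟩ := hRle
  have hp := hp.mono l₁
  have hq := hq.mono l₂
  have hPe : ∀ k z, ENNReal.ofReal (Real.exp (-2 * (p k z + q k z))) =
      ENNReal.ofReal (Real.exp (-2 * p k z)) * ENNReal.ofReal (Real.exp (-2 * q k z)) := fun k z => by
    rw [mul_add, Real.exp_add, ENNReal.ofReal_mul (Real.exp_nonneg _)]
  obtain ⟨ρ, hρ, b, B, hbB, hfb, happ⟩ := exists_coeff_approx hR (f := f)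
    (hfU.mono ((Metric.ball_subset_ball l₅).trans (hRU.trans Set.inter_subset_left))) (G := G)
    ((lintegral_mono_set ((Metric.ball_subset_ball l₅).trans
      (hRU.trans Set.inter_subset_right))).trans_lt hint).ne
    (P := fun k z => p k z + q k z) (C := C₁ + C₂) (fun k => (hp.smooth k).add (hq.smooth k))
    (fun k z hz a => by
      rw [levi_add (hp.smooth k) (hq.smooth k)]
      exact add_nonneg (hp.levi_nonneg k z hz a) (hq.levi_nonneg k z hz a))
    (fun k z hz => add_le_add (hp.le_const k z hz) (hq.le_const k z hz))
    (fun k z hz => by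
      rw [hPe]
      have a1 := ofReal_exp_le_wexp one_pos (hp.le k z hz)
      have a2 := ofReal_exp_le_wexp one_pos (hq.le k z hz)
      simp only [mul_one] at a1 a2
      exact mul_le_mul' a1 a2)
    (fun z hz => by
      simp only [hPe]
      have a1 := hp.wexp_le_liminf one_pos hz
      have a2 := hq.wexp_le_liminf one_pos hz
      simp only [mul_one] at a1 a2
      exact (mul_le_mul' a1 a2).trans ENNReal.le_liminf_mul)
    (hr.mono l₃) (hb.mono fun z hz hzR => hz (Metric.ball_subset_ball l₄ hzR))
  have := mem_of_approx Q hz hadd hmul hcongr hρ hbB happ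
  exact (hcongr _ _ hfb.symm this).2

lemma norm_circle_le (z w : Cn n) {r : ℝ} (hr : 0 ≤ r) (θ : ℝ) :
    ‖z + ((r : ℂ) * Complex.exp (Complex.I * θ)) • w‖ ≤ ‖z‖ + r * ‖w‖ := by
  refine (norm_add_le _ _).trans (add_le_add_right ?_ _)
  rw [norm_smul, norm_mul, norm_exp_I_mul, mul_one, Complex.norm_real, Real.norm_of_nonneg hr]

lemma intervalIntegrable_circle {h : Cn n → ℝ} {m R : ℝ}
    (husc : UpperSemicontinuousOn h (Metric.ball 0 R)) (hm : ∀ z ∈ Metric.ball (0 : Cn n) R, m ≤ h z)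
    {z w : Cn n} {r : ℝ} (hr : 0 ≤ r) (hrR : ‖z‖ + r * ‖w‖ < R) :
    IntervalIntegrable (fun θ : ℝ => h (z + ((r : ℂ) * Complex.exp (Complex.I * θ)) • w)) volume
      0 (2 * Real.pi) := by
  have hsub : Metric.closedBall (0 : Cn n) (‖z‖ + r * ‖w‖) ⊆ Metric.ball 0 R :=
    Metric.closedBall_subset_ball hrR
  have hK : ∀ θ : ℝ, z + ((r : ℂ) * Complex.exp (Complex.I * θ)) • w ∈
      Metric.closedBall (0 : Cn n) (‖z‖ + r * ‖w‖) := fun θ =>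
    mem_closedBall_zero_iff.2 (norm_circle_le z w hr θ)
  obtain ⟨B, hB⟩ := (husc.mono hsub).bddAbove_of_isCompact (isCompact_closedBall _ _)
  refine intervalIntegrable_usc (m := m) (B := B) ?_ (fun θ => hm _ (hsub (hK θ)))
    (fun θ => hB ⟨_, hK θ, rfl⟩) _ _
  rw [← upperSemicontinuousOn_univ_iff]
  exact husc.comp (f := h) (g := fun θ : ℝ => z + ((r : ℂ) * Complex.exp (Complex.I * θ)) • w)
    (by fun_prop) fun θ _ => hsub (hK θ)

lemma usc_trunc_of {u : Cn n → EReal} {U : Set (Cn n)} (hu : UpperSemicontinuousOn u U)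
    (ht : ∀ z ∈ U, u z < ⊤) (m : ℕ) : UpperSemicontinuousOn (trunc u m) U := by
  intro z hz A hA
  rw [trunc_lt_iff (ht z hz)] at hA
  filter_upwards [hu z hz A hA.1, self_mem_nhdsWithin] with y hy hyU
  exact (trunc_lt_iff (ht y hyU) m).2 ⟨hy, hA.2⟩

/-- The local data of a plurisubharmonic function on a ball. -/
structure SubOn (u : Cn n → EReal) (R : ℝ) : Prop where
  usc : UpperSemicontinuousOn u (Metric.ball 0 R)
  lt_top : ∀ z ∈ Metric.ball (0 : Cn n) R, u z < ⊤
  submean : ∀ z ∈ Metric.ball (0 : Cn n) R, ∀ w : Cn n, ∃ ε > 0, ∀ r : ℝ, 0 < r → r < ε →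
    ∀ m : ℕ, u z ≤ ((circleAvg u z w r m : ℝ) : EReal)

lemma PSHNear.subOn {u : Cn n → EReal} (hu : PSHNear u) :
    ∃ R₀ > 0, ∀ R ≤ R₀, SubOn u R := by
  obtain ⟨U, hU0, hU, hp⟩ := hu
  obtain ⟨R₀, hR₀, hRU⟩ := Metric.mem_nhds_iff.1 hU0
  refine ⟨R₀, hR₀, fun R hR => ?_⟩
  have hs : Metric.ball (0 : Cn n) R ⊆ U := (Metric.ball_subset_ball hR).trans hRU
  refine ⟨hp.usc.mono hs, fun z hz => hp.lt_top z (hs hz), fun z hz w => ?_⟩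
  obtain ⟨ε, hε, h⟩ := hp.submean z (hs hz) w
  exact ⟨ε, hε, fun r hr hr' m => (h r hr hr').trans (iInf_le _ m)⟩

lemma PSHNear.exists_ne_bot {u : Cn n → EReal} (hu : PSHNear u) {R : ℝ} (hR : 0 < R) :
    ∃ w ∈ Metric.ball (0 : Cn n) R, u w ≠ ⊥ := by
  obtain ⟨ε, hε, h⟩ := ae_ne_bot hu
  by_contra! hcon
  have h0 : volume (Metric.ball (0 : Cn n) (min ε R)) = 0 := by
    refine measure_mono_null (fun y hy => ?_) h
    intro hy'
    exact hy' (Metric.ball_subset_ball (min_le_left _ _) hy)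
      (hcon y (Metric.ball_subset_ball (min_le_right _ _) hy))
  exact (Metric.measure_ball_pos volume (0 : Cn n) (lt_min hε hR)).ne' h0

lemma SubOn.pshNear {u : Cn n → EReal} {R : ℝ} (hR : 0 < R) (hu : SubOn u R)
    (hb : ∃ w ∈ Metric.ball (0 : Cn n) R, u w ≠ ⊥) : PSHNear u := by
  refine ⟨Metric.ball 0 R, Metric.ball_mem_nhds 0 hR, Metric.isOpen_ball, hu.usc, hu.lt_top, ?_, ?_⟩
  · intro z hz
    rwa [(convex_ball (0 : Cn n) R).isPreconnected.connectedComponentIn hz]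
  · intro z hz w
    obtain ⟨ε, hε, h⟩ := hu.submean z hz w
    exact ⟨ε, hε, fun r hr hr' => le_iInf fun m => h r hr hr' m⟩

lemma exists_circle_radius {z : Cn n} {R : ℝ} (hz : z ∈ Metric.ball (0 : Cn n) R) (w : Cn n) :
    ∃ ε > 0, ∀ r : ℝ, 0 < r → r < ε → ‖z‖ + r * ‖w‖ < R := by
  have hz' := mem_ball_zero_iff.1 hz
  refine ⟨(R - ‖z‖) / (‖w‖ + 1), div_pos (by linarith) (by positivity), fun r hr h => ?_⟩
  rw [lt_div_iff₀ (by positivity)] at h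
  nlinarith

lemma ereal_mul_lt_iff {c : ℝ} (hc : 0 < c) {x y : EReal} :
    (c : EReal) * x < y ↔ x < ((c⁻¹ : ℝ) : EReal) * y := by
  have hc' : (0 : EReal) ≤ c := by exact_mod_cast hc.le
  have hi' : (0 : EReal) ≤ (c⁻¹ : ℝ) := by exact_mod_cast (inv_pos.2 hc).le
  have e1 : (c : EReal) * (c⁻¹ : ℝ) = 1 := by
    rw [← EReal.coe_mul, mul_inv_cancel₀ hc.ne', EReal.coe_one]
  have e2 : ((c⁻¹ : ℝ) : EReal) * (c : EReal) = 1 := by rw [mul_comm, e1]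
  rw [← not_le, ← not_le, not_iff_not]
  constructor
  · intro h
    have := mul_le_mul_of_nonneg_left h hi'
    rwa [← mul_assoc, e2, one_mul] at this
  · intro h
    have := mul_le_mul_of_nonneg_left h hc'
    rwa [← mul_assoc, e1, one_mul] at this

lemma SubOn.const_mul {u : Cn n → EReal} {R c : ℝ} (hc : 0 < c) (hu : SubOn u R) :
    SubOn (fun z => (c : EReal) * u z) R := by
  have husc : UpperSemicontinuousOn (fun z => (c : EReal) * u z) (Metric.ball 0 R) := by
    intro z hz y hy
    have := hu.usc z hz _ ((ereal_mul_lt_iff hc).1 hy)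
    exact this.mono fun x hx => (ereal_mul_lt_iff hc).2 hx
  have hlt : ∀ z ∈ Metric.ball (0 : Cn n) R, (c : EReal) * u z < ⊤ := fun z hz => by
    rw [ereal_mul_lt_iff hc, EReal.coe_mul_top_of_pos (inv_pos.2 hc)]
    exact hu.lt_top z hz
  refine ⟨husc, hlt, fun z hz w => ?_⟩
  obtain ⟨ε, hε, h⟩ := hu.submean z hz w
  obtain ⟨ε', hε', hcirc⟩ := exists_circle_radius hz w
  refine ⟨min ε ε', lt_min hε hε', fun r hr hr' m => ?_⟩
  obtain ⟨hr1, hr2⟩ := lt_min_iff.1 hr'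
  obtain ⟨k, hk⟩ := exists_nat_ge ((m : ℝ) / c)
  have hkm : (m : ℝ) ≤ c * k := by rw [div_le_iff₀ hc] at hk; linarith
  have hrR := hcirc r hr hr2
  have i1 := intervalIntegrable_circle (usc_trunc_of hu.usc hu.lt_top k)
    (fun y hy => neg_le_trunc (hu.lt_top y hy) k) (w := w) hr.le hrR
  have i2 := intervalIntegrable_circle (usc_trunc_of husc hlt m)
    (fun y hy => neg_le_trunc (hlt y hy) m) (w := w) hr.le hrR
  have key : c * circleAvg u z w r k ≤ circleAvg (fun z => (c : EReal) * u z) z w r m := by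
    rw [circleAvg, circleAvg, mul_left_comm, ← intervalIntegral.integral_const_mul]
    refine mul_le_mul_of_nonneg_left ?_ (by positivity)
    refine intervalIntegral.integral_mono_on (by positivity) (i1.const_mul c) i2 fun θ _ => ?_
    set y := z + ((r : ℂ) * Complex.exp (Complex.I * θ)) • w with hy
    have hyR : y ∈ Metric.ball (0 : Cn n) R :=
      mem_ball_zero_iff.2 ((norm_circle_le z w hr.le θ).trans_lt hrR)
    change c * trunc u k y ≤ trunc (fun z => (c : EReal) * u z) m y
    rw [← EReal.coe_le_coe_iff, EReal.coe_mul, coe_trunc (hu.lt_top y hyR), coe_trunc (hlt y hyR)]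
    rcases le_total (u y) ((-(k : ℝ) : ℝ) : EReal) with h' | h'
    · rw [max_eq_right h', ← EReal.coe_mul]
      refine le_max_of_le_right ?_
      rw [EReal.coe_le_coe_iff]; linarith
    · rw [max_eq_left h']; exact le_max_left _ _
  calc (c : EReal) * u z ≤ (c : EReal) * ((circleAvg u z w r k : ℝ) : EReal) :=
        mul_le_mul_of_nonneg_left (h r hr hr1 k) (by exact_mod_cast hc.le)
    _ ≤ _ := by rw [← EReal.coe_mul]; exact EReal.coe_le_coe_iff.2 key

lemma SubOn.max {u v : Cn n → EReal} {R : ℝ} (hu : SubOn u R) (hv : SubOn v R) :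
    SubOn (fun z => max (u z) (v z)) R := by
  have husc : UpperSemicontinuousOn (fun z => Max.max (u z) (v z)) (Metric.ball 0 R) :=
    hu.usc.sup hv.usc
  have hlt : ∀ z ∈ Metric.ball (0 : Cn n) R, Max.max (u z) (v z) < ⊤ := fun z hz =>
    max_lt (hu.lt_top z hz) (hv.lt_top z hz)
  have key : ∀ u' : Cn n → EReal, SubOn u' R → (∀ y, u' y ≤ Max.max (u y) (v y)) →
      ∀ z ∈ Metric.ball (0 : Cn n) R, ∀ w : Cn n, ∃ ε > 0, ∀ r : ℝ, 0 < r → r < ε →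
        ∀ m : ℕ, u' z ≤ ((circleAvg (fun z => Max.max (u z) (v z)) z w r m : ℝ) : EReal) := by
    intro u' hu' hle z hz w
    obtain ⟨ε, hε, h⟩ := hu'.submean z hz w
    obtain ⟨ε', hε', hcirc⟩ := exists_circle_radius hz w
    refine ⟨min ε ε', lt_min hε hε', fun r hr hr' m => ?_⟩
    obtain ⟨hr1, hr2⟩ := lt_min_iff.1 hr'
    have hrR := hcirc r hr hr2
    refine (h r hr hr1 m).trans (EReal.coe_le_coe_iff.2 ?_)
    rw [circleAvg, circleAvg]
    refine mul_le_mul_of_nonneg_left ?_ (by positivity)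
    refine intervalIntegral.integral_mono_on (by positivity)
      (intervalIntegrable_circle (usc_trunc_of hu'.usc hu'.lt_top m)
        (fun y hy => neg_le_trunc (hu'.lt_top y hy) m) (w := w) hr.le hrR)
      (intervalIntegrable_circle (usc_trunc_of husc hlt m)
        (fun y hy => neg_le_trunc (hlt y hy) m) (w := w) hr.le hrR) fun θ _ => ?_
    set y := z + ((r : ℂ) * Complex.exp (Complex.I * θ)) • w with hy
    have hyR : y ∈ Metric.ball (0 : Cn n) R :=
      mem_ball_zero_iff.2 ((norm_circle_le z w hr.le θ).trans_lt hrR)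
    change trunc u' m y ≤ trunc (fun z => Max.max (u z) (v z)) m y
    rw [← EReal.coe_le_coe_iff, coe_trunc (hu'.lt_top y hyR), coe_trunc (hlt y hyR)]
    exact max_le_max_right _ (hle y)
  refine ⟨husc, hlt, fun z hz w => ?_⟩
  obtain ⟨ε₁, hε₁, h₁⟩ := key u hu (fun y => le_max_left _ _) z hz w
  obtain ⟨ε₂, hε₂, h₂⟩ := key v hv (fun y => le_max_right _ _) z hz w
  exact ⟨min ε₁ ε₂, lt_min hε₁ hε₂, fun r hr hr' m =>
    max_le (h₁ r hr (lt_min_iff.1 hr').1 m) (h₂ r hr (lt_min_iff.1 hr').2 m)⟩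

lemma PSHNear.const_mul {u : Cn n → EReal} {c : ℝ} (hc : 0 < c) (hu : PSHNear u) :
    PSHNear fun z => (c : EReal) * u z := by
  obtain ⟨R, hR, h⟩ := hu.subOn
  obtain ⟨w, hw, hne⟩ := hu.exists_ne_bot hR
  refine ((h R le_rfl).const_mul hc).pshNear hR ⟨w, hw, ?_⟩
  rw [← bot_lt_iff_ne_bot] at hne ⊢
  by_contra hcon
  rw [not_bot_lt_iff] at hcon
  lift u w to ℝ using ⟨((h R le_rfl).lt_top w hw).ne, hne.ne'⟩ with x
  exact EReal.coe_ne_bot (c * x) (by rw [EReal.coe_mul]; exact hcon)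

lemma PSHNear.max {u v : Cn n → EReal} (hu : PSHNear u) (hv : PSHNear v) :
    PSHNear fun z => max (u z) (v z) := by
  obtain ⟨R₁, hR₁, h₁⟩ := hu.subOn
  obtain ⟨R₂, hR₂, h₂⟩ := hv.subOn
  have hR := lt_min hR₁ hR₂
  obtain ⟨w, hw, hne⟩ := hu.exists_ne_bot hR
  refine ((h₁ _ (min_le_left _ _)).max (h₂ _ (min_le_right _ _))).pshNear hR ⟨w, hw, ?_⟩
  exact (lt_of_lt_of_le (bot_lt_iff_ne_bot.2 hne) (le_max_left _ _)).ne'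

lemma MeasNear.add {g h : Cn n → ℝ≥0∞} (hg : MeasNear g) (hh : MeasNear h) :
    MeasNear fun z => g z + h z := by
  obtain ⟨U, hU, hg⟩ := hg
  obtain ⟨V, hV, hh⟩ := hh
  exact ⟨U ∩ V, inter_mem hU hV, (hg.mono_measure (Measure.restrict_mono Set.inter_subset_left le_rfl)).add
    (hh.mono_measure (Measure.restrict_mono Set.inter_subset_right le_rfl))⟩

lemma MeasNear.sum {ι : Type*} (s : Finset ι) {g : ι → Cn n → ℝ≥0∞} (hg : ∀ i, MeasNear (g i)) :
    MeasNear fun z => ∑ i ∈ s, g i z := by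
  classical
  induction s using Finset.induction_on with
  | empty => exact ⟨Set.univ, univ_mem, by simp⟩
  | insert a s ha ih =>
    simp only [Finset.sum_insert ha]
    exact (hg a).add ih

lemma IntNear.sum {ι : Type*} (s : Finset ι) {g : ι → Cn n → ℝ≥0∞} (hm : ∀ i, MeasNear (g i))
    (hg : ∀ i, IntNear (g i)) : IntNear fun z => ∑ i ∈ s, g i z := by
  classical
  induction s using Finset.induction_on with
  | empty => exact ⟨Set.univ, univ_mem, by simp⟩
  | insert a s ha ih =>
    simp only [Finset.sum_insert ha]
    exact (hg a).add ih (hm a)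

lemma measNear_dens0 {m : ℕ} {f₀ : Fin m → Cn n → ℂ} {φ₀ : Cn n → EReal}
    (hf : ∀ j, HoloNear (f₀ j)) (h₀ : PSHNear φ₀) : MeasNear (dens0 f₀ φ₀) :=
  (MeasNear.sum Finset.univ fun j => measNear_enorm_sq (hf j).continuousOn).mul (measNear_wexp h₀ _)

/-- Strong openness for the densities `|f₀|² e^{-2φ₀}` of tuples. -/
theorem strong_openness_dens0 {m : ℕ} {f₀ : Fin m → Cn n → ℂ} {φ₀ φ ψ : Cn n → EReal}
    (hf : ∀ j, HoloNear (f₀ j)) (h₀ : PSHNear φ₀) (hφ : PSHNear φ) (hψ : PSHNear ψ)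
    (hint : IntNear fun z => dens0 f₀ φ₀ z * wexp (-2) φ z) :
    ∃ s > 0, IntNear fun z => dens0 f₀ φ₀ z * wexp (-2) φ z * wexp (-2 * s) ψ z := by
  have hj : ∀ j, ∃ s > 0, IntNear fun z =>
      ‖f₀ j z‖ₑ ^ 2 * (wexp (-2) φ₀ z * wexp (-2) φ z * wexp (-2 * s) ψ z) := fun j => by
    refine strong_openness (hf j) h₀ hφ hψ (hint.mono ENNReal.one_ne_top ?_)
    refine Eventually.of_forall fun z => ?_
    rw [one_mul, dens0, mul_assoc]
    refine mul_le_mul_left ?_ _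
    exact Finset.single_le_sum (f := fun j => (‖f₀ j z‖₊ : ℝ≥0∞) ^ 2) (fun _ _ => bot_le)
      (Finset.mem_univ j)
  choose s hs hsi using hj
  obtain ⟨s₀, hs₀, hle⟩ : ∃ s₀ > 0, ∀ j, s₀ ≤ s j := by
    rcases isEmpty_or_nonempty (Fin m) with h | h
    · exact ⟨1, one_pos, fun j => h.elim j⟩
    · obtain ⟨j, hj⟩ := Finite.exists_min s
      exact ⟨s j, hs j, hj⟩
  obtain ⟨C, hC⟩ := hψ.eventually_le
  refine ⟨s₀, hs₀, ?_⟩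
  have hint' : ∀ j, IntNear fun z =>
      ‖f₀ j z‖ₑ ^ 2 * (wexp (-2) φ₀ z * wexp (-2) φ z * wexp (-2 * s₀) ψ z) := fun j => by
    refine (hsi j).mono (C := ENNReal.ofReal (Real.exp (2 * (s j - s₀) * C))) ENNReal.ofReal_ne_top ?_
    filter_upwards [hC] with z hz
    calc _ ≤ ‖f₀ j z‖ₑ ^ 2 * (wexp (-2) φ₀ z * wexp (-2) φ z *
          (ENNReal.ofReal (Real.exp (2 * (s j - s₀) * C)) * wexp (-2 * s j) ψ z)) := by
          gcongr
          exact wexp_le_wexp hz (hle j) (hs j)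
      _ = _ := by ring
  refine (IntNear.sum Finset.univ (fun j => ?_) hint').congr (Eventually.of_forall fun z => ?_)
  · exact (measNear_enorm_sq (hf j).continuousOn).mul
      (((measNear_wexp h₀ _).mul (measNear_wexp hφ _)).mul (measNear_wexp hψ _))
  · simp only [dens0, normSq2, ← Finset.sum_mul, mul_assoc]
    rfl

lemma pshNear_zero : PSHNear (fun _ : Cn n => (0 : EReal)) := by
  refine SubOn.pshNear (R := 1) one_pos ⟨upperSemicontinuousOn_const, fun z _ => EReal.zero_lt_top, ?_⟩
    ⟨0, Metric.mem_ball_self one_pos, EReal.zero_ne_bot⟩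
  intro z _ w
  refine ⟨1, one_pos, fun r _ _ m => ?_⟩
  have : max (0 : EReal) ((-(m : ℝ) : ℝ) : EReal) = 0 := by
    refine max_eq_left ?_
    rw [← EReal.coe_zero, EReal.coe_le_coe_iff]
    simp
  simp only [circleAvg, this, EReal.toReal_zero]
  simp

/-- The density `W e^{2tψ - 2cΦ}` of the Tian function. -/
def tianDens (W : Cn n → ℝ≥0∞) (ψ Φ : Cn n → EReal) (t c : ℝ) (z : Cn n) : ℝ≥0∞ :=
  W z * wexp (2 * t) ψ z * wexp (-2 * c) Φ z

lemma tianDens_eq {W : Cn n → ℝ≥0∞} {ψ Φ : Cn n → EReal} {z : Cn n} {x y : ℝ} (hx : Φ z = x)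
    (hy : ψ z = y) (t c : ℝ) :
    tianDens W ψ Φ t c z = W z * ENNReal.ofReal (Real.exp (2 * t * y - 2 * c * x)) := by
  rw [tianDens, wexp_of_eq_coe _ hx, wexp_of_eq_coe _ hy, mul_assoc, ← ENNReal.ofReal_mul (Real.exp_pos _).le,
    ← Real.exp_add]
  congr 4
  ring

lemma measNear_tianDens {W : Cn n → ℝ≥0∞} {ψ Φ : Cn n → EReal} (hW : MeasNear W) (hψ : PSHNear ψ)
    (hΦ : PSHNear Φ) (t c : ℝ) : MeasNear (tianDens W ψ Φ t c) :=
  (hW.mul (measNear_wexp hψ _)).mul (measNear_wexp hΦ _)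

/-- Near the origin, a pointwise statement about two plurisubharmonic functions may be checked
at the points where both are finite. -/
lemma exists_nhds_finite {ψ Φ : Cn n → EReal} (hψ : PSHNear ψ) (hΦ : PSHNear Φ) {P : Cn n → Prop}
    (h : ∀ᶠ z in 𝓝 (0 : Cn n), ∀ x y : ℝ, Φ z = x → ψ z = y → P z) :
    ∃ V ∈ 𝓝 (0 : Cn n), ∀ᵐ z : Cn n, z ∈ V → P z := by
  obtain ⟨ε₁, hε₁, h₁⟩ := ae_ne_bot hψ
  obtain ⟨ε₂, hε₂, h₂⟩ := ae_ne_bot hΦ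
  obtain ⟨C₁, hC₁⟩ := hψ.eventually_le
  obtain ⟨C₂, hC₂⟩ := hΦ.eventually_le
  refine ⟨_, inter_mem (inter_mem (Metric.ball_mem_nhds 0 hε₁) (Metric.ball_mem_nhds 0 hε₂))
    ((h.and hC₁).and hC₂), ?_⟩
  filter_upwards [h₁, h₂] with z hz₁ hz₂ hz
  have hy := EReal.coe_toReal (hz.2.1.2.trans_lt (EReal.coe_lt_top C₁)).ne (hz₁ hz.1.1)
  have hx := EReal.coe_toReal (hz.2.2.trans_lt (EReal.coe_lt_top C₂)).ne (hz₂ hz.1.2)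
  exact hz.2.1.1 _ _ hx.symm hy.symm

lemma IntNear.tianDens_of_le {W : Cn n → ℝ≥0∞} {ψ Φ : Cn n → EReal} (hψ : PSHNear ψ)
    (hΦ : PSHNear Φ) {s d t c K : ℝ} (hA : IntNear (tianDens W ψ Φ s d))
    (h : ∀ᶠ z in 𝓝 (0 : Cn n), ∀ x y : ℝ, Φ z = x → ψ z = y →
      2 * t * y - 2 * c * x ≤ K + (2 * s * y - 2 * d * x)) :
    IntNear (tianDens W ψ Φ t c) := by
  obtain ⟨V, hV, hP⟩ := exists_nhds_finite (P := fun z => tianDens W ψ Φ t c z ≤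
    ENNReal.ofReal (Real.exp K) * tianDens W ψ Φ s d z) hψ hΦ (h.mono fun z hz x y hx hy => by
      rw [tianDens_eq hx hy, tianDens_eq hx hy, mul_left_comm, ← ENNReal.ofReal_mul (Real.exp_pos _).le,
        ← Real.exp_add]
      gcongr
      exact hz x y hx hy)
  exact hA.mono_ae ENNReal.ofReal_ne_top hV hP

lemma IntNear.tianDens_of_or {W : Cn n → ℝ≥0∞} {ψ Φ : Cn n → EReal} (hW : MeasNear W)
    (hψ : PSHNear ψ) (hΦ : PSHNear Φ) {b s d r t c K : ℝ} (hb : 0 < b)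
    (hA : IntNear (tianDens W ψ Φ s d))
    (hB : IntNear fun z => W z * wexp (-2) (fun z => max (Φ z) (((b⁻¹ : ℝ) : EReal) * ψ z)) z *
      wexp (-2 * r) ψ z)
    (h : ∀ᶠ z in 𝓝 (0 : Cn n), ∀ x y : ℝ, Φ z = x → ψ z = y →
      2 * t * y - 2 * c * x ≤ K + (2 * s * y - 2 * d * x) ∨
      y ≤ b * x ∧ 2 * t * y - 2 * c * x ≤ K + (-2 * x - 2 * r * y)) :
    IntNear (tianDens W ψ Φ t c) := by
  set φ' : Cn n → EReal := fun z => max (Φ z) (((b⁻¹ : ℝ) : EReal) * ψ z) with hφ'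
  obtain ⟨V, hV, hP⟩ := exists_nhds_finite (P := fun z => tianDens W ψ Φ t c z ≤
    ENNReal.ofReal (Real.exp K) * (tianDens W ψ Φ s d z + W z * wexp (-2) φ' z * wexp (-2 * r) ψ z))
    hψ hΦ (h.mono fun z hz x y hx hy => by
      rw [mul_add]
      rcases hz x y hx hy with h | ⟨hyx, h⟩
      · refine le_trans ?_ le_self_add
        rw [tianDens_eq hx hy, tianDens_eq hx hy, mul_left_comm, ← ENNReal.ofReal_mul (Real.exp_pos _).le,
          ← Real.exp_add]
        gcongr
      · refine le_trans ?_ le_add_self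
        have hφx : φ' z = x := by
          simp only [hφ', hx, hy]
          refine max_eq_left ?_
          rw [← EReal.coe_mul, EReal.coe_le_coe_iff, inv_mul_le_iff₀ hb]
          exact hyx
        rw [tianDens_eq hx hy, wexp_of_eq_coe _ hφx, wexp_of_eq_coe _ hy, mul_assoc (W z), mul_left_comm,
          ← ENNReal.ofReal_mul (Real.exp_pos _).le, ← ENNReal.ofReal_mul (Real.exp_pos _).le,
          ← Real.exp_add, ← Real.exp_add]
        gcongr
        linarith)
  exact (hA.add hB (measNear_tianDens hW hψ hΦ s d)).mono_ae ENNReal.ofReal_ne_top hV hP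

lemma tianDens_zero (W : Cn n → ℝ≥0∞) (ψ Φ : Cn n → EReal) (c : ℝ) :
    tianDens W ψ Φ 0 c = fun z => W z * wexp (-2 * c) Φ z := by
  funext z
  rw [tianDens, mul_zero, wexp_zero, mul_one]

lemma leO.real {ψ φ : Cn n → EReal} {b : ℝ} (h : leO ψ fun z => (b : EReal) * φ z) :
    ∃ C : ℝ, ∀ᶠ z in 𝓝 (0 : Cn n), ∀ x y : ℝ, φ z = x → ψ z = y → y ≤ b * x + C := by
  obtain ⟨C, hC⟩ := h
  refine ⟨C, hC.mono fun z hz x y hx hy => ?_⟩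
  simp only [hx, hy] at hz
  exact_mod_cast hz

lemma PSHNear.eventually_real_le {u : Cn n → EReal} (hu : PSHNear u) :
    ∃ C : ℝ, ∀ᶠ z in 𝓝 (0 : Cn n), ∀ x : ℝ, u z = x → x ≤ C := by
  obtain ⟨C, hC⟩ := hu.eventually_le
  refine ⟨C, hC.mono fun z hz x hx => ?_⟩
  rw [hx] at hz
  exact_mod_cast hz

/-- Integrability of the Tian density is monotone in `c`. -/
lemma IntNear.tianDens_anti {W : Cn n → ℝ≥0∞} {ψ Φ : Cn n → EReal} (hψ : PSHNear ψ)
    (hΦ : PSHNear Φ) {t c c' : ℝ} (hI : IntNear (tianDens W ψ Φ t c)) (hc : c' ≤ c) :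
    IntNear (tianDens W ψ Φ t c') := by
  obtain ⟨C, hC⟩ := hΦ.eventually_real_le
  refine hI.tianDens_of_le hψ hΦ (K := 2 * (c - c') * C) (hC.mono fun z hz x y hx hy => ?_)
  nlinarith [hz x hx]

/-- If `ψ ≤ bΦ + O(1)`, then integrability propagates along the direction `(1, b)`. -/
lemma IntNear.tianDens_shift {W : Cn n → ℝ≥0∞} {ψ Φ : Cn n → EReal} (hψ : PSHNear ψ)
    (hΦ : PSHNear Φ) {t s c b : ℝ} (ht : 0 ≤ t) (hb : leO ψ fun z => (b : EReal) * Φ z)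
    (hI : IntNear (tianDens W ψ Φ s c)) : IntNear (tianDens W ψ Φ (s + t) (c + t * b)) := by
  obtain ⟨C, hC⟩ := hb.real
  refine hI.tianDens_of_le hψ hΦ (K := 2 * t * C) (hC.mono fun z hz x y hx hy => ?_)
  nlinarith [hz x y hx hy]

lemma leO_const_mul {Φ : Cn n → EReal} (hΦ : PSHNear Φ) {c : ℝ} (hc1 : c ≤ 1) :
    leO Φ fun z => (c : EReal) * Φ z := by
  obtain ⟨C, hC⟩ := hΦ.eventually_le
  refine ⟨(1 - c) * C, hC.mono fun z hz => ?_⟩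
  change Φ z ≤ (c : EReal) * Φ z + _
  induction h : Φ z with
  | bot => exact bot_le
  | top => rw [h] at hz; exact absurd (top_le_iff.1 hz) (EReal.coe_ne_top C)
  | coe x =>
    rw [h] at hz
    norm_cast at hz ⊢
    nlinarith

lemma wexp_const_mul (a c : ℝ) (u : Cn n → EReal) (z : Cn n) :
    wexp a (fun z => (c : EReal) * u z) z = wexp (a * c) u z := by
  rw [wexp, wexp, EReal.coe_mul, mul_assoc]

lemma leO_of_max_leO {ψ Φ : Cn n → EReal} {b : ℝ} (hb : 0 < b)
    (h : leO (fun z => max (Φ z) (((b⁻¹ : ℝ) : EReal) * ψ z)) Φ) :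
    leO ψ fun z => (b : EReal) * Φ z := by
  obtain ⟨C, hC⟩ := h
  refine ⟨b * C, hC.mono fun z hz => ?_⟩
  have h1 := (le_max_right _ _).trans hz
  have hb' : (0 : EReal) ≤ b := by exact_mod_cast hb.le
  have h2 := mul_le_mul_of_nonneg_left h1 hb'
  rw [← mul_assoc, ← EReal.coe_mul, mul_inv_cancel₀ hb.ne', EReal.coe_one, one_mul] at h2
  refine h2.trans (le_of_eq ?_)
  change _ = (b : EReal) * Φ z + _
  induction h : Φ z with
  | bot => rw [EReal.bot_add, EReal.coe_mul_bot_of_pos hb, EReal.bot_add]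
  | top => rw [EReal.top_add_coe, EReal.coe_mul_top_of_pos hb, EReal.top_add_coe]
  | coe x => norm_cast; ring

namespace IsLocalZhouWeight

variable {m : ℕ} {f₀ : Fin m → Cn n → ℂ} {φ₀ Φ ψ : Cn n → EReal}

lemma intNear_zero_iff (hΦ : IsLocalZhouWeight f₀ φ₀ Φ) (hψ : PSHNear ψ) (c : ℝ) :
    IntNear (tianDens (dens0 f₀ φ₀) ψ Φ 0 c) ↔ c < 1 := by
  have hP := hΦ.zhou.psh
  have h1 : ¬ IntNear (tianDens (dens0 f₀ φ₀) ψ Φ 0 1) := by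
    rw [tianDens_zero, mul_one]
    exact hΦ.zhou.nonint
  have h0 : IntNear (tianDens (dens0 f₀ φ₀) ψ Φ 0 0) := by
    rw [tianDens_zero]
    refine hΦ.int₀.congr (Eventually.of_forall fun z => ?_)
    simp only [mul_zero, wexp_zero, mul_one]
  constructor
  · intro h
    by_contra! hc
    exact h1 (h.tianDens_anti hψ hP hc)
  · intro hc
    rcases le_or_gt c 0 with hc0 | hc0
    · exact h0.tianDens_anti hψ hP hc0
    · by_contra hI
      have hmax := hΦ.zhou.maximal (fun z => (c : EReal) * Φ z) (hP.const_mul hc0)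
        (leO_const_mul hP hc.le) (by simpa only [tianDens_zero, wexp_const_mul] using hI)
      obtain ⟨C, hC⟩ := hmax.1
      refine h1 (h0.tianDens_of_le hψ hP (K := 2 * (C / (1 - c))) (hC.mono fun z hz x y hx hy => ?_))
      simp only [hx] at hz
      norm_cast at hz
      have : -x ≤ C / (1 - c) := by
        rw [le_div_iff₀ (by linarith)]
        linarith
      linarith

lemma intNear_max (hΦ : IsLocalZhouWeight f₀ φ₀ Φ) (hψ : PSHNear ψ) {b : ℝ} (hb : 0 < b)
    (hS : ¬ leO ψ fun z => (b : EReal) * Φ z) :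
    IntNear fun z => dens0 f₀ φ₀ z *
      wexp (-2) (fun z => max (Φ z) (((b⁻¹ : ℝ) : EReal) * ψ z)) z := by
  by_contra hI
  refine hS (leO_of_max_leO hb (hΦ.zhou.maximal _
    (hΦ.zhou.psh.max (hψ.const_mul (inv_pos.2 hb))) ?_ hI).1)
  refine ⟨0, Eventually.of_forall fun z => ?_⟩
  rw [EReal.coe_zero, add_zero]
  exact le_max_left _ _

lemma not_intNear_of_not_leO (hΦ : IsLocalZhouWeight f₀ φ₀ Φ) (hψ : PSHNear ψ) {b : ℝ} (hb : 0 < b)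
    (hS : ¬ leO ψ fun z => (b : EReal) * Φ z) {t : ℝ} (ht : 0 ≤ t) :
    ¬ IntNear (tianDens (dens0 f₀ φ₀) ψ Φ t (1 + b * t)) := by
  intro hI
  refine lt_irrefl (1 : ℝ) ((hΦ.intNear_zero_iff hψ 1).1 ?_)
  refine IntNear.tianDens_of_or (measNear_dens0 hΦ.holo hΦ.psh₀) hψ hΦ.zhou.psh hb hI (r := 0) (K := 0)
    ?_ (Eventually.of_forall fun z x y _ _ => ?_)
  · refine (hΦ.intNear_max hψ hb hS).congr (Eventually.of_forall fun z => ?_)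
    simp only [mul_zero, wexp_zero, mul_one]
  · rcases le_total y (b * x) with h | h
    · right
      exact ⟨h, by linarith⟩
    · left
      nlinarith [mul_le_mul_of_nonneg_left h ht]

lemma exists_intNear_of_not_leO (hΦ : IsLocalZhouWeight f₀ φ₀ Φ) (hψ : PSHNear ψ) {b : ℝ} (hb : 0 < b)
    (hS : ¬ leO ψ fun z => (b : EReal) * Φ z) :
    ∃ t₀ > 0, ∀ t c : ℝ, 0 ≤ t → t ≤ t₀ → c < 1 - b * t →
      IntNear (tianDens (dens0 f₀ φ₀) ψ Φ (-t) c) := by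
  have hP := hΦ.zhou.psh
  obtain ⟨t₀, ht₀, hI⟩ := strong_openness_dens0 hΦ.holo hΦ.psh₀
    (hP.max (hψ.const_mul (inv_pos.2 hb))) hψ (hΦ.intNear_max hψ hb hS)
  refine ⟨t₀, ht₀, fun t c ht htt hc => ?_⟩
  obtain ⟨C, hC⟩ := hP.eventually_real_le
  obtain ⟨D, hD⟩ := hψ.eventually_real_le
  refine IntNear.tianDens_of_or (measNear_dens0 hΦ.holo hΦ.psh₀) hψ hP hb
    ((hΦ.intNear_zero_iff hψ (c + t * b)).2 (by linarith)) hI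
    (K := max 0 (2 * (1 - c) * C + 2 * (t₀ - t) * D)) ?_
  filter_upwards [hC, hD] with z hz₁ hz₂ x y hx hy
  have hx := hz₁ x hx
  have hy := hz₂ y hy
  rcases le_total y (b * x) with h | h
  · right
    have hc1 : c < 1 := by nlinarith
    exact ⟨h, by nlinarith [le_max_right 0 (2 * (1 - c) * C + 2 * (t₀ - t) * D),
      mul_le_mul_of_nonneg_left hx (sub_nonneg.2 hc1.le), mul_le_mul_of_nonneg_left hy (sub_nonneg.2 htt)]⟩
  · left
    nlinarith [le_max_left 0 (2 * (1 - c) * C + 2 * (t₀ - t) * D), mul_le_mul_of_nonneg_left h ht]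

lemma bddAbove_leO (hΦ : IsLocalZhouWeight f₀ φ₀ Φ) (hψ : PSHNear ψ) :
    BddAbove {b : ℝ | 0 ≤ b ∧ leO ψ fun z => (b : EReal) * Φ z} := by
  have hP := hΦ.zhou.psh
  obtain ⟨s, hs, hI⟩ := strong_openness_dens0 hΦ.holo hΦ.psh₀ pshNear_zero hψ
    (hΦ.int₀.congr (Eventually.of_forall fun z => by
      simp only
      rw [wexp_of_eq_coe (x := 0) _ (by simp), mul_zero, Real.exp_zero, ENNReal.ofReal_one, mul_one]))
  have hI' : IntNear (tianDens (dens0 f₀ φ₀) ψ Φ (-s) 0) := by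
    refine hI.congr (Eventually.of_forall fun z => ?_)
    simp only [tianDens]
    rw [mul_zero, wexp_zero, mul_one, wexp_of_eq_coe (u := fun _ => 0) (x := 0) _ (by simp),
      mul_zero, Real.exp_zero, ENNReal.ofReal_one, mul_one]
    ring_nf
  refine ⟨s⁻¹, fun b hb => ?_⟩
  have h := hI'.tianDens_shift hψ hP hs.le hb.2
  rw [neg_add_cancel, zero_add, hΦ.intNear_zero_iff hψ] at h
  rw [← one_div, le_div_iff₀ hs]
  linarith

end IsLocalZhouWeight

/-- A function with the linear behaviour of the Tian function near `0` is differentiable there. -/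
lemma hasDerivAt_of_affine_right {T : ℝ → ℝ} {σ : ℝ} (hr : ∀ t, 0 ≤ t → T t = 1 + σ * t)
    (hl : Tendsto (fun t : ℝ => (T 0 - T (-t)) / t) (𝓝[>] (0 : ℝ)) (𝓝 σ)) : HasDerivAt T σ 0 := by
  rw [hasDerivAt_iff_tendsto_slope, ← Set.Iio_union_Ioi, nhdsWithin_union, tendsto_sup]
  constructor
  · have hneg : Tendsto (fun t : ℝ => -t) (𝓝[<] (0 : ℝ)) (𝓝[>] (0 : ℝ)) := by
      simpa using tendsto_neg_nhdsLT (a := (0 : ℝ))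
    refine (hl.comp hneg).congr' ?_
    filter_upwards [self_mem_nhdsWithin] with t ht
    rw [slope_def_field, Function.comp, neg_neg, sub_zero, div_neg, ← neg_div, neg_sub]
  · refine tendsto_const_nhds.congr' ?_
    filter_upwards [self_mem_nhdsWithin] with t (ht : 0 < t)
    rw [slope_def_field, hr t ht.le, hr 0 le_rfl]
    rw [mul_zero, sub_zero, add_zero, add_sub_cancel_left, mul_div_cancel_right₀ _ ht.ne']

namespace IsLocalZhouWeight

variable {m : ℕ} {f₀ : Fin m → Cn n → ℂ} {φ₀ Φ ψ : Cn n → EReal}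

lemma zero_mem_leO (hψ : PSHNear ψ) :
    (0 : ℝ) ∈ {b : ℝ | 0 ≤ b ∧ leO ψ fun z => (b : EReal) * Φ z} := by
  obtain ⟨C, hC⟩ := hψ.eventually_le
  refine ⟨le_rfl, C, hC.mono fun z hz => ?_⟩
  simpa using hz

lemma not_leO_of_zhouNumber_lt (hΦ : IsLocalZhouWeight f₀ φ₀ Φ) (hψ : PSHNear ψ) {b : ℝ}
    (hb : zhouNumber ψ Φ < b) : 0 < b ∧ ¬ leO ψ fun z => (b : EReal) * Φ z := by
  have hb0 : 0 < b := (le_csSup (hΦ.bddAbove_leO hψ) (zero_mem_leO hψ)).trans_lt hb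
  exact ⟨hb0, fun h => hb.not_ge (le_csSup (hΦ.bddAbove_leO hψ) ⟨hb0.le, h⟩)⟩

lemma tnW_of_nonneg (hΦ : IsLocalZhouWeight f₀ φ₀ Φ) (hψ : PSHNear ψ) {t : ℝ} (ht : 0 ≤ t) :
    TnW f₀ φ₀ ψ Φ t = 1 + zhouNumber ψ Φ * t := by
  have hP := hΦ.zhou.psh
  change sSup {c : ℝ | IntNear (tianDens (dens0 f₀ φ₀) ψ Φ t c)} = _
  have hlow : ∀ b ∈ {b : ℝ | 0 ≤ b ∧ leO ψ fun z => (b : EReal) * Φ z}, ∀ c < 1 + b * t,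
      IntNear (tianDens (dens0 f₀ φ₀) ψ Φ t c) := fun b hb c hc => by
    have := ((hΦ.intNear_zero_iff hψ (c - t * b)).2 (by linarith)).tianDens_shift hψ hP ht hb.2
    rwa [zero_add, sub_add_cancel] at this
  have hup : ∀ c, IntNear (tianDens (dens0 f₀ φ₀) ψ Φ t c) → c ≤ 1 + zhouNumber ψ Φ * t := by
    intro c hc
    have hb : ∀ b > zhouNumber ψ Φ, c ≤ 1 + b * t := fun b hb => by
      obtain ⟨hb0, hS⟩ := hΦ.not_leO_of_zhouNumber_lt hψ hb
      by_contra! hcb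
      exact hΦ.not_intNear_of_not_leO hψ hb0 hS ht (hc.tianDens_anti hψ hP hcb.le)
    have hlim : Tendsto (fun b : ℝ => 1 + b * t) (𝓝[>] (zhouNumber ψ Φ))
        (𝓝 (1 + zhouNumber ψ Φ * t)) :=
      ((continuous_const.add (continuous_id.mul continuous_const)).tendsto _).mono_left
        nhdsWithin_le_nhds
    exact ge_of_tendsto hlim (eventually_mem_nhdsWithin.mono hb)
  refine le_antisymm (csSup_le ⟨_, hlow 0 (zero_mem_leO hψ) 0 (by simp)⟩ hup) ?_
  refine le_of_forall_lt fun c hc => ?_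
  have hbdd : BddAbove {c : ℝ | IntNear (tianDens (dens0 f₀ φ₀) ψ Φ t c)} := ⟨_, hup⟩
  obtain ⟨d, hcd, hd⟩ := exists_between hc
  refine hcd.trans_le (le_csSup hbdd ?_)
  rcases ht.eq_or_lt with rfl | ht'
  · exact hlow 0 (zero_mem_leO hψ) d (by simpa using hd)
  · have h1 : (d - 1) / t < zhouNumber ψ Φ := by
      rw [div_lt_iff₀ ht']
      linarith
    obtain ⟨b, hb, hlt⟩ := exists_lt_of_lt_csSup ⟨0, zero_mem_leO hψ⟩ h1
    refine hlow b hb d ?_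
    rw [div_lt_iff₀ ht'] at hlt
    linarith

lemma tendsto_tnW_neg (hΦ : IsLocalZhouWeight f₀ φ₀ Φ) (hψ : PSHNear ψ) :
    Tendsto (fun t : ℝ => (TnW f₀ φ₀ ψ Φ 0 - TnW f₀ φ₀ ψ Φ (-t)) / t) (𝓝[>] (0 : ℝ))
      (𝓝 (zhouNumber ψ Φ)) := by
  have hP := hΦ.zhou.psh
  have h0 : TnW f₀ φ₀ ψ Φ 0 = 1 := by rw [hΦ.tnW_of_nonneg hψ le_rfl, mul_zero, add_zero]
  have hup : ∀ t > 0, ∀ c, IntNear (tianDens (dens0 f₀ φ₀) ψ Φ (-t) c) →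
      c ≤ 1 - zhouNumber ψ Φ * t := fun t ht c hc => by
    have : zhouNumber ψ Φ ≤ (1 - c) / t := by
      refine csSup_le ⟨0, zero_mem_leO hψ⟩ fun b hb => ?_
      have h := hc.tianDens_shift hψ hP ht.le hb.2
      rw [neg_add_cancel, hΦ.intNear_zero_iff hψ] at h
      rw [le_div_iff₀ ht]
      linarith
    rw [le_div_iff₀ ht] at this
    linarith
  have key : ∀ b > zhouNumber ψ Φ, ∀ᶠ t in 𝓝[>] (0 : ℝ),
      zhouNumber ψ Φ ≤ (TnW f₀ φ₀ ψ Φ 0 - TnW f₀ φ₀ ψ Φ (-t)) / t ∧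
      (TnW f₀ φ₀ ψ Φ 0 - TnW f₀ φ₀ ψ Φ (-t)) / t ≤ b := by
    intro b hb
    obtain ⟨hb0, hS⟩ := hΦ.not_leO_of_zhouNumber_lt hψ hb
    obtain ⟨t₀, ht₀, hI⟩ := hΦ.exists_intNear_of_not_leO hψ hb0 hS
    filter_upwards [Ioc_mem_nhdsGT ht₀] with t ht
    have hT : TnW f₀ φ₀ ψ Φ (-t) = sSup {c : ℝ | IntNear (tianDens (dens0 f₀ φ₀) ψ Φ (-t) c)} := rfl
    have hlow : ∀ c < 1 - b * t, c ∈ {c : ℝ | IntNear (tianDens (dens0 f₀ φ₀) ψ Φ (-t) c)} :=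
      fun c hc => hI t c ht.1.le ht.2 hc
    have hbdd : BddAbove {c : ℝ | IntNear (tianDens (dens0 f₀ φ₀) ψ Φ (-t) c)} := ⟨_, hup t ht.1⟩
    have h1 : TnW f₀ φ₀ ψ Φ (-t) ≤ 1 - zhouNumber ψ Φ * t :=
      csSup_le ⟨1 - b * t - 1, hlow _ (by linarith)⟩ (hup t ht.1)
    have h2 : 1 - b * t ≤ TnW f₀ φ₀ ψ Φ (-t) := by
      rw [hT]
      exact le_of_forall_lt_imp_le_of_dense fun c hc => le_csSup hbdd (hlow c hc)
    rw [h0, le_div_iff₀ ht.1, div_le_iff₀ ht.1]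
    constructor <;> linarith
  refine tendsto_order.2 ⟨fun a ha => ?_, fun a ha => ?_⟩
  · exact (key _ (lt_add_one _)).mono fun t ht => ha.trans_le ht.1
  · obtain ⟨b, hb, hba⟩ := exists_between ha
    exact (key b hb).mono fun t ht => ht.2.trans_lt hba

end IsLocalZhouWeight

/-- linearity of the Tian function attached to a Zhou weight:
`Tn(0) = 1`, `Tn` is differentiable at `0`, its left derivative at `0` is `σ(ψ,Φ)`, and
`Tn(t) = 1 + σ(ψ,Φ)·t` for `t ≥ 0`. -/
theorem statement14 {n m : ℕ} (f₀ : Fin m → Cn n → ℂ) (φ₀ Φ ψ : Cn n → EReal)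
    (hΦ : IsLocalZhouWeight f₀ φ₀ Φ) (hψ : PSHNear ψ)
    (hLelong : ∃ ν₀ : ℝ, 0 < ν₀ ∧ leO ψ (fun z => (ν₀ : EReal) * elog ‖z‖)) :
    TnW f₀ φ₀ ψ Φ 0 = 1 ∧
    HasDerivAt (TnW f₀ φ₀ ψ Φ) (zhouNumber ψ Φ) 0 ∧
    Tendsto (fun t : ℝ => (TnW f₀ φ₀ ψ Φ 0 - TnW f₀ φ₀ ψ Φ (-t)) / t) (𝓝[>] (0 : ℝ))
      (𝓝 (zhouNumber ψ Φ)) ∧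
    ∀ t : ℝ, 0 ≤ t → TnW f₀ φ₀ ψ Φ t = 1 + zhouNumber ψ Φ * t := by
  have h := fun t ht => hΦ.tnW_of_nonneg hψ (t := t) ht
  exact ⟨by rw [h 0 le_rfl, mul_zero, add_zero],
    hasDerivAt_of_affine_right h (hΦ.tendsto_tnW_neg hψ), hΦ.tendsto_tnW_neg hψ, h⟩
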